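/- There exists a positive integer n₀ such that for every n ≥ n₀ the following holds: if P is a set of n points in the Euclidean plane ℝ², not all lying on one line, then P spans at least n/2 ordinary lines. -/

import Mathlib

set_option linter.all false

/-- A line in the Euclidean plane `ℝ × ℝ`: a one-dimensional affine subspace. -/
def IsLine (L : AffineSubspace ℝ (ℝ × ℝ)) : Prop :=
  (L : Set (ℝ × ℝ)).Nonempty ∧ Module.finrank ℝ L.direction = 1

/-- The number of ordinary lines of a planar point set `P`, i.e. lines
containing exactly two points of `P`. -/
noncomputable def numOrdinaryLines (P : Set (ℝ × ℝ)) : ℕ :=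
  {L : AffineSubspace ℝ (ℝ × ℝ) | IsLine L ∧ (P ∩ (L : Set (ℝ × ℝ))).ncard = 2}.ncard

/-- Vectors in `ℝ³`. -/
abbrev V3 := ℝ × ℝ × ℝ

namespace DM

open Finset

def dot (a b : V3) : ℝ := a.1 * b.1 + a.2.1 * b.2.1 + a.2.2 * b.2.2

def crs (a b : V3) : V3 :=
  (a.2.1 * b.2.2 - a.2.2 * b.2.1, a.2.2 * b.1 - a.1 * b.2.2, a.1 * b.2.1 - a.2.1 * b.1)

def det3 (a b c : V3) : ℝ := dot (crs a b) c

lemma dot_add_left (a b c : V3) : dot (a + b) c = dot a c + dot b c := by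
  simp [dot]; ring
lemma dot_sub_left (a b c : V3) : dot (a - b) c = dot a c - dot b c := by
  simp [dot]; ring
lemma dot_smul_left (r : ℝ) (a c : V3) : dot (r • a) c = r * dot a c := by
  simp [dot]; ring
lemma dot_neg_left (a c : V3) : dot (-a) c = - dot a c := by
  simp [dot]; ring
lemma dot_add_right (a b c : V3) : dot a (b + c) = dot a b + dot a c := by
  simp [dot]; ring
lemma dot_sub_right (a b c : V3) : dot a (b - c) = dot a b - dot a c := by
  simp [dot]; ring
lemma dot_smul_right (r : ℝ) (a c : V3) : dot a (r • c) = r * dot a c := by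
  simp [dot]; ring
lemma dot_neg_right (a c : V3) : dot a (-c) = - dot a c := by
  simp [dot]; ring
lemma dot_comm (a c : V3) : dot a c = dot c a := by
  simp [dot]; ring
lemma dot_self_pos {a : V3} (h : a ≠ 0) : 0 < dot a a := by
  rcases a with ⟨x, y, z⟩
  simp only [ne_eq, Prod.mk_eq_zero, not_and, dot] at *
  by_cases hx : x = 0
  · by_cases hy : y = 0
    · have := mul_self_pos.2 (h hx hy)
      nlinarith [mul_self_nonneg x, mul_self_nonneg y]
    · have := mul_self_pos.2 hy
      nlinarith [mul_self_nonneg x, mul_self_nonneg z]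
  · have := mul_self_pos.2 hx
    nlinarith [mul_self_nonneg y, mul_self_nonneg z]

lemma det3_def (a b c : V3) : det3 a b c = dot (crs a b) c := rfl
lemma det3_swap12 (a b c : V3) : det3 b a c = - det3 a b c := by
  simp [det3, dot, crs]; ring
lemma det3_swap23 (a b c : V3) : det3 a c b = - det3 a b c := by
  simp [det3, dot, crs]; ring
lemma det3_rot (a b c : V3) : det3 b c a = det3 a b c := by
  simp [det3, dot, crs]; ring
lemma det3_self12 (a c : V3) : det3 a a c = 0 := by
  simp [det3, dot, crs]; ring
lemma det3_self13 (a c : V3) : det3 a c a = 0 := by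
  simp [det3, dot, crs]; ring
lemma det3_self23 (a c : V3) : det3 a c c = 0 := by
  simp [det3, dot, crs]; ring
lemma crs_swap (a b : V3) : crs b a = - crs a b := by
  ext <;> simp [crs] <;> ring
lemma crs_ne_swap {a b : V3} (h : crs a b ≠ 0) : crs b a ≠ 0 := by
  rw [crs_swap]; simpa using h

/-- Cramer identity. -/
lemma cramer (a b c d : V3) :
    det3 a b c • d = det3 d b c • a + det3 a d c • b + det3 a b d • c := by
  ext <;> simp [det3, dot, crs] <;> ring

/-- determinants of rows and columns -/
lemma dot_crs_crs (a b u w : V3) :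
    dot (crs a b) (crs u w) = dot a u * dot b w - dot a w * dot b u := by
  simp [dot, crs]; ring

lemma crs_crs (a b c : V3) : crs (crs a b) c = dot a c • b - dot b c • a := by
  ext <;> simp [dot, crs] <;> ring

/-- If `c` is orthogonal to independent `a b` then it is proportional to `crs a b`. -/
lemma dot_self_crs (a b c : V3) (ha : dot a c = 0) (hb : dot b c = 0) :
    dot (crs a b) (crs a b) • c = det3 a b c • crs a b := by
  rcases a with ⟨a1, a2, a3⟩
  rcases b with ⟨b1, b2, b3⟩
  rcases c with ⟨c1, c2, c3⟩
  simp only [dot, crs, det3] at *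
  ext
  · simp
    linear_combination (a1 * (b2 ^ 2 + b3 ^ 2) - b1 * (a2 * b2 + a3 * b3)) * ha
      + (b1 * (a2^2 + a3^2) - a1 * (a2*b2+a3*b3)) * hb
  · simp
    linear_combination (a2 * (b1 ^ 2 + b3 ^ 2) - b2 * (a1 * b1 + a3 * b3)) * ha
      + (b2 * (a1^2 + a3^2) - a2 * (a1*b1+a3*b3)) * hb
  · simp
    linear_combination (a3 * (b1 ^ 2 + b2 ^ 2) - b3 * (a1 * b1 + a2 * b2)) * ha
      + (b3 * (a1^2 + a2^2) - a3 * (a1*b1+a2*b2)) * hb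

lemma exists_smul_of_orth {a b c : V3} (hab : crs a b ≠ 0) (ha : dot a c = 0) (hb : dot b c = 0) :
    ∃ r : ℝ, c = r • crs a b := by
  have h := dot_self_crs a b c ha hb
  have hp := dot_self_pos hab
  refine ⟨(dot (crs a b) (crs a b))⁻¹ * det3 a b c, ?_⟩
  rw [mul_smul, ← h, smul_smul, inv_mul_cancel₀ hp.ne', one_smul]

/-- If `det3 a b c = 0` and `a,b` independent, `c` is a combination. -/
lemma exists_comb {a b c : V3} (hab : crs a b ≠ 0) (h : det3 a b c = 0) :
    ∃ x y : ℝ, c = x • a + y • b := by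
  have hp := dot_self_pos hab
  have hc := cramer a b (crs a b) c
  rw [det3_def a b (crs a b), h, zero_smul, add_zero] at hc
  refine ⟨(dot (crs a b) (crs a b))⁻¹ * det3 c b (crs a b),
    (dot (crs a b) (crs a b))⁻¹ * det3 a c (crs a b), ?_⟩
  rw [mul_smul, mul_smul, ← smul_add, ← hc, smul_smul, inv_mul_cancel₀ hp.ne', one_smul]

/-- Density of nonvanishing. -/
lemma dense_ne {u : V3} (hu : u ≠ 0) : Dense {ψ : V3 | dot ψ u ≠ 0} := by
  intro ψ
  by_cases h : dot ψ u = 0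
  · rw [Metric.mem_closure_iff]
    intro ε hε
    have hu' : 0 < ‖u‖ := norm_pos_iff.2 hu
    refine ⟨ψ + (ε / (2 * ‖u‖)) • u, ?_, ?_⟩
    · simp only [Set.mem_setOf_eq, dot_add_left, dot_smul_left, h, zero_add]
      have := dot_self_pos hu
      positivity
    · rw [dist_eq_norm]
      have : ψ - (ψ + (ε / (2 * ‖u‖)) • u) = -((ε / (2 * ‖u‖)) • u) := by abel
      rw [this, norm_neg, norm_smul, Real.norm_of_nonneg (by positivity)]
      field_simp
      linarith
  · exact subset_closure h

lemma continuous_dot (u : V3) : Continuous (fun ψ : V3 => dot ψ u) := by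
  unfold dot; fun_prop

/-- Generic perturbation. -/
lemma perturb {ι κ : Type*} (U : Finset ι) (u : ι → V3) (hu : ∀ i ∈ U, u i ≠ 0)
    (A : Finset κ) (a : κ → V3) (ψ : V3) (hψ : ∀ k ∈ A, 0 < dot ψ (a k)) :
    ∃ ψ' : V3, (∀ i ∈ U, dot ψ' (u i) ≠ 0) ∧ ∀ k ∈ A, 0 < dot ψ' (a k) := by
  classical
  have hopen : IsOpen {x : V3 | ∀ k ∈ A, 0 < dot x (a k)} := by
    have : {x : V3 | ∀ k ∈ A, 0 < dot x (a k)} = ⋂ k ∈ A, {x | 0 < dot x (a k)} := by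
      ext; simp
    rw [this]
    exact isOpen_biInter_finset (fun k _ => isOpen_lt continuous_const (continuous_dot _))
  have key : ∀ U' : Finset ι, U' ⊆ U →
      IsOpen {x : V3 | ∀ i ∈ U', dot x (u i) ≠ 0} ∧ Dense {x : V3 | ∀ i ∈ U', dot x (u i) ≠ 0} := by
    intro U'
    induction U' using Finset.induction_on with
    | empty => intro _; simp
    | insert i s his ih =>
      intro hs
      have h1 := ih (fun x hx => hs (mem_insert_of_mem hx))
      have hi : IsOpen {x : V3 | dot x (u i) ≠ 0} := isOpen_ne_fun (continuous_dot _) continuous_const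
      have e : {x : V3 | ∀ j ∈ insert i s, dot x (u j) ≠ 0}
          = {x : V3 | dot x (u i) ≠ 0} ∩ {x : V3 | ∀ j ∈ s, dot x (u j) ≠ 0} := by
        ext; simp
      rw [e]
      exact ⟨hi.inter h1.1, (dense_ne (hu i (hs (mem_insert_self _ _)))).inter_of_isOpen_left h1.2 hi⟩
  obtain ⟨x, hx1, hx2⟩ := (key U subset_rfl).2.inter_open_nonempty _ hopen ⟨ψ, hψ⟩
  exact ⟨x, hx2, hx1⟩

/-- Small parameter. -/
lemma small_eps {κ : Type*} (A : Finset κ) (x y : κ → ℝ) (hx : ∀ k ∈ A, 0 < x k) :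
    ∃ ε : ℝ, 0 < ε ∧ ∀ k ∈ A, 0 < x k + ε * y k := by
  classical
  induction A using Finset.induction_on with
  | empty => exact ⟨1, one_pos, by simp⟩
  | insert i s his ih =>
    obtain ⟨ε, hε, h⟩ := ih (fun k hk => hx k (mem_insert_of_mem hk))
    have hxi := hx i (mem_insert_self _ _)
    refine ⟨min ε (x i / (2 * (|y i| + 1))), by positivity, ?_⟩
    set δ := min ε (x i / (2 * (|y i| + 1))) with hδ
    have hδ0 : 0 < δ := by positivity
    intro k hk
    rcases mem_insert.1 hk with rfl | hk
    · have h1 : δ ≤ x k / (2 * (|y k| + 1)) := min_le_right _ _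
      have h2 : δ * (2 * (|y k| + 1)) ≤ x k := by
        rwa [le_div_iff₀ (by positivity)] at h1
      have h3 := neg_abs_le (y k)
      nlinarith [abs_nonneg (y k)]
    · have h1 : δ ≤ ε := min_le_left _ _
      have h2 := h k hk
      have h3 := hx k (mem_insert_of_mem hk)
      by_cases hy : 0 ≤ y k
      · positivity
      · push Not at hy
        nlinarith

end DM

namespace DM

open Finset
open scoped Classical

variable {n : ℕ}

structure Cfg (v : Fin n → V3) : Prop where
  np : ∀ i j, i ≠ j → crs (v i) (v j) ≠ 0
  sp : ∃ i j k, det3 (v i) (v j) (v k) ≠ 0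

noncomputable def sgn (T : Finset (Fin n)) (i : Fin n) : ℝ := if i ∈ T then 1 else -1

noncomputable def ev (v : Fin n → V3) (T : Finset (Fin n)) (i : Fin n) : V3 := sgn T i • v i

def IsTope (v : Fin n → V3) (T : Finset (Fin n)) : Prop :=
  ∃ φ : V3, ∀ i, 0 < dot φ (ev v T i)

/-- flip the sign of one element -/
noncomputable def fl (T : Finset (Fin n)) (i : Fin n) : Finset (Fin n) := symmDiff T {i}

lemma mem_fl {T : Finset (Fin n)} {i j : Fin n} : j ∈ fl T i ↔ (j ∈ T ↔ j ≠ i) := by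
  unfold fl
  rw [mem_symmDiff]
  simp only [mem_singleton]
  tauto

lemma fl_fl (T : Finset (Fin n)) (i : Fin n) : fl (fl T i) i = T := by
  ext j; simp only [mem_fl]; tauto
lemma fl_comm (T : Finset (Fin n)) (i j : Fin n) : fl (fl T i) j = fl (fl T j) i := by
  ext k; simp only [mem_fl]; tauto
lemma sgn_fl_self (T : Finset (Fin n)) (i : Fin n) : sgn (fl T i) i = - sgn T i := by
  by_cases h : i ∈ T <;> simp [sgn, mem_fl, h]
lemma sgn_fl_ne (T : Finset (Fin n)) {i j : Fin n} (h : j ≠ i) : sgn (fl T i) j = sgn T j := by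
  simp [sgn, mem_fl, h]
lemma sgn_mul_self (T : Finset (Fin n)) (i : Fin n) : sgn T i * sgn T i = 1 := by
  unfold sgn; split_ifs <;> norm_num
lemma sgn_ne (T : Finset (Fin n)) (i : Fin n) : sgn T i ≠ 0 := by
  unfold sgn; split_ifs <;> norm_num
lemma sgn_cases (T : Finset (Fin n)) (i : Fin n) : sgn T i = 1 ∨ sgn T i = -1 := by
  unfold sgn; split_ifs <;> simp
lemma ev_fl_self (v : Fin n → V3) (T : Finset (Fin n)) (i : Fin n) :
    ev v (fl T i) i = - ev v T i := by simp [ev, sgn_fl_self]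
lemma ev_fl_ne (v : Fin n → V3) (T : Finset (Fin n)) {i j : Fin n} (h : j ≠ i) :
    ev v (fl T i) j = ev v T j := by simp [ev, sgn_fl_ne T h]
lemma dot_ev (v : Fin n → V3) (T : Finset (Fin n)) (i : Fin n) (φ : V3) :
    dot φ (ev v T i) = sgn T i * dot φ (v i) := by simp [ev, dot_smul_right]
lemma crs_smul_smul (a b : ℝ) (x y : V3) : crs (a • x) (b • y) = (a * b) • crs x y := by
  ext <;> simp [crs] <;> ring
lemma det3_smul (a b c : ℝ) (x y z : V3) : det3 (a • x) (b • y) (c • z) = (a * b * c) * det3 x y z := by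
  simp [crs, det3, dot]; ring
lemma Cfg.ev_np {v : Fin n → V3} (hv : Cfg v) (T : Finset (Fin n)) {i j : Fin n} (h : i ≠ j) :
    crs (ev v T i) (ev v T j) ≠ 0 := by
  unfold ev; rw [crs_smul_smul]
  exact smul_ne_zero (mul_ne_zero (sgn_ne _ _) (sgn_ne _ _)) (hv.np i j h)

noncomputable def walls (v : Fin n → V3) (T : Finset (Fin n)) : Finset (Fin n) :=
  univ.filter (fun i => IsTope v (fl T i))

noncomputable def topes (v : Fin n → V3) : Finset (Finset (Fin n)) :=
  univ.filter (IsTope v)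

lemma mem_walls {v : Fin n → V3} {T : Finset (Fin n)} {i : Fin n} :
    i ∈ walls v T ↔ IsTope v (fl T i) := by simp [walls]
lemma mem_topes {v : Fin n → V3} {T : Finset (Fin n)} : T ∈ topes v ↔ IsTope v T := by simp [topes]

/-- no functional vanishes on all vectors -/
lemma Cfg.exists_ne {v : Fin n → V3} (hv : Cfg v) {χ : V3} (hχ : χ ≠ 0) : ∃ l, dot χ (v l) ≠ 0 := by
  obtain ⟨i, j, k, h⟩ := hv.sp
  by_contra hc
  push Not at hc
  apply h
  have := cramer (v i) (v j) (v k) χ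
  have h2 : det3 (v i) (v j) (v k) * dot χ χ = 0 := by
    rw [← dot_smul_right, this]
    simp [dot_add_right, dot_smul_right, hc]
  rcases mul_eq_zero.1 h2 with h3 | h3
  · exact h3
  · exact absurd h3 (dot_self_pos hχ).ne'

/-- Main lemma: positivity on walls implies positivity everywhere. -/
lemma Cfg.pos_of_walls {v : Fin n → V3} (hv : Cfg v) {T : Finset (Fin n)} (hT : IsTope v T)
    {ψ : V3} (hψ : ∀ w ∈ walls v T, 0 < dot ψ (ev v T w)) (l : Fin n) : 0 < dot ψ (ev v T l) := by
  obtain ⟨φ, hφ⟩ := hT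
  by_contra hl
  push Not at hl
  -- first perturbation
  obtain ⟨δ, hδ, h1⟩ := small_eps (walls v T) (fun w => dot ψ (ev v T w))
    (fun w => - dot φ (ev v T w)) hψ
  -- second perturbation
  let a : Fin n → V3 := fun k => if k ∈ walls v T then ev v T k else - ev v T l
  have h2 : ∀ k ∈ insert l (walls v T), 0 < dot (ψ - δ • φ) (a k) := by
    intro k hk
    simp only [a]
    split_ifs with hk'
    · rw [dot_sub_left, dot_smul_left]; have := h1 k hk'; linarith
    · rw [dot_neg_right, dot_sub_left, dot_smul_left]; have := mul_pos hδ (hφ l); linarith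
  by_cases hlw : l ∈ walls v T
  · linarith [hψ l hlw]
  obtain ⟨χ, hχ1, hχ2⟩ := perturb (univ.offDiag : Finset (Fin n × Fin n))
    (fun q => dot φ (ev v T q.2) • ev v T q.1 - dot φ (ev v T q.1) • ev v T q.2) (by
      intro q hq h0
      have hq' : q.1 ≠ q.2 := by simpa using hq
      have := hv.ev_np T hq'
      apply this
      have h3 : crs (dot φ (ev v T q.2) • ev v T q.1 - dot φ (ev v T q.1) • ev v T q.2) (ev v T q.2)
        = dot φ (ev v T q.2) • crs (ev v T q.1) (ev v T q.2) := by
        ext <;> simp [crs] <;> ring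
      rw [h0] at h3
      have h4 : crs 0 (ev v T q.2) = 0 := by ext <;> simp [crs]
      rw [h4] at h3
      exact (smul_eq_zero.1 h3.symm).resolve_left (hφ _).ne')
    (insert l (walls v T)) a (ψ - δ • φ) h2
  have hw : ∀ w ∈ walls v T, 0 < dot χ (ev v T w) := by
    intro w hw; have := hχ2 w (mem_insert_of_mem hw); simpa [a, hw] using this
  have hl' : dot χ (ev v T l) < 0 := by
    have := hχ2 l (mem_insert_self _ _); simp [a, hlw, dot_neg_right] at this; exact this
  -- ratios
  let ρ : Fin n → ℝ := fun i => dot χ (ev v T i) / dot φ (ev v T i)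
  have hρ : ∀ i, dot χ (ev v T i) = ρ i * dot φ (ev v T i) := fun i =>
    (div_mul_cancel₀ _ (hφ i).ne').symm
  have hinj : ∀ i j, i ≠ j → ρ i ≠ ρ j := by
    intro i j hij he
    apply hχ1 (i, j) (by simpa using hij)
    simp only [dot_sub_right, dot_smul_right, hρ, he]; ring
  obtain ⟨i0, -, hi0⟩ := exists_min_image univ ρ ⟨l, mem_univ l⟩
  have hneg : ρ i0 < 0 := by
    refine lt_of_le_of_lt (hi0 l (mem_univ _)) ?_
    exact div_neg_of_neg_of_pos hl' (hφ l)
  -- find c with 1 + c ρ i0 <0 , 1 + c ρ j > 0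
  have hx : ∀ j ∈ univ.erase i0, 0 < 1 + (-1 / ρ i0) * ρ j := by
    intro j hj
    have hj' : j ≠ i0 := (mem_erase.1 hj).1
    have : ρ i0 < ρ j := lt_of_le_of_ne (hi0 j (mem_univ _)) (hinj i0 j hj'.symm)
    have h5 : ρ j / ρ i0 < 1 := by rw [div_lt_one_of_neg hneg]; exact this
    have : -1 / ρ i0 * ρ j = - (ρ j / ρ i0) := by ring
    linarith
  obtain ⟨ε, hε, h6⟩ := small_eps (univ.erase i0) _ ρ hx
  have htop : IsTope v (fl T i0) := by
    refine ⟨φ + (-1 / ρ i0 + ε) • χ, ?_⟩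
    intro j
    by_cases hj : j = i0
    · subst hj
      rw [ev_fl_self, dot_neg_right, dot_add_left, dot_smul_left, hρ]
      have e1 : -1 / ρ j * ρ j = -1 := div_mul_cancel₀ _ hneg.ne
      have e2 : -(dot φ (ev v T j) + (-1 / ρ j + ε) * (ρ j * dot φ (ev v T j)))
        = - ((1 + (-1 / ρ j * ρ j) + ε * ρ j) * dot φ (ev v T j)) := by ring
      rw [e2, e1]
      have := mul_pos (mul_pos hε (neg_pos.2 hneg)) (hφ j)
      nlinarith
    · rw [ev_fl_ne v T hj, dot_add_left, dot_smul_left, hρ]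
      have h7 := mul_pos (h6 j (by simp [hj])) (hφ j)
      nlinarith
  have h8 := hw i0 (mem_walls.2 htop)
  rw [hρ] at h8
  have := hφ i0
  nlinarith

/-- walls span -/
lemma Cfg.walls_span {v : Fin n → V3} (hv : Cfg v) {T : Finset (Fin n)} (hT : IsTope v T)
    {χ : V3} (hχ : χ ≠ 0) : ∃ w ∈ walls v T, dot χ (v w) ≠ 0 := by
  by_contra hc
  push Not at hc
  obtain ⟨l, hl⟩ := hv.exists_ne hχ
  obtain ⟨φ, hφ⟩ := hT
  have key : ∀ M : ℝ, 0 < dot φ (ev v T l) + M * dot χ (ev v T l) := by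
    intro M
    have := hv.pos_of_walls ⟨φ, hφ⟩ (ψ := φ + M • χ) (by
      intro w hw
      rw [dot_add_left, dot_smul_left, dot_ev v T w χ, hc w hw]
      simpa using hφ w) l
    rwa [dot_add_left, dot_smul_left] at this
  have hne : dot χ (ev v T l) ≠ 0 := by rw [dot_ev]; exact mul_ne_zero (sgn_ne _ _) hl
  have := key (- dot φ (ev v T l) / dot χ (ev v T l))
  rw [div_mul_cancel₀ _ hne] at this
  linarith

lemma Cfg.walls_card {v : Fin n → V3} (hv : Cfg v) {T : Finset (Fin n)} (hT : IsTope v T) :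
    3 ≤ (walls v T).card := by
  by_contra hc
  push Not at hc
  have hn : ∃ a b : Fin n, a ≠ b := by
    obtain ⟨i, j, k, h⟩ := hv.sp
    refine ⟨i, j, ?_⟩
    rintro rfl
    exact h (det3_self12 _ _)
  have : ∃ a b : Fin n, a ≠ b ∧ walls v T ⊆ {a, b} := by
    have h2 : (walls v T).card ≤ 2 := by omega
    obtain ⟨a, b, hab⟩ := hn
    have hcard : 2 ≤ Fintype.card (Fin n) := by
      have := Finset.card_le_card (Finset.subset_univ {a, b})
      rwa [card_pair hab] at this
    obtain ⟨S, hS, hS2⟩ := Finset.exists_superset_card_eq h2 hcard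
    obtain ⟨x, y, hxy, rfl⟩ := card_eq_two.1 hS2
    exact ⟨x, y, hxy, hS⟩
  obtain ⟨a, b, hab, hsub⟩ := this
  obtain ⟨w, hw, h⟩ := hv.walls_span hT (hv.np a b hab)
  rcases mem_insert.1 (hsub hw) with rfl | hw'
  · exact h (det3_self13 _ _)
  · rw [mem_singleton.1 hw'] at h; exact h (det3_self23 _ _)

/-- Triangles: cone coordinates -/
lemma Cfg.cone {v : Fin n → V3} (hv : Cfg v) {T : Finset (Fin n)} (hT : IsTope v T)
    {i j k : Fin n} (hw : walls v T = {i, j, k}) :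
    det3 (v i) (v j) (v k) ≠ 0 ∧ ∀ l, ∃ a b c : ℝ, 0 ≤ a ∧ 0 ≤ b ∧ 0 ≤ c ∧
      ev v T l = a • ev v T i + b • ev v T j + c • ev v T k := by
  have hcard := hv.walls_card hT
  have hij : i ≠ j := by
    rintro rfl; rw [hw] at hcard; simp at hcard
    have := card_le_two (a := i) (b := k); omega
  have hdet : det3 (v i) (v j) (v k) ≠ 0 := by
    obtain ⟨w, hw', h⟩ := hv.walls_span hT (hv.np i j hij)
    rw [hw] at hw'
    simp only [mem_insert, mem_singleton] at hw'
    rcases hw' with rfl | rfl | rfl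
    · exact absurd (det3_self13 _ _) h
    · exact absurd (det3_self23 _ _) h
    · exact h
  refine ⟨hdet, fun l => ?_⟩
  set ei := ev v T i with hei
  set ej := ev v T j with hej
  set ek := ev v T k with hek
  set D := det3 ei ej ek with hD
  have hD0 : D ≠ 0 := by
    rw [hD, hei, hej, hek]; unfold ev; rw [det3_smul]
    exact mul_ne_zero (mul_ne_zero (mul_ne_zero (sgn_ne _ _) (sgn_ne _ _)) (sgn_ne _ _)) hdet
  -- dual basis
  let di : V3 := D⁻¹ • crs ej ek
  let dj : V3 := D⁻¹ • crs ek ei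
  let dk : V3 := D⁻¹ • crs ei ej
  have r1 : ∀ x, dot (crs ej ek) x = det3 x ej ek := by intro x; simp [det3, dot, crs]; ring
  have r2 : ∀ x, dot (crs ek ei) x = det3 ei x ek := by intro x; simp [det3, dot, crs]; ring
  have r3 : ∀ x, dot (crs ei ej) x = det3 ei ej x := by intro x; rfl
  have dii : dot di ei = 1 := by simp only [di, dot_smul_left, r1]; exact inv_mul_cancel₀ hD0
  have dij : dot di ej = 0 := by simp only [di, dot_smul_left, r1, det3_self12]; ring
  have dik : dot di ek = 0 := by simp only [di, dot_smul_left, r1, det3_self13]; ring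
  have dji : dot dj ei = 0 := by simp only [dj, dot_smul_left, r2, det3_self12]; ring
  have djj : dot dj ej = 1 := by simp only [dj, dot_smul_left, r2]; exact inv_mul_cancel₀ hD0
  have djk : dot dj ek = 0 := by simp only [dj, dot_smul_left, r2, det3_self23]; ring
  have dki : dot dk ei = 0 := by simp only [dk, dot_smul_left, r3, det3_self13]; ring
  have dkj : dot dk ej = 0 := by simp only [dk, dot_smul_left, r3, det3_self23]; ring
  have dkk : dot dk ek = 1 := by simp only [dk, dot_smul_left, r3]; exact inv_mul_cancel₀ hD0
  have comb : ∀ x y z : ℝ, 0 < x → 0 < y → 0 < z →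
      0 < x * dot di (ev v T l) + y * dot dj (ev v T l) + z * dot dk (ev v T l) := by
    intro x y z hx hy hz
    have := hv.pos_of_walls hT (ψ := x • di + y • dj + z • dk) (by
      intro w hw'
      rw [hw] at hw'
      simp only [mem_insert, mem_singleton] at hw'
      rcases hw' with rfl | rfl | rfl
      · rw [← hei]; simp [dot_add_left, dot_smul_left, dii, dji, dki, hx]
      · rw [← hej]; simp [dot_add_left, dot_smul_left, dij, djj, dkj, hy]
      · rw [← hek]; simp [dot_add_left, dot_smul_left, dik, djk, dkk, hz]) l
    simpa [dot_add_left, dot_smul_left] using this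
  have lim : ∀ A B : ℝ, (∀ M : ℝ, 0 < M → 0 < M * A + B) → 0 ≤ A := by
    intro A B h
    by_contra hA
    push Not at hA
    have := h ((|B| + 1) / (-A)) (div_pos (by positivity) (by linarith))
    have e : (|B| + 1) / (-A) * A = -(|B| + 1) := by
      have : A ≠ 0 := hA.ne
      field_simp
    rw [e] at this
    linarith [le_abs_self B]
  refine ⟨dot di (ev v T l), dot dj (ev v T l), dot dk (ev v T l), ?_, ?_, ?_, ?_⟩
  · refine lim _ (dot dj (ev v T l) + dot dk (ev v T l)) (fun M hM => ?_)
    have := comb M 1 1 hM one_pos one_pos; linarith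
  · refine lim _ (dot di (ev v T l) + dot dk (ev v T l)) (fun M hM => ?_)
    have := comb 1 M 1 one_pos hM one_pos; linarith
  · refine lim _ (dot di (ev v T l) + dot dj (ev v T l)) (fun M hM => ?_)
    have := comb 1 1 M one_pos one_pos hM; linarith
  · have := cramer ei ej ek (ev v T l)
    simp only [di, dj, dk, dot_smul_left, r1, r2, r3, mul_smul]
    rw [← smul_add, ← smul_add, ← this, smul_smul, inv_mul_cancel₀ hD0, one_smul]

end DM

namespace DM

open Finset
open scoped Classical

variable {n : ℕ}

/-! ### Lines -/
noncomputable def Ln (v : Fin n → V3) (i j : Fin n) : Finset (Fin n) :=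
  univ.filter (fun k => det3 (v i) (v j) (v k) = 0)

lemma mem_Ln {v : Fin n → V3} {i j k : Fin n} : k ∈ Ln v i j ↔ det3 (v i) (v j) (v k) = 0 := by
  simp [Ln]
lemma left_mem_Ln (v : Fin n → V3) (i j : Fin n) : i ∈ Ln v i j := mem_Ln.2 (det3_self13 _ _)
lemma right_mem_Ln (v : Fin n → V3) (i j : Fin n) : j ∈ Ln v i j := mem_Ln.2 (det3_self23 _ _)
lemma Ln_comm (v : Fin n → V3) (i j : Fin n) : Ln v i j = Ln v j i := by
  ext k; rw [mem_Ln, mem_Ln, det3_swap12, neg_eq_zero]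

lemma crs_comb (a b : V3) (x y x' y' : ℝ) :
    crs (x • a + y • b) (x' • a + y' • b) = (x * y' - x' * y) • crs a b := by
  ext <;> simp [crs] <;> ring

lemma Cfg.Ln_eq {v : Fin n → V3} (hv : Cfg v) {i j k l : Fin n} (hij : i ≠ j) (hkl : k ≠ l)
    (hk : k ∈ Ln v i j) (hl : l ∈ Ln v i j) : Ln v k l = Ln v i j := by
  obtain ⟨x, y, h1⟩ := exists_comb (hv.np i j hij) (mem_Ln.1 hk)
  obtain ⟨x', y', h2⟩ := exists_comb (hv.np i j hij) (mem_Ln.1 hl)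
  have h3 := hv.np k l hkl
  have h4 : crs (v k) (v l) = (x * y' - x' * y) • crs (v i) (v j) := by rw [h1, h2, crs_comb]
  have h5 : x * y' - x' * y ≠ 0 := by
    intro h; rw [h4, h, zero_smul] at h3; exact h3 rfl
  ext m
  rw [mem_Ln, mem_Ln, det3_def, h4, dot_smul_left, ← det3_def]
  simp [h5]

noncomputable def lines (v : Fin n → V3) : Finset (Finset (Fin n)) :=
  (univ.offDiag : Finset (Fin n × Fin n)).image (fun q => Ln v q.1 q.2)

lemma mem_lines {v : Fin n → V3} {L : Finset (Fin n)} :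
    L ∈ lines v ↔ ∃ i j, i ≠ j ∧ Ln v i j = L := by
  simp [lines]
lemma Ln_mem_lines {v : Fin n → V3} {i j : Fin n} (h : i ≠ j) : Ln v i j ∈ lines v :=
  mem_lines.2 ⟨i, j, h, rfl⟩
lemma Cfg.line_eq {v : Fin n → V3} (hv : Cfg v) {L : Finset (Fin n)} (hL : L ∈ lines v)
    {i j : Fin n} (hij : i ≠ j) (hi : i ∈ L) (hj : j ∈ L) : L = Ln v i j := by
  obtain ⟨a, b, hab, rfl⟩ := mem_lines.1 hL
  exact (hv.Ln_eq hab hij hi hj).symm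
lemma Cfg.line_inter {v : Fin n → V3} (hv : Cfg v) {L M : Finset (Fin n)} (hL : L ∈ lines v)
    (hM : M ∈ lines v) {i j : Fin n} (hij : i ≠ j) (hi : i ∈ L) (hj : j ∈ L) (hi' : i ∈ M)
    (hj' : j ∈ M) : L = M := by
  rw [hv.line_eq hL hij hi hj, hv.line_eq hM hij hi' hj']
lemma two_le_line {v : Fin n → V3} {L : Finset (Fin n)} (hL : L ∈ lines v) : 2 ≤ L.card := by
  obtain ⟨a, b, hab, rfl⟩ := mem_lines.1 hL
  rw [← card_pair hab]
  apply card_le_card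
  intro x hx
  rcases mem_insert.1 hx with rfl | hx
  · exact left_mem_Ln _ _ _
  · rw [mem_singleton.1 hx]; exact right_mem_Ln _ _ _

/-! ### Pencils -/
structure Pen (v : Fin n → V3) (p : Fin n) where
  al : V3
  be : V3
  c : ℝ
  hc : c ≠ 0
  hal : dot al (v p) = 0
  hbe : dot be (v p) = 0
  hcrs : crs al be = c • v p
  hne : ∀ j, j ≠ p → dot be (v j) ≠ 0

lemma Cfg.v_ne {v : Fin n → V3} (hv : Cfg v) (p : Fin n) : v p ≠ 0 := by
  intro h
  obtain ⟨i, j, k, hd⟩ := hv.sp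
  have : ∃ q, q ≠ p := by
    by_contra hc; push Not at hc
    rw [hc i, hc j] at hd; exact hd (det3_self12 _ _)
  obtain ⟨q, hq⟩ := this
  apply hv.np p q hq.symm
  rw [h]; ext <;> simp [crs]

lemma Cfg.exists_pen {v : Fin n → V3} (hv : Cfg v) (p : Fin n) : Nonempty (Pen v p) := by
  obtain ⟨χ, h1, -⟩ := perturb (univ.erase p) (fun j => crs (v p) (v j))
    (fun j hj => hv.np p j (mem_erase.1 hj).1.symm) (∅ : Finset (Fin n)) (fun _ => 0) 0 (by simp)
  have hne : ∀ j, j ≠ p → dot (crs (v p) χ) (v j) ≠ 0 := by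
    intro j hj
    have := h1 j (by simp [hj])
    rw [dot_comm, ← det3_def] at this
    rw [← det3_def, det3_swap23]
    simpa using this
  have hbp : dot (crs (v p) χ) (v p) = 0 := det3_self13 _ _
  have hb0 : crs (v p) χ ≠ 0 := by
    obtain ⟨i, j, k, hd⟩ := hv.sp
    have : ∃ q, q ≠ p := by
      by_contra hc; push Not at hc
      rw [hc i, hc j] at hd; exact hd (det3_self12 _ _)
    obtain ⟨q, hq⟩ := this
    intro h
    apply hne q hq
    rw [h]; simp [dot]
  refine ⟨⟨crs (v p) (crs (v p) χ), crs (v p) χ, - dot (crs (v p) χ) (crs (v p) χ), ?_,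
    det3_self13 _ _, hbp, ?_, hne⟩⟩
  · have := dot_self_pos hb0; linarith
  · rw [crs_crs, dot_comm, hbp, zero_smul, zero_sub, neg_smul]

namespace Pen
variable {v : Fin n → V3} {p : Fin n} (P : Pen v p) (I : Finset (Fin n))

noncomputable def crit (j : Fin n) : ℝ := - dot P.al (v j) / dot P.be (v j)
noncomputable def C : Finset ℝ := I.image P.crit
noncomputable def rk (j : Fin n) : ℕ := ((P.C I).filter (fun c => c < P.crit j)).card
noncomputable def A (t : ℕ) : Finset (Fin n) :=
  I.filter (fun j => 0 < dot P.be (v j) ↔ P.rk I j < t)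

lemma eval_eq {j : Fin n} (hj : j ≠ p) (s : ℝ) :
    dot (P.al + s • P.be) (v j) = dot P.be (v j) * (s - P.crit j) := by
  have := P.hne j hj
  rw [dot_add_left, dot_smul_left, crit]; field_simp; ring

lemma crit_eq_iff {j k : Fin n} (hj : j ≠ p) (hk : k ≠ p) :
    P.crit j = P.crit k ↔ det3 (v p) (v j) (v k) = 0 := by
  have h1 := P.hne j hj
  have h2 := P.hne k hk
  have h3 : P.c * det3 (v p) (v j) (v k) =
      dot P.al (v j) * dot P.be (v k) - dot P.al (v k) * dot P.be (v j) := by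
    rw [← dot_crs_crs, P.hcrs, dot_smul_left]
    simp [det3, dot, crs]; left; ring
  have h4 : det3 (v p) (v j) (v k) = 0 ↔
      dot P.al (v j) * dot P.be (v k) - dot P.al (v k) * dot P.be (v j) = 0 := by
    rw [← h3]; simp [P.hc]
  rw [h4, crit, crit, div_eq_div_iff h1 h2]
  constructor <;> intro h <;> linarith

lemma rk_lt {j : Fin n} (hj : j ∈ I) : P.rk I j < (P.C I).card := by
  apply card_lt_card
  rw [ssubset_iff_of_subset (filter_subset _ _)]
  exact ⟨P.crit j, mem_image_of_mem _ hj, by simp⟩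

lemma rk_lt_iff {j k : Fin n} (hj : j ∈ I) : P.rk I j < P.rk I k ↔ P.crit j < P.crit k := by
  constructor
  · intro h
    by_contra hc
    push Not at hc
    apply absurd h
    rw [not_lt]
    apply card_le_card
    intro c hc'
    rw [mem_filter] at hc' ⊢
    exact ⟨hc'.1, lt_of_lt_of_le hc'.2 hc⟩
  · intro h
    apply card_lt_card
    rw [ssubset_iff_of_subset]
    · exact ⟨P.crit j, by simp [C, h, mem_image_of_mem _ hj], by simp⟩
    · intro c hc'
      rw [mem_filter] at hc' ⊢
      exact ⟨hc'.1, hc'.2.trans h⟩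

lemma rk_eq_iff {j k : Fin n} (hj : j ∈ I) (hk : k ∈ I) : P.rk I j = P.rk I k ↔ P.crit j = P.crit k := by
  have h1 := P.rk_lt_iff I (k := k) hj
  have h2 := P.rk_lt_iff I (k := j) hk
  constructor
  · intro h; apply le_antisymm
    · rw [← not_lt, ← h2]; omega
    · rw [← not_lt, ← h1]; omega
  · intro h
    have a1 : ¬ (P.rk I j < P.rk I k) := by rw [h1, h]; exact lt_irrefl _
    have a2 : ¬ (P.rk I k < P.rk I j) := by rw [h2, h]; exact lt_irrefl _
    omega

/-- every rank is attained -/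
lemma exists_rk {t : ℕ} (ht : t < (P.C I).card) : ∃ j ∈ I, P.rk I j = t := by
  have hinj : Set.InjOn (fun c => ((P.C I).filter (fun x => x < c)).card) (P.C I : Set ℝ) := by
    intro a ha b hb hab
    obtain ⟨j, hj, rfl⟩ := mem_image.1 (mem_coe.1 ha)
    obtain ⟨k, hk, rfl⟩ := mem_image.1 (mem_coe.1 hb)
    exact (P.rk_eq_iff I hj hk).1 hab
  have hmaps : (P.C I).image (fun c => ((P.C I).filter (fun x => x < c)).card) ⊆ range (P.C I).card := by
    intro x hx
    obtain ⟨c, hc, rfl⟩ := mem_image.1 hx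
    obtain ⟨j, hj, rfl⟩ := mem_image.1 hc
    exact mem_range.2 (P.rk_lt I hj)
  have heq := eq_of_subset_of_card_le hmaps (by rw [card_range, card_image_of_injOn hinj])
  have : t ∈ (P.C I).image (fun c => ((P.C I).filter (fun x => x < c)).card) := by
    rw [heq]; exact mem_range.2 ht
  obtain ⟨c, hc, h⟩ := mem_image.1 this
  obtain ⟨j, hj, rfl⟩ := mem_image.1 hc
  exact ⟨j, hj, h⟩

lemma mem_A {t : ℕ} {j : Fin n} : j ∈ P.A I t ↔ j ∈ I ∧ (0 < dot P.be (v j) ↔ P.rk I j < t) := by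
  simp [A]

/-- sign vectors on the pencil -/
def InZ (v : Fin n → V3) (p : Fin n) (I T : Finset (Fin n)) : Prop :=
  ∃ φ : V3, dot φ (v p) = 0 ∧ ∀ j ∈ I, 0 < dot φ (ev v T j)

lemma pos_ev_iff (v : Fin n → V3) (T : Finset (Fin n)) (j : Fin n) (φ : V3) :
    0 < dot φ (ev v T j) ↔ dot φ (v j) ≠ 0 ∧ (j ∈ T ↔ 0 < dot φ (v j)) := by
  rw [dot_ev, sgn]
  split_ifs with h
  · simp only [one_mul, h, true_iff]
    exact ⟨fun h => ⟨h.ne', h⟩, fun h => h.2⟩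
  · simp only [neg_mul, one_mul, h, false_iff, not_lt]
    constructor
    · intro h; exact ⟨by linarith, by linarith⟩
    · rintro ⟨h1, h2⟩; have := lt_of_le_of_ne h2 h1; linarith

lemma sep (t : ℕ) : ∃ s : ℝ, ∀ j ∈ I, (P.rk I j < t → P.crit j < s) ∧ (t ≤ P.rk I j → s < P.crit j) := by
  obtain ⟨s, h1, h2⟩ := Order.exists_between_finsets ((I.filter (fun j => P.rk I j < t)).image P.crit)
    ((I.filter (fun j => t ≤ P.rk I j)).image P.crit) (by
      intro x hx y hy
      obtain ⟨j, hj, rfl⟩ := mem_image.1 hx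
      obtain ⟨k, hk, rfl⟩ := mem_image.1 hy
      rw [mem_filter] at hj hk
      exact (P.rk_lt_iff I hj.1).1 (by omega))
  refine ⟨s, fun j hj => ⟨fun h => h1 _ (mem_image_of_mem _ (by simp [hj, h])),
    fun h => h2 _ (mem_image_of_mem _ (by simp [hj, h]))⟩⟩

lemma A_real (hpI : p ∉ I) (t : ℕ) : ∃ s : ℝ,
    (∀ j ∈ I, (P.rk I j < t → P.crit j < s) ∧ (t ≤ P.rk I j → s < P.crit j)) ∧
    ∀ j ∈ I, 0 < dot (P.al + s • P.be) (ev v (P.A I t) j) := by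
  obtain ⟨s, hs⟩ := P.sep I t
  refine ⟨s, hs, fun j hj => ?_⟩
  have hjp : j ≠ p := fun h => hpI (h ▸ hj)
  have hb := P.hne j hjp
  rw [pos_ev_iff, P.eval_eq hjp, P.mem_A]
  rcases lt_or_ge (P.rk I j) t with h | h
  · have h1 := (hs j hj).1 h
    have h2 : 0 < s - P.crit j := by linarith
    refine ⟨mul_ne_zero hb h2.ne', ?_⟩
    simp [hj, h, h2]
  · have h1 := (hs j hj).2 h
    have h2 : s - P.crit j < 0 := by linarith
    refine ⟨mul_ne_zero hb h2.ne, ?_⟩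
    have : ¬ (P.rk I j < t) := by omega
    simp only [hj, this, true_and, iff_false, not_lt]
    constructor
    · intro h3; exact mul_pos_of_neg_of_neg (lt_of_le_of_ne h3 hb) h2
    · intro h3; by_contra h4; push Not at h4; nlinarith

lemma inZ_A (hpI : p ∉ I) (t : ℕ) : InZ v p I (P.A I t) := by
  obtain ⟨s, -, h⟩ := P.A_real I hpI t
  exact ⟨_, by simp [dot_add_left, dot_smul_left, P.hal, P.hbe], h⟩

lemma inZ_compl {T : Finset (Fin n)} (h : InZ v p I T) : InZ v p I (I \ T) := by
  obtain ⟨φ, h1, h2⟩ := h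
  refine ⟨-φ, by simp [dot_neg_left, h1], fun j hj => ?_⟩
  have := (pos_ev_iff _ _ _ _).1 (h2 j hj)
  rw [pos_ev_iff, dot_neg_left, mem_sdiff]
  refine ⟨by simpa using this.1, ?_⟩
  simp only [hj, true_and, this.2, not_lt, Left.neg_pos_iff]
  exact ⟨fun h => lt_of_le_of_ne h this.1, fun h => h.le⟩

lemma crs_al_be_ne (hv : Cfg v) : crs P.al P.be ≠ 0 := by
  rw [P.hcrs]; exact smul_ne_zero P.hc (hv.v_ne p)

lemma A_sub (t : ℕ) : P.A I t ⊆ I := filter_subset _ _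

lemma A_card : P.A I (P.C I).card = I.filter (fun j => 0 < dot P.be (v j)) := by
  ext j; rw [P.mem_A, mem_filter]
  constructor
  · rintro ⟨h1, h2⟩; exact ⟨h1, h2.2 (P.rk_lt I h1)⟩
  · rintro ⟨h1, h2⟩; exact ⟨h1, by simp [h2, P.rk_lt I h1]⟩
lemma A_zero : P.A I 0 = I \ P.A I (P.C I).card := by
  rw [A_card]
  ext j; rw [P.mem_A]; simp; tauto

lemma inZ_cases (hv : Cfg v) (hpI : p ∉ I) {T : Finset (Fin n)} (hTI : T ⊆ I) (h : InZ v p I T) :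
    ∃ t ≤ (P.C I).card, T = P.A I t ∨ T = I \ P.A I t := by
  have main : ∀ (x y : ℝ) (T : Finset (Fin n)), T ⊆ I → (∀ j ∈ I, 0 < dot (x • P.al + y • P.be) (ev v T j)) →
      (0 < x ∨ (x = 0 ∧ 0 ≤ y)) → ∃ t ≤ (P.C I).card, T = P.A I t := by
    intro x y T hTI h hx
    rcases hx with hx | ⟨rfl, hy⟩
    · refine ⟨((P.C I).filter (fun c => c < y / x)).card, card_filter_le _ _, ?_⟩
      ext j
      by_cases hj : j ∈ I
      · have hjp : j ≠ p := fun h => hpI (h ▸ hj)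
        have hb := P.hne j hjp
        have h1 := (pos_ev_iff _ _ _ _).1 (h j hj)
        have e : x • P.al + y • P.be = x • (P.al + (y / x) • P.be) := by
          rw [smul_add, smul_smul, mul_div_cancel₀ _ hx.ne']
        rw [e, dot_smul_left, P.eval_eq hjp] at h1
        rw [h1.2, P.mem_A]
        have hne : y / x - P.crit j ≠ 0 := by
          intro h0; apply h1.1; rw [h0]; ring
        have h2 : P.rk I j < ((P.C I).filter (fun c => c < y / x)).card ↔ P.crit j < y / x := by
          constructor
          · intro h3
            by_contra h4
            push Not at h4
            apply absurd h3
            rw [not_lt]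
            apply card_le_card
            intro c hc'
            rw [mem_filter] at hc' ⊢
            exact ⟨hc'.1, lt_of_lt_of_le hc'.2 h4⟩
          · intro h3
            apply card_lt_card
            rw [ssubset_iff_of_subset]
            · exact ⟨P.crit j, by rw [mem_filter]; exact ⟨mem_image_of_mem _ hj, h3⟩, by simp⟩
            · intro c hc'
              rw [mem_filter] at hc' ⊢
              exact ⟨hc'.1, hc'.2.trans h3⟩
        rw [h2, ← sub_pos (a := y / x)]
        simp only [hj, true_and, mul_pos_iff_of_pos_left hx]
        rcases lt_or_gt_of_ne hb with hb | hb
        · simp only [not_lt.2 hb.le, false_iff, not_lt]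
          constructor
          · intro h5; nlinarith
          · intro h5; exact mul_pos_of_neg_of_neg hb (lt_of_le_of_ne h5 hne)
        · simp [hb]
      · have : j ∉ T := fun h => hj (hTI h)
        simp [this, P.mem_A, hj]
    · refine ⟨_, le_rfl, ?_⟩
      rw [A_card]
      ext j
      by_cases hj : j ∈ I
      · have h1 := (pos_ev_iff _ _ _ _).1 (h j hj)
        rw [zero_smul, zero_add, dot_smul_left] at h1
        have hy' : 0 < y := lt_of_le_of_ne hy (fun h => h1.1 (by rw [← h]; ring))
        rw [h1.2, mem_filter, mul_pos_iff_of_pos_left hy']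
        simp [hj]
      · have : j ∉ T := fun h => hj (hTI h)
        simp [this, hj]
  obtain ⟨φ, h1, h2⟩ := h
  have h3 : det3 P.al P.be φ = 0 := by
    rw [det3_def, P.hcrs, dot_smul_left, dot_comm, h1, mul_zero]
  obtain ⟨x, y, rfl⟩ := exists_comb (P.crs_al_be_ne hv) h3
  by_cases hx : 0 < x ∨ (x = 0 ∧ 0 ≤ y)
  · obtain ⟨t, ht, h⟩ := main x y T hTI h2 hx
    exact ⟨t, ht, Or.inl h⟩
  · obtain ⟨t, ht, h⟩ := main (-x) (-y) (I \ T) sdiff_subset (by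
      intro j hj
      have := (pos_ev_iff _ _ _ _).1 (h2 j hj)
      have e : (-x) • P.al + (-y) • P.be = -(x • P.al + y • P.be) := by
        rw [neg_smul, neg_smul, neg_add]
      rw [e, pos_ev_iff, dot_neg_left, mem_sdiff]
      refine ⟨by simpa using this.1, ?_⟩
      simp only [hj, true_and, this.2, not_lt, Left.neg_pos_iff]
      exact ⟨fun h => lt_of_le_of_ne h this.1, fun h => h.le⟩) (by
      push Not at hx
      rcases lt_or_eq_of_le hx.1 with h | h
      · left; linarith
      · right; exact ⟨by rw [h, neg_zero], by linarith [hx.2 h]⟩)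
    refine ⟨t, ht, Or.inr ?_⟩
    rw [← h, Finset.sdiff_sdiff_eq_self hTI]

lemma A_inj {t t' : ℕ} (ht : t ≤ (P.C I).card) (ht' : t' ≤ (P.C I).card) (h : P.A I t = P.A I t') :
    t = t' := by
  wlog hlt : t < t' generalizing t t'
  · rcases Nat.lt_or_ge t' t with h1 | h1
    · exact (this ht' ht h.symm h1).symm
    · omega
  obtain ⟨j, hj, hr⟩ := P.exists_rk I (t := t) (by omega)
  have h1 := P.mem_A I (t := t) (j := j)
  have h2 := P.mem_A I (t := t') (j := j)
  rw [h, h2, hr] at h1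
  simp [hj, hlt] at h1
  rw [← not_lt] at h1; tauto

noncomputable def Z (v : Fin n → V3) (p : Fin n) (I : Finset (Fin n)) : Finset (Finset (Fin n)) :=
  I.powerset.filter (InZ v p I)

lemma Z_card (hv : Cfg v) (hpI : p ∉ I) (hI : I.Nonempty) : (Z v p I).card = 2 * (P.C I).card := by
  have hm : 0 < (P.C I).card := card_pos.2 (hI.image _)
  have hZ : Z v p I = (range (P.C I).card).image (P.A I) ∪
      (range (P.C I).card).image (fun t => I \ P.A I t) := by
    ext T
    rw [Z, mem_filter, mem_powerset, mem_union, mem_image, mem_image]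
    constructor
    · rintro ⟨h1, h2⟩
      obtain ⟨t, ht, h⟩ := P.inZ_cases I hv hpI h1 h2
      rcases ht.lt_or_eq with ht | rfl
      · rcases h with h | h
        · exact Or.inl ⟨t, mem_range.2 ht, h.symm⟩
        · exact Or.inr ⟨t, mem_range.2 ht, h.symm⟩
      · rcases h with h | h
        · refine Or.inr ⟨0, mem_range.2 hm, ?_⟩
          rw [A_zero, h, Finset.sdiff_sdiff_eq_self]; exact filter_subset _ _
        · exact Or.inl ⟨0, mem_range.2 hm, by rw [A_zero, h]⟩
    · rintro (⟨t, ht, rfl⟩ | ⟨t, ht, rfl⟩)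
      · exact ⟨filter_subset _ _, P.inZ_A I hpI t⟩
      · exact ⟨sdiff_subset, inZ_compl I (P.inZ_A I hpI t)⟩
  have hinj : Set.InjOn (P.A I) (range (P.C I).card : Set ℕ) := by
    intro a ha b hb hab
    simp at ha hb
    exact P.A_inj I ha.le hb.le hab
  rw [hZ, card_union_of_disjoint, card_image_of_injOn hinj, card_image_of_injOn, card_range]
  · ring
  · intro a ha b hb hab
    apply hinj ha hb
    have := congrArg (fun S => I \ S) hab
    simp only at this
    rwa [Finset.sdiff_sdiff_eq_self (P.A_sub I a), Finset.sdiff_sdiff_eq_self (P.A_sub I b)] at this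
  · rw [disjoint_left]
    intro T h1 h2
    obtain ⟨t, ht, rfl⟩ := mem_image.1 h1
    obtain ⟨t', ht', h⟩ := mem_image.1 h2
    rw [mem_range] at ht ht'
    obtain ⟨j, hj, hr⟩ := P.exists_rk I (t := (P.C I).card - 1) (by omega)
    have e := congrArg (fun S => j ∈ S) h
    simp only [mem_sdiff, P.mem_A, hr, hj, true_and] at e
    have e1 : ¬ ((P.C I).card - 1 < t) := by omega
    have e2 : ¬ ((P.C I).card - 1 < t') := by omega
    simp only [e1, e2, eq_iff_iff, iff_false] at e
    tauto

end Pen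

lemma card_image_congr {α β γ : Type*} [DecidableEq β] [DecidableEq γ] (s : Finset α) (f : α → β) (g : α → γ)
    (h : ∀ a ∈ s, ∀ b ∈ s, f a = f b ↔ g a = g b) : (s.image f).card = (s.image g).card := by
  classical
  induction s using Finset.induction_on with
  | empty => simp
  | insert a s ha ih =>
    have ih' := ih (fun x hx y hy => h x (mem_insert_of_mem hx) y (mem_insert_of_mem hy))
    rw [image_insert, image_insert]
    by_cases hf : f a ∈ s.image f
    · have hg : g a ∈ s.image g := by
        obtain ⟨b, hb, e⟩ := mem_image.1 hf
        exact mem_image.2 ⟨b, hb, (h b (mem_insert_of_mem hb) a (mem_insert_self _ _)).1 e⟩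
      rw [insert_eq_of_mem hf, insert_eq_of_mem hg, ih']
    · have hg : g a ∉ s.image g := by
        intro hg
        obtain ⟨b, hb, e⟩ := mem_image.1 hg
        exact hf (mem_image.2 ⟨b, hb, (h b (mem_insert_of_mem hb) a (mem_insert_self _ _)).2 e⟩)
      rw [card_insert_of_notMem hf, card_insert_of_notMem hg, ih']

lemma Cfg.Ln_eq_iff {v : Fin n → V3} (hv : Cfg v) {p j k : Fin n} (hj : j ≠ p) (hk : k ≠ p) :
    Ln v p j = Ln v p k ↔ det3 (v p) (v j) (v k) = 0 := by
  constructor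
  · intro h; have := right_mem_Ln v p k; rw [← h] at this; exact mem_Ln.1 this
  · intro h; exact (hv.Ln_eq hj.symm hk.symm (left_mem_Ln _ _ _) (mem_Ln.2 h)).symm

/-- number of lines through p and points of I -/
noncomputable def mult (v : Fin n → V3) (p : Fin n) (I : Finset (Fin n)) : ℕ := (I.image (Ln v p)).card

lemma Pen.C_card {v : Fin n → V3} {p : Fin n} (P : Pen v p) (hv : Cfg v) {I : Finset (Fin n)} (hp : p ∉ I) :
    (P.C I).card = mult v p I := by
  apply card_image_congr
  intro a ha b hb
  have ha' : a ≠ p := fun h => hp (h ▸ ha)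
  have hb' : b ≠ p := fun h => hp (h ▸ hb)
  rw [P.crit_eq_iff ha' hb', hv.Ln_eq_iff ha' hb']

lemma Cfg.Z_card {v : Fin n → V3} (hv : Cfg v) {p : Fin n} {I : Finset (Fin n)} (hp : p ∉ I) (hI : I.Nonempty) :
    (Pen.Z v p I).card = 2 * mult v p I := by
  obtain ⟨P⟩ := hv.exists_pen p
  rw [P.Z_card I hv hp hI, P.C_card hv hp]

end DM

namespace DM

open Finset
open scoped Classical

variable {n : ℕ}

def IsTI (v : Fin n → V3) (I T : Finset (Fin n)) : Prop := ∃ φ : V3, ∀ i ∈ I, 0 < dot φ (ev v T i)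
noncomputable def TI (v : Fin n → V3) (I : Finset (Fin n)) : Finset (Finset (Fin n)) :=
  I.powerset.filter (IsTI v I)

lemma mem_TI {v : Fin n → V3} {I T : Finset (Fin n)} : T ∈ TI v I ↔ T ⊆ I ∧ IsTI v I T := by
  simp [TI]

lemma TI_univ (v : Fin n → V3) : TI v univ = topes v := by
  ext T; simp [mem_TI, mem_topes, IsTI, IsTope]

/-- extend by an element with nonzero value -/
lemma ext_tope {v : Fin n → V3} {I T : Finset (Fin n)} {p : Fin n} (hp : p ∉ I) (hT : T ⊆ I) {φ : V3}
    (h : ∀ i ∈ I, 0 < dot φ (ev v T i)) (h0 : dot φ (v p) ≠ 0) :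
    (dot φ (v p) < 0 ∧ T ∈ TI v (insert p I)) ∨ (0 < dot φ (v p) ∧ insert p T ∈ TI v (insert p I)) := by
  have hpT : p ∉ T := fun h => hp (hT h)
  rcases lt_or_gt_of_ne h0 with h0 | h0
  · left
    refine ⟨h0, mem_TI.2 ⟨hT.trans (subset_insert _ _), φ, fun i hi => ?_⟩⟩
    rcases mem_insert.1 hi with rfl | hi
    · rw [Pen.pos_ev_iff]; simp [hpT, h0.ne, h0.le]
    · exact h i hi
  · right
    refine ⟨h0, mem_TI.2 ⟨insert_subset_insert _ hT, φ, fun i hi => ?_⟩⟩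
    rcases mem_insert.1 hi with rfl | hi
    · rw [Pen.pos_ev_iff]; simp [h0.ne', h0]
    · have hip : i ≠ p := fun e => hp (e ▸ hi)
      have := (Pen.pos_ev_iff _ _ _ _).1 (h i hi)
      rw [Pen.pos_ev_iff, mem_insert]
      simpa [hip] using this

lemma Cfg.inZ_both {v : Fin n → V3} (hv : Cfg v) {I T : Finset (Fin n)} {p : Fin n} (hp : p ∉ I) (hT : T ⊆ I)
    (h : Pen.InZ v p I T) : T ∈ TI v (insert p I) ∧ insert p T ∈ TI v (insert p I) := by
  obtain ⟨φ, h1, h2⟩ := h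
  have hvp := dot_self_pos (hv.v_ne p)
  have key : ∀ χ : V3, dot χ (v p) ≠ 0 → ∃ ψ : V3, (∀ i ∈ I, 0 < dot ψ (ev v T i)) ∧
      ∃ ε : ℝ, 0 < ε ∧ dot ψ (v p) = ε * dot χ (v p) := by
    intro χ hχ
    obtain ⟨ε, hε, h3⟩ := small_eps I (fun i => dot φ (ev v T i)) (fun i => dot χ (ev v T i)) h2
    refine ⟨φ + ε • χ, fun i hi => ?_, ε, hε, ?_⟩
    · rw [dot_add_left, dot_smul_left]; exact h3 i hi
    · rw [dot_add_left, dot_smul_left, h1, zero_add]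
  constructor
  · have e1 : dot (-(v p)) (v p) < 0 := by rw [dot_neg_left]; linarith
    obtain ⟨ψ, a1, ε, hε, a2⟩ := key (-(v p)) e1.ne
    have : dot ψ (v p) < 0 := by rw [a2]; exact mul_neg_of_pos_of_neg hε e1
    rcases ext_tope hp hT a1 this.ne with h | h
    · exact h.2
    · linarith [h.1]
  · obtain ⟨ψ, a1, ε, hε, a2⟩ := key (v p) hvp.ne'
    have : 0 < dot ψ (v p) := by rw [a2]; exact mul_pos hε hvp
    rcases ext_tope hp hT a1 this.ne' with h | h
    · linarith [h.1]
    · exact h.2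

lemma Cfg.TI_step {v : Fin n → V3} (hv : Cfg v) {I : Finset (Fin n)} {p : Fin n} (hp : p ∉ I) :
    (TI v I).card + (Pen.Z v p I).card ≤ (TI v (insert p I)).card := by
  set X := (TI v I).filter (fun T => T ∈ TI v (insert p I)) with hX
  set Y := (TI v I).filter (fun T => insert p T ∈ TI v (insert p I)) with hY
  have h1 : X ∪ Y = TI v I := by
    rw [hX, hY, ← filter_or, filter_eq_self]
    intro T hT
    obtain ⟨hTI, φ, hφ⟩ := mem_TI.1 hT
    obtain ⟨χ, hχ1, hχ2⟩ := perturb {p} v (fun i _ => hv.v_ne i) I (ev v T) φ hφ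
    rcases ext_tope hp hTI hχ2 (hχ1 p (mem_singleton_self _)) with h | h
    · exact Or.inl h.2
    · exact Or.inr h.2
  have h2 : Pen.Z v p I ⊆ X ∩ Y := by
    intro T hT
    obtain ⟨hTI, hZ⟩ := mem_filter.1 hT
    rw [mem_powerset] at hTI
    obtain ⟨a, b⟩ := hv.inZ_both hp hTI hZ
    have hT' : T ∈ TI v I := by
      obtain ⟨φ, _, h⟩ := hZ
      exact mem_TI.2 ⟨hTI, φ, h⟩
    rw [mem_inter, mem_filter, mem_filter]
    exact ⟨⟨hT', a⟩, hT', b⟩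
  have h3 : X.card + Y.card ≤ (TI v (insert p I)).card := by
    have hinj : Set.InjOn (fun T => insert p T) (Y : Set (Finset (Fin n))) := by
      intro a ha b hb hab
      have ha' : p ∉ a := fun h => hp ((mem_TI.1 (mem_filter.1 ha).1).1 h)
      have hb' : p ∉ b := fun h => hp ((mem_TI.1 (mem_filter.1 hb).1).1 h)
      have := congrArg (fun S => erase S p) hab
      simpa [erase_insert ha', erase_insert hb'] using this
    rw [← card_image_of_injOn hinj, ← card_union_of_disjoint]
    · apply card_le_card
      apply union_subset
      · intro T hT; exact (mem_filter.1 hT).2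
      · intro T hT
        obtain ⟨S, hS, rfl⟩ := mem_image.1 hT
        exact (mem_filter.1 hS).2
    · rw [disjoint_left]
      intro T hT hT'
      obtain ⟨S, hS, rfl⟩ := mem_image.1 hT'
      exact hp ((mem_TI.1 (mem_filter.1 hT).1).1 (mem_insert_self _ _))
  have h4 := card_union_add_card_inter X Y
  have h5 := card_le_card h2
  rw [h1] at h4
  omega

noncomputable def below (i : Fin n) : Finset (Fin n) := univ.filter (fun j => j < i)

lemma Cfg.pos_n {v : Fin n → V3} (hv : Cfg v) : 0 < n := by
  obtain ⟨i, -⟩ := hv.sp; exact i.pos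

lemma Cfg.topes_ge {v : Fin n → V3} (hv : Cfg v) :
    2 + 2 * ∑ i, mult v i (below i) ≤ (topes v).card := by
  have key : ∀ k : ℕ, 1 ≤ k → k ≤ n →
      2 + 2 * ∑ i ∈ univ.filter (fun i : Fin n => i.val < k), mult v i (below i)
        ≤ (TI v (univ.filter (fun i : Fin n => i.val < k))).card := by
    intro k hk
    induction k, hk using Nat.le_induction with
    | base =>
      intro hn
      have e : univ.filter (fun i : Fin n => i.val < 1) = {(⟨0, by omega⟩ : Fin n)} := by
        ext i; simp [Fin.ext_iff]
      rw [e, sum_singleton]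
      have h0 : below (⟨0, by omega⟩ : Fin n) = ∅ := by
        ext i; simp [below, Fin.lt_def]
      rw [h0]
      have h1 := hv.TI_step (I := ∅) (p := (⟨0, by omega⟩ : Fin n)) (by simp)
      have h2 : TI v ∅ = {∅} := by ext T; simp [mem_TI, IsTI]
      have h3 : Pen.Z v (⟨0, by omega⟩ : Fin n) ∅ = {∅} := by
        ext T; simp only [Pen.Z, mem_filter, mem_powerset, subset_empty, mem_singleton, Pen.InZ]
        constructor
        · exact fun h => h.1
        · intro h; exact ⟨h, 0, by simp [dot], by simp⟩
      rw [h2, h3] at h1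
      simpa [mult] using h1
    | succ k hk ih =>
      intro hn
      have ih' := ih (by omega)
      set p : Fin n := ⟨k, by omega⟩ with hp
      have e : univ.filter (fun i : Fin n => i.val < k + 1) =
          insert p (univ.filter (fun i : Fin n => i.val < k)) := by
        ext i; simp [Fin.ext_iff, hp]; omega
      have hb : below p = univ.filter (fun i : Fin n => i.val < k) := by
        ext i; simp [below, Fin.lt_def, hp]
      have hnot : p ∉ univ.filter (fun i : Fin n => i.val < k) := by simp [hp]
      rw [e, sum_insert hnot]
      have h1 := hv.TI_step hnot
      have h2 := hv.Z_card hnot ⟨⟨0, by omega⟩, by simp; omega⟩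
      rw [hb]
      omega
  have := key n hv.pos_n le_rfl
  have e : univ.filter (fun i : Fin n => i.val < n) = univ := by ext i; simp
  rw [e, TI_univ] at this
  exact this

lemma Cfg.mult_eq {v : Fin n → V3} (hv : Cfg v) (p : Fin n) {I : Finset (Fin n)} (hp : p ∉ I) :
    mult v p I = ((lines v).filter (fun L => p ∈ L ∧ ∃ j ∈ L, j ∈ I)).card := by
  unfold mult
  congr 1
  ext L
  rw [mem_image, mem_filter]
  constructor
  · rintro ⟨j, hj, rfl⟩
    have hjp : p ≠ j := fun h => hp (h ▸ hj)
    exact ⟨Ln_mem_lines hjp, left_mem_Ln _ _ _, j, right_mem_Ln _ _ _, hj⟩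
  · rintro ⟨h1, h2, j, h3, h4⟩
    have hjp : p ≠ j := fun h => hp (h ▸ h4)
    exact ⟨j, h4, (hv.line_eq h1 hjp h2 h3).symm⟩

lemma Cfg.sum_below {v : Fin n → V3} (hv : Cfg v) :
    ∑ i, mult v i (below i) = ∑ L ∈ lines v, (L.card - 1) := by
  have h1 : ∀ i : Fin n, mult v i (below i) =
      ((lines v).filter (fun L => i ∈ L ∧ ∃ j ∈ L, j ∈ below i)).card := fun i =>
    hv.mult_eq i (by simp [below])
  simp_rw [h1, card_filter]
  rw [sum_comm]
  apply sum_congr rfl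
  intro L hL
  rw [← card_filter]
  have hne : L.Nonempty := card_pos.1 (by have := two_le_line hL; omega)
  have : univ.filter (fun i => i ∈ L ∧ ∃ j ∈ L, j ∈ below i) = L.erase (L.min' hne) := by
    ext i
    simp only [mem_filter, mem_univ, true_and, mem_erase, below]
    constructor
    · rintro ⟨h1, j, h2, h3⟩
      refine ⟨?_, h1⟩
      rintro rfl
      exact absurd (L.min'_le j h2) (not_le.2 h3)
    · rintro ⟨h1, h2⟩
      exact ⟨h2, L.min' hne, L.min'_mem hne, lt_of_le_of_ne (L.min'_le i h2) (Ne.symm h1)⟩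
  rw [this, card_erase_of_mem (L.min'_mem hne)]

lemma Cfg.sum_mult {v : Fin n → V3} (hv : Cfg v) :
    ∑ i, mult v i (univ.erase i) = ∑ L ∈ lines v, L.card := by
  have h1 : ∀ i : Fin n, mult v i (univ.erase i) =
      ((lines v).filter (fun L => i ∈ L)).card := by
    intro i
    rw [hv.mult_eq i (by simp)]
    congr 1
    ext L
    simp only [mem_filter, mem_erase, mem_univ, and_true]
    constructor
    · rintro ⟨a, b, c⟩; exact ⟨a, b⟩
    · rintro ⟨a, b⟩
      refine ⟨a, b, ?_⟩
      obtain ⟨j, hj, h⟩ := exists_mem_ne (s := L) (by have := two_le_line a; omega) i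
      exact ⟨j, hj, h⟩
  simp_rw [h1, card_filter]
  rw [sum_comm]
  apply sum_congr rfl
  intro L hL
  rw [← card_filter]
  congr 1
  ext i; simp

/-- T with wall p gives an element of Z -/
lemma wall_inZ {v : Fin n → V3} {T : Finset (Fin n)} {p : Fin n} (hT : IsTope v T)
    (hp : p ∈ walls v T) : Pen.InZ v p (univ.erase p) (T.erase p) := by
  obtain ⟨φ, hφ⟩ := hT
  obtain ⟨ψ, hψ⟩ := mem_walls.1 hp
  have a := hφ p
  have b := hψ p
  rw [ev_fl_self, dot_neg_right] at b
  refine ⟨(-dot ψ (ev v T p)) • φ + dot φ (ev v T p) • ψ, ?_, ?_⟩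
  · have : dot ((-dot ψ (ev v T p)) • φ + dot φ (ev v T p) • ψ) (ev v T p) = 0 := by
      rw [dot_add_left, dot_smul_left, dot_smul_left]; ring
    rw [dot_ev] at this
    exact (mul_eq_zero.1 this).resolve_left (sgn_ne _ _)
  · intro j hj
    have hjp : j ≠ p := (mem_erase.1 hj).1
    have e : ev v (T.erase p) j = ev v T j := by simp [ev, sgn, hjp]
    rw [e, dot_add_left, dot_smul_left, dot_smul_left]
    have c := hψ j
    rw [ev_fl_ne v T hjp] at c
    have := hφ j
    positivity

lemma Cfg.wall_count {v : Fin n → V3} (hv : Cfg v) (p : Fin n) :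
    ((topes v).filter (fun T => p ∈ walls v T)).card ≤ 4 * mult v p (univ.erase p) := by
  have hne : (univ.erase p : Finset (Fin n)).Nonempty := by
    obtain ⟨i, j, k, hd⟩ := hv.sp
    by_contra h
    have : ∀ q, q = p := by
      intro q; by_contra hq; exact h ⟨q, by simp [hq]⟩
    rw [this i, this j] at hd; exact hd (det3_self12 _ _)
  have h1 := hv.Z_card (p := p) (I := univ.erase p) (by simp) hne
  have h2 : ((topes v).filter (fun T => p ∈ walls v T)).card ≤
      ((Pen.Z v p (univ.erase p)) ×ˢ ({true, false} : Finset Bool)).card := by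
    apply card_le_card_of_injOn (fun T => (T.erase p, decide (p ∈ T)))
    · intro T hT
      rw [mem_coe, mem_filter, mem_topes] at hT
      rw [mem_coe, mem_product]
      refine ⟨?_, by simp [em]⟩
      rw [Pen.Z, mem_filter, mem_powerset]
      exact ⟨erase_subset_erase _ (subset_univ _), wall_inZ hT.1 hT.2⟩
    · intro T _ S _ h
      simp only [Prod.mk.injEq, decide_eq_decide] at h
      ext j
      by_cases hj : j = p
      · subst hj; exact h.2
      · have := congrArg (fun X => j ∈ X) h.1
        simpa [hj] using this
  rw [card_product] at h2
  simp at h2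
  omega

/-- Melchior with all terms -/
theorem Cfg.melchior {v : Fin n → V3} (hv : Cfg v) :
    ∑ T ∈ topes v, (((walls v T).card : ℤ) - 3) + ∑ L ∈ lines v, 2 * ((L.card : ℤ) - 3) + 6 ≤ 0 := by
  have h1 := hv.topes_ge
  rw [hv.sum_below] at h1
  have h2 : ∑ T ∈ topes v, (walls v T).card ≤ 4 * ∑ L ∈ lines v, L.card := by
    rw [← hv.sum_mult, mul_sum]
    have : ∀ T, (walls v T).card = ∑ i, if i ∈ walls v T then 1 else 0 := by
      intro T; rw [← card_filter]; congr 1; ext; simp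
    simp_rw [this]
    rw [sum_comm]
    apply sum_le_sum
    intro i _
    rw [← card_filter]
    exact hv.wall_count i
  have h3 : ((∑ L ∈ lines v, (L.card - 1) : ℕ) : ℤ) = ∑ L ∈ lines v, ((L.card : ℤ) - 1) := by
    push_cast
    apply sum_congr rfl
    intro L hL
    have := two_le_line hL
    push_cast [Nat.cast_sub (show 1 ≤ L.card by omega)]
    rfl
  zify at h1 h2
  rw [← Nat.cast_sum, h3] at h1
  rw [sum_sub_distrib, sum_const, nsmul_eq_mul]
  rw [sum_sub_distrib, sum_const, nsmul_eq_mul] at h1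
  rw [← mul_sum, sum_sub_distrib, sum_const, nsmul_eq_mul]
  linarith

end DM

namespace DM

open Finset
open scoped Classical

variable {n : ℕ}

noncomputable def N2 (v : Fin n → V3) : ℕ := ((lines v).filter (fun L => L.card = 2)).card

lemma Cfg.melchior_split {v : Fin n → V3} (hv : Cfg v) :
    ∑ T ∈ topes v, ((walls v T).card - 3) + 2 * ∑ L ∈ lines v, (L.card - 3) + 6 ≤ 2 * N2 v := by
  have h := hv.melchior
  have h1 : ∑ T ∈ topes v, (((walls v T).card : ℤ) - 3) = ((∑ T ∈ topes v, ((walls v T).card - 3) : ℕ) : ℤ) := by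
    push_cast
    apply sum_congr rfl
    intro T hT
    have := hv.walls_card (mem_topes.1 hT)
    push_cast [Nat.cast_sub this]; rfl
  have h2 : ∑ L ∈ lines v, 2 * ((L.card : ℤ) - 3) =
      2 * ((∑ L ∈ lines v, (L.card - 3) : ℕ) : ℤ) - 2 * (N2 v : ℤ) := by
    rw [← mul_sum, ← mul_sub]
    congr 1
    rw [N2, card_filter]
    push_cast
    rw [← sum_sub_distrib]
    apply sum_congr rfl
    intro L hL
    have := two_le_line hL
    split_ifs with h3
    · rw [h3]; norm_num
    · push_cast [Nat.cast_sub (show 3 ≤ L.card by omega)]; ring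
  rw [h1, h2] at h
  omega

/-- exactly three points on the line -/
def Tri (v : Fin n → V3) (i j k : Fin n) : Prop := i ≠ j ∧ j ≠ k ∧ i ≠ k ∧ Ln v i j = {i, j, k}

lemma Cfg.tri_of_card {v : Fin n → V3} (hv : Cfg v) {i j : Fin n} (hij : i ≠ j) (h : (Ln v i j).card = 3) :
    ∃ k, Tri v i j k := by
  have h1 : (((Ln v i j).erase i).erase j).card = 1 := by
    rw [card_erase_of_mem, card_erase_of_mem (left_mem_Ln _ _ _), h]
    exact mem_erase.2 ⟨hij.symm, right_mem_Ln _ _ _⟩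
  obtain ⟨k, hk⟩ := card_eq_one.1 h1
  have hk' : k ∈ ((Ln v i j).erase i).erase j := by rw [hk]; simp
  simp only [mem_erase] at hk'
  refine ⟨k, hij, Ne.symm hk'.1, Ne.symm hk'.2.1, ?_⟩
  rw [← insert_erase (left_mem_Ln v i j), ← insert_erase (mem_erase.2 ⟨hij.symm, right_mem_Ln v i j⟩), hk]

lemma Tri.card {v : Fin n → V3} {i j k : Fin n} (h : Tri v i j k) : (Ln v i j).card = 3 := by
  rw [h.2.2.2]; exact card_eq_three.2 ⟨i, j, k, h.1, h.2.2.1, h.2.1, rfl⟩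
lemma Tri.swap12 {v : Fin n → V3} {i j k : Fin n} (h : Tri v i j k) : Tri v j i k :=
  ⟨h.1.symm, h.2.2.1, h.2.1, by rw [Ln_comm, h.2.2.2]; ext; simp; tauto⟩
lemma Tri.swap23 {v : Fin n → V3} {i j k : Fin n} (hv : Cfg v) (h : Tri v i j k) : Tri v i k j :=
  ⟨h.2.2.1, h.2.1.symm, h.1, by
    rw [hv.Ln_eq h.1 h.2.2.1 (left_mem_Ln _ _ _) (by rw [h.2.2.2]; simp), h.2.2.2]; ext; simp; tauto⟩
lemma Tri.rot {v : Fin n → V3} {i j k : Fin n} (hv : Cfg v) (h : Tri v i j k) : Tri v j k i :=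
  h.swap12.swap23 hv
lemma Tri.rot' {v : Fin n → V3} {i j k : Fin n} (hv : Cfg v) (h : Tri v i j k) : Tri v k i j :=
  (h.rot hv).rot hv
lemma Tri.uniq {v : Fin n → V3} {i j k l : Fin n} (h : Tri v i j k) (h' : Tri v i j l) : k = l := by
  have : k ∈ ({i, j, l} : Finset (Fin n)) := by rw [← h'.2.2.2, h.2.2.2]; simp
  simp only [mem_insert, mem_singleton] at this
  rcases this with e | e | e
  · exact absurd e.symm h.2.2.1
  · exact absurd e.symm h.2.1
  · exact e
lemma Tri.det {v : Fin n → V3} {i j k : Fin n} (h : Tri v i j k) : det3 (v i) (v j) (v k) = 0 :=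
  mem_Ln.1 (by rw [h.2.2.2]; simp)

lemma det3_ev (v : Fin n → V3) (T : Finset (Fin n)) (i j k : Fin n) :
    det3 (ev v T i) (ev v T j) (ev v T k) = sgn T i * sgn T j * sgn T k * det3 (v i) (v j) (v k) := by
  simp only [ev, det3_smul]
lemma det3_ev_eq_zero (v : Fin n → V3) (T : Finset (Fin n)) (i j k : Fin n) :
    det3 (ev v T i) (ev v T j) (ev v T k) = 0 ↔ det3 (v i) (v j) (v k) = 0 := by
  rw [det3_ev]; simp [sgn_ne]

lemma det3_comb3 (a b x y z : V3) (p q r : ℝ) (h : z = p • a + q • b + r • x) :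
    det3 a b z = r * det3 a b x := by
  rw [h]; simp [det3, dot, crs]; ring

lemma det3_comb4 (a b x y z w : V3) (p q r : ℝ) (h : z = p • w + q • x + r • y) :
    det3 a b z = p * det3 a b w + q * det3 a b x + r * det3 a b y := by
  rw [h]; simp [det3, dot, crs]; ring

lemma Cfg.cross_aux {v : Fin n → V3} (hv : Cfg v) {T : Finset (Fin n)} (hT : IsTope v T)
    {i j k l : Fin n} (hw : walls v T = {i, j, k}) (hl : Tri v i j l)
    (hc : (walls v (fl T i)).card = 3) : l ∈ walls v (fl T i) := by
  obtain ⟨hdet, hcone⟩ := hv.cone hT hw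
  have hiw : i ∈ walls v T := by rw [hw]; simp
  have hT' : IsTope v (fl T i) := mem_walls.1 hiw
  have hiw' : i ∈ walls v (fl T i) := by rw [mem_walls, fl_fl]; exact hT
  obtain ⟨x, y, hxy, hxye⟩ : ∃ x y, x ≠ y ∧ (walls v (fl T i)).erase i = {x, y} := by
    apply card_eq_two.1; rw [card_erase_of_mem hiw', hc]
  have hw' : walls v (fl T i) = {i, x, y} := by rw [← insert_erase hiw', hxye]
  have hxi : x ≠ i := by
    have : x ∈ (walls v (fl T i)).erase i := by rw [hxye]; simp
    exact (mem_erase.1 this).1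
  have hyi : y ≠ i := by
    have : y ∈ (walls v (fl T i)).erase i := by rw [hxye]; simp
    exact (mem_erase.1 this).1
  obtain ⟨-, hcone'⟩ := hv.cone hT' hw'
  set D := det3 (ev v T i) (ev v T j) (ev v T k) with hD
  have hD0 : D ≠ 0 := by rw [hD, Ne, det3_ev_eq_zero]; exact hdet
  -- sign of det3 i j .
  have hsign : ∀ z, 0 ≤ D * det3 (ev v T i) (ev v T j) (ev v T z) := by
    intro z
    obtain ⟨a, b, c, ha, hb, hc, h⟩ := hcone z
    rw [det3_comb3 _ _ _ 0 _ _ _ _ h, ← hD]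
    nlinarith [mul_self_nonneg D]
  have hij : i ≠ j := hl.1
  -- j is not a wall of the flip
  have hj : j ∉ walls v (fl T i) := by
    intro hj
    obtain ⟨φ, hφ⟩ := mem_walls.1 hj
    have h1 := hφ i
    have h2 := hφ j
    have h3 := hφ l
    rw [ev_fl_ne _ _ hij, ev_fl_self, dot_neg_right] at h1
    rw [ev_fl_self, ev_fl_ne _ _ hij.symm, dot_neg_right] at h2
    rw [ev_fl_ne _ _ hl.2.1.symm, ev_fl_ne _ _ hl.2.2.1.symm] at h3
    obtain ⟨a, b, c, ha, hb, hc, h⟩ := hcone l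
    have h4 := det3_comb3 _ _ _ 0 _ _ _ _ h
    rw [(det3_ev_eq_zero v T i j l).2 hl.det, ← hD] at h4
    have hc0 : c = 0 := by
      rcases mul_eq_zero.1 h4.symm with h | h
      · exact h
      · exact absurd h hD0
    rw [h, hc0, zero_smul, add_zero, dot_add_right, dot_smul_right, dot_smul_right] at h3
    nlinarith
  obtain ⟨a, b, c, ha, hb, hc', h⟩ := hcone' j
  rw [ev_fl_ne _ _ hij.symm, ev_fl_self, ev_fl_ne _ _ hxi, ev_fl_ne _ _ hyi] at h
  have h5 := det3_comb4 (ev v T i) (ev v T j) _ _ _ _ _ _ _ h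
  rw [det3_self23] at h5
  have h6 : det3 (ev v T i) (ev v T j) (-ev v T i) = 0 := by simp [det3, dot, crs]; ring
  rw [h6] at h5
  have key : ∀ z, z ≠ i → z ∈ walls v (fl T i) → det3 (ev v T i) (ev v T j) (ev v T z) = 0 → z = l := by
    intro z hz hzw h
    have h7 : z ∈ Ln v i j := mem_Ln.2 ((det3_ev_eq_zero v T i j z).1 h)
    rw [hl.2.2.2] at h7
    simp only [mem_insert, mem_singleton] at h7
    rcases h7 with rfl | rfl | rfl
    · exact absurd rfl hz
    · exact absurd hzw hj
    · rfl
  have h8 : D * (b * det3 (ev v T i) (ev v T j) (ev v T x)) + D * (c * det3 (ev v T i) (ev v T j) (ev v T y)) = 0 := by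
    rw [← mul_add]
    rw [show b * det3 (ev v T i) (ev v T j) (ev v T x) + c * det3 (ev v T i) (ev v T j) (ev v T y) = 0 by linarith]
    ring
  have h9 := mul_nonneg hb (hsign x)
  have h10 := mul_nonneg hc' (hsign y)
  have h11 : b * (D * det3 (ev v T i) (ev v T j) (ev v T x)) = 0 := by nlinarith
  have h12 : c * (D * det3 (ev v T i) (ev v T j) (ev v T y)) = 0 := by nlinarith
  rcases mul_eq_zero.1 h11 with hb0 | h13
  · rcases mul_eq_zero.1 h12 with hc0 | h14
    · exfalso
      rw [hb0, hc0, zero_smul, zero_smul, add_zero, add_zero] at h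
      apply hv.ev_np T hij
      rw [h]; ext <;> simp [crs] <;> ring
    · have := key y hyi (by rw [hw']; simp) ((mul_eq_zero.1 h14).resolve_left hD0)
      rw [← this, hw']; simp
  · have := key x hxi (by rw [hw']; simp) ((mul_eq_zero.1 h13).resolve_left hD0)
    rw [← this, hw']; simp

lemma Cfg.cross {v : Fin n → V3} (hv : Cfg v) {T : Finset (Fin n)} (hT : IsTope v T)
    {i j k l m : Fin n} (hw : walls v T = {i, j, k}) (hl : Tri v i j l) (hm : Tri v i k m)
    (hc : (walls v (fl T i)).card = 3) : walls v (fl T i) = {i, l, m} := by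
  have h1 := hv.cross_aux hT hw hl hc
  have hw2 : walls v T = {i, k, j} := by rw [hw]; ext; simp; tauto
  have h2 := hv.cross_aux hT hw2 hm hc
  have hiw' : i ∈ walls v (fl T i) := by rw [mem_walls, fl_fl]; exact hT
  have hlm : l ≠ m := by
    rintro rfl
    have := (hl.swap23 hv).2.2.2
    have h4 : k ∈ Ln v i l := by rw [(hm.swap23 hv).2.2.2]; simp
    have h5 : k ∈ Ln v i j := by
      rw [hl.2.2.2]; rw [this] at h4; simp at h4 ⊢; tauto
    exact (hv.cone hT hw).1 (mem_Ln.1 h5)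
  symm
  apply eq_of_subset_of_card_le
  · intro x hx
    simp only [mem_insert, mem_singleton] at hx
    rcases hx with rfl | rfl | rfl <;> assumption
  · rw [hc]
    exact (card_eq_three.2 ⟨i, l, m, hl.2.2.1, hm.2.2.1, hlm, rfl⟩).ge

end DM

namespace DM

open Finset
open scoped Classical

variable {n : ℕ}

def G0 (v : Fin n → V3) (T : Finset (Fin n)) : Prop :=
  IsTope v T ∧ (walls v T).card = 3 ∧ (∀ i ∈ walls v T, (walls v (fl T i)).card = 3) ∧
    ∀ i ∈ walls v T, ∀ j ∈ walls v T, i ≠ j → (Ln v i j).card = 3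

def Gd (v : Fin n → V3) : ℕ → Finset (Fin n) → Prop
  | 0 => G0 v
  | d + 1 => fun T => Gd v d T ∧ ∀ i ∈ walls v T, Gd v d (fl T i)

lemma Gd_zero {v : Fin n → V3} {d : ℕ} {T : Finset (Fin n)} (h : Gd v d T) : G0 v T := by
  induction d with
  | zero => exact h
  | succ d ih => exact ih h.1

/-- The flags -/
noncomputable def Fl (v : Fin n → V3) (i : Fin n) (L : Finset (Fin n)) : Finset (Finset (Fin n)) :=
  (topes v).filter (fun T => (walls v T).card = 3 ∧ i ∈ walls v T ∧ ∃ j ∈ walls v T, j ≠ i ∧ j ∈ L)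

lemma sgn_eq_of_mul {T S : Finset (Fin n)} {l m : Fin n} {X : ℝ} (h1 : 0 < sgn T l * sgn T m * X)
    (h2 : 0 < sgn S l * sgn S m * X) (h : m ∈ T ↔ m ∈ S) : l ∈ T ↔ l ∈ S := by
  have e : sgn T m = sgn S m := by simp [sgn, h]
  rw [e] at h1
  by_cases a : l ∈ T <;> by_cases b : l ∈ S <;> simp [a, b] <;>
    · simp [sgn, a, b] at h1 h2
      split_ifs at h1 h2 <;> linarith

lemma Cfg.flag_facts {v : Fin n → V3} (hv : Cfg v) {T : Finset (Fin n)} {i : Fin n} {L : Finset (Fin n)}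
    (hL : L ∈ lines v) (hi : i ∈ L) (hT : T ∈ Fl v i L) (P : Pen v i) {j0 l0 : Fin n} (hj0 : j0 ∈ L) (hj0i : j0 ≠ i)
    (hl0 : l0 ∉ L) :
    (∀ l, l ∉ L → 0 < sgn T l * sgn T l0 * (det3 (v i) (v j0) (v l) * det3 (v i) (v j0) (v l0))) ∧
    (∀ l ∈ L, l ≠ i → 0 < sgn T l * sgn T j0 * (dot P.be (v l) * dot P.be (v j0))) := by
  obtain ⟨hT1, hT2, hT3, j, hj1, hj2, hj3⟩ := mem_filter.1 hT
  rw [mem_topes] at hT1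
  obtain ⟨k, hk⟩ : ∃ k, ((walls v T).erase i).erase j = {k} := by
    apply card_eq_one.1
    rw [card_erase_of_mem (mem_erase.2 ⟨hj2, hj1⟩), card_erase_of_mem hT3, hT2]
  have hw : walls v T = {i, j, k} := by
    rw [← insert_erase hT3, ← insert_erase (mem_erase.2 ⟨hj2, hj1⟩), hk]
  obtain ⟨hdet, hcone⟩ := hv.cone hT1 hw
  have hLe : L = Ln v i j := hv.line_eq hL hj2.symm hi hj3
  set D := det3 (ev v T i) (ev v T j) (ev v T k) with hD
  have hD0 : D ≠ 0 := by rw [hD, Ne, det3_ev_eq_zero]; exact hdet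
  have hsign : ∀ z, 0 ≤ D * det3 (ev v T i) (ev v T j) (ev v T z) := by
    intro z
    obtain ⟨a, b, c, ha, hb, hc, h⟩ := hcone z
    rw [det3_comb3 _ _ _ 0 _ _ _ _ h, ← hD]
    nlinarith [mul_self_nonneg D]
  have hpos : ∀ z, z ∉ L → 0 < D * det3 (ev v T i) (ev v T j) (ev v T z) := by
    intro z hz
    apply lt_of_le_of_ne (hsign z)
    intro h
    have := (mul_eq_zero.1 h.symm).resolve_left hD0
    rw [det3_ev_eq_zero] at this
    exact hz (by rw [hLe]; exact mem_Ln.2 this)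
  constructor
  · intro l hl
    have h1 := mul_pos (hpos l hl) (hpos l0 hl0)
    rw [det3_ev, det3_ev] at h1
    -- j0 in terms of i j
    obtain ⟨x, y, hxy⟩ := exists_comb (hv.np i j hj2.symm) (mem_Ln.1 (hLe ▸ hj0))
    have hy : y ≠ 0 := by
      intro h0
      apply hv.np i j0 hj0i.symm
      rw [hxy, h0]; ext <;> simp [crs] <;> ring
    have e : ∀ z, det3 (v i) (v j0) z = y * det3 (v i) (v j) z := by
      intro z; rw [hxy]; simp [det3, crs, dot]; ring
    rw [e, e]
    have a1 := sgn_mul_self T i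
    have a2 := sgn_mul_self T j
    have h2 : D * (sgn T i * sgn T j * sgn T l * det3 (v i) (v j) (v l)) *
      (D * (sgn T i * sgn T j * sgn T l0 * det3 (v i) (v j) (v l0))) =
      (sgn T i * sgn T i) * (sgn T j * sgn T j) * (D * D) * (sgn T l * sgn T l0 *
        (det3 (v i) (v j) (v l) * det3 (v i) (v j) (v l0))) := by ring
    rw [h2, a1, a2] at h1
    have h3 : 0 < D * D := mul_self_pos.2 hD0
    have h4 : 0 < y * y := mul_self_pos.2 hy
    have h5 : 0 < sgn T l * sgn T l0 * (det3 (v i) (v j) (v l) * det3 (v i) (v j) (v l0)) := by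
      rw [one_mul, one_mul] at h1
      exact (mul_pos_iff_of_pos_left h3).1 h1
    have := mul_pos h4 h5
    calc 0 < _ := this
      _ = _ := by ring
  · have key : ∀ l ∈ L, l ≠ i → ∃ b : ℝ, 0 < b ∧ sgn T l * dot P.be (v l) = b * (sgn T j * dot P.be (v j)) := by
      intro l hl hli
      obtain ⟨a, b, c, ha, hb, hc, h⟩ := hcone l
      have h4 := det3_comb3 _ _ _ 0 _ _ _ _ h
      rw [(det3_ev_eq_zero v T i j l).2 (mem_Ln.1 (hLe ▸ hl)), ← hD] at h4
      have hc0 : c = 0 := (mul_eq_zero.1 h4.symm).resolve_right hD0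
      rw [hc0, zero_smul, add_zero] at h
      have hb0 : b ≠ 0 := by
        intro hb0
        rw [hb0, zero_smul, add_zero] at h
        apply hv.ev_np T hli
        rw [h]; ext <;> simp [crs] <;> ring
      refine ⟨b, lt_of_le_of_ne hb hb0.symm, ?_⟩
      rw [← dot_ev, ← dot_ev, h, dot_add_right, dot_smul_right, dot_smul_right, dot_ev v T i, P.hbe]
      ring
    intro l hl hli
    obtain ⟨b, hb, h1⟩ := key l hl hli
    obtain ⟨b', hb', h2⟩ := key j0 hj0 hj0i
    have h3 : sgn T j * dot P.be (v j) ≠ 0 := mul_ne_zero (sgn_ne _ _) (P.hne j hj2)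
    have h4 : 0 < (b * (sgn T j * dot P.be (v j))) * (b' * (sgn T j * dot P.be (v j))) := by
      have := mul_self_pos.2 h3
      have := mul_pos (mul_pos hb hb') this
      nlinarith
    rw [← h1, ← h2] at h4
    calc 0 < _ := h4
      _ = _ := by ring

lemma Cfg.flag_card {v : Fin n → V3} (hv : Cfg v) {i : Fin n} {L : Finset (Fin n)}
    (hL : L ∈ lines v) (hi : i ∈ L) : (Fl v i L).card ≤ 8 := by
  obtain ⟨P⟩ := hv.exists_pen i
  obtain ⟨j0, hj0, hj0i⟩ := exists_mem_ne (s := L) (by have := two_le_line hL; omega) i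
  obtain ⟨l0, hl0⟩ : ∃ l0, l0 ∉ L := by
    obtain ⟨a, b, hab, rfl⟩ := mem_lines.1 hL
    obtain ⟨l, hl⟩ := hv.exists_ne (hv.np a b hab)
    exact ⟨l, fun h => hl (mem_Ln.1 h)⟩
  have : (Fl v i L).card ≤ (univ : Finset (Bool × Bool × Bool)).card := by
    apply card_le_card_of_injOn (fun T => (decide (i ∈ T), decide (j0 ∈ T), decide (l0 ∈ T)))
    · intro _ _; simp
    · intro T hT S hS h
      simp only [Prod.mk.injEq, decide_eq_decide] at h
      obtain ⟨h1, h2, h3⟩ := h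
      have fT := hv.flag_facts hL hi hT P hj0 hj0i hl0
      have fS := hv.flag_facts hL hi hS P hj0 hj0i hl0
      ext l
      by_cases hl : l ∈ L
      · by_cases hli : l = i
        · subst hli; exact h1
        · exact sgn_eq_of_mul (fT.2 l hl hli) (fS.2 l hl hli) h2
      · exact sgn_eq_of_mul (fT.1 l hl) (fS.1 l hl) h3
  simpa using this

noncomputable def badT (v : Fin n → V3) (d : ℕ) : Finset (Finset (Fin n)) :=
  (topes v).filter (fun T => ¬ Gd v d T)

lemma Cfg.bad0 {v : Fin n → V3} (hv : Cfg v) : (badT v 0).card ≤ 58 * N2 v := by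
  have hm := hv.melchior_split
  set A1 := (topes v).filter (fun T => (walls v T).card ≠ 3) with hA1
  have hS : ∑ T ∈ A1, ((walls v T).card - 3) ≤ 2 * N2 v := by
    have : ∑ T ∈ A1, ((walls v T).card - 3) ≤ ∑ T ∈ topes v, ((walls v T).card - 3) :=
      sum_le_sum_of_subset (filter_subset _ _)
    omega
  have hA1ge : ∀ T ∈ A1, 4 ≤ (walls v T).card := by
    intro T hT
    obtain ⟨h1, h2⟩ := mem_filter.1 hT
    have := hv.walls_card (mem_topes.1 h1)
    omega
  have c1 : A1.card ≤ 2 * N2 v := by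
    refine le_trans ?_ hS
    rw [card_eq_sum_ones]
    exact sum_le_sum (fun T hT => by have := hA1ge T hT; omega)
  set A2 := A1.biUnion (fun S => (walls v S).image (fl S)) with hA2
  have c2 : A2.card ≤ 8 * N2 v := by
    calc A2.card ≤ ∑ S ∈ A1, ((walls v S).image (fl S)).card := card_biUnion_le
      _ ≤ ∑ S ∈ A1, 4 * ((walls v S).card - 3) := by
        apply sum_le_sum
        intro S hS
        have := hA1ge S hS
        have h2 : ((walls v S).image (fl S)).card ≤ (walls v S).card := card_image_le
        omega
      _ ≤ 8 * N2 v := by rw [← mul_sum]; omega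
  set A3 := ((lines v).filter (fun L => L.card ≠ 3)).biUnion (fun L => L.biUnion (fun i => Fl v i L)) with hA3
  have c3 : A3.card ≤ 48 * N2 v := by
    calc A3.card ≤ ∑ L ∈ (lines v).filter (fun L => L.card ≠ 3), (L.biUnion (fun i => Fl v i L)).card :=
          card_biUnion_le
      _ ≤ ∑ L ∈ (lines v).filter (fun L => L.card ≠ 3), ((if L.card = 2 then 16 else 0) + 32 * (L.card - 3)) := by
        apply sum_le_sum
        intro L hL
        obtain ⟨h1, h2⟩ := mem_filter.1 hL
        have h3 : (L.biUnion (fun i => Fl v i L)).card ≤ ∑ i ∈ L, (Fl v i L).card := card_biUnion_le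
        have h4 : ∑ i ∈ L, (Fl v i L).card ≤ ∑ i ∈ L, 8 := sum_le_sum (fun i hi => hv.flag_card h1 hi)
        rw [sum_const, smul_eq_mul] at h4
        have h5 := two_le_line h1
        split_ifs with h6
        · omega
        · omega
      _ ≤ ∑ L ∈ lines v, ((if L.card = 2 then 16 else 0) + 32 * (L.card - 3)) :=
        sum_le_sum_of_subset (filter_subset _ _)
      _ = 16 * N2 v + 32 * ∑ L ∈ lines v, (L.card - 3) := by
        rw [sum_add_distrib, mul_sum, N2, card_filter, mul_sum]
        congr 1
        apply sum_congr rfl; intro L _; split_ifs <;> simp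
      _ ≤ 48 * N2 v := by omega
  have hsub : badT v 0 ⊆ A1 ∪ A2 ∪ A3 := by
    intro T hT
    obtain ⟨hT1, hT2⟩ := mem_filter.1 hT
    have hTt := mem_topes.1 hT1
    by_contra hc
    rw [mem_union, mem_union] at hc
    push Not at hc
    obtain ⟨⟨n1, n2⟩, n3⟩ := hc
    have hw3 : (walls v T).card = 3 := by
      by_contra h; exact n1 (mem_filter.2 ⟨hT1, h⟩)
    apply hT2
    refine ⟨hTt, hw3, ?_, ?_⟩
    · intro i hi
      by_contra h
      apply n2
      rw [hA2, mem_biUnion]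
      refine ⟨fl T i, mem_filter.2 ⟨mem_topes.2 (mem_walls.1 hi), h⟩, mem_image.2 ⟨i, ?_, fl_fl _ _⟩⟩
      rw [mem_walls, fl_fl]; exact hTt
    · intro i hi j hj hij
      by_contra h
      apply n3
      rw [hA3, mem_biUnion]
      refine ⟨Ln v i j, mem_filter.2 ⟨Ln_mem_lines hij, h⟩, ?_⟩
      rw [mem_biUnion]
      exact ⟨i, left_mem_Ln _ _ _, mem_filter.2 ⟨hT1, hw3, hi, j, hj, hij.symm, right_mem_Ln _ _ _⟩⟩
  have h1 := card_le_card hsub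
  have h2 := card_union_le (A1 ∪ A2) A3
  have h3 := card_union_le A1 A2
  omega

lemma bad_step {v : Fin n → V3} (d : ℕ) : (badT v (d + 1)).card ≤ 4 * (badT v d).card := by
  set X := ((badT v d).filter (fun S => (walls v S).card = 3)).biUnion (fun S => (walls v S).image (fl S)) with hX
  have hsub : badT v (d + 1) ⊆ badT v d ∪ X := by
    intro T hT
    obtain ⟨hT1, hT2⟩ := mem_filter.1 hT
    rw [mem_union]
    by_cases h : Gd v d T
    · right
      have : ∃ i ∈ walls v T, ¬ Gd v d (fl T i) := by
        by_contra hc; push Not at hc; exact hT2 ⟨h, hc⟩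
      obtain ⟨i, hi, hn⟩ := this
      rw [hX, mem_biUnion]
      refine ⟨fl T i, mem_filter.2 ⟨mem_filter.2 ⟨mem_topes.2 (mem_walls.1 hi), hn⟩, (Gd_zero h).2.2.1 i hi⟩,
        mem_image.2 ⟨i, ?_, fl_fl _ _⟩⟩
      rw [mem_walls, fl_fl]; exact mem_topes.1 hT1
    · left; exact mem_filter.2 ⟨hT1, h⟩
  have hXc : X.card ≤ 3 * (badT v d).card := by
    calc X.card ≤ ∑ S ∈ (badT v d).filter (fun S => (walls v S).card = 3), ((walls v S).image (fl S)).card :=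
          card_biUnion_le
      _ ≤ ∑ S ∈ (badT v d).filter (fun S => (walls v S).card = 3), 3 := by
        apply sum_le_sum
        intro S hS
        rw [← (mem_filter.1 hS).2]
        exact card_image_le
      _ ≤ ∑ S ∈ badT v d, 3 := sum_le_sum_of_subset (filter_subset _ _)
      _ = 3 * (badT v d).card := by rw [sum_const, smul_eq_mul, mul_comm]
  have h1 := card_le_card hsub
  have h2 := card_union_le (badT v d) X
  omega

/-- number of bad flags at `p` -/
noncomputable def bad (v : Fin n → V3) (p : Fin n) : ℕ :=
  ((badT v 3).filter (fun T => p ∈ walls v T)).card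

theorem Cfg.sum_bad {v : Fin n → V3} (hv : Cfg v) : ∑ p, bad v p ≤ 11138 * N2 v := by
  have h0 := hv.bad0
  have h1 := bad_step (v := v) 0
  have h2 := bad_step (v := v) 1
  have h3 := bad_step (v := v) 2
  have hm := hv.melchior_split
  have e : ∑ p, bad v p = ∑ T ∈ badT v 3, (walls v T).card := by
    unfold bad
    simp_rw [card_filter]
    rw [sum_comm]
    apply sum_congr rfl
    intro T _
    rw [← card_filter]; congr 1; ext; simp
  rw [e]
  have h4 : ∑ T ∈ badT v 3, (walls v T).card ≤ ∑ T ∈ badT v 3, (3 + ((walls v T).card - 3)) :=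
    sum_le_sum (fun T _ => by omega)
  rw [sum_add_distrib, sum_const, smul_eq_mul] at h4
  have h5 : ∑ T ∈ badT v 3, ((walls v T).card - 3) ≤ ∑ T ∈ topes v, ((walls v T).card - 3) :=
    sum_le_sum_of_subset (filter_subset _ _)
  simp only [zero_add, Nat.reduceAdd] at h1 h2 h3
  omega

end DM

namespace DM

open Finset
open scoped Classical

variable {n : ℕ}

lemma Gd.tope {v : Fin n → V3} {d : ℕ} {T : Finset (Fin n)} (h : Gd v d T) : IsTope v T := (Gd_zero h).1

lemma ne_of_card3 {i j k : Fin n} (h : ({i, j, k} : Finset (Fin n)).card = 3) : i ≠ j ∧ j ≠ k ∧ i ≠ k := by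
  refine ⟨?_, ?_, ?_⟩ <;> rintro rfl
  · have := card_le_two (a := i) (b := k); simp_all
  · have := card_le_two (a := i) (b := j); simp_all
  · have := card_le_two (a := i) (b := j)
    have e : ({i, j, i} : Finset (Fin n)) = {i, j} := by ext; simp; tauto
    rw [e] at h; omega

lemma Gd.ne {v : Fin n → V3} {d : ℕ} {T : Finset (Fin n)} (h : Gd v d T) {i j k : Fin n} (hw : walls v T = {i, j, k}) :
    i ≠ j ∧ j ≠ k ∧ i ≠ k := by
  apply ne_of_card3; rw [← hw]; exact (Gd_zero h).2.1

lemma Gd.step {v : Fin n → V3} {d : ℕ} {T : Finset (Fin n)} (h : Gd v (d+1) T) {i : Fin n} (hi : i ∈ walls v T) :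
    Gd v d (fl T i) := h.2 i hi

lemma Gd.third {v : Fin n → V3} (hv : Cfg v) {d : ℕ} {T : Finset (Fin n)} (h : Gd v d T) {i j : Fin n}
    (hi : i ∈ walls v T) (hj : j ∈ walls v T) (hij : i ≠ j) : ∃ l, Tri v i j l :=
  hv.tri_of_card hij ((Gd_zero h).2.2.2 i hi j hj hij)

lemma Gd.cross {v : Fin n → V3} (hv : Cfg v) {d : ℕ} {T : Finset (Fin n)} (h : Gd v d T) {i j k l m : Fin n}
    (hw : walls v T = {i, j, k}) (hl : Tri v i j l) (hm : Tri v i k m) : walls v (fl T i) = {i, l, m} :=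
  hv.cross h.tope hw hl hm ((Gd_zero h).2.2.1 i (by simp [hw]))

lemma set3_a (i j k : Fin n) : ({i, j, k} : Finset (Fin n)) = {j, i, k} := by ext; simp; tauto
lemma set3_b (i j k : Fin n) : ({i, j, k} : Finset (Fin n)) = {k, i, j} := by ext; simp; tauto

lemma third_eq {i j k l : Fin n} (h : ({i, j, k} : Finset (Fin n)) = {i, j, l}) (h1 : i ≠ k) (h2 : j ≠ k) : k = l := by
  have : k ∈ ({i, j, l} : Finset (Fin n)) := by rw [← h]; simp
  simp at this
  rcases this with h | h | h
  · exact absurd h.symm h1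
  · exact absurd h.symm h2
  · exact h

/-- the lattice data along a run -/
structure Run (v : Fin n → V3) (p : Fin n) (W : ℕ → Finset (Fin n)) (Q R : ℕ → Fin n) (a b : ℕ) : Prop where
  gd : ∀ s, a ≤ s → s ≤ b → Gd v 3 (W s)
  wl : ∀ s, a ≤ s → s ≤ b → walls v (W s) = {p, Q s, R (s+1)}
  tri : ∀ s, a ≤ s → s ≤ b + 1 → Tri v p (Q s) (R s)
  step : ∀ s, a ≤ s → s < b → W (s+1) = fl (fl (W s) (R (s+1))) (Q (s+1))

section
variable {v : Fin n → V3} {p : Fin n} {W : ℕ → Finset (Fin n)} {Q R : ℕ → Fin n} {a b : ℕ}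

lemma const_of_step {α : Type*} {f : ℕ → α} {a b : ℕ} (h : ∀ s, a ≤ s → s < b → f s = f (s+1)) :
    ∀ s, a ≤ s → s ≤ b → f s = f a := by
  intro s hs
  induction s, hs using Nat.le_induction with
  | base => intro _; rfl
  | succ k hk ih => intro hb; rw [← h k hk (by omega)]; exact ih (by omega)

lemma Run.p1 (hv : Cfg v) (h : Run v p W Q R a b) (hab : a ≤ b) :
    ∃ p1, (∀ s, a ≤ s → s ≤ b → Tri v p1 (Q s) (R (s+1))) ∧
      (∀ s, a ≤ s → s ≤ b → walls v (fl (W s) (R (s+1))) = {R (s+1), Q (s+1), p1}) := by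
  have ex : ∀ s, ∃ x, a ≤ s → s ≤ b → Tri v (R (s+1)) (Q s) x := by
    intro s
    by_cases hs : a ≤ s ∧ s ≤ b
    · obtain ⟨x, hx⟩ := (h.gd s hs.1 hs.2).third hv (i := R (s+1)) (j := Q s) (by simp [h.wl s hs.1 hs.2])
        (by simp [h.wl s hs.1 hs.2]) ((h.gd s hs.1 hs.2).ne (h.wl s hs.1 hs.2)).2.1.symm
      exact ⟨x, fun _ _ => hx⟩
    · exact ⟨p, fun h1 h2 => absurd ⟨h1, h2⟩ hs⟩
  choose f hf using ex
  have hD : ∀ s, a ≤ s → s ≤ b → walls v (fl (W s) (R (s+1))) = {R (s+1), Q (s+1), f s} := by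
    intro s h1 h2
    apply (h.gd s h1 h2).cross hv (j := p) (k := Q s)
    · rw [h.wl s h1 h2, set3_b]
    · exact ((h.tri (s+1) (by omega) (by omega)).rot' hv)
    · exact hf s h1 h2
  have hc : ∀ s, a ≤ s → s < b → f s = f (s+1) := by
    intro s h1 h2
    have g := (h.gd s h1 h2.le).step (i := R (s+1)) (by simp [h.wl s h1 h2.le])
    have w := hD s h1 h2.le
    have ne := g.ne w
    obtain ⟨y, hy⟩ := g.third hv (i := Q (s+1)) (j := f s) (by simp [w]) (by simp [w]) ne.2.1
    have := g.cross hv (i := Q (s+1)) (j := R (s+1)) (k := f s) (by rw [w, set3_a]) ((h.tri (s+1) (by omega) (by omega)).rot hv) hy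
    rw [← h.step s h1 h2] at this
    have w' := h.wl (s+1) (by omega) (by omega)
    have ne' := (h.gd (s+1) (by omega) (by omega)).ne w'
    rw [w', set3_a] at this
    have e := third_eq this ne'.2.1 ne'.2.2
    rw [← e] at hy
    have := hf (s+1) (by omega) (by omega)
    exact ((hy.swap23 hv).swap12).uniq this
  have hcc := const_of_step hc
  refine ⟨f a, fun s h1 h2 => ?_, fun s h1 h2 => ?_⟩
  · rw [← hcc s h1 h2]; exact (hf s h1 h2).rot' hv |>.swap23 hv
  · rw [← hcc s h1 h2]; exact hD s h1 h2

lemma Run.pm (hv : Cfg v) (h : Run v p W Q R a b) (hab : a ≤ b) :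
    ∃ pm, (∀ s, a ≤ s → s ≤ b → Tri v pm (Q (s+1)) (R s)) := by
  have hE : ∀ s, a ≤ s → s ≤ b → walls v (fl (W s) p) = {p, R s, Q (s+1)} := by
    intro s h1 h2
    exact (h.gd s h1 h2).cross hv (h.wl s h1 h2) (h.tri s h1 (by omega)) ((h.tri (s+1) (by omega) (by omega)).swap23 hv)
  have hg : ∀ s, a ≤ s → s ≤ b → Gd v 2 (fl (W s) p) := fun s h1 h2 =>
    (h.gd s h1 h2).step (by simp [h.wl s h1 h2])
  have ex : ∀ s, ∃ x, a ≤ s → s ≤ b → Tri v (R s) (Q (s+1)) x := by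
    intro s
    by_cases hs : a ≤ s ∧ s ≤ b
    · obtain ⟨x, hx⟩ := (hg s hs.1 hs.2).third hv (i := R s) (j := Q (s+1)) (by simp [hE s hs.1 hs.2])
        (by simp [hE s hs.1 hs.2]) ((hg s hs.1 hs.2).ne (hE s hs.1 hs.2)).2.1
      exact ⟨x, fun _ _ => hx⟩
    · exact ⟨p, fun h1 h2 => absurd ⟨h1, h2⟩ hs⟩
  choose f hf using ex
  have hc : ∀ s, a ≤ s → s < b → f s = f (s+1) := by
    intro s h1 h2
    have t1 := h.tri (s+1) (by omega) (by omega)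
    have c1 := (hg s h1 h2.le).cross hv (i := Q (s+1)) (j := p) (k := R s) (by rw [hE s h1 h2.le, set3_b]) (t1.swap12)
      ((hf s h1 h2.le).swap12)
    have c2 := (hg (s+1) (by omega) (by omega)).cross hv (i := R (s+1)) (j := p) (k := Q (s+1+1)) (by rw [hE (s+1) (by omega) (by omega), set3_a])
      (t1.rot' hv) (hf (s+1) (by omega) (by omega))
    have e : fl (fl (W (s+1)) p) (R (s+1)) = fl (fl (W s) p) (Q (s+1)) := by
      rw [h.step s h1 h2, fl_comm _ p (R (s+1)), fl_comm _ (Q (s+1)) (R (s+1)), fl_fl, fl_comm]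
    rw [e, c1, set3_a] at c2
    have g := (hg s h1 h2.le).step (i := Q (s+1)) (by simp [hE s h1 h2.le])
    have := g.ne c1
    exact third_eq c2 this.2.1 this.2.2
  have hcc := const_of_step hc
  refine ⟨f a, fun s h1 h2 => ?_⟩
  rw [← hcc s h1 h2]; exact ((hf s h1 h2).swap12).rot' hv

lemma Run.p2 (hv : Cfg v) (h : Run v p W Q R a b) (hab : a < b) :
    ∃ p1 p2, (∀ s, a ≤ s → s ≤ b → Tri v p1 (Q s) (R (s+1))) ∧ (∀ s, a ≤ s → s < b → Tri v p2 (Q s) (R (s+2))) := by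
  obtain ⟨p1, h1, hD⟩ := h.p1 hv hab.le
  have gD : ∀ s, a ≤ s → s ≤ b → Gd v 2 (fl (W s) (R (s+1))) := fun s h1 h2 =>
    (h.gd s h1 h2).step (by simp [h.wl s h1 h2])
  have gU : ∀ s, a ≤ s → s ≤ b → Gd v 1 (fl (fl (W s) (R (s+1))) p1) := fun s h1 h2 =>
    (gD s h1 h2).step (by simp [hD s h1 h2])
  have hU : ∀ s, a ≤ s → s < b → walls v (fl (fl (W s) (R (s+1))) p1) = {p1, Q s, R (s+2)} := by
    intro s i1 i2
    exact (gD s i1 i2.le).cross hv (j := R (s+1)) (k := Q (s+1)) (by rw [hD s i1 i2.le, set3_b]) ((h1 s i1 i2.le).swap23 hv)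
      (h1 (s+1) (by omega) (by omega))
  have ex : ∀ s, ∃ x, a ≤ s → s < b → Tri v (Q s) (R (s+2)) x := by
    intro s
    by_cases hs : a ≤ s ∧ s < b
    · obtain ⟨x, hx⟩ := (gU s hs.1 hs.2.le).third hv (i := Q s) (j := R (s+2)) (by simp [hU s hs.1 hs.2])
        (by simp [hU s hs.1 hs.2]) ((gU s hs.1 hs.2.le).ne (hU s hs.1 hs.2)).2.1
      exact ⟨x, fun _ _ => hx⟩
    · exact ⟨p, fun h1 h2 => absurd ⟨h1, h2⟩ hs⟩
  choose f hf using ex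
  have hc : ∀ s, a ≤ s → s < b - 1 → f s = f (s+1) := by
    intro s i1 i2
    have t1 := h1 (s+1) (by omega) (by omega)
    have c1 := (gU s i1 (by omega)).cross hv (i := R (s+2)) (j := p1) (k := Q s) (by rw [hU s i1 (by omega), set3_b])
      (t1.rot' hv) ((hf s i1 (by omega)).swap12)
    have c2 := (gU (s+1) (by omega) (by omega)).cross hv (i := Q (s+1)) (j := p1) (k := R (s+1+2)) (by rw [hU (s+1) (by omega) (by omega), set3_a])
      (t1.swap12) (hf (s+1) (by omega) (by omega))
    have e : fl (fl (fl (W (s+1)) (R (s+1+1))) p1) (Q (s+1)) = fl (fl (fl (W s) (R (s+1))) p1) (R (s+2)) := by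
      rw [h.step s i1 (by omega)]
      rw [fl_comm _ p1 (Q (s+1)), fl_comm _ (R (s+1+1)) (Q (s+1)), fl_fl, fl_comm _ (R (s+1+1)) p1]
    rw [e, c1, set3_a] at c2
    have g := (gU s i1 (by omega)).step (i := R (s+2)) (by simp [hU s i1 (by omega)])
    have := g.ne c1
    exact third_eq c2 this.2.1 this.2.2
  have hcc := const_of_step hc
  refine ⟨p1, f a, h1, fun s i1 i2 => ?_⟩
  rw [← hcc s i1 (by omega)]; exact (hf s i1 i2).rot' hv
end

end DM

namespace DM

open Finset
open scoped Classical

variable {n : ℕ}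

namespace Pen
variable {v : Fin n → V3} {p : Fin n} (P : Pen v p)

noncomputable def W (s : ℕ) : Finset (Fin n) := insert p (P.A (univ.erase p) (s+1))
noncomputable def r (j : Fin n) : ℕ := P.rk (univ.erase p) j
noncomputable def M : ℕ := (P.C (univ.erase p)).card

lemma W_tope (hv : Cfg v) (s : ℕ) : IsTope v (P.W s) ∧ p ∈ walls v (P.W s) := by
  have h := hv.inZ_both (p := p) (I := univ.erase p) (by simp) (P.A_sub _ (s+1)) (P.inZ_A _ (by simp) (s+1))
  rw [insert_erase (mem_univ p), TI_univ, mem_topes, mem_topes] at h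
  refine ⟨h.2, ?_⟩
  rw [mem_walls]
  convert h.1 using 1
  ext j
  rw [mem_fl]
  by_cases hj : j = p
  · subst hj; simp [W, Pen.mem_A]
  · simp [W, hj]

lemma W_inj {s s' : ℕ} (h1 : s + 1 ≤ P.M) (h2 : s' + 1 ≤ P.M) (h : P.W s = P.W s') : s = s' := by
  have : P.A (univ.erase p) (s+1) = P.A (univ.erase p) (s'+1) := by
    have e : ∀ t, (insert p (P.A (univ.erase p) t)).erase p = P.A (univ.erase p) t := by
      intro t; rw [erase_insert]; simp [Pen.mem_A]
    rw [← e, ← e (s'+1)]; unfold W at h; rw [h]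
  have := P.A_inj _ h1 h2 this
  omega

lemma mem_W {s : ℕ} {j : Fin n} (hj : j ≠ p) : j ∈ P.W s ↔ (0 < dot P.be (v j) ↔ P.r j < s + 1) := by
  simp [W, hj, Pen.mem_A, r]

lemma phi_nonneg {s : ℕ} {c : ℝ} (hc : ∀ l, l ≠ p → (P.r l < s+1 → P.crit l ≤ c) ∧ (s+1 ≤ P.r l → c ≤ P.crit l)) (l : Fin n) :
    0 ≤ dot (P.al + c • P.be) (ev v (P.W s) l) ∧
      (l ≠ p → dot (P.al + c • P.be) (ev v (P.W s) l) = 0 → P.crit l = c) := by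
  by_cases hl : l = p
  · subst hl
    rw [dot_ev, dot_add_left, dot_smul_left, P.hal, P.hbe]; simp
  · have hb := P.hne l hl
    have h := hc l hl
    have hm := P.mem_W (s := s) hl
    constructor
    · rw [dot_ev, P.eval_eq hl, sgn]
      by_cases hbp : 0 < dot P.be (v l) <;> by_cases hr : P.r l < s + 1
      · rw [if_pos (hm.2 (by simp [hbp, hr]))]; have := h.1 hr; nlinarith
      · rw [if_neg (by rw [hm]; simp [hbp, hr])]; have := h.2 (by omega); nlinarith
      · rw [if_neg (by rw [hm]; simp [hbp, hr])]; have := h.1 hr; nlinarith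
      · rw [if_pos (hm.2 (by simp [hbp, hr]))]; have := h.2 (by omega); nlinarith
    · intro _ h0
      rw [dot_ev, P.eval_eq hl] at h0
      have := (mul_eq_zero.1 ((mul_eq_zero.1 h0).resolve_left (sgn_ne _ _))).resolve_left hb
      linarith

lemma wall_rank (hv : Cfg v) {s : ℕ} {x y j : Fin n} (hw : walls v (P.W s) = {p, x, y}) (hj : j ≠ p) (hx : x ≠ p) (hy : y ≠ p)
    (hc : ∀ l, l ≠ p → (P.r l < s+1 → P.crit l ≤ P.crit j) ∧ (s+1 ≤ P.r l → P.crit j ≤ P.crit l)) :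
    P.crit x = P.crit j ∨ P.crit y = P.crit j := by
  obtain ⟨-, hcone⟩ := hv.cone (P.W_tope hv s).1 hw
  obtain ⟨a, b, d, ha, hb, hd, h⟩ := hcone j
  have hp : dot (P.al + P.crit j • P.be) (ev v (P.W s) p) = 0 := by
    rw [dot_ev, dot_add_left, dot_smul_left, P.hal, P.hbe]; simp
  have hj0 : dot (P.al + P.crit j • P.be) (ev v (P.W s) j) = 0 := by
    rw [dot_ev, P.eval_eq hj]; simp
  have hX := P.phi_nonneg hc x
  have hY := P.phi_nonneg hc y
  have h0 := congrArg (dot (P.al + P.crit j • P.be)) h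
  rw [hj0, dot_add_right, dot_add_right, dot_smul_right, dot_smul_right, dot_smul_right, hp] at h0
  by_contra hcon
  push Not at hcon
  have hXp := lt_of_le_of_ne hX.1 (fun e => hcon.1 (hX.2 hx e.symm))
  have hYp := lt_of_le_of_ne hY.1 (fun e => hcon.2 (hY.2 hy e.symm))
  have m1 := mul_nonneg hb hXp.le
  have m2 := mul_nonneg hd hYp.le
  have b0 : b = 0 := by
    by_contra hb0
    have := mul_pos (lt_of_le_of_ne hb (Ne.symm hb0)) hXp
    linarith
  have d0 : d = 0 := by
    by_contra hb0
    have := mul_pos (lt_of_le_of_ne hd (Ne.symm hb0)) hYp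
    linarith
  apply hv.ev_np (P.W s) hj.symm
  rw [h, b0, d0]
  ext <;> simp [crs] <;> ring

lemma W_walls (hv : Cfg v) {s : ℕ} (hs : s + 1 < P.M) (h3 : (walls v (P.W s)).card = 3) :
    ∃ x y, walls v (P.W s) = {p, x, y} ∧ x ≠ p ∧ y ≠ p ∧ P.r x = s ∧ P.r y = s + 1 := by
  have hp := (P.W_tope hv s).2
  obtain ⟨x, y, hxy, he⟩ := card_eq_two.1 (show ((walls v (P.W s)).erase p).card = 2 by rw [card_erase_of_mem hp, h3])
  have hw : walls v (P.W s) = {p, x, y} := by rw [← insert_erase hp, he]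
  have hx : x ≠ p := by have : x ∈ (walls v (P.W s)).erase p := by rw [he]; simp
                        exact (mem_erase.1 this).1
  have hy : y ≠ p := by have : y ∈ (walls v (P.W s)).erase p := by rw [he]; simp
                        exact (mem_erase.1 this).1
  obtain ⟨j, hj, hjr⟩ := P.exists_rk (univ.erase p) (t := s) (by unfold M at hs; omega)
  obtain ⟨k, hk, hkr⟩ := P.exists_rk (univ.erase p) (t := s+1) hs
  have hjp : j ≠ p := (mem_erase.1 hj).1
  have hkp : k ≠ p := (mem_erase.1 hk).1
  have mm : ∀ l, l ≠ p → l ∈ univ.erase p := fun l hl => by simp [hl]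
  have cmp : ∀ a b, a ≠ p → b ≠ p → (P.r a ≤ P.r b → P.crit a ≤ P.crit b) := by
    intro a b ha hb h
    by_contra hc; push Not at hc
    have := (P.rk_lt_iff (univ.erase p) (mm b hb)).2 hc
    unfold r at h; omega
  have e1 := P.wall_rank hv hw hjp hx hy (fun l hl => ⟨fun h => cmp _ _ hl hjp (by unfold r at *; omega),
    fun h => cmp _ _ hjp hl (by unfold r at *; omega)⟩)
  have e2 := P.wall_rank hv hw hkp hx hy (fun l hl => ⟨fun h => cmp _ _ hl hkp (by unfold r at *; omega),
    fun h => cmp _ _ hkp hl (by unfold r at *; omega)⟩)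
  rw [← P.rk_eq_iff _ (mm x hx) hj, ← P.rk_eq_iff _ (mm y hy) hj] at e1
  rw [← P.rk_eq_iff _ (mm x hx) hk, ← P.rk_eq_iff _ (mm y hy) hk] at e2
  rw [hjr] at e1
  rw [hkr] at e2
  rcases e1 with e1 | e1
  · rcases e2 with e2 | e2
    · omega
    · exact ⟨x, y, hw, hx, hy, e1, e2⟩
  · rcases e2 with e2 | e2
    · exact ⟨y, x, by rw [hw]; ext; simp; tauto, hy, hx, e1, e2⟩
    · omega

lemma r_eq_iff {j k : Fin n} (hj : j ≠ p) (hk : k ≠ p) : P.r j = P.r k ↔ det3 (v p) (v j) (v k) = 0 := by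
  rw [← P.crit_eq_iff hj hk]; exact P.rk_eq_iff _ (by simp [hj]) (by simp [hk])

lemma r_lt {j : Fin n} (hj : j ≠ p) : P.r j < P.M := P.rk_lt _ (by simp [hj])

/-- good index -/
def good (s : ℕ) : Prop := s + 1 < P.M ∧ Gd v 3 (P.W s)

lemma tri_rank {q z : Fin n} (h : Tri v p q z) : P.r z = P.r q :=
  (P.r_eq_iff h.2.2.1.symm h.1.symm).2 (by have := h.det; rw [det3_swap23]; simp [this])

lemma tri_unique {q z j : Fin n} (h : Tri v p q z) (hj : j ≠ p) (hr : P.r j = P.r q) : j = q ∨ j = z := by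
  have : j ∈ Ln v p q := mem_Ln.2 ((P.r_eq_iff h.1.symm hj).1 hr.symm)
  rw [h.2.2.2] at this
  simp at this; tauto

lemma exists_run (hv : Cfg v) {a b : ℕ} (hab : a ≤ b) (hg : ∀ s, a ≤ s → s ≤ b → P.good s) :
    ∃ Q R : ℕ → Fin n, Run v p P.W Q R a b ∧ ∀ s, a ≤ s → s ≤ b + 1 → P.r (Q s) = s ∧ P.r (R s) = s := by
  have ex : ∀ s, ∃ x y z w, a ≤ s → s ≤ b → walls v (P.W s) = {p, x, y} ∧ x ≠ p ∧ y ≠ p ∧ P.r x = s ∧ P.r y = s+1 ∧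
      Tri v p x z ∧ Tri v p y w := by
    intro s
    by_cases hs : a ≤ s ∧ s ≤ b
    · have g := hg s hs.1 hs.2
      obtain ⟨x, y, h1, h2, h3, h4, h5⟩ := P.W_walls hv g.1 (Gd_zero g.2).2.1
      obtain ⟨z, hz⟩ := g.2.third hv (i := p) (j := x) (by simp [h1]) (by simp [h1]) h2.symm
      obtain ⟨w, hw⟩ := g.2.third hv (i := p) (j := y) (by simp [h1]) (by simp [h1]) h3.symm
      exact ⟨x, y, z, w, fun _ _ => ⟨h1, h2, h3, h4, h5, hz, hw⟩⟩
    · exact ⟨p, p, p, p, fun h1 h2 => absurd ⟨h1, h2⟩ hs⟩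
  choose x y z w hE using ex
  -- the step
  have hstep : ∀ s, a ≤ s → s ≤ b → P.W (s+1) = fl (fl (P.W s) (y s)) (w s) := by
    intro s h1 h2
    obtain ⟨e1, e2, e3, e4, e5, e6, e7⟩ := hE s h1 h2
    ext j
    rw [mem_fl, mem_fl]
    by_cases hjp : j = p
    · subst hjp
      have := e7.2.2.1
      simp [W, e3.symm, this]
    · rw [P.mem_W hjp, P.mem_W hjp]
      by_cases hr : P.r j = s + 1
      · rcases P.tri_unique e7 hjp (by rw [hr, e5]) with rfl | rfl
        · have := e7.2.1
          rw [hr]; simp [this]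
        · have := e7.2.1.symm
          rw [hr]; simp [this]
      · have n1 : j ≠ y s := fun h => hr (by rw [h, e5])
        have n2 : j ≠ w s := fun h => hr (by rw [h, P.tri_rank e7, e5])
        simp only [n1, n2, ne_eq, not_false_eq_true, iff_true]
        have : P.r j < s + 1 + 1 ↔ P.r j < s + 1 := by omega
        rw [this]
  have hlink : ∀ s, a ≤ s → s + 1 ≤ b → x (s+1) = w s ∧ z (s+1) = y s := by
    intro s h1 h2
    obtain ⟨e1, e2, e3, e4, e5, e6, e7⟩ := hE s h1 (by omega)
    obtain ⟨f1, f2, f3, f4, f5, f6, f7⟩ := hE (s+1) (by omega) h2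
    have g := hg s h1 (by omega)
    have hgD : Gd v 2 (fl (P.W s) (y s)) := g.2.step (by simp [e1])
    obtain ⟨u, hu⟩ := g.2.third hv (i := y s) (j := x s) (by simp [e1]) (by simp [e1]) (g.2.ne e1).2.1.symm
    have hD := g.2.cross hv (i := y s) (j := p) (k := x s) (by rw [e1, set3_b]) e7.swap12 hu
    have hm : w s ∈ walls v (P.W (s+1)) := by
      have hg2 := hgD.step (i := w s) (by simp [hD])
      rw [mem_walls, hstep s h1 (by omega), fl_fl]
      exact hgD.tope
    have hx : x (s+1) = w s := by
      rw [f1] at hm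
      simp at hm
      have r1 : P.r (w s) = s + 1 := by rw [P.tri_rank e7, e5]
      rcases hm with h | h | h
      · exact absurd h e7.2.2.1.symm
      · exact h.symm
      · rw [h, f5] at r1; omega
    refine ⟨hx, ?_⟩
    rw [hx] at f6
    exact f6.uniq (e7.swap23 hv)
  refine ⟨fun s => if s ≤ b then x s else w (s-1), fun s => if s = a then z a else y (s-1), ⟨?_, ?_, ?_, ?_⟩, ?_⟩
  · intro s h1 h2; exact (hg s h1 h2).2
  · intro s h1 h2
    simp [h2, show s + 1 ≠ a by omega]
    exact (hE s h1 h2).1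
  · intro s h1 h2
    by_cases hsa : s = a
    · subst hsa; simp [hab]; exact (hE s le_rfl hab).2.2.2.2.2.1
    · obtain ⟨s, rfl⟩ : ∃ s', s = s' + 1 := ⟨s - 1, by omega⟩
      have hh := hE s (by omega) (by omega)
      by_cases hsb : s + 1 ≤ b
      · simp [hsa, hsb]
        rw [(hlink s (by omega) hsb).1]; exact hh.2.2.2.2.2.2.swap23 hv
      · simp [hsa, hsb]; exact hh.2.2.2.2.2.2.swap23 hv
  · intro s h1 h2
    simp [show s + 1 ≠ a by omega, show s + 1 ≤ b by omega]
    rw [(hlink s h1 h2).1]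
    exact hstep s h1 h2.le
  · intro s h1 h2
    by_cases hsa : s = a
    · subst hsa; simp [hab]
      obtain ⟨e1, e2, e3, e4, e5, e6, e7⟩ := hE s le_rfl hab
      exact ⟨e4, by rw [P.tri_rank e6, e4]⟩
    · obtain ⟨s, rfl⟩ : ∃ s', s = s' + 1 := ⟨s - 1, by omega⟩
      obtain ⟨e1, e2, e3, e4, e5, e6, e7⟩ := hE s (by omega) (by omega)
      have : P.r (w s) = s + 1 := by rw [P.tri_rank e7, e5]
      by_cases hsb : s + 1 ≤ b
      · simp [hsa, hsb, e5]
        rw [(hlink s (by omega) hsb).1]; exact this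
      · simp [hsa, hsb, e5, this]
end Pen

end DM

namespace DM

open Finset
open scoped Classical

noncomputable section

abbrev MP := MvPolynomial (Fin 2) ℝ
abbrev VD (d : ℕ) : Submodule ℝ MP := MvPolynomial.restrictTotalDegree (Fin 2) ℝ d

/-- evaluation at a point -/
def E (f : MP) (z : ℝ × ℝ) : ℝ := MvPolynomial.eval ![z.1, z.2] f

lemma mem_VD {d : ℕ} {f : MP} : f ∈ VD d ↔ f.totalDegree ≤ d := MvPolynomial.mem_restrictTotalDegree _ _ _

@[simp] lemma E_mul (f g : MP) (z : ℝ × ℝ) : E (f * g) z = E f z * E g z := by simp [E]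
@[simp] lemma E_add (f g : MP) (z : ℝ × ℝ) : E (f + g) z = E f z + E g z := by simp [E]
@[simp] lemma E_sub (f g : MP) (z : ℝ × ℝ) : E (f - g) z = E f z - E g z := by simp [E]
@[simp] lemma E_zero (z : ℝ × ℝ) : E 0 z = 0 := by simp [E]
@[simp] lemma E_one (z : ℝ × ℝ) : E 1 z = 1 := by simp [E]
@[simp] lemma E_C (c : ℝ) (z : ℝ × ℝ) : E (MvPolynomial.C c) z = c := by simp [E]
@[simp] lemma E_smul (c : ℝ) (f : MP) (z : ℝ × ℝ) : E (c • f) z = c * E f z := by simp [E]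
@[simp] lemma E_X0 (z : ℝ × ℝ) : E (MvPolynomial.X 0) z = z.1 := by simp [E]
@[simp] lemma E_X1 (z : ℝ × ℝ) : E (MvPolynomial.X 1) z = z.2 := by simp [E]

lemma finrank_VD (d : ℕ) : 2 * Module.finrank ℝ (VD d) = (d+1) * (d+2) := by
  have h1 := Module.finrank_eq_nat_card_basis (MvPolynomial.basisRestrictSupport (σ := Fin 2) ℝ {n | (n.sum fun _ e => e) ≤ d})
  have h2 : Module.finrank ℝ (VD d) = Nat.card {n : Fin 2 →₀ ℕ | (n.sum fun _ e => e) ≤ d} := h1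
  rw [h2]
  let e : {n : Fin 2 →₀ ℕ | (n.sum fun _ e => e) ≤ d} ≃ ((range (d+1)).sigma (fun i => range (d+1-i)) : Finset (Σ _ : ℕ, ℕ)) :=
    { toFun := fun f => ⟨⟨f.1 0, f.1 1⟩, by
        have := f.2
        simp only [Set.mem_setOf_eq] at this
        rw [Finsupp.sum_fintype _ _ (by simp), Fin.sum_univ_two] at this
        simp; omega⟩
      invFun := fun x => ⟨Finsupp.equivFunOnFinite.symm ![x.1.1, x.1.2], by
        have := x.2
        rw [mem_sigma, mem_range, mem_range] at this
        simp only [Set.mem_setOf_eq]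
        rw [Finsupp.sum_fintype _ _ (by simp), Fin.sum_univ_two]
        simp; omega⟩
      left_inv := by
        intro f
        ext i
        fin_cases i <;> simp
      right_inv := by
        intro x
        simp }
  rw [Nat.card_congr e, Nat.card_eq_fintype_card, Fintype.card_coe, card_sigma]
  simp only [card_range]
  clear h1 h2 e
  induction d with
  | zero => simp
  | succ d ih =>
    rw [sum_range_succ']
    have : ∀ k ∈ range (d+1), d + 1 + 1 - (k+1) = d + 1 - k := fun k _ => by omega
    rw [sum_congr rfl this, Nat.sub_zero, mul_add, ih]
    ring

/-- evaluation on a finset -/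
def evS (S : Finset (ℝ × ℝ)) : MP →ₗ[ℝ] (S → ℝ) where
  toFun f := fun z => E f z
  map_add' f g := by ext; simp
  map_smul' c f := by ext; simp

lemma exists_vanish (S : Finset (ℝ × ℝ)) (d : ℕ) (h : 2 * S.card < (d+1) * (d+2)) :
    ∃ f : MP, f ≠ 0 ∧ f.totalDegree ≤ d ∧ ∀ z ∈ S, E f z = 0 := by
  have hlt : Module.finrank ℝ (S → ℝ) < Module.finrank ℝ (VD d) := by
    have := finrank_VD d
    rw [Module.finrank_fintype_fun_eq_card, Fintype.card_coe]; omega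
  have := LinearMap.ker_ne_bot_of_finrank_lt (f := (evS S).domRestrict (VD d)) hlt
  obtain ⟨f, hf, hf0⟩ := Submodule.exists_mem_ne_zero_of_ne_bot this
  refine ⟨f, by simpa using hf0, mem_VD.1 f.2, fun z hz => ?_⟩
  exact congrFun (LinearMap.mem_ker.1 hf) ⟨z, hz⟩

/-- linear form -/
def lin (u : V3) : MP := MvPolynomial.C u.1 * MvPolynomial.X 0 + MvPolynomial.C u.2.1 * MvPolynomial.X 1 + MvPolynomial.C u.2.2

lemma E_lin (u : V3) (z : ℝ × ℝ) : E (lin u) z = dot u (z.1, z.2, 1) := by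
  simp [lin, dot]

lemma lin_deg (u : V3) : (lin u).totalDegree ≤ 1 := by
  have hx : ∀ (c : ℝ) (i : Fin 2), (MvPolynomial.C c * MvPolynomial.X i : MP).totalDegree ≤ 1 := by
    intro c i
    refine (MvPolynomial.totalDegree_mul _ _).trans ?_
    simp
  refine (MvPolynomial.totalDegree_add _ _).trans (max_le ((MvPolynomial.totalDegree_add _ _).trans (max_le (hx _ _) (hx _ _))) ?_)
  simp

lemma exists_delta (S : Finset (ℝ × ℝ)) (z0 : ℝ × ℝ) (h0 : z0 ∉ S) :
    ∃ f : MP, f.totalDegree ≤ S.card ∧ E f z0 ≠ 0 ∧ ∀ z ∈ S, E f z = 0 := by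
  induction S using Finset.induction_on with
  | empty => exact ⟨1, by simp, by simp, by simp⟩
  | insert a S ha ih =>
    obtain ⟨f, h1, h2, h3⟩ := ih (fun h => h0 (mem_insert_of_mem h))
    have hne : z0 ≠ a := fun h => h0 (by simp [h])
    set l := lin (z0.1 - a.1, z0.2 - a.2, -((z0.1 - a.1) * a.1 + (z0.2 - a.2) * a.2)) with hl
    refine ⟨l * f, ?_, ?_, ?_⟩
    · rw [card_insert_of_notMem ha]
      refine (MvPolynomial.totalDegree_mul _ _).trans ?_
      have := lin_deg (z0.1 - a.1, z0.2 - a.2, -((z0.1 - a.1) * a.1 + (z0.2 - a.2) * a.2))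
      rw [← hl] at this; omega
    · rw [E_mul]
      refine mul_ne_zero ?_ h2
      rw [hl, E_lin]
      simp only [dot]
      have : (z0.1 - a.1) ≠ 0 ∨ z0.2 - a.2 ≠ 0 := by
        by_contra hc; push Not at hc
        exact hne (Prod.ext (by linarith [hc.1]) (by linarith [hc.2]))
      have : 0 < (z0.1 - a.1)^2 + (z0.2 - a.2)^2 := by
        rcases this with h | h <;> positivity
      intro h
      nlinarith
    · intro z hz
      rw [E_mul]
      rcases mem_insert.1 hz with rfl | hz
      · rw [hl, E_lin]; simp [dot]
      · rw [h3 z hz, mul_zero]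

lemma evS_surj (S : Finset (ℝ × ℝ)) (d : ℕ) (h : S.card ≤ d + 1) :
    Function.Surjective ((evS S).domRestrict (VD d)) := by
  have hd : ∀ z : S, ∃ f : VD d, ∀ w : S, E f.1 w = if w = z then 1 else 0 := by
    intro z
    obtain ⟨f, h1, h2, h3⟩ := exists_delta (S.erase z) z (by simp)
    refine ⟨⟨(E f z)⁻¹ • f, mem_VD.2 ?_⟩, fun w => ?_⟩
    · have := card_erase_of_mem z.2
      exact (MvPolynomial.totalDegree_smul_le _ _).trans (by omega)
    · simp only [E_smul]
      split_ifs with hw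
      · rw [hw]; exact inv_mul_cancel₀ h2
      · rw [h3 w (by simp; exact hw), mul_zero]
  choose f hf using hd
  intro g
  refine ⟨∑ z, g z • f z, ?_⟩
  rw [map_sum]
  ext w
  simp only [map_smul, Finset.sum_apply, Pi.smul_apply, smul_eq_mul]
  have : ∀ z, ((evS S).domRestrict (VD d)) (f z) w = if w = z then 1 else 0 := fun z => hf z w
  simp [this]

theorem bezout {H G : MP} (hH : Irreducible H) {g : ℕ} (hG : G.totalDegree ≤ g) (hn : ¬ H ∣ G)
    (S : Finset (ℝ × ℝ)) (hS : ∀ z ∈ S, E H z = 0 ∧ E G z = 0) : S.card ≤ H.totalDegree * g := by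
  by_contra hcon
  push Not at hcon
  obtain ⟨S', hS', hc⟩ := exists_subset_card_eq (show H.totalDegree * g + 1 ≤ S.card from hcon)
  set e := H.totalDegree with he
  set k := e * g with hk
  have hG0 : G ≠ 0 := by rintro rfl; exact hn (dvd_zero _)
  have hH0 : H ≠ 0 := hH.ne_zero
  let d := e + g + k
  let Φ0 : (VD (g + k) × VD (e + k)) →ₗ[ℝ] MP :=
    { toFun := fun x => x.1.1 * H + x.2.1 * G
      map_add' := by intro x y; simp; ring
      map_smul' := by intro c x; simp }
  let Φ : (VD (g + k) × VD (e + k)) →ₗ[ℝ] VD d := Φ0.codRestrict (VD d) (by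
    intro x
    rw [mem_VD]
    refine (MvPolynomial.totalDegree_add _ _).trans (max_le ?_ ?_)
    · refine (MvPolynomial.totalDegree_mul _ _).trans ?_
      have := mem_VD.1 x.1.2; simp only [d]; omega
    · refine (MvPolynomial.totalDegree_mul _ _).trans ?_
      have := mem_VD.1 x.2.2; simp only [d]; omega)
  let Ψ : VD k →ₗ[ℝ] (VD (g+k) × VD (e+k)) :=
    { toFun := fun c => (⟨- (G * c.1), mem_VD.2 (by
          rw [MvPolynomial.totalDegree_neg]
          refine (MvPolynomial.totalDegree_mul _ _).trans ?_
          have := mem_VD.1 c.2; omega)⟩, ⟨H * c.1, mem_VD.2 (by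
          refine (MvPolynomial.totalDegree_mul _ _).trans ?_
          have := mem_VD.1 c.2; omega)⟩)
      map_add' := by intro x y; ext1 <;> ext1 <;> simp <;> ring
      map_smul' := by intro c x; ext1 <;> ext1 <;> simp }
  have hker : LinearMap.ker Φ ≤ LinearMap.range Ψ := by
    rintro ⟨A, B⟩ hx
    have h0 : A.1 * H + B.1 * G = 0 := congrArg Subtype.val (LinearMap.mem_ker.1 hx)
    have hdv : H ∣ B.1 * G := ⟨-A.1, by linear_combination h0⟩
    obtain ⟨c, hc⟩ := (hH.prime.dvd_or_dvd hdv).resolve_right hn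
    have hA : A.1 = - (G * c) := by
      have : H * (A.1 + G * c) = 0 := by rw [hc] at h0; linear_combination h0
      have := (mul_eq_zero.1 this).resolve_left hH0
      linear_combination this
    have hcd : c.totalDegree ≤ k := by
      by_cases hc0 : c = 0
      · simp [hc0]
      · have h1 := MvPolynomial.totalDegree_mul_of_isDomain hH0 hc0
        rw [← hc] at h1
        have := mem_VD.1 B.2
        omega
    refine ⟨⟨c, mem_VD.2 hcd⟩, ?_⟩
    ext1
    · ext1; exact hA.symm
    · ext1; exact hc.symm
  have hrange : LinearMap.range Φ ≤ LinearMap.ker ((evS S').domRestrict (VD d)) := by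
    rintro _ ⟨x, rfl⟩
    rw [LinearMap.mem_ker]
    ext z
    have := hS z (hS' z.2)
    show E (x.1.1 * H + x.2.1 * G) z = 0
    simp [this.1, this.2]
  have r1 := LinearMap.finrank_range_add_finrank_ker Φ
  have r2 := LinearMap.finrank_range_add_finrank_ker ((evS S').domRestrict (VD d))
  rw [LinearMap.range_eq_top.2 (evS_surj S' d (by rw [hc]; simp only [d]; omega)), finrank_top,
    Module.finrank_fintype_fun_eq_card, Fintype.card_coe, hc] at r2
  have r3 := Submodule.finrank_mono hrange
  have r4 := Submodule.finrank_mono hker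
  have r5 := LinearMap.finrank_range_le Ψ
  rw [Module.finrank_prod] at r1
  have d1 := finrank_VD (g + k)
  have d2 := finrank_VD (e + k)
  have d3 := finrank_VD k
  have d4 : 2 * Module.finrank ℝ (VD d) = (e + g + k +1) * (e + g + k +2) := finrank_VD d
  nlinarith

end

end DM

namespace DM

open Finset
open scoped Classical

noncomputable section

def hat (z : ℝ × ℝ) : V3 := (z.1, z.2, 1)

lemma E_lin' (u : V3) (z : ℝ × ℝ) : E (lin u) z = dot u (hat z) := E_lin u z

/-- restriction to a parametrized line -/
def rs (p d : ℝ × ℝ) : MP →ₐ[ℝ] Polynomial ℝ :=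
  MvPolynomial.aeval ![Polynomial.C p.1 + Polynomial.C d.1 * Polynomial.X, Polynomial.C p.2 + Polynomial.C d.2 * Polynomial.X]

lemma rs_eval (p d : ℝ × ℝ) (f : MP) (s : ℝ) : (rs p d f).eval s = E f (p.1 + s * d.1, p.2 + s * d.2) := by
  induction f using MvPolynomial.induction_on with
  | C a => simp [rs, E]
  | add f g hf hg => rw [map_add, Polynomial.eval_add, hf, hg, E_add]
  | mul_X f i hf =>
    rw [map_mul, Polynomial.eval_mul, hf, E_mul]
    congr 1
    fin_cases i <;> simp [rs] <;> ring

lemma rs_deg (p d : ℝ × ℝ) (f : MP) : (rs p d f).natDegree ≤ f.totalDegree := by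
  have h := MvPolynomial.aeval_natDegree_le (n := 1) f le_rfl
    ![Polynomial.C p.1 + Polynomial.C d.1 * Polynomial.X, Polynomial.C p.2 + Polynomial.C d.2 * Polynomial.X] (by
      intro i
      fin_cases i <;> simp <;> compute_degree)
  rw [mul_one] at h; exact h

lemma lin_dvd_aux (u : V3) (f : MP) (g0 g1 : ℝ) :
    lin u ∣ f - MvPolynomial.aeval ![MvPolynomial.X 0 - MvPolynomial.C g0 * lin u, MvPolynomial.X 1 - MvPolynomial.C g1 * lin u] f := by
  induction f using MvPolynomial.induction_on with
  | C a => simp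
  | add f g hf hg =>
    rw [map_add]
    convert dvd_add hf hg using 1; ring
  | mul_X f i hf =>
    rw [map_mul]
    set w : MP := MvPolynomial.aeval ![MvPolynomial.X 0 - MvPolynomial.C g0 * lin u, MvPolynomial.X 1 - MvPolynomial.C g1 * lin u] f
    have : lin u ∣ (MvPolynomial.X i : MP) - MvPolynomial.aeval ![MvPolynomial.X 0 - MvPolynomial.C g0 * lin u, MvPolynomial.X 1 - MvPolynomial.C g1 * lin u] (MvPolynomial.X i : MP) := by
      fin_cases i <;> simp
    obtain ⟨c, hc⟩ := hf
    obtain ⟨c', hc'⟩ := this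
    refine ⟨c * MvPolynomial.X i + w * c', ?_⟩
    linear_combination MvPolynomial.X i * hc + w * hc'

lemma lin_dvd_of_rs {u : V3} (hu : u.1 ≠ 0 ∨ u.2.1 ≠ 0) {f : MP}
    (h : rs (- u.1 * u.2.2 / (u.1^2+u.2.1^2), - u.2.1 * u.2.2 / (u.1^2+u.2.1^2)) (-u.2.1, u.1) f = 0) : lin u ∣ f := by
  have hN : 0 < u.1^2 + u.2.1^2 := by rcases hu with h | h <;> positivity
  set N := u.1^2 + u.2.1^2 with hNd
  have := lin_dvd_aux u f (u.1/N) (u.2.1/N)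
  have e : MvPolynomial.aeval ![MvPolynomial.X 0 - MvPolynomial.C (u.1/N) * lin u, MvPolynomial.X 1 - MvPolynomial.C (u.2.1/N) * lin u] f
      = Polynomial.aeval (MvPolynomial.C (1/N) * (MvPolynomial.C (-u.2.1) * MvPolynomial.X 0 + MvPolynomial.C u.1 * MvPolynomial.X 1) : MP)
        (rs (- u.1 * u.2.2 / N, - u.2.1 * u.2.2 / N) (-u.2.1, u.1) f) := by
    rw [rs, ← AlgHom.comp_apply, MvPolynomial.comp_aeval]
    congr 2
    ext1 i
    fin_cases i
    · simp only [Fin.zero_eta, Fin.isValue, Matrix.cons_val_zero, map_add, map_mul, Polynomial.aeval_C, Polynomial.aeval_X,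
        MvPolynomial.algebraMap_eq]
      have h1 : (1:ℝ) = u.1 / N * u.1 + (-u.2.1) * (1/N) * (-u.2.1) := by field_simp; rw [hNd]; try ring
      have h2 : (0:ℝ) = u.1/N * u.2.1 + (-u.2.1)*(1/N) * u.1 := by ring
      have h3 : (0:ℝ) = u.1/N * u.2.2 + (- u.1 * u.2.2 / N) := by ring
      replace h1 := congrArg (MvPolynomial.C (σ := Fin 2)) h1
      replace h2 := congrArg (MvPolynomial.C (σ := Fin 2)) h2
      replace h3 := congrArg (MvPolynomial.C (σ := Fin 2)) h3
      simp only [map_add, map_mul, map_one, map_zero] at h1 h2 h3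
      rw [lin]
      linear_combination (MvPolynomial.X 0) * h1 + (MvPolynomial.X 1) * h2 + h3
    · simp only [Fin.mk_one, Fin.isValue, Matrix.cons_val_one, Matrix.cons_val_fin_one, map_add, map_mul, Polynomial.aeval_C, Polynomial.aeval_X,
        MvPolynomial.algebraMap_eq]
      have h1 : (1:ℝ) = u.2.1 / N * u.2.1 + (u.1) * (1/N) * (u.1) := by field_simp; rw [hNd]; try ring
      have h2 : (0:ℝ) = u.2.1/N * u.1 + (u.1)*(1/N) * (-u.2.1) := by ring
      have h3 : (0:ℝ) = u.2.1/N * u.2.2 + (- u.2.1 * u.2.2 / N) := by ring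
      replace h1 := congrArg (MvPolynomial.C (σ := Fin 2)) h1
      replace h2 := congrArg (MvPolynomial.C (σ := Fin 2)) h2
      replace h3 := congrArg (MvPolynomial.C (σ := Fin 2)) h3
      simp only [map_add, map_mul, map_one, map_zero] at h1 h2 h3
      rw [lin]
      linear_combination (MvPolynomial.X 1) * h1 + (MvPolynomial.X 0) * h2 + h3
  rw [e, h, map_zero, sub_zero] at this
  exact this

lemma lin_dvd {u : V3} (hu : u.1 ≠ 0 ∨ u.2.1 ≠ 0) {f : MP} (S : Finset (ℝ × ℝ)) (hc : f.totalDegree < S.card)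
    (hS : ∀ z ∈ S, dot u (hat z) = 0 ∧ E f z = 0) : lin u ∣ f := by
  have hN : 0 < u.1^2 + u.2.1^2 := by rcases hu with h | h <;> positivity
  apply lin_dvd_of_rs hu
  set N := u.1^2 + u.2.1^2 with hNd
  have hz : ∀ z ∈ S, z.1 = - u.1 * u.2.2 / N + ((-u.2.1 * z.1 + u.1 * z.2)/N) * (-u.2.1) ∧
      z.2 = - u.2.1 * u.2.2 / N + ((-u.2.1 * z.1 + u.1 * z.2)/N) * (u.1) := by
    intro z hz
    have := (hS z hz).1
    simp only [dot, hat] at this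
    constructor <;> field_simp <;> rw [hNd]
    · linear_combination u.1 * this
    · linear_combination u.2.1 * this
  apply Polynomial.eq_zero_of_natDegree_lt_card_of_eval_eq_zero' _ (S.image (fun z => (-u.2.1 * z.1 + u.1 * z.2)/N))
  · intro s hs
    obtain ⟨z, hzS, rfl⟩ := mem_image.1 hs
    rw [rs_eval]
    simp only
    rw [← (hz z hzS).1, ← (hz z hzS).2]
    exact (hS z hzS).2
  · rw [card_image_of_injOn]
    · exact lt_of_le_of_lt (rs_deg _ _ _) hc
    · intro z hz1 w hw1 h
      simp only at h
      have a := hz z hz1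
      have b := hz w hw1
      rw [h] at a
      exact Prod.ext (a.1.trans b.1.symm) (a.2.trans b.2.symm)

lemma lin_totalDegree {u : V3} (hu : u.1 ≠ 0 ∨ u.2.1 ≠ 0) : (lin u).totalDegree = 1 := by
  apply le_antisymm (lin_deg u)
  by_contra h
  have h0 : (lin u).totalDegree = 0 := by omega
  rw [MvPolynomial.totalDegree_eq_zero_iff_eq_C] at h0
  set c := MvPolynomial.coeff 0 (lin u)
  have e : ∀ z, dot u (hat z) = c := fun z => by rw [← E_lin', h0, E_C]
  have e0 := e (0,0)
  have e1 := e (1,0)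
  have e2 := e (0,1)
  simp [dot, hat] at e0 e1 e2
  rcases hu with h | h <;> apply h <;> linarith

lemma lin_ne {u : V3} (hu : u.1 ≠ 0 ∨ u.2.1 ≠ 0) : lin u ≠ 0 := by
  intro h; have := lin_totalDegree hu; rw [h] at this; simp at this

lemma crs_hat {a b : ℝ × ℝ} (h : a ≠ b) : (crs (hat a) (hat b)).1 ≠ 0 ∨ (crs (hat a) (hat b)).2.1 ≠ 0 := by
  by_contra hc
  push Not at hc
  simp [crs, hat] at hc
  exact h (Prod.ext (by linarith [hc.2]) (by linarith [hc.1]))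

/-- division: quotient degree -/
lemma lin_div {u : V3} (hu : u.1 ≠ 0 ∨ u.2.1 ≠ 0) {f : MP} {k : ℕ} (hf : f.totalDegree ≤ k + 1) (S : Finset (ℝ × ℝ)) (hc : k + 1 < S.card)
    (hS : ∀ z ∈ S, dot u (hat z) = 0 ∧ E f z = 0) : ∃ g, f = lin u * g ∧ g.totalDegree ≤ k := by
  obtain ⟨g, hg⟩ := lin_dvd hu S (by omega) hS
  by_cases hg0 : g = 0
  · exact ⟨0, by rw [hg, hg0], by simp⟩
  refine ⟨g, hg, ?_⟩
  have := MvPolynomial.totalDegree_mul_of_isDomain (lin_ne hu) hg0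
  rw [← hg, lin_totalDegree hu] at this
  omega

lemma deg1_line {f : MP} (hf : f.totalDegree ≤ 1) {a b c : ℝ × ℝ} (hab : a ≠ b) (hc : det3 (hat a) (hat b) (hat c) = 0)
    (ha : E f a = 0) (hb : E f b = 0) : E f c = 0 := by
  obtain ⟨g, hg⟩ := lin_dvd (u := crs (hat a) (hat b)) (crs_hat hab) (f := f) {a, b} (by rw [card_pair hab]; omega) (by
    intro z hz
    simp at hz
    rcases hz with rfl | rfl
    · exact ⟨det3_self13 _ _, ha⟩
    · exact ⟨det3_self23 _ _, hb⟩)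
  rw [hg, E_mul, E_lin', ← det3_def, hc, zero_mul]

lemma chasles {a1 a2 a3 b1 b2 b3 c1 c2 c3 : ℝ × ℝ} {F : MP} (hF : F.totalDegree ≤ 3)
    (ra : det3 (hat a1) (hat a2) (hat a3) = 0) (rb : det3 (hat b1) (hat b2) (hat b3) = 0) (rc : det3 (hat c1) (hat c2) (hat c3) = 0)
    (k1 : det3 (hat a1) (hat b1) (hat c1) = 0) (k2 : det3 (hat a2) (hat b2) (hat c2) = 0) (k3 : det3 (hat a3) (hat b3) (hat c3) = 0)
    (ha12 : a1 ≠ a2) (ha23 : a2 ≠ a3) (ha13 : a1 ≠ a3) (hb12 : b1 ≠ b2) (hb23 : b2 ≠ b3) (hb13 : b1 ≠ b3) (hc12 : c1 ≠ c2)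
    (m1 : det3 (hat a1) (hat b1) (hat a2) ≠ 0) (m2 : det3 (hat a2) (hat b2) (hat a3) ≠ 0) (m3 : det3 (hat a3) (hat b3) (hat a1) ≠ 0)
    (hb1 : det3 (hat a1) (hat a2) (hat b1) ≠ 0) (hb2 : det3 (hat a1) (hat a2) (hat b2) ≠ 0) (hb3 : det3 (hat a1) (hat a2) (hat b3) ≠ 0)
    (hc1 : det3 (hat a1) (hat a2) (hat c1) ≠ 0) (hc2 : det3 (hat a1) (hat a2) (hat c2) ≠ 0)
    (hd1 : det3 (hat b1) (hat b2) (hat c1) ≠ 0) (hd2 : det3 (hat b1) (hat b2) (hat c2) ≠ 0)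
    (f1 : E F a1 = 0) (f2 : E F a2 = 0) (f3 : E F a3 = 0) (f4 : E F b1 = 0) (f5 : E F b2 = 0) (f6 : E F b3 = 0)
    (f7 : E F c1 = 0) (f8 : E F c2 = 0) : E F c3 = 0 := by
  -- a fourth point of the line a1 a2
  obtain ⟨s, hs⟩ : ∃ s : ℝ, s ≠ 0 ∧ s ≠ 1 ∧ ∀ z ∈ ({a3} : Finset (ℝ×ℝ)), (a1.1 + s * (a2.1 - a1.1), a1.2 + s * (a2.2 - a1.2)) ≠ z := by
    by_contra hcon
    push Not at hcon
    have h2 := hcon 2 (by norm_num) (by norm_num)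
    have h3 := hcon 3 (by norm_num) (by norm_num)
    simp at h2 h3
    have := h2.trans h3.symm
    simp [Prod.ext_iff] at this
    apply ha12
    exact Prod.ext (by linarith [this.1]) (by linarith [this.2])
  obtain ⟨hs0, hs1, hs3⟩ := hs
  set z : ℝ × ℝ := (a1.1 + s * (a2.1 - a1.1), a1.2 + s * (a2.2 - a1.2)) with hz
  have hz3 : z ≠ a3 := hs3 a3 (by simp)
  have hz1 : z ≠ a1 := by
    intro h; simp [hz, Prod.ext_iff, hs0] at h
    exact ha12 (Prod.ext (by linarith [h.1]) (by linarith [h.2]))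
  have hz2 : z ≠ a2 := by
    intro h; simp only [hz, Prod.ext_iff] at h
    apply ha12
    have e1 : (s - 1) * (a2.1 - a1.1) = 0 := by linear_combination h.1
    have e2 : (s - 1) * (a2.2 - a1.2) = 0 := by linear_combination h.2
    have := sub_ne_zero.2 hs1
    exact Prod.ext (by linarith [(mul_eq_zero.1 e1).resolve_left this]) (by linarith [(mul_eq_zero.1 e2).resolve_left this])
  have hzl : det3 (hat a1) (hat a2) (hat z) = 0 := by
    simp [det3, dot, crs, hat, hz]; ring
  -- z is off the columns
  have hzhat : hat z = (1 - s) • hat a1 + s • hat a2 := by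
    ext <;> simp [hat, hz] <;> ring
  have off : ∀ x y w : ℝ × ℝ, det3 (hat a1) (hat a2) (hat x) = 0 → z ≠ x → x ≠ w → det3 (hat a1) (hat a2) (hat w) = 0 → det3 (hat x) (hat y) (hat w) ≠ 0 →
      det3 (hat x) (hat y) (hat z) ≠ 0 := by
    intro x y w hx hzx hxw hw hd h0
    -- x, z, y collinear and x z spans the line, which contains w
    have hd2 := deg1_line (f := lin (crs (hat x) (hat y))) (lin_deg _) (c := w) hzx.symm (by
      -- x, z, w collinear
      have e1 := deg1_line (f := lin (crs (hat a1) (hat a2))) (lin_deg _) (c := w) hzx.symm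
      have hcx : crs (hat a1) (hat a2) ≠ 0 := by
        intro h; have := crs_hat ha12; rw [h] at this; simp at this
      by_contra hne
      -- dot with normal zero for three independent vectors
      obtain ⟨c, hc⟩ : ∃ c : V3, c = crs (hat a1) (hat a2) := ⟨_, rfl⟩
      have q1 : dot c (hat x) = 0 := by rw [hc]; exact hx
      have q2 : dot c (hat z) = 0 := by rw [hc]; exact hzl
      have q3 : dot c (hat w) = 0 := by rw [hc]; exact hw
      have key : ∀ (c1 c2 c3 : ℝ), c1 = 0 → c2 = 0 → c3 = 0 → c = (c1, c2, c3) → False := by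
        intro c1 c2 c3 h1 h2 h3 h; apply hcx; rw [← hc, h, h1, h2, h3]; rfl
      refine key c.1 c.2.1 c.2.2 ?_ ?_ ?_ rfl
      · have : det3 (hat x) (hat z) (hat w) * c.1 = 0 := by
          simp only [det3, dot, crs, hat] at *
          linear_combination (z.2 - w.2) * q1 + (w.2 - x.2) * q2 + (x.2 - z.2) * q3
        exact (mul_eq_zero.1 this).resolve_left hne
      · have : det3 (hat x) (hat z) (hat w) * c.2.1 = 0 := by
          simp only [det3, dot, crs, hat] at *
          linear_combination (w.1 - z.1) * q1 + (x.1 - w.1) * q2 + (z.1 - x.1) * q3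
        exact (mul_eq_zero.1 this).resolve_left hne
      · have : det3 (hat x) (hat z) (hat w) * c.2.2 = 0 := by
          simp only [det3, dot, crs, hat] at *
          linear_combination (z.1 * w.2 - z.2 * w.1) * q1 + (w.1*x.2 - w.2*x.1) * q2 + (x.1 * z.2 - x.2 * z.1) * q3
        exact (mul_eq_zero.1 this).resolve_left hne) (by rw [E_lin']; exact det3_self13 _ _) (by rw [E_lin']; exact h0)
    rw [E_lin'] at hd2
    exact hd hd2
  have o1 := off a1 b1 a2 (det3_self13 _ _) hz1 ha12 (det3_self23 _ _) m1
  have o2 := off a2 b2 a3 (det3_self23 _ _) hz2 ha23 ra m2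
  have o3 := off a3 b3 a1 ra hz3 ha13.symm (det3_self13 _ _) m3
  set Mp : MP := lin (crs (hat a1) (hat b1)) * lin (crs (hat a2) (hat b2)) * lin (crs (hat a3) (hat b3)) with hMp
  have hM : ∀ w, E Mp w = det3 (hat a1) (hat b1) (hat w) * det3 (hat a2) (hat b2) (hat w) * det3 (hat a3) (hat b3) (hat w) := by
    intro w; rw [hMp, E_mul, E_mul, E_lin', E_lin', E_lin']; rfl
  have hMz : E Mp z ≠ 0 := by rw [hM]; exact mul_ne_zero (mul_ne_zero o1 o2) o3
  have hMdeg : Mp.totalDegree ≤ 3 := by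
    refine (MvPolynomial.totalDegree_mul _ _).trans ?_
    have h1 := lin_deg (crs (hat a1) (hat b1))
    have h2 := lin_deg (crs (hat a2) (hat b2))
    have h3 := lin_deg (crs (hat a3) (hat b3))
    have h4 := MvPolynomial.totalDegree_mul (lin (crs (hat a1) (hat b1))) (lin (crs (hat a2) (hat b2)))
    omega
  set c := E F z / E Mp z with hc
  set F' := F - c • Mp with hF'
  have hF'deg : F'.totalDegree ≤ 2 + 1 := by
    refine (MvPolynomial.totalDegree_sub _ _).trans (max_le hF ((MvPolynomial.totalDegree_smul_le _ _).trans hMdeg))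
  have hE : ∀ w, E F w = 0 → (det3 (hat a1) (hat b1) (hat w) = 0 ∨ det3 (hat a2) (hat b2) (hat w) = 0 ∨ det3 (hat a3) (hat b3) (hat w) = 0) → E F' w = 0 := by
    intro w h1 h2
    rw [hF', E_sub, E_smul, h1, hM]
    rcases h2 with h | h | h <;> rw [h] <;> ring
  obtain ⟨G2, hG2, hG2d⟩ := lin_div (crs_hat ha12) hF'deg {a1, a2, a3, z} (by
    rw [card_insert_of_notMem, card_insert_of_notMem, card_pair hz3.symm]
    · norm_num
    · simp [ha23, hz2.symm]
    · simp [ha12, ha13, hz1.symm]) (by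
    intro w hw
    simp at hw
    rcases hw with rfl | rfl | rfl | hw
    · exact ⟨det3_self13 _ _, hE _ f1 (Or.inl (det3_self13 _ _))⟩
    · exact ⟨det3_self23 _ _, hE _ f2 (Or.inr (Or.inl (det3_self13 _ _)))⟩
    · exact ⟨ra, hE _ f3 (Or.inr (Or.inr (det3_self13 _ _)))⟩
    · rw [hw]
      refine ⟨hzl, ?_⟩
      rw [hF', E_sub, E_smul, hc]; field_simp; ring)
  have hG2z : ∀ w, E F' w = 0 → det3 (hat a1) (hat a2) (hat w) ≠ 0 → E G2 w = 0 := by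
    intro w h1 h2
    rw [hG2, E_mul, E_lin'] at h1
    exact (mul_eq_zero.1 h1).resolve_left h2
  obtain ⟨G1, hG1, hG1d⟩ := lin_div (crs_hat hb12) hG2d {b1, b2, b3} (by
    rw [card_insert_of_notMem, card_pair hb23]
    · norm_num
    · simp [hb12, hb13]) (by
    intro w hw
    simp at hw
    rcases hw with rfl | rfl | rfl
    · exact ⟨det3_self13 _ _, hG2z _ (hE _ f4 (Or.inl (det3_self23 _ _))) hb1⟩
    · exact ⟨det3_self23 _ _, hG2z _ (hE _ f5 (Or.inr (Or.inl (det3_self23 _ _)))) hb2⟩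
    · exact ⟨rb, hG2z _ (hE _ f6 (Or.inr (Or.inr (det3_self23 _ _)))) hb3⟩)
  have hG1z : ∀ w, E G2 w = 0 → det3 (hat b1) (hat b2) (hat w) ≠ 0 → E G1 w = 0 := by
    intro w h1 h2
    rw [hG1, E_mul, E_lin'] at h1
    exact (mul_eq_zero.1 h1).resolve_left h2
  have hfin := deg1_line hG1d hc12 rc (hG1z _ (hG2z _ (hE _ f7 (Or.inl k1)) hc1) hd1)
    (hG1z _ (hG2z _ (hE _ f8 (Or.inr (Or.inl k2))) hc2) hd2)
  have hF'3 : E F' c3 = 0 := by rw [hG2, hG1, E_mul, E_mul, hfin, mul_zero, mul_zero]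
  have hM3 : E Mp c3 = 0 := by rw [hM, k3, mul_zero]
  rw [hF', E_sub, E_smul, hM3] at hF'3
  linarith

end

end DM

namespace DM

open Finset
open scoped Classical

noncomputable section
variable {n : ℕ}

/-- lift of planar points -/
def lift (pt : Fin n → ℝ × ℝ) : Fin n → V3 := fun i => hat (pt i)

lemma lift_inj {pt : Fin n → ℝ × ℝ} (hv : Cfg (lift pt)) {i j : Fin n} (h : i ≠ j) : pt i ≠ pt j := by
  intro e
  apply hv.np i j h
  simp only [lift, e]
  ext <;> simp [crs] <;> ring

lemma Tri.det_ne {v : Fin n → V3} {i j k l : Fin n} (h : Tri v i j k) (h1 : l ≠ i) (h2 : l ≠ j) (h3 : l ≠ k) :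
    det3 (v i) (v j) (v l) ≠ 0 := by
  intro h0
  have := mem_Ln.2 h0
  rw [h.2.2.2] at this
  simp [h1, h2, h3] at this

lemma chaslesI {pt : Fin n → ℝ × ℝ} (hv : Cfg (lift pt)) {a1 a2 a3 b1 b2 b3 c1 c2 c3 : Fin n} {F : MP} (hF : F.totalDegree ≤ 3)
    (ra : Tri (lift pt) a1 a2 a3) (rb : Tri (lift pt) b1 b2 b3) (rc : Tri (lift pt) c1 c2 c3)
    (k1 : Tri (lift pt) a1 b1 c1) (k2 : Tri (lift pt) a2 b2 c2) (k3 : Tri (lift pt) a3 b3 c3)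
    (n1 : a1 ≠ b2 ∧ a1 ≠ b3 ∧ a1 ≠ c2 ∧ a1 ≠ c3) (n2 : a2 ≠ b1 ∧ a2 ≠ b3 ∧ a2 ≠ c1 ∧ a2 ≠ c3)
    (n3 : a3 ≠ b1 ∧ a3 ≠ b2 ∧ a3 ≠ c1 ∧ a3 ≠ c2) (n4 : b1 ≠ c2 ∧ b2 ≠ c1 ∧ b3 ≠ c1 ∧ b3 ≠ c2)
    (f1 : E F (pt a1) = 0) (f2 : E F (pt a2) = 0) (f3 : E F (pt a3) = 0) (f4 : E F (pt b1) = 0) (f5 : E F (pt b2) = 0) (f6 : E F (pt b3) = 0)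
    (f7 : E F (pt c1) = 0) (f8 : E F (pt c2) = 0) : E F (pt c3) = 0 :=
  chasles hF ra.det rb.det rc.det k1.det k2.det k3.det (lift_inj hv ra.1) (lift_inj hv ra.2.1) (lift_inj hv ra.2.2.1)
    (lift_inj hv rb.1) (lift_inj hv rb.2.1) (lift_inj hv rb.2.2.1) (lift_inj hv rc.1)
    (k1.det_ne ra.1.symm n2.1 n2.2.2.1) (k2.det_ne ra.2.1.symm n3.2.1 n3.2.2.2) (k3.det_ne ra.2.2.1 n1.2.1 n1.2.2.2)
    (ra.det_ne k1.1.symm n2.1.symm n3.1.symm) (ra.det_ne n1.1.symm k2.1.symm n3.2.1.symm) (ra.det_ne n1.2.1.symm n2.2.1.symm k3.1.symm)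
    (ra.det_ne k1.2.2.1.symm n2.2.2.1.symm n3.2.2.1.symm) (ra.det_ne n1.2.2.1.symm k2.2.2.1.symm n3.2.2.2.symm)
    (rb.det_ne k1.2.1.symm n4.2.1.symm n4.2.2.1.symm) (rb.det_ne n4.1.symm k2.2.1.symm n4.2.2.2.symm)
    f1 f2 f3 f4 f5 f6 f7 f8

lemma Pen.tri_off {v : Fin n → V3} {p : Fin n} (P : Pen v p) (hv : Cfg v) {x q r : Fin n} (h : Tri v x q r) (hq : q ≠ p) (hr : r ≠ p)
    (hne : P.r q ≠ P.r r) : x ≠ p ∧ P.r x ≠ P.r q ∧ P.r x ≠ P.r r := by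
  have hx : x ≠ p := by
    rintro rfl
    exact hne ((P.r_eq_iff hq hr).2 h.det)
  refine ⟨hx, ?_, ?_⟩
  · intro e
    have hd := (P.r_eq_iff hx hq).1 e
    have hp : p ∈ Ln v x q := mem_Ln.2 (by rw [det3_rot]; exact hd)
    rw [h.2.2.2] at hp
    simp [hx.symm, hq.symm, hr.symm] at hp
  · intro e
    have hd := (P.r_eq_iff hx hr).1 e
    have h' := h.swap23 hv
    have hp : p ∈ Ln v x r := mem_Ln.2 (by rw [det3_rot]; exact hd)
    rw [h'.2.2.2] at hp
    simp [hx.symm, hq.symm, hr.symm] at hp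

lemma Pen.run_cubic {pt : Fin n → ℝ × ℝ} (hv : Cfg (lift pt)) {p : Fin n} (P : Pen (lift pt) p) {a b : ℕ} (hab : a ≤ b)
    (hg : ∀ s, a ≤ s → s ≤ b → P.good s) :
    ∃ F : MP, F ≠ 0 ∧ F.totalDegree ≤ 3 ∧ E F (pt p) = 0 ∧
      ∀ j, j ≠ p → a ≤ P.r j → P.r j ≤ b + 1 → E F (pt j) = 0 ∧ (Ln (lift pt) p j).card = 3 := by
  obtain ⟨Q, R, hR, hr⟩ := P.exists_run hv hab hg
  have hcls : ∀ j, j ≠ p → a ≤ P.r j → P.r j ≤ b + 1 → j = Q (P.r j) ∨ j = R (P.r j) := by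
    intro j hj h1 h2
    exact P.tri_unique (hR.tri _ h1 h2) hj (hr _ h1 h2).1.symm
  have hcard : ∀ j, j ≠ p → a ≤ P.r j → P.r j ≤ b + 1 → (Ln (lift pt) p j).card = 3 := by
    intro j hj h1 h2
    have ht := hR.tri _ h1 h2
    rcases hcls j hj h1 h2 with h | h
    · rw [h]; exact ht.card
    · rw [h]; exact (ht.swap23 hv).card
  suffices h : ∃ F : MP, F ≠ 0 ∧ F.totalDegree ≤ 3 ∧ E F (pt p) = 0 ∧ ∀ s, a ≤ s → s ≤ b + 1 → E F (pt (Q s)) = 0 ∧ E F (pt (R s)) = 0 by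
    obtain ⟨F, h1, h2, h3, h4⟩ := h
    refine ⟨F, h1, h2, h3, fun j hj i1 i2 => ⟨?_, hcard j hj i1 i2⟩⟩
    rcases hcls j hj i1 i2 with h | h
    · rw [h]; exact (h4 _ i1 i2).1
    · rw [h]; exact (h4 _ i1 i2).2
  by_cases hlen : b < a + 2
  · set S : Finset (ℝ × ℝ) := ({p, Q a, R a, Q (a+1), R (a+1), Q (a+2), R (a+2)} : Finset (Fin n)).image pt with hS
    have hSc : S.card ≤ 7 := by
      refine card_image_le.trans ((card_insert_le _ _).trans ?_)
      have := card_le_six (a := Q a) (b := R a) (c := Q (a+1)) (d := R (a+1)) (e := Q (a+2)) (f := R (a+2))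
      omega
    obtain ⟨F, h1, h2, h3⟩ := exists_vanish S 3 (by omega)
    refine ⟨F, h1, h2, h3 _ (by simp [hS]), fun s i1 i2 => ?_⟩
    have : s = a ∨ s = a + 1 ∨ s = a + 2 := by omega
    rcases this with rfl | rfl | rfl
    · exact ⟨h3 _ (by simp [hS]), h3 _ (by simp [hS])⟩
    · exact ⟨h3 _ (mem_image_of_mem _ (by simp)), h3 _ (mem_image_of_mem _ (by simp))⟩
    · exact ⟨h3 _ (mem_image_of_mem _ (by simp)), h3 _ (mem_image_of_mem _ (by simp))⟩
  · push Not at hlen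
    obtain ⟨pm, hm⟩ := hR.pm hv hab
    obtain ⟨p1, p2, h1, h2⟩ := hR.p2 hv (by omega)
    have h0 := hR.tri
    have hQp : ∀ s, a ≤ s → s ≤ b + 1 → Q s ≠ p := fun s i j => (h0 s i j).1.symm
    have hRp : ∀ s, a ≤ s → s ≤ b + 1 → R s ≠ p := fun s i j => (h0 s i j).2.2.1.symm
    have om : ∀ s, a ≤ s → s ≤ b → pm ≠ p ∧ P.r pm ≠ s ∧ P.r pm ≠ s + 1 := by
      intro s i j
      have := P.tri_off hv (hm s i j) (hQp _ (by omega) (by omega)) (hRp _ i (by omega)) (by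
        rw [(hr _ (by omega) (by omega)).1, (hr _ i (by omega)).2]; omega)
      rw [(hr _ (by omega) (by omega)).1, (hr _ i (by omega)).2] at this
      tauto
    have o1 : ∀ s, a ≤ s → s ≤ b → p1 ≠ p ∧ P.r p1 ≠ s ∧ P.r p1 ≠ s + 1 := by
      intro s i j
      have := P.tri_off hv (h1 s i j) (hQp _ (by omega) (by omega)) (hRp _ (by omega) (by omega)) (by
        rw [(hr _ (by omega) (by omega)).1, (hr _ (by omega) (by omega)).2]; omega)
      rw [(hr _ (by omega) (by omega)).1, (hr _ (by omega) (by omega)).2] at this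
      tauto
    have o2 : ∀ s, a ≤ s → s < b → p2 ≠ p ∧ P.r p2 ≠ s ∧ P.r p2 ≠ s + 2 := by
      intro s i j
      have := P.tri_off hv (h2 s i j) (hQp _ (by omega) (by omega)) (hRp _ (by omega) (by omega)) (by
        rw [(hr _ (by omega) (by omega)).1, (hr _ (by omega) (by omega)).2]; omega)
      rw [(hr _ (by omega) (by omega)).1, (hr _ (by omega) (by omega)).2] at this
      tauto
    have rm : ∀ s, a ≤ s → s ≤ b + 1 → P.r pm ≠ s := by
      intro s i j
      by_cases h : s ≤ b
      · exact (om s i h).2.1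
      · have := (om b hab le_rfl).2.2; omega
    have r1 : ∀ s, a ≤ s → s ≤ b + 1 → P.r p1 ≠ s := by
      intro s i j
      by_cases h : s ≤ b
      · exact (o1 s i h).2.1
      · have := (o1 b hab le_rfl).2.2; omega
    have r2 : ∀ s, a ≤ s → s ≤ b + 1 → P.r p2 ≠ s := by
      intro s i j
      by_cases h : s < b
      · exact (o2 s i h).2.1
      · have := (o2 (s-2) (by omega) (by omega)).2.2; omega
    have qm : ∀ s, a ≤ s → s ≤ b + 1 → Q s ≠ pm ∧ R s ≠ pm := fun s i j =>
      ⟨fun e => rm s i j (by rw [← e, (hr s i j).1]), fun e => rm s i j (by rw [← e, (hr s i j).2])⟩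
    have q1 : ∀ s, a ≤ s → s ≤ b + 1 → Q s ≠ p1 ∧ R s ≠ p1 := fun s i j =>
      ⟨fun e => r1 s i j (by rw [← e, (hr s i j).1]), fun e => r1 s i j (by rw [← e, (hr s i j).2])⟩
    have q2 : ∀ s, a ≤ s → s ≤ b + 1 → Q s ≠ p2 ∧ R s ≠ p2 := fun s i j =>
      ⟨fun e => r2 s i j (by rw [← e, (hr s i j).1]), fun e => r2 s i j (by rw [← e, (hr s i j).2])⟩
    have qq : ∀ s t, a ≤ s → s ≤ b + 1 → a ≤ t → t ≤ b + 1 → s ≠ t → Q s ≠ Q t ∧ Q s ≠ R t ∧ R s ≠ Q t ∧ R s ≠ R t := by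
      intro s t i1 i2 j1 j2 h
      have e1 := hr s i1 i2
      have e2 := hr t j1 j2
      refine ⟨?_, ?_, ?_, ?_⟩ <;> intro e <;> apply h
      · rw [← e1.1, e, e2.1]
      · rw [← e1.1, e, e2.2]
      · rw [← e1.2, e, e2.1]
      · rw [← e1.2, e, e2.2]
    have hpm : pm ≠ p := (om a le_rfl hab).1
    have hp1 : p1 ≠ p := (o1 a le_rfl hab).1
    have hp2 : p2 ≠ p := (o2 a le_rfl (by omega)).1
    have hm1 : pm ≠ p1 := by
      intro e
      have t1 := hm a le_rfl hab
      have t2 := h1 (a+1) (by omega) (by omega)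
      rw [e] at t1
      exact (qq a (a+1+1) (by omega) (by omega) (by omega) (by omega) (by omega)).2.2.2 (t1.uniq t2)
    have h12 : p1 ≠ p2 := by
      intro e
      have t1 := h1 a le_rfl hab
      have t2 := h2 a (by omega) (by omega)
      rw [e] at t1
      exact (qq (a+1) (a+2) (by omega) (by omega) (by omega) (by omega) (by omega)).2.2.2 (t1.uniq t2)
    set S : Finset (ℝ × ℝ) := ({pm, p, p1, p2, Q a, Q (a+1), R a, R (a+1), R (a+2)} : Finset (Fin n)).image pt with hS
    have hSc : S.card ≤ 9 := by
      refine card_image_le.trans ?_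
      exact (card_insert_le _ _).trans (by
        have h1 := card_insert_le p ({p1, p2, Q a, Q (a+1), R a, R (a+1), R (a+2)} : Finset (Fin n))
        have h2 := card_insert_le p1 ({p2, Q a, Q (a+1), R a, R (a+1), R (a+2)} : Finset (Fin n))
        have h3 := card_le_six (a := p2) (b := Q a) (c := Q (a+1)) (d := R a) (e := R (a+1)) (f := R (a+2))
        omega)
    obtain ⟨F, hF0, hFd, hF⟩ := exists_vanish S 3 (by omega)
    have fp : E F (pt p) = 0 := hF _ (mem_image_of_mem _ (by simp))
    have fm : E F (pt pm) = 0 := hF _ (mem_image_of_mem _ (by simp))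
    have f1 : E F (pt p1) = 0 := hF _ (mem_image_of_mem _ (by simp))
    have f2 : E F (pt p2) = 0 := hF _ (mem_image_of_mem _ (by simp))
    -- hex 1
    have hex1 : ∀ k, a + 1 ≤ k → k ≤ b → E F (pt (Q (k-1))) = 0 → E F (pt (Q k)) = 0 → E F (pt (R (k-1))) = 0 → E F (pt (R k)) = 0 →
        E F (pt (R (k+1))) = 0 → E F (pt (Q (k+1))) = 0 := by
      intro k i1 i2 g1 g2 g3 g4 g5
      obtain ⟨c, rfl⟩ : ∃ c, k = c + 1 := ⟨k - 1, by omega⟩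
      rw [Nat.add_sub_cancel] at g1 g3
      have A0 : a ≤ c := by omega
      have A1 : c ≤ b + 1 := by omega
      have A2 : c + 1 ≤ b + 1 := by omega
      have A3 : c + 2 ≤ b + 1 := by omega
      refine chaslesI hv hFd (a1 := R c) (a2 := Q c) (a3 := p) (b1 := Q (c+1)) (b2 := p1) (b3 := R (c+2)) (c1 := pm) (c2 := R (c+1)) (c3 := Q (c+2))
        (((h0 c A0 A1).rot hv).swap12) ((h1 (c+1) (by omega) (by omega)).swap12) ((hm (c+1) (by omega) (by omega)).swap23 hv)
        ((hm c (by omega) (by omega)).rot hv).swap12 ((h1 c (by omega) (by omega)).swap12)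
        ((h0 (c+2) (by omega) (by omega)).swap23 hv)
        ⟨(q1 c A0 A1).2, (qq _ _ (by omega) (by omega) (by omega) (by omega) (by omega)).2.2.2, (qq _ _ (by omega) (by omega) (by omega) (by omega) (by omega)).2.2.2, (qq _ _ (by omega) (by omega) (by omega) (by omega) (by omega)).2.2.1⟩
        ⟨(qq _ _ (by omega) (by omega) (by omega) (by omega) (by omega)).1, (qq _ _ (by omega) (by omega) (by omega) (by omega) (by omega)).2.1, (qm c A0 A1).1, (qq _ _ (by omega) (by omega) (by omega) (by omega) (by omega)).1⟩
        ⟨(hQp _ (by omega) (by omega)).symm, hp1.symm, hpm.symm, (hRp _ (by omega) (by omega)).symm⟩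
        ⟨(h0 (c+1) (by omega) A2).2.1, hm1.symm, (qm _ (by omega) A3).2, (qq _ _ (by omega) (by omega) (by omega) (by omega) (by omega)).2.2.2⟩
        g3 g1 fp g2 f1 g5 fm g4
    have hex2 : ∀ k, a + 1 ≤ k → k < b → E F (pt (Q (k-1))) = 0 → E F (pt (Q k)) = 0 → E F (pt (R k)) = 0 →
        E F (pt (R (k+1))) = 0 → E F (pt (Q (k+1))) = 0 → E F (pt (R (k+2))) = 0 := by
      intro k i1 i2 g1 g2 g3 g4 g5
      obtain ⟨c, rfl⟩ : ∃ c, k = c + 1 := ⟨k - 1, by omega⟩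
      rw [Nat.add_sub_cancel] at g1
      have A0 : a ≤ c := by omega
      refine chaslesI hv hFd (a1 := R (c+2)) (a2 := p) (a3 := Q (c+2)) (b1 := Q c) (b2 := R (c+1)) (b3 := p1) (c1 := p2) (c2 := Q (c+1)) (c3 := R (c+3))
        ((h0 (c+2) (by omega) (by omega)).rot' hv) ((h1 c (by omega) (by omega)).rot hv) (h2 (c+1) (by omega) (by omega))
        (((h2 c (by omega) (by omega)).rot hv).swap12) ((h0 (c+1) (by omega) (by omega)).swap23 hv)
        ((h1 (c+2) (by omega) (by omega)).swap12)
        ⟨(qq _ _ (by omega) (by omega) (by omega) (by omega) (by omega)).2.2.2, (q1 _ (by omega) (by omega)).2, (qq _ _ (by omega) (by omega) (by omega) (by omega) (by omega)).2.2.1, (qq _ _ (by omega) (by omega) (by omega) (by omega) (by omega)).2.2.2⟩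
        ⟨(hQp _ (by omega) (by omega)).symm, hp1.symm, hp2.symm, (hRp _ (by omega) (by omega)).symm⟩
        ⟨(qq _ _ (by omega) (by omega) (by omega) (by omega) (by omega)).1, (qq _ _ (by omega) (by omega) (by omega) (by omega) (by omega)).2.1, (q2 _ (by omega) (by omega)).1, (qq _ _ (by omega) (by omega) (by omega) (by omega) (by omega)).1⟩
        ⟨(qq _ _ (by omega) (by omega) (by omega) (by omega) (by omega)).1, (q2 _ (by omega) (by omega)).2, h12, (q1 _ (by omega) (by omega)).1.symm⟩
        g4 fp g5 g1 g3 f1 f2 g2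
    have ind : ∀ k, a + 1 ≤ k → k ≤ b → (∀ s, a ≤ s → s ≤ k → E F (pt (Q s)) = 0 ∧ E F (pt (R s)) = 0) ∧ E F (pt (R (k+1))) = 0 := by
      intro k hk
      induction k, hk using Nat.le_induction with
      | base =>
        intro _
        refine ⟨fun s i j => ?_, hF _ (mem_image_of_mem _ (by simp))⟩
        have : s = a ∨ s = a + 1 := by omega
        rcases this with rfl | rfl
        · exact ⟨hF _ (mem_image_of_mem _ (by simp)), hF _ (mem_image_of_mem _ (by simp))⟩
        · exact ⟨hF _ (mem_image_of_mem _ (by simp)), hF _ (mem_image_of_mem _ (by simp))⟩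
      | succ k hk ih =>
        intro hkb
        obtain ⟨i1, i2⟩ := ih (by omega)
        have e1 := i1 (k-1) (by omega) (by omega)
        have e2 := i1 k (by omega) (by omega)
        have hq := hex1 k hk (by omega) e1.1 e2.1 e1.2 e2.2 i2
        refine ⟨fun s j1 j2 => ?_, hex2 k hk (by omega) e1.1 e2.1 e2.2 i2 hq⟩
        by_cases h : s ≤ k
        · exact i1 s j1 h
        · obtain rfl : s = k + 1 := by omega
          exact ⟨hq, i2⟩
    obtain ⟨i1, i2⟩ := ind b (by omega) le_rfl
    have e1 := i1 (b-1) (by omega) (by omega)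
    have e2 := i1 b (by omega) (by omega)
    have hq := hex1 b (by omega) le_rfl e1.1 e2.1 e1.2 e2.2 i2
    refine ⟨F, hF0, hFd, fp, fun s j1 j2 => ?_⟩
    by_cases h : s ≤ b
    · exact i1 s j1 h
    · obtain rfl : s = b + 1 := by omega
      exact ⟨hq, i2⟩

end
end DM

namespace DM

open Finset
open scoped Classical

noncomputable section
variable {n : ℕ}

/-- the cover of the points by runs, seen from `p` -/
structure Cov (pt : Fin n → ℝ × ℝ) (p : Fin n) (B : ℕ) where
  K : Finset ℕ
  G : ℕ → MP
  R : ℕ → Finset (Fin n)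
  X : Finset (Finset (Fin n))
  hK : K.card ≤ B
  hX : X.card ≤ B
  hG : ∀ k, G k ≠ 0 ∧ (G k).totalDegree ≤ 3 ∧ E (G k) (pt p) = 0
  hR : ∀ k, ∀ q ∈ R k, q ≠ p ∧ E (G k) (pt q) = 0 ∧ (Ln (lift pt) p q).card = 3 ∧ Ln (lift pt) p q ⊆ insert p (R k)
  hXp : ∀ L ∈ X, p ∈ L ∧ ∃ q, q ≠ p ∧ L = Ln (lift pt) p q
  cov : ∀ q, q ≠ p → (∃ k ∈ K, q ∈ R k) ∨ Ln (lift pt) p q ∈ X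

lemma Cfg.exists_cov {pt : Fin n → ℝ × ℝ} (hv : Cfg (lift pt)) (p : Fin n) : Nonempty (Cov pt p (bad (lift pt) p + 1)) := by
  obtain ⟨P⟩ := hv.exists_pen p
  set K : Finset ℕ := (range P.M).filter (fun s => ¬ P.good s) with hKd
  have hKc : K.card ≤ bad (lift pt) p + 1 := by
    have h1 : (K.erase (P.M - 1)).card ≤ bad (lift pt) p := by
      refine card_le_card_of_injOn P.W ?_ ?_
      · intro s hs
        simp only [hKd, coe_erase, Set.mem_sdiff, mem_coe, mem_filter, mem_range, Set.mem_singleton_iff] at hs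
        have ht := P.W_tope hv s
        simp only [mem_coe, mem_filter, badT, mem_topes]
        refine ⟨⟨ht.1, fun h => hs.1.2 ⟨by omega, h⟩⟩, ht.2⟩
      · intro s hs t ht e
        simp only [hKd, coe_erase, Set.mem_sdiff, mem_coe, mem_filter, mem_range, Set.mem_singleton_iff] at hs ht
        exact P.W_inj (by omega) (by omega) e
    have := pred_card_le_card_erase (s := K) (a := P.M - 1)
    omega
  have key : ∀ k, ∃ (G : MP) (R : Finset (Fin n)), (G ≠ 0 ∧ G.totalDegree ≤ 3 ∧ E G (pt p) = 0) ∧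
      (∀ q ∈ R, q ≠ p ∧ E G (pt q) = 0 ∧ (Ln (lift pt) p q).card = 3 ∧ Ln (lift pt) p q ⊆ insert p R) ∧
      ∀ j, j ≠ p → P.r j < k → (∀ s, P.r j ≤ s → s < k → P.good s) → j ∈ R := by
    intro k
    have hex : ∃ a, a ≤ k ∧ ∀ s, a ≤ s → s < k → P.good s := ⟨k, le_rfl, fun s h1 h2 => by omega⟩
    set a := Nat.find hex with ha
    obtain ⟨ha1, ha2⟩ := Nat.find_spec hex
    rw [← ha] at ha1 ha2
    have hmin : ∀ j, P.r j < k → (∀ s, P.r j ≤ s → s < k → P.good s) → a ≤ P.r j := fun j h1 h2 =>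
      Nat.find_min' hex ⟨h1.le, h2⟩
    by_cases hk : a = k
    · obtain ⟨F, h1, h2, h3⟩ := exists_vanish {pt p} 3 (by simp)
      refine ⟨F, ∅, ⟨h1, h2, h3 _ (by simp)⟩, by simp, fun j hj i1 i2 => ?_⟩
      have := hmin j i1 i2; omega
    · obtain ⟨F, h1, h2, h3, h4⟩ := P.run_cubic hv (a := a) (b := k - 1) (by omega) (fun s i j => ha2 s i (by omega))
      refine ⟨F, univ.filter (fun j => j ≠ p ∧ a ≤ P.r j ∧ P.r j ≤ k - 1 + 1), ⟨h1, h2, h3⟩, ?_, ?_⟩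
      · intro q hq
        simp only [mem_filter, mem_univ, true_and] at hq
        obtain ⟨i1, i2, i3⟩ := hq
        refine ⟨i1, (h4 q i1 i2 i3).1, (h4 q i1 i2 i3).2, ?_⟩
        intro j hj
        by_cases hjp : j = p
        · simp [hjp]
        · have := (P.r_eq_iff i1 hjp).2 (mem_Ln.1 hj)
          simp only [mem_insert, mem_filter, mem_univ, true_and]
          right; rw [← this]; exact ⟨hjp, i2, i3⟩
      · intro j hj i1 i2
        simp only [mem_filter, mem_univ, true_and]
        exact ⟨hj, hmin j i1 i2, by omega⟩
  choose G R h1 h2 h3 using key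
  set Lk : ℕ → Finset (Fin n) := fun s => univ.filter (fun j => j = p ∨ P.r j = s) with hLk
  have hLn : ∀ q, q ≠ p → Ln (lift pt) p q = Lk (P.r q) := by
    intro q hq
    ext j
    by_cases hjp : j = p
    · simp [hLk, hjp, left_mem_Ln]
    · rw [mem_Ln, ← P.r_eq_iff hq hjp]
      simp only [hLk, mem_filter, mem_univ, true_and, hjp, false_or]; exact eq_comm
  refine ⟨⟨K, G, R, (univ.filter (fun q => q ≠ p ∧ P.r q ∈ K)).image (fun q => Ln (lift pt) p q), hKc, ?_, h1, h2, ?_, ?_⟩⟩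
  · refine le_trans (card_le_card (t := K.image Lk) ?_) (card_image_le.trans hKc)
    intro L hL
    obtain ⟨q, hq, rfl⟩ := mem_image.1 hL
    simp only [mem_filter, mem_univ, true_and] at hq
    exact mem_image.2 ⟨_, hq.2, (hLn q hq.1).symm⟩
  · intro L hL
    obtain ⟨q, hq, rfl⟩ := mem_image.1 hL
    simp only [mem_filter, mem_univ, true_and] at hq
    exact ⟨left_mem_Ln .., q, hq.1, rfl⟩
  · intro q hq
    have hlt := P.r_lt hq
    by_cases hgq : P.good (P.r q)
    · left
      have hex : ∃ k, P.r q ≤ k ∧ ¬ P.good k := ⟨P.M - 1, by omega, fun h => by have := h.1; omega⟩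
      obtain ⟨i1, i2⟩ := Nat.find_spec hex
      have hmin := fun m => Nat.find_min' hex (m := m)
      set k := Nat.find hex
      have hkM : k ≤ P.M - 1 := hmin _ ⟨by omega, fun h => by have := h.1; omega⟩
      have hne : P.r q ≠ k := fun e => i2 (e ▸ hgq)
      refine ⟨k, by simp only [hKd, mem_filter, mem_range]; exact ⟨by omega, i2⟩, h3 k q hq (by omega) ?_⟩
      intro s j1 j2
      by_contra hc
      have := hmin s ⟨j1, hc⟩
      omega
    · right
      exact mem_image.2 ⟨q, by simp only [mem_filter, mem_univ, true_and, hKd, mem_range]; exact ⟨hq, hlt, hgq⟩, rfl⟩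

end
end DM

namespace DM

open Finset
open scoped Classical

noncomputable section
variable {n : ℕ}

/-- points of the configuration on the zero set of `H` -/
def zs (pt : Fin n → ℝ × ℝ) (H : MP) : Finset (Fin n) := univ.filter (fun p => E H (pt p) = 0)

lemma mem_zs {pt : Fin n → ℝ × ℝ} {H : MP} {p : Fin n} : p ∈ zs pt H ↔ E H (pt p) = 0 := by simp [zs]

/-- unpaired points seen from `p` -/
def unp (pt : Fin n → ℝ × ℝ) (H : MP) (p : Fin n) : Finset (Fin n) :=
  (zs pt H).filter (fun q => ¬ ∃ q' ∈ zs pt H, Tri (lift pt) p q q')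

lemma lift_injective {pt : Fin n → ℝ × ℝ} (hv : Cfg (lift pt)) : Function.Injective pt := by
  intro i j h
  by_contra hc
  exact lift_inj hv hc h

lemma bezoutI {pt : Fin n → ℝ × ℝ} (hv : Cfg (lift pt)) {H G : MP} (hH : Irreducible H) {g : ℕ} (hG : G.totalDegree ≤ g) (hn : ¬ H ∣ G)
    (S : Finset (Fin n)) (hS : ∀ z ∈ S, E H (pt z) = 0 ∧ E G (pt z) = 0) : S.card ≤ H.totalDegree * g := by
  rw [← card_image_of_injective S (lift_injective hv)]
  apply bezout hH hG hn
  intro z hz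
  obtain ⟨i, hi, rfl⟩ := mem_image.1 hz
  exact hS i hi

lemma irr_deg_pos {H : MP} (hH : Irreducible H) : 0 < H.totalDegree := by
  by_contra h
  have h0 : H.totalDegree = 0 := by omega
  obtain hC := MvPolynomial.totalDegree_eq_zero_iff_eq_C.1 h0
  have hne : MvPolynomial.coeff 0 H ≠ 0 := by
    intro h; rw [h] at hC; apply hH.ne_zero; rw [hC]; simp
  apply hH.not_isUnit
  rw [hC]
  exact (isUnit_iff_ne_zero.2 hne).map MvPolynomial.C

lemma deg_mul {f g : MP} (hf : f ≠ 0) (hg : g ≠ 0) : (f * g).totalDegree = f.totalDegree + g.totalDegree :=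
  MvPolynomial.totalDegree_mul_of_isDomain hf hg

lemma deg0_E {f : MP} (hf : f.totalDegree = 0) (z w : ℝ × ℝ) : E f z = E f w := by
  rw [MvPolynomial.totalDegree_eq_zero_iff_eq_C.1 hf]
  simp [E]

lemma deg0_E_ne {f : MP} (hf : f.totalDegree = 0) (h0 : f ≠ 0) (z : ℝ × ℝ) : E f z ≠ 0 := by
  have hC := MvPolynomial.totalDegree_eq_zero_iff_eq_C.1 hf
  intro h
  apply h0
  rw [hC] at h ⊢
  simp [E] at h
  rw [h]; simp

lemma not_dvd_of_deg {H G : MP} (hG : G ≠ 0) (h : G.totalDegree < H.totalDegree) : ¬ H ∣ G := by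
  rintro ⟨K, rfl⟩
  have hH : H ≠ 0 := left_ne_zero_of_mul hG
  rw [deg_mul hH (right_ne_zero_of_mul hG)] at h
  omega

/-- few points of an irreducible curve on a line -/
lemma line_zs {pt : Fin n → ℝ × ℝ} (hv : Cfg (lift pt)) {H : MP} (hH : Irreducible H) (h2 : 2 ≤ H.totalDegree) {p q : Fin n} (hpq : p ≠ q)
    (S : Finset (Fin n)) (hS : ∀ z ∈ S, E H (pt z) = 0 ∧ z ∈ Ln (lift pt) p q) : S.card ≤ H.totalDegree := by
  have hu := crs_hat (lift_inj hv hpq)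
  have := bezoutI hv hH (lin_deg (crs (hat (pt p)) (hat (pt q)))) (not_dvd_of_deg (lin_ne hu) (by rw [lin_totalDegree hu]; omega)) S (by
    intro z hz
    refine ⟨(hS z hz).1, ?_⟩
    rw [E_lin', ← det3_def]
    exact mem_Ln.1 (hS z hz).2)
  omega

lemma Cov.count {pt : Fin n → ℝ × ℝ} {p : Fin n} {B : ℕ} (c : Cov pt p B) (S : Finset (Fin n)) (hp : p ∉ S) {x y : ℕ}
    (hx : ∀ k ∈ c.K, (S ∩ c.R k).card ≤ x) (hy : ∀ L ∈ c.X, (S ∩ L).card ≤ y) : S.card ≤ B * x + B * y := by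
  have h1 : S ⊆ c.K.biUnion (fun k => S ∩ c.R k) ∪ c.X.biUnion (fun L => S ∩ L) := by
    intro q hq
    have hqp : q ≠ p := fun e => hp (e ▸ hq)
    rcases c.cov q hqp with ⟨k, hk, hqk⟩ | h
    · exact mem_union_left _ (mem_biUnion.2 ⟨k, hk, mem_inter.2 ⟨hq, hqk⟩⟩)
    · exact mem_union_right _ (mem_biUnion.2 ⟨_, h, mem_inter.2 ⟨hq, right_mem_Ln ..⟩⟩)
  have h2 := (card_le_card h1).trans (card_union_le _ _)
  have h3 : (c.K.biUnion (fun k => S ∩ c.R k)).card ≤ c.K.card * x := card_biUnion_le_card_mul _ _ _ hx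
  have h4 : (c.X.biUnion (fun L => S ∩ L)).card ≤ c.X.card * y := card_biUnion_le_card_mul _ _ _ hy
  have h5 := Nat.mul_le_mul_right x c.hK
  have h6 := Nat.mul_le_mul_right y c.hX
  omega

/-- cubic case: `p` off the cubic sees few of its points -/
lemma cubic_off {pt : Fin n → ℝ × ℝ} (hv : Cfg (lift pt)) {H : MP} (hH : Irreducible H) (h3 : H.totalDegree = 3) {p : Fin n}
    (hp : E H (pt p) ≠ 0) : (zs pt H).card ≤ 12 * (bad (lift pt) p + 1) := by
  obtain ⟨c⟩ := hv.exists_cov p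
  have := c.count (zs pt H) (by simpa [mem_zs] using hp) (x := 9) (y := 3) ?_ ?_
  · omega
  · intro k hk
    have hG := c.hG k
    have := bezoutI hv hH hG.2.1 ?_ (zs pt H ∩ c.R k) ?_
    · rw [h3] at this; omega
    · rintro ⟨A, hA⟩
      rw [hA] at hG
      have hd := deg_mul (left_ne_zero_of_mul hG.1) (right_ne_zero_of_mul hG.1)
      have h0 : A.totalDegree = 0 := by omega
      have := hG.2.2
      rw [E_mul] at this
      rcases mul_eq_zero.1 this with h | h
      · exact hp h
      · exact deg0_E_ne h0 (right_ne_zero_of_mul hG.1) _ h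
    · intro z hz
      rw [mem_inter, mem_zs] at hz
      exact ⟨hz.1, (c.hR k z hz.2).2.1⟩
  · intro L hL
    obtain ⟨_, q, hq, rfl⟩ := c.hXp L hL
    have := line_zs hv hH (by omega) hq.symm (zs pt H ∩ Ln (lift pt) p q) (by
      intro z hz; rw [mem_inter, mem_zs] at hz; exact hz)
    omega

/-- conic case: `p` off the conic pairs up almost all of its points -/
lemma conic_off {pt : Fin n → ℝ × ℝ} (hv : Cfg (lift pt)) {H : MP} (hH : Irreducible H) (h2 : H.totalDegree = 2) {p : Fin n}
    (hp : E H (pt p) ≠ 0) : (unp pt H p).card ≤ 8 * (bad (lift pt) p + 1) := by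
  obtain ⟨c⟩ := hv.exists_cov p
  have hsub : ∀ z ∈ unp pt H p, E H (pt z) = 0 ∧ ¬ ∃ q' ∈ zs pt H, Tri (lift pt) p z q' := by
    intro z hz; rw [unp, mem_filter, mem_zs] at hz; exact hz
  have := c.count (unp pt H p) (fun h => hp (hsub p h).1) (x := 6) (y := 2) ?_ ?_
  · omega
  · intro k hk
    have hG := c.hG k
    by_cases hd : H ∣ c.G k
    · obtain ⟨A, hA⟩ := hd
      rw [hA] at hG
      have hdeg := deg_mul (left_ne_zero_of_mul hG.1) (right_ne_zero_of_mul hG.1)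
      have hA1 : A.totalDegree ≤ 1 := by omega
      have hAp : E A (pt p) = 0 := by
        have := hG.2.2
        rw [E_mul] at this
        rcases mul_eq_zero.1 this with h | h
        · exact absurd h hp
        · exact h
      have := bezoutI hv hH hA1 (not_dvd_of_deg (right_ne_zero_of_mul hG.1) (by omega)) (unp pt H p ∩ c.R k) ?_
      · omega
      · intro z hz
        rw [mem_inter] at hz
        obtain ⟨i1, i2⟩ := hsub z hz.1
        refine ⟨i1, ?_⟩
        obtain ⟨j1, j2, j3, j4⟩ := c.hR k z hz.2
        obtain ⟨w, hw⟩ := hv.tri_of_card j1.symm j3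
        have hwR : w ∈ c.R k := by
          have : w ∈ Ln (lift pt) p z := by rw [hw.2.2.2]; simp
          have := j4 this
          rw [mem_insert] at this
          exact this.resolve_left hw.2.2.1.symm
        have hw0 := (c.hR k w hwR).2.1
        rw [hA, E_mul] at hw0
        rcases mul_eq_zero.1 hw0 with h | h
        · exact absurd ⟨w, mem_zs.2 h, hw⟩ i2
        · exact deg1_line hA1 (lift_inj hv hw.2.2.1) ((hw.swap23 hv).det) hAp h
    · have := bezoutI hv hH hG.2.1 hd (unp pt H p ∩ c.R k) ?_
      · rw [h2] at this; omega
      · intro z hz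
        rw [mem_inter] at hz
        exact ⟨(hsub z hz.1).1, (c.hR k z hz.2).2.1⟩
  · intro L hL
    obtain ⟨_, q, hq, rfl⟩ := c.hXp L hL
    have := line_zs hv hH (by omega) hq.symm (unp pt H p ∩ Ln (lift pt) p q) (by
      intro z hz; rw [mem_inter] at hz; exact ⟨(hsub z hz.1).1, hz.2⟩)
    omega

lemma exists_factor {ι : Type} (f : ι → ℝ × ℝ) : ∀ (d : ℕ) (G : MP), G ≠ 0 → G.totalDegree ≤ d → ∀ S : Finset ι, S.Nonempty → (∀ z ∈ S, E G (f z) = 0) →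
    ∃ H, Irreducible H ∧ H ∣ G ∧ S.card ≤ d * (S.filter (fun z => E H (f z) = 0)).card := by
  intro d
  induction d with
  | zero =>
    intro G h0 hd S hS hz
    obtain ⟨z, hzS⟩ := hS
    exact absurd (hz z hzS) (deg0_E_ne (by omega) h0 _)
  | succ d ih =>
    intro G h0 hd S hS hz
    have hu : ¬ IsUnit G := by
      intro hu
      obtain ⟨z, hzS⟩ := hS
      obtain ⟨G', hG'⟩ := hu.exists_right_inv
      have : E (G * G') (f z) = 0 := by rw [E_mul, hz z hzS, zero_mul]
      rw [hG'] at this; simp at this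
    obtain ⟨H, hH, A, hA⟩ := WfDvdMonoid.exists_irreducible_factor hu h0
    by_cases hc : S.card ≤ (d+1) * (S.filter (fun z => E H (f z) = 0)).card
    · exact ⟨H, hH, ⟨A, hA⟩, hc⟩
    push Not at hc
    have hA0 : A ≠ 0 := by rintro rfl; simp at hA; exact h0 hA
    have hdeg : G.totalDegree = H.totalDegree + A.totalDegree := by rw [hA, deg_mul hH.ne_zero hA0]
    have hp := irr_deg_pos hH
    have hsplit := card_filter_add_card_filter_not (s := S) (fun z => E H (f z) = 0)
    set S' := S.filter (fun z => ¬ E H (f z) = 0) with hS'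
    set a := (S.filter (fun z => E H (f z) = 0)).card
    have hne : S'.Nonempty := by
      rw [← card_pos]
      by_contra h
      have : S'.card = 0 := by omega
      nlinarith
    obtain ⟨H', i1, i2, i3⟩ := ih A hA0 (by omega) S' hne (by
      intro z hz'
      rw [hS', mem_filter] at hz'
      have := hz z hz'.1
      rw [hA, E_mul] at this
      exact (mul_eq_zero.1 this).resolve_left hz'.2)
    refine ⟨H', i1, i2.trans ⟨H, by rw [hA, mul_comm]⟩, ?_⟩
    have hle : (S'.filter (fun z => E H' (f z) = 0)).card ≤ (S.filter (fun z => E H' (f z) = 0)).card :=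
      card_le_card (filter_subset_filter _ (filter_subset _ _))
    set b := (S'.filter (fun z => E H' (f z) = 0)).card
    have hd0 : 0 < d := by
      by_contra h
      have : d = 0 := by omega
      subst this
      have := card_pos.2 hne
      omega
    have h5 : d * (S.card) ≤ d * ((d+1) * b) := by nlinarith
    exact (Nat.le_of_mul_le_mul_left h5 hd0).trans (Nat.mul_le_mul_left _ hle)

lemma atyp {pt : Fin n → ℝ × ℝ} (hv : Cfg (lift pt)) (hN : 2 * N2 (lift pt) < n) (e : ℕ) :
    (univ.filter (fun p => 5569 * e < bad (lift pt) p)).card * e ≤ n := by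
  have h := hv.sum_bad
  have h1 : (univ.filter (fun p => 5569 * e < bad (lift pt) p)).card * (5569 * e) ≤ ∑ p, bad (lift pt) p := by
    refine le_trans ?_ (sum_le_sum_of_subset (filter_subset (fun p => 5569 * e < bad (lift pt) p) univ))
    rw [← smul_eq_mul]
    apply card_nsmul_le_sum
    intro x hx
    rw [mem_filter] at hx
    exact hx.2.le
  nlinarith

lemma rich_sum {v : Fin n → V3} (hv : Cfg v) (hN : 2 * N2 v < n) (𝓛 : Finset (Finset (Fin n))) (h : 𝓛 ⊆ lines v) :
    2 * ∑ L ∈ 𝓛, (L.card - 3) + 6 < n := by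
  have h1 := hv.melchior_split
  have h2 : ∑ L ∈ 𝓛, (L.card - 3) ≤ ∑ L ∈ lines v, (L.card - 3) := sum_le_sum_of_subset h
  omega

/-- existence of a component carrying many points -/
theorem exists_comp (e : ℕ) (he : 2 ≤ e) : ∃ D N0 : ℕ, 0 < D ∧ ∀ n, N0 ≤ n → ∀ pt : Fin n → ℝ × ℝ, Cfg (lift pt) → 2 * N2 (lift pt) < n →
    ∃ H : MP, Irreducible H ∧ 2 ≤ H.totalDegree ∧ H.totalDegree ≤ 3 ∧ n ≤ D * (zs pt H).card := by
  set B := 5569 * e + 1 with hB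
  set D := 18 * B with hD
  refine ⟨D, 24 * D, by omega, fun n hn pt hv hN => ?_⟩
  set 𝓛 := (lines (lift pt)).filter (fun L => n ≤ D * L.card) with h𝓛
  have hrs := rich_sum hv hN 𝓛 (filter_subset _ _)
  have hbig : ∀ L ∈ 𝓛, 24 ≤ L.card := by
    intro L hL
    have := (mem_filter.1 hL).2
    exact Nat.le_of_mul_le_mul_left (by nlinarith : D * 24 ≤ D * L.card) (by omega)
  set Y := univ.filter (fun p => ∀ L ∈ 𝓛, p ∉ L) with hY
  have hYc : n ≤ 3 * Y.card := by
    have h1 : (univ : Finset (Fin n)) ⊆ Y ∪ 𝓛.biUnion id := by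
      intro p _
      by_cases h : ∀ L ∈ 𝓛, p ∉ L
      · exact mem_union_left _ (mem_filter.2 ⟨mem_univ _, h⟩)
      · push Not at h
        obtain ⟨L, h1, h2⟩ := h
        exact mem_union_right _ (mem_biUnion.2 ⟨L, h1, h2⟩)
    have h2 := (card_le_card h1).trans (card_union_le _ _)
    rw [card_univ, Fintype.card_fin] at h2
    have h3 : (𝓛.biUnion id).card ≤ ∑ L ∈ 𝓛, L.card := card_biUnion_le
    have h4 : 7 * ∑ L ∈ 𝓛, L.card ≤ 8 * ∑ L ∈ 𝓛, (L.card - 3) := by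
      rw [mul_sum, mul_sum]
      apply sum_le_sum
      intro L hL
      have := hbig L hL
      omega
    omega
  obtain ⟨p, hp⟩ : ∃ p, bad (lift pt) p ≤ 5569 * e := by
    by_contra hc
    push Not at hc
    have h1 := atyp hv hN e
    rw [filter_true_of_mem (fun p _ => hc p), card_univ, Fintype.card_fin] at h1
    nlinarith
  obtain ⟨c⟩ := hv.exists_cov p
  -- a run with many points
  have hrun : ∃ k ∈ c.K, n ≤ 6 * B * (Y.erase p ∩ c.R k).card := by
    by_contra hcon
    push Not at hcon
    have h1 := c.count (Y.erase p) (by simp) (x := (n - 1) / (6 * B)) (y := (n-1) / D) (by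
      intro k hk
      rw [Nat.le_div_iff_mul_le (by omega), mul_comm]
      have := hcon k hk; omega) (by
      intro L hL
      rw [Nat.le_div_iff_mul_le (by omega), mul_comm]
      by_contra hc
      obtain ⟨_, q, hq, rfl⟩ := c.hXp L hL
      have hle : (Y.erase p ∩ Ln (lift pt) p q).card ≤ (Ln (lift pt) p q).card := card_le_card inter_subset_right
      have hm : Ln (lift pt) p q ∈ 𝓛 := mem_filter.2 ⟨Ln_mem_lines hq.symm, by have := Nat.mul_le_mul_left D hle; omega⟩
      have : Y.erase p ∩ Ln (lift pt) p q = ∅ := by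
        rw [eq_empty_iff_forall_notMem]
        intro z hz
        rw [mem_inter, mem_erase] at hz
        exact (mem_filter.1 hz.1.2).2 _ hm hz.2
      rw [this] at hc
      simp at hc)
    have h2 := pred_card_le_card_erase (s := Y) (a := p)
    have h3 : 6 * (B * ((n-1) / (6 * B))) ≤ n - 1 := by
      have := Nat.div_mul_le_self (n-1) (6*B); nlinarith
    have h4 : 18 * (B * ((n-1) / D)) ≤ n - 1 := by
      have := Nat.div_mul_le_self (n-1) D; rw [hD] at this ⊢; nlinarith
    have h5 : (bad (lift pt) p + 1) * ((n-1) / (6 * B)) ≤ B * ((n-1) / (6 * B)) := Nat.mul_le_mul_right _ (by omega)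
    have h6 : (bad (lift pt) p + 1) * ((n-1) / D) ≤ B * ((n-1) / D) := Nat.mul_le_mul_right _ (by omega)
    omega
  obtain ⟨k, hk, hkc⟩ := hrun
  set S := Y.erase p ∩ c.R k with hS
  have hSne : S.Nonempty := by
    rw [← card_pos]
    by_contra h
    have : S.card = 0 := by omega
    rw [this] at hkc
    omega
  obtain ⟨H, i1, i2, i3⟩ := exists_factor pt 3 (c.G k) (c.hG k).1 (c.hG k).2.1 S hSne (by
    intro z hz
    exact (c.hR k z (mem_inter.1 hz).2).2.1)
  have hHd : H.totalDegree ≤ 3 := by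
    by_contra h
    exact not_dvd_of_deg (c.hG k).1 (by have := (c.hG k).2.1; omega) i2
  have hcn : n ≤ D * (S.filter (fun z => E H (pt z) = 0)).card := by nlinarith
  refine ⟨H, i1, ?_, hHd, hcn.trans (Nat.mul_le_mul_left _ (card_le_card ?_))⟩
  · by_contra h1
    have hd1 : H.totalDegree ≤ 1 := by omega
    have h24 : 1 < (S.filter (fun z => E H (pt z) = 0)).card :=
      lt_of_lt_of_le (by omega) (Nat.le_of_mul_le_mul_left (by nlinarith : D * 24 ≤ D * (S.filter (fun z => E H (pt z) = 0)).card) (by omega))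
    obtain ⟨x, hx, y, hy, hxy⟩ := one_lt_card.1 h24
    have hsub : S.filter (fun z => E H (pt z) = 0) ⊆ Ln (lift pt) x y := by
      intro z hz
      rw [mem_Ln]
      by_contra hdet
      -- H vanishes at three noncollinear points
      rw [mem_filter] at hx hy hz
      have hu := crs_hat (lift_inj hv hxy)
      have hdv := lin_dvd hu {pt x, pt y} (f := H) (by rw [card_pair (lift_inj hv hxy)]; omega) (by
        intro w hw
        simp only [mem_insert, mem_singleton] at hw
        rcases hw with rfl | rfl
        · exact ⟨by rw [← det3_def, det3_self13], hx.2⟩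
        · exact ⟨by rw [← det3_def, det3_self23], hy.2⟩)
      obtain ⟨A, hA⟩ := hdv
      have hA0 : A ≠ 0 := by rintro rfl; rw [mul_zero] at hA; exact i1.ne_zero hA
      have hdg := deg_mul (lin_ne hu) hA0
      rw [← hA, lin_totalDegree hu] at hdg
      have := hz.2
      rw [hA, E_mul, E_lin', ← det3_def] at this
      rcases mul_eq_zero.1 this with h | h
      · exact hdet h
      · exact deg0_E_ne (by omega) hA0 _ h
    have hm : Ln (lift pt) x y ∈ 𝓛 := mem_filter.2 ⟨Ln_mem_lines hxy, hcn.trans (Nat.mul_le_mul_left _ (card_le_card hsub))⟩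
    have hxY : x ∈ Y := by
      have := (mem_filter.1 hx).1
      rw [hS, mem_inter, mem_erase] at this
      exact this.1.2
    exact (mem_filter.1 hxY).2 _ hm (left_mem_Ln ..)
  · intro z hz
    exact mem_zs.2 (mem_filter.1 hz).2

end
end DM

namespace DM

open Finset
open scoped Classical

noncomputable section
variable {n : ℕ}

lemma exists_poly {f : MP} {N : ℕ} (hf : f.totalDegree ≤ N) :
    ∃ c : ℕ → ℕ → ℝ, (∀ i j, N < i + j → c i j = 0) ∧
      f = ∑ i ∈ range (N+1), ∑ j ∈ range (N+1), MvPolynomial.C (c i j) * MvPolynomial.X 0 ^ i * MvPolynomial.X 1 ^ j := by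
  set g : ℕ × ℕ → (Fin 2 →₀ ℕ) := fun x => Finsupp.single 0 x.1 + Finsupp.single 1 x.2 with hg
  have hginj : Function.Injective g := by
    intro x y h
    have h0 := DFunLike.congr_fun h 0
    have h1 := DFunLike.congr_fun h 1
    simp [hg] at h0 h1
    exact Prod.ext h0 h1
  have hgs : ∀ m : Fin 2 →₀ ℕ, g (m 0, m 1) = m := by
    intro m; ext i; fin_cases i <;> simp [hg]
  have hdeg : ∀ m ∈ f.support, m 0 + m 1 ≤ N := by
    intro m hm
    have := MvPolynomial.le_totalDegree hm
    rw [Finsupp.sum_fintype _ _ (by simp)] at this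
    simp [Fin.sum_univ_two] at this
    omega
  refine ⟨fun i j => f.coeff (g (i, j)), ?_, ?_⟩
  · intro i j h
    by_contra hc
    have := hdeg _ (MvPolynomial.mem_support_iff.2 hc)
    simp [hg] at this
    omega
  · conv_lhs => rw [f.as_sum]
    rw [← sum_product']
    rw [sum_subset (s₂ := (range (N+1) ×ˢ range (N+1)).image g)]
    · rw [sum_image (fun x _ y _ h => hginj h)]
      apply sum_congr rfl
      rintro ⟨i, j⟩ -
      rw [MvPolynomial.monomial_eq]
      simp [hg, Finsupp.prod_add_index', pow_add, mul_assoc]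
    · intro m hm
      refine mem_image.2 ⟨(m 0, m 1), ?_, hgs m⟩
      have := hdeg m hm
      simp; omega
    · intro m _ hm
      rw [MvPolynomial.notMem_support_iff.1 hm, map_zero]

lemma exists_lin {f : MP} (hf : f.totalDegree ≤ 1) : ∃ u, f = lin u := by
  obtain ⟨c, h0, h⟩ := exists_poly hf
  refine ⟨(c 1 0, c 0 1, c 0 0), ?_⟩
  rw [h]
  have := h0 1 1 (by omega)
  simp [sum_range_succ, lin, this]
  ring

/-- explicit quadratic polynomial -/
def quad (c0 c1 c2 c3 c4 c5 : ℝ) : MP := lin (c1, c2, c0) + MvPolynomial.X 0 * lin (c3, c4, 0) + MvPolynomial.X 1 * lin (0, c5, 0)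

/-- explicit cubic polynomial -/
def cub (c : Fin 10 → ℝ) : MP := lin (c 1, c 2, c 0) + MvPolynomial.X 0 * lin (c 3, c 4, 0) + MvPolynomial.X 1 * lin (0, c 5, 0)
  + MvPolynomial.X 0 * MvPolynomial.X 0 * lin (c 6, c 7, 0) + MvPolynomial.X 1 * MvPolynomial.X 1 * lin (c 8, c 9, 0)

lemma exists_cub {f : MP} (hf : f.totalDegree ≤ 3) : ∃ c, f = cub c := by
  obtain ⟨c, h0, h⟩ := exists_poly hf
  refine ⟨![c 0 0, c 1 0, c 0 1, c 2 0, c 1 1, c 0 2, c 3 0, c 2 1, c 1 2, c 0 3], ?_⟩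
  rw [h]
  simp [sum_range_succ, lin, cub, h0 1 3, h0 2 2, h0 2 3, h0 3 1, h0 3 2, h0 3 3]
  ring

lemma quad_deg (c0 c1 c2 c3 c4 c5 : ℝ) : (quad c0 c1 c2 c3 c4 c5).totalDegree ≤ 2 := by
  have h : ∀ i u, (MvPolynomial.X i * lin u : MP).totalDegree ≤ 2 := by
    intro i u
    refine (MvPolynomial.totalDegree_mul _ _).trans ?_
    have := lin_deg u
    rw [MvPolynomial.totalDegree_X]; omega
  unfold quad
  refine (MvPolynomial.totalDegree_add _ _).trans (max_le ((MvPolynomial.totalDegree_add _ _).trans (max_le ?_ (h _ _))) (h _ _))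
  exact (lin_deg _).trans (by omega)

def cH (c : Fin 10 → ℝ) (z : ℝ × ℝ) : ℝ := c 0 + c 1 * z.1 + c 2 * z.2 + c 3 * z.1^2 + c 4 * z.1 * z.2 + c 5 * z.2^2
  + c 6 * z.1^3 + c 7 * z.1^2 * z.2 + c 8 * z.1 * z.2^2 + c 9 * z.2^3
/-- partial derivatives as polynomials -/
def Px (c : Fin 10 → ℝ) : MP := quad (c 1) (2 * c 3) (c 4) (3 * c 6) (2 * c 7) (c 8)
def Py (c : Fin 10 → ℝ) : MP := quad (c 2) (c 4) (2 * c 5) (c 7) (2 * c 8) (3 * c 9)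
def Pxx (c : Fin 10 → ℝ) : MP := lin (6 * c 6, 2 * c 7, 2 * c 3)
def Pxy (c : Fin 10 → ℝ) : MP := lin (2 * c 7, 2 * c 8, c 4)
def Pyy (c : Fin 10 → ℝ) : MP := lin (2 * c 8, 6 * c 9, 2 * c 5)
/-- directional derivatives -/
def D1 (c : Fin 10 → ℝ) (z w : ℝ × ℝ) : ℝ := w.1 * E (Px c) z + w.2 * E (Py c) z
def D2 (c : Fin 10 → ℝ) (z w : ℝ × ℝ) : ℝ := w.1^2 * E (Pxx c) z + 2 * w.1 * w.2 * E (Pxy c) z + w.2^2 * E (Pyy c) z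
def D3 (c : Fin 10 → ℝ) (w : ℝ × ℝ) : ℝ := c 6 * w.1^3 + c 7 * w.1^2 * w.2 + c 8 * w.1 * w.2^2 + c 9 * w.2^3

lemma E_cub (c : Fin 10 → ℝ) (z : ℝ × ℝ) : E (cub c) z = cH c z := by
  simp [cub, cH, E_lin, dot]; ring

lemma taylor (c : Fin 10 → ℝ) (z w : ℝ × ℝ) (s : ℝ) :
    E (cub c) (z.1 + s * w.1, z.2 + s * w.2) = E (cub c) z + s * D1 c z w + s^2 * (D2 c z w / 2) + s^3 * D3 c w := by
  simp [E_cub, cH, D1, D2, D3, Px, Py, Pxx, Pxy, Pyy, quad, E_lin, dot]; ring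

lemma no_line {H : MP} (hH : Irreducible H) (h2 : 2 ≤ H.totalDegree) {z w : ℝ × ℝ} (hw : w ≠ 0)
    (h : ∀ s : ℝ, E H (z.1 + s * w.1, z.2 + s * w.2) = 0) : False := by
  have hzz : z ≠ (z.1 + w.1, z.2 + w.2) := by
    intro e
    apply hw
    have e1 := congrArg Prod.fst e
    have e2 := congrArg Prod.snd e
    simp at e1 e2
    exact Prod.ext e1 e2
  have hu := crs_hat hzz
  have hinj : Function.Injective (fun s : ℕ => ((z.1 + (s:ℝ) * w.1, z.2 + (s:ℝ) * w.2) : ℝ × ℝ)) := by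
    intro s t hst
    simp at hst
    by_contra hne
    apply hw
    have hne' : (s:ℝ) ≠ t := by exact_mod_cast hne
    exact Prod.ext (hst.1.resolve_left hne) (hst.2.resolve_left hne)
  have hd := lin_dvd hu ((range (H.totalDegree + 1)).image (fun s : ℕ => ((z.1 + (s:ℝ) * w.1, z.2 + (s:ℝ) * w.2) : ℝ × ℝ))) (f := H)
    (by rw [card_image_of_injective _ hinj, card_range]; omega) (by
      intro x hx
      obtain ⟨s, -, rfl⟩ := mem_image.1 hx
      refine ⟨?_, h s⟩
      simp [dot, crs, hat]; ring)
  obtain ⟨A, hA⟩ := hd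
  rcases hH.isUnit_or_isUnit hA with hu' | hu'
  · have := lin_totalDegree hu
    rw [MvPolynomial.isUnit_iff_totalDegree_of_isReduced] at hu'
    omega
  · have h0 : A.totalDegree = 0 := (MvPolynomial.isUnit_iff_totalDegree_of_isReduced.1 hu').2
    have := MvPolynomial.totalDegree_mul (lin (crs (hat z) (hat (z.1 + w.1, z.2 + w.2)))) A
    rw [← hA] at this
    have := lin_deg (crs (hat z) (hat (z.1 + w.1, z.2 + w.2)))
    omega

/-- polar polynomial -/
def Pol (c : Fin 10 → ℝ) (X : V3) : MP := lin (-X.1, 0, X.2.1) * Px c + lin (0, -X.1, X.2.2) * Py c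

lemma E_Pol (c : Fin 10 → ℝ) (X : V3) (z : ℝ × ℝ) : E (Pol c X) z = D1 c z (X.2.1 - X.1 * z.1, X.2.2 - X.1 * z.2) := by
  simp [Pol, E_lin, dot, D1]; ring

lemma Pol_deg (c : Fin 10 → ℝ) (X : V3) : (Pol c X).totalDegree ≤ 3 := by
  unfold Pol
  have h1 := lin_deg (-X.1, 0, X.2.1)
  have h2 := lin_deg (0, -X.1, X.2.2)
  have h3 : (Px c).totalDegree ≤ 2 := quad_deg ..
  have h4 : (Py c).totalDegree ≤ 2 := quad_deg ..
  refine (MvPolynomial.totalDegree_add _ _).trans (max_le ?_ ?_)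
  · exact (MvPolynomial.totalDegree_mul _ _).trans (by omega)
  · exact (MvPolynomial.totalDegree_mul _ _).trans (by omega)

lemma cubic_zero {a b d : ℝ} (h : ∀ s : ℝ, a + b * s + d * s^2 = 0) : a = 0 ∧ b = 0 ∧ d = 0 := by
  have h0 := h 0
  have h1 := h 1
  have h2 := h (-1)
  refine ⟨?_, ?_, ?_⟩ <;> linarith

lemma class_bound {pt : Fin n → ℝ × ℝ} (hv : Cfg (lift pt)) {c : Fin 10 → ℝ} (hH : Irreducible (cub c)) (h3 : (cub c).totalDegree = 3)
    {X : V3} (hX : X ≠ 0) (S : Finset (Fin n)) (hS : ∀ a ∈ S, E (cub c) (pt a) = 0 ∧ E (Pol c X) (pt a) = 0) : S.card ≤ 9 := by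
  by_contra hcon
  have hnd : ¬ ¬ (cub c ∣ Pol c X) := by
    intro hnd
    have := bezoutI hv hH (Pol_deg c X) hnd S hS
    rw [h3] at this
    omega
  push Not at hnd
  obtain ⟨K, hK⟩ := hnd
  obtain ⟨a, ha, b, hb, hab⟩ := one_lt_card.1 (show 1 < S.card by omega)
  have hKm : ∃ μ : ℝ, ∀ z, E (Pol c X) z = μ * E (cub c) z := by
    by_cases hK0 : K = 0
    · exact ⟨0, fun z => by rw [hK, hK0]; simp⟩
    · have hd := deg_mul hH.ne_zero hK0
      rw [← hK] at hd
      have := Pol_deg c X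
      have h0 : K.totalDegree = 0 := by omega
      refine ⟨E K (0,0), fun z => ?_⟩
      rw [hK, E_mul, deg0_E h0 z (0,0), mul_comm]
  obtain ⟨μ, hμ⟩ := hKm
  by_cases hX0 : X.1 = 0
  · -- point at infinity
    set w : ℝ × ℝ := X.2 with hw
    have hw0 : w ≠ 0 := by
      intro h
      apply hX
      exact Prod.ext hX0 h
    have key : ∀ z, D1 c z w = μ * E (cub c) z := by
      intro z
      rw [← hμ, E_Pol, hX0]
      simp [hw]
    -- expand along line through a
    have hz := (hS a ha).1
    set z := pt a
    apply no_line hH (by omega) hw0 (z := z)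
    intro s
    have hD : ∀ s : ℝ, D1 c (z.1 + s * w.1, z.2 + s * w.2) w = D1 c z w + s * D2 c z w + 3 * s^2 * D3 c w := by
      intro s
      simp [D1, D2, D3, Px, Py, Pxx, Pxy, Pyy, quad, E_lin, dot]; ring
    have hE : ∀ s : ℝ, D1 c z w + s * D2 c z w + 3 * s^2 * D3 c w = μ * (s * D1 c z w + s^2 * (D2 c z w / 2) + s^3 * D3 c w) := by
      intro s
      rw [← hD, key, taylor, hz]; ring
    have e0 := hE 0
    have e1 := hE 1
    have e2 := hE (-1)
    have e3 := hE 2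
    have a1 : D1 c z w = 0 := by linarith
    rw [a1] at e1 e2 e3
    have a3 : μ * D3 c w = 0 := by linarith
    have a2 : D2 c z w = 0 := by
      have : μ * D2 c z w = 6 * D3 c w := by linarith
      rcases mul_eq_zero.1 a3 with h | h
      · rw [h] at e1 e2; linarith
      · rw [h] at e1 e2; linarith
    have a3' : D3 c w = 0 := by rw [a2] at e1; linarith
    rw [taylor, hz, a1, a2, a3']; ring
  · -- finite point
    set x : ℝ × ℝ := (X.2.1 / X.1, X.2.2 / X.1) with hx
    obtain ⟨q, hq, hqx⟩ : ∃ q ∈ S, pt q ≠ x := by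
      by_cases h : pt a = x
      · exact ⟨b, hb, fun h' => lift_inj hv hab (h.trans h'.symm)⟩
      · exact ⟨a, ha, h⟩
    have hz := (hS q hq).1
    set z := pt q
    set w : ℝ × ℝ := z - x with hw
    have hw0 : w ≠ 0 := sub_ne_zero.2 hqx
    have hzw : z = (x.1 + 1 * w.1, x.2 + 1 * w.2) := by ext <;> simp [hw]
    apply no_line hH (by omega) hw0 (z := x)
    have key : ∀ s : ℝ, - X.1 * (s * D1 c x w + s^2 * D2 c x w + 3 * s^3 * D3 c w) =
        μ * (E (cub c) x + s * D1 c x w + s^2 * (D2 c x w / 2) + s^3 * D3 c w) := by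
      intro s
      rw [← taylor, ← hμ, E_Pol]
      have e1 : X.2.1 = X.1 * x.1 := by simp [hx]; field_simp
      have e2 : X.2.2 = X.1 * x.2 := by simp [hx]; field_simp
      rw [e1, e2]
      simp [D1, D2, D3, Px, Py, Pxx, Pxy, Pyy, quad, E_lin, dot]; ring
    have hz' := hz
    rw [hzw, taylor] at hz'
    set A := E (cub c) x with hA
    set B := D1 c x w
    set C := D2 c x w
    set D := D3 c w
    have k0 := key 0
    have k1 := key 1
    have k2 := key (-1)
    have k3 := key 2
    have q0 : μ * A = 0 := by linarith
    have q2 : (2 * X.1 + μ) * C = 0 := by linarith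
    have q3 : (3 * X.1 + μ) * D = 0 := by linarith
    have q1 : (X.1 + μ) * B = 0 := by linarith
    have hall : A = 0 ∧ B = 0 ∧ C = 0 ∧ D = 0 := by
      rcases mul_eq_zero.1 q0 with h | h
      · rw [h, add_zero] at q1 q2 q3
        have hB : B = 0 := (mul_eq_zero.1 q1).resolve_left hX0
        have hC : C = 0 := (mul_eq_zero.1 q2).resolve_left (by simpa using hX0)
        have hD : D = 0 := (mul_eq_zero.1 q3).resolve_left (by simpa using hX0)
        exact ⟨by rw [hB, hC, hD] at hz'; linarith, hB, hC, hD⟩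
      · rcases mul_eq_zero.1 q1 with h1 | h1
        · have hC : C = 0 := (mul_eq_zero.1 q2).resolve_left (fun h' => hX0 (by linarith))
          have hD : D = 0 := (mul_eq_zero.1 q3).resolve_left (fun h' => hX0 (by linarith))
          exact ⟨h, by rw [h, hC, hD] at hz'; linarith, hC, hD⟩
        · rcases mul_eq_zero.1 q2 with h2 | h2
          · have hD : D = 0 := (mul_eq_zero.1 q3).resolve_left (fun h' => hX0 (by linarith))
            exact ⟨h, h1, by rw [h, h1, hD] at hz'; linarith, hD⟩
          · exact ⟨h, h1, h2, by rw [h, h1, h2] at hz'; linarith⟩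
    intro s
    rw [taylor, ← hA]
    rw [hall.1, show D1 c x w = 0 from hall.2.1, show D2 c x w = 0 from hall.2.2.1, show D3 c w = 0 from hall.2.2.2]
    ring

/-- flex polynomial -/
def Flx (c : Fin 10 → ℝ) : MP := Pxx c * (Py c * Py c) - MvPolynomial.C 2 * (Pxy c * (Px c * Py c)) + Pyy c * (Px c * Px c)

lemma Flx_deg (c : Fin 10 → ℝ) : (Flx c).totalDegree ≤ 5 := by
  have h3 : (Px c).totalDegree ≤ 2 := quad_deg ..
  have h4 : (Py c).totalDegree ≤ 2 := quad_deg ..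
  have h5 : (Pxx c).totalDegree ≤ 1 := lin_deg _
  have h6 : (Pxy c).totalDegree ≤ 1 := lin_deg _
  have h7 : (Pyy c).totalDegree ≤ 1 := lin_deg _
  have m : ∀ f g : MP, (f * g).totalDegree ≤ f.totalDegree + g.totalDegree := MvPolynomial.totalDegree_mul
  unfold Flx
  refine (MvPolynomial.totalDegree_add _ _).trans (max_le ((MvPolynomial.totalDegree_sub _ _).trans (max_le ?_ ?_)) ?_)
  · have := m (Pxx c) (Py c * Py c); have := m (Py c) (Py c); omega
  · have := m (MvPolynomial.C 2) (Pxy c * (Px c * Py c)); have := m (Pxy c) (Px c * Py c); have := m (Px c) (Py c)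
    rw [MvPolynomial.totalDegree_C] at *; omega
  · have := m (Pyy c) (Px c * Px c); have := m (Px c) (Px c); omega

/-- derivative at a point in a direction -/
def dd (z d : ℝ × ℝ) (f : MP) : ℝ := (rs z d f).derivative.eval 0

lemma dd_add (z d : ℝ × ℝ) (f g : MP) : dd z d (f + g) = dd z d f + dd z d g := by simp [dd]
lemma dd_sub (z d : ℝ × ℝ) (f g : MP) : dd z d (f - g) = dd z d f - dd z d g := by simp [dd]
lemma dd_mul (z d : ℝ × ℝ) (f g : MP) : dd z d (f * g) = dd z d f * E g z + E f z * dd z d g := by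
  have ev : ∀ f, (rs z d f).eval 0 = E f z := by intro f; rw [rs_eval]; simp
  simp [dd, Polynomial.derivative_mul, ev]
lemma dd_C (z d : ℝ × ℝ) (x : ℝ) : dd z d (MvPolynomial.C x) = 0 := by simp [dd, rs]
lemma dd_X0 (z d : ℝ × ℝ) : dd z d (MvPolynomial.X 0) = d.1 := by simp [dd, rs]
lemma dd_X1 (z d : ℝ × ℝ) : dd z d (MvPolynomial.X 1) = d.2 := by simp [dd, rs]
lemma dd_lin (z d : ℝ × ℝ) (u : V3) : dd z d (lin u) = u.1 * d.1 + u.2.1 * d.2 := by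
  simp [lin, dd_add, dd_mul, dd_C, dd_X0, dd_X1]

lemma dd_cub (z d : ℝ × ℝ) (c : Fin 10 → ℝ) : dd z d (cub c) = D1 c z d := by
  simp [cub, dd_add, dd_mul, dd_lin, dd_X0, dd_X1, D1, Px, Py, quad, E_lin, dot]; ring
lemma dd_Px (z d : ℝ × ℝ) (c : Fin 10 → ℝ) : dd z d (Px c) = d.1 * E (Pxx c) z + d.2 * E (Pxy c) z := by
  simp [dd_add, dd_mul, dd_lin, dd_X0, dd_X1, Px, Pxx, Pxy, quad, E_lin, dot]; ring
lemma dd_Py (z d : ℝ × ℝ) (c : Fin 10 → ℝ) : dd z d (Py c) = d.1 * E (Pxy c) z + d.2 * E (Pyy c) z := by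
  simp [dd_add, dd_mul, dd_lin, dd_X0, dd_X1, Py, Pyy, Pxy, quad, E_lin, dot]; ring

lemma flex_alg {p q r s t c6 c7 c8 c9 : ℝ} (f0 : r * q^2 - 2 * s * p * q + t * p^2 = 0)
    (h : (-q * (6 * c6) + p * (2 * c7)) * (q * q) + r * (2 * q * (-q * s + p * t))
      - 2 * ((-q * (2 * c7) + p * (2 * c8)) * (p * q) + s * ((-q * r + p * s) * q + p * (-q * s + p * t)))
      + ((-q * (2 * c8) + p * (6 * c9)) * (p * p) + t * (2 * p * (-q * r + p * s))) = 0) (hN : p^2 + q^2 ≠ 0) :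
    c6 * (-q)^3 + c7 * (-q)^2 * p + c8 * (-q) * p^2 + c9 * p^3 = 0 := by
  have key : (p^2 + q^2) * (6 * (c6 * (-q)^3 + c7 * (-q)^2 * p + c8 * (-q) * p^2 + c9 * p^3)) = 0 := by
    linear_combination (p^2 + q^2) * h
  have := (mul_eq_zero.1 key).resolve_left hN
  linarith

lemma E_Flx (z : ℝ × ℝ) (c : Fin 10 → ℝ) : E (Flx c) z = E (Pxx c) z * (E (Py c) z * E (Py c) z)
    - 2 * (E (Pxy c) z * (E (Px c) z * E (Py c) z)) + E (Pyy c) z * (E (Px c) z * E (Px c) z) := by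
  simp only [Flx, E_add, E_sub, E_mul, E_C]

lemma dd_Pxx (z d : ℝ × ℝ) (c : Fin 10 → ℝ) : dd z d (Pxx c) = (6 * c 6) * d.1 + (2 * c 7) * d.2 := by
  rw [Pxx, dd_lin]
lemma dd_Pxy (z d : ℝ × ℝ) (c : Fin 10 → ℝ) : dd z d (Pxy c) = (2 * c 7) * d.1 + (2 * c 8) * d.2 := by
  rw [Pxy, dd_lin]
lemma dd_Pyy (z d : ℝ × ℝ) (c : Fin 10 → ℝ) : dd z d (Pyy c) = (2 * c 8) * d.1 + (6 * c 9) * d.2 := by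
  rw [Pyy, dd_lin]

lemma sq_add_ne {p q : ℝ} (hne : p ≠ 0 ∨ q ≠ 0) : p^2 + q^2 ≠ 0 := by
  rcases hne with h | h
  · have : 0 < p^2 := by positivity
    nlinarith [sq_nonneg q]
  · have : 0 < q^2 := by positivity
    nlinarith [sq_nonneg p]

lemma flex_D3 {z : ℝ × ℝ} {c : Fin 10 → ℝ} (hne : E (Px c) z ≠ 0 ∨ E (Py c) z ≠ 0) (hF : E (Flx c) z = 0)
    (hdd : dd z (- E (Py c) z, E (Px c) z) (Flx c) = 0) : D2 c z (- E (Py c) z, E (Px c) z) = 0 ∧ D3 c (- E (Py c) z, E (Px c) z) = 0 := by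
  rw [E_Flx] at hF
  rw [Flx, dd_add, dd_sub, dd_mul, dd_mul, dd_mul, dd_mul, dd_mul, dd_mul, dd_mul, dd_C, dd_Px, dd_Py, dd_Pxx, dd_Pxy, dd_Pyy,
    E_mul, E_mul, E_mul, E_mul, E_C] at hdd
  unfold D2 D3
  generalize E (Px c) z = p at *
  generalize E (Py c) z = q at *
  generalize E (Pxx c) z = r at *
  generalize E (Pxy c) z = s at *
  generalize E (Pyy c) z = t at *
  have hN : p^2 + q^2 ≠ 0 := sq_add_ne hne
  constructor
  · linear_combination hF
  · refine flex_alg (r := r) (s := s) (t := t) (by linear_combination hF) ?_ hN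
    linear_combination hdd

lemma flex_bound {pt : Fin n → ℝ × ℝ} (hv : Cfg (lift pt)) {c : Fin 10 → ℝ} (hH : Irreducible (cub c)) (h3 : (cub c).totalDegree = 3)
    (S : Finset (Fin n)) (hS : ∀ a ∈ S, E (cub c) (pt a) = 0 ∧ E (Flx c) (pt a) = 0)
    (hns : ∃ a, E (cub c) (pt a) = 0 ∧ (E (Px c) (pt a) ≠ 0 ∨ E (Py c) (pt a) ≠ 0)) : S.card ≤ 15 := by
  by_contra hcon
  have hnd : ¬ ¬ (cub c ∣ Flx c) := by
    intro hnd
    have := bezoutI hv hH (Flx_deg c) hnd S hS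
    rw [h3] at this
    omega
  push Not at hnd
  obtain ⟨K, hK⟩ := hnd
  obtain ⟨a, ha, hne⟩ := hns
  have hd0 : ((- E (Py c) (pt a), E (Px c) (pt a)) : ℝ × ℝ) ≠ 0 := by
    intro h
    have e1 := congrArg Prod.fst h
    have e2 := congrArg Prod.snd h
    simp only [Prod.fst_zero, Prod.snd_zero, neg_eq_zero] at e1 e2
    exact hne.elim (fun h' => h' e2) (fun h' => h' e1)
  have hF : E (Flx c) (pt a) = 0 := by rw [hK, E_mul, ha, zero_mul]
  have hd1 : D1 c (pt a) (- E (Py c) (pt a), E (Px c) (pt a)) = 0 := by unfold D1; ring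
  have hdd : dd (pt a) (- E (Py c) (pt a), E (Px c) (pt a)) (Flx c) = 0 := by
    rw [hK, dd_mul, dd_cub, hd1, ha]; ring
  obtain ⟨hd2, hd3⟩ := flex_D3 hne hF hdd
  apply no_line hH (by omega) hd0 (z := pt a)
  intro s
  rw [taylor, ha, hd1, hd2, hd3]; ring

end
end DM

namespace DM

open Finset
open scoped Classical

noncomputable section
variable {n : ℕ}

/-- point on the line `ab` -/
def pl (a b : ℝ × ℝ) (τ : ℝ) : ℝ × ℝ := (a.1 + τ * (b.1 - a.1), a.2 + τ * (b.2 - a.2))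

lemma dot_pl (m : V3) (a b : ℝ × ℝ) (τ : ℝ) : dot m (hat (pl a b τ)) = (1 - τ) * dot m (hat a) + τ * dot m (hat b) := by
  simp [dot, hat, pl]; ring

lemma pl_avoid {m1 m2 : V3} {a b : ℝ × ℝ} (h1 : dot m1 (hat a) ≠ 0) (h1b : dot m1 (hat b) = 0) (h2 : dot m2 (hat a) ≠ 0) :
    ∃ τ : ℝ, τ ≠ 0 ∧ τ ≠ 1 ∧ dot m1 (hat (pl a b τ)) ≠ 0 ∧ dot m2 (hat (pl a b τ)) ≠ 0 := by
  by_cases h : dot m2 (hat (pl a b 2)) = 0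
  · refine ⟨3, by norm_num, by norm_num, ?_, ?_⟩
    · rw [dot_pl, h1b]; intro h'; apply h1; linarith
    · rw [dot_pl] at *; intro h'; apply h2; linarith
  · refine ⟨2, by norm_num, by norm_num, ?_, h⟩
    rw [dot_pl, h1b]; intro h'; apply h1; linarith

lemma interp {a p q : V3} (h : det3 a p q ≠ 0) (x y : ℝ) : ∃ l : V3, dot l a = 0 ∧ dot l p = x ∧ dot l q = y := by
  refine ⟨(x / det3 a p q) • crs q a + (y / det3 a p q) • crs a p, ?_, ?_, ?_⟩
  · rw [dot_add_left, dot_smul_left, dot_smul_left]; simp [dot, crs]; ring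
  · rw [dot_add_left, dot_smul_left, dot_smul_left]
    have e1 : dot (crs q a) p = det3 a p q := by simp [det3, dot, crs]; ring
    have e2 : dot (crs a p) p = 0 := by simp [dot, crs]; ring
    rw [e1, e2]; field_simp; ring
  · rw [dot_add_left, dot_smul_left, dot_smul_left]
    have e1 : dot (crs q a) q = 0 := by simp [dot, crs]; ring
    have e2 : dot (crs a p) q = det3 a p q := rfl
    rw [e1, e2]; field_simp; ring

lemma decomp {H : MP} (h3 : H.totalDegree ≤ 3) {a b c d e : ℝ × ℝ}
    (ha : E H a = 0) (hb : E H b = 0) (hc : E H c = 0) (hd : E H d = 0) (he : E H e = 0)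
    (habc : det3 (hat a) (hat b) (hat c) = 0) (hade : det3 (hat a) (hat d) (hat e) = 0)
    (hbda : det3 (hat b) (hat d) (hat a) ≠ 0) (hcea : det3 (hat c) (hat e) (hat a) ≠ 0)
    (hbc : b ≠ c) (hde : d ≠ e) (hac : a ≠ c) (hae : a ≠ e)
    (hbe : det3 (hat a) (hat b) (hat e) ≠ 0) :
    ∃ k l : V3, H = lin (crs (hat a) (hat b)) * (lin (crs (hat a) (hat d)) * lin k) +
      lin (crs (hat b) (hat d)) * lin (crs (hat c) (hat e)) * lin l ∧ dot l (hat a) = 0 := by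
  obtain ⟨τ, t0, t1, t2, t3⟩ := pl_avoid (m1 := crs (hat b) (hat d)) (m2 := crs (hat c) (hat e)) (a := a) (b := b) hbda (by simp [dot, crs]; ring) hcea
  obtain ⟨σ, s0, s1, s2, s3⟩ := pl_avoid (m1 := crs (hat b) (hat d)) (m2 := crs (hat c) (hat e)) (a := a) (b := d) hbda (by simp [dot, crs]; ring) hcea
  set p1 := pl a b τ with hp1
  set p2 := pl a d σ with hp2
  have hdet : det3 (hat a) (hat p1) (hat p2) ≠ 0 := by
    have : det3 (hat a) (hat p1) (hat p2) = - τ * σ * det3 (hat b) (hat d) (hat a) * (-1) := by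
      simp [det3, dot, crs, hat, hp1, hp2, pl]; ring
    rw [this]
    simp only [neg_mul, mul_neg, mul_one, neg_neg]
    exact mul_ne_zero (mul_ne_zero t0 s0) hbda
  obtain ⟨l, la, l1, l2⟩ := interp hdet (E H p1 / (dot (crs (hat b) (hat d)) (hat p1) * dot (crs (hat c) (hat e)) (hat p1)))
    (E H p2 / (dot (crs (hat b) (hat d)) (hat p2) * dot (crs (hat c) (hat e)) (hat p2)))
  have hab : a ≠ b := by rintro rfl; apply hbda; simp [det3, dot, crs]; ring
  have had : a ≠ d := by rintro rfl; apply hbda; simp [det3, dot, crs]; ring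
  have hself : ∀ x y : V3, dot (crs x y) x = 0 := by intro x y; simp [dot, crs]; ring
  have hself' : ∀ x y : V3, dot (crs x y) y = 0 := by intro x y; simp [dot, crs]; ring
  set G := H - lin (crs (hat b) (hat d)) * lin (crs (hat c) (hat e)) * lin l with hG
  have hGd : G.totalDegree ≤ 2 + 1 := by
    refine (MvPolynomial.totalDegree_sub _ _).trans (max_le (by omega) ?_)
    have := MvPolynomial.totalDegree_mul (lin (crs (hat b) (hat d)) * lin (crs (hat c) (hat e))) (lin l)
    have := MvPolynomial.totalDegree_mul (lin (crs (hat b) (hat d))) (lin (crs (hat c) (hat e)))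
    have := lin_deg l
    have := lin_deg (crs (hat b) (hat d))
    have := lin_deg (crs (hat c) (hat e))
    omega
  have Ga : E G a = 0 := by simp [hG, E_lin', ha, la]
  have Gb : E G b = 0 := by simp [hG, E_lin', hb, hself]
  have Gc : E G c = 0 := by simp [hG, E_lin', hc, hself]
  have Gd : E G d = 0 := by simp [hG, E_lin', hd, hself']
  have Ge : E G e = 0 := by simp [hG, E_lin', he, hself']
  have G1 : E G p1 = 0 := by simp only [hG, E_sub, E_mul, E_lin', l1]; field_simp; ring
  have G2 : E G p2 = 0 := by simp only [hG, E_sub, E_mul, E_lin', l2]; field_simp; ring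
  have p1a : a ≠ p1 := by
    intro h; rw [← h] at hdet; apply hdet; simp [det3, dot, crs]; ring
  have p1b : b ≠ p1 := by intro h; rw [← h] at t2; exact t2 (hself _ _)
  have p1c : c ≠ p1 := by intro h; rw [← h] at t3; exact t3 (hself _ _)
  have p2d : d ≠ p2 := by intro h; rw [← h] at s2; exact s2 (hself' _ _)
  have p2e : e ≠ p2 := by intro h; rw [← h] at s3; exact s3 (hself' _ _)
  have x1 : dot (crs (hat a) (hat b)) (hat p1) = 0 := by rw [hp1, dot_pl, hself, hself']; ring
  have x2 : dot (crs (hat a) (hat d)) (hat p2) = 0 := by rw [hp2, dot_pl, hself, hself']; ring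
  obtain ⟨K1, hK1, dK1⟩ := lin_div (crs_hat hab) hGd {a, b, c, p1} (by
    rw [card_insert_of_notMem (by simp [hab, hac, p1a]), card_insert_of_notMem (by simp [hbc, p1b]), card_pair p1c]; norm_num) (by
    intro z hz
    simp only [mem_insert, mem_singleton] at hz
    rcases hz with rfl | rfl | rfl | rfl
    · exact ⟨hself _ _, Ga⟩
    · exact ⟨hself' _ _, Gb⟩
    · exact ⟨habc, Gc⟩
    · exact ⟨x1, G1⟩)
  have nz : ∀ z, dot (crs (hat a) (hat b)) (hat z) ≠ 0 → E G z = 0 → E K1 z = 0 := by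
    intro z h1 h2
    rw [hK1, E_mul, E_lin'] at h2
    exact (mul_eq_zero.1 h2).resolve_left h1
  have ne1 : dot (crs (hat a) (hat b)) (hat d) ≠ 0 := by
    intro h; apply hbda; rw [← h]; simp [det3, dot, crs]; ring
  have ne2 : dot (crs (hat a) (hat b)) (hat p2) ≠ 0 := by
    rw [hp2, dot_pl, hself]; simpa using ⟨s0, ne1⟩
  obtain ⟨K2, hK2, dK2⟩ := lin_div (k := 1) (crs_hat had) dK1 {d, e, p2} (by
    rw [card_insert_of_notMem (by simp [hde, p2d]), card_pair p2e]; norm_num) (by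
    intro z hz
    simp only [mem_insert, mem_singleton] at hz
    rcases hz with rfl | rfl | rfl
    · exact ⟨hself' _ _, nz _ ne1 Gd⟩
    · exact ⟨hade, nz _ hbe Ge⟩
    · exact ⟨x2, nz _ ne2 G2⟩)
  obtain ⟨k, rfl⟩ := exists_lin dK2
  refine ⟨k, l, ?_, la⟩
  rw [← hK2, ← hK1, hG]; ring

/-- Decomposition data of a cubic. -/
structure Dec (c : Fin 10 → ℝ) (a u v : ℝ × ℝ) (l1 l2 k m1 m2 l : V3) : Prop where
  eq : cub c = lin l1 * (lin l2 * lin k) + lin m1 * lin m2 * lin l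
  l1a : dot l1 (hat a) = 0
  l2a : dot l2 (hat a) = 0
  la : dot l (hat a) = 0
  m1a : dot m1 (hat a) ≠ 0
  m2a : dot m2 (hat a) ≠ 0
  m1u : dot m1 (hat u) = 0
  m2v : dot m2 (hat v) = 0
  ku : dot k (hat u) = 0
  kv : dot k (hat v) = 0
  l1u : dot l1 (hat u) ≠ 0
  l2u : dot l2 (hat u) ≠ 0

/-- the six-line configuration -/
structure Con (pt : Fin n → ℝ × ℝ) (A : Finset (Fin n)) (a b c d e u v : Fin n) : Prop where
  ha : a ∈ A
  hb : b ∈ A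
  hc : c ∈ A
  hd : d ∈ A
  he : e ∈ A
  hu : u ∈ A
  hv : v ∈ A
  abc : Tri (lift pt) a b c
  ade : Tri (lift pt) a d e
  bdu : Tri (lift pt) b d u
  cev : Tri (lift pt) c e v
  da : d ≠ a
  db : d ≠ b
  dc : d ≠ c

lemma Tri.mem_iff {v : Fin n → V3} {i j k l : Fin n} (h : Tri v i j k) : det3 (v i) (v j) (v l) = 0 ↔ (l = i ∨ l = j ∨ l = k) := by
  rw [← mem_Ln, h.2.2.2]; simp

lemma Con.ex {pt : Fin n → ℝ × ℝ} (hv : Cfg (lift pt)) {C : Fin 10 → ℝ} (h3 : (cub C).totalDegree = 3) {a b c d e u v : Fin n}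
    (h : Con pt (zs pt (cub C)) a b c d e u v) : ∃ l1 l2 k m1 m2 l, Dec C (pt a) (pt u) (pt v) l1 l2 k m1 m2 l := by
  obtain ⟨ha, hb, hc, hd, he, hu, hv', abc, ade, bdu, cev, da, db, dc⟩ := h
  rw [mem_zs] at *
  -- e not on line abc
  have eL : ∀ x ∈ Ln (lift pt) a b, x ≠ a → x ∉ Ln (lift pt) a d := by
    intro x hx hxa hx'
    have e1 := hv.Ln_eq abc.1 hxa.symm (left_mem_Ln _ _ _) hx
    have e2 := hv.Ln_eq da.symm hxa.symm (left_mem_Ln _ _ _) hx'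
    have : d ∈ Ln (lift pt) a b := by rw [← e1, e2]; exact right_mem_Ln _ _ _
    rw [abc.2.2.2] at this
    simp [da, db, dc] at this
  have hbL : b ∈ Ln (lift pt) a b := right_mem_Ln _ _ _
  have hcL : c ∈ Ln (lift pt) a b := by rw [abc.2.2.2]; simp
  have haL : a ∈ Ln (lift pt) a b := left_mem_Ln _ _ _
  have hdL : d ∈ Ln (lift pt) a d := right_mem_Ln _ _ _
  have heL : e ∈ Ln (lift pt) a d := by rw [ade.2.2.2]; simp
  have haL' : a ∈ Ln (lift pt) a d := left_mem_Ln _ _ _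
  have bad := eL b hbL abc.1.symm
  have cad := eL c hcL abc.2.2.1.symm
  have eab : e ∉ Ln (lift pt) a b := fun h => eL e h ade.2.2.1.symm heL
  have dab : d ∉ Ln (lift pt) a b := fun h => eL d h da hdL
  have two : ∀ x y z w : Fin n, x ≠ y → z ≠ w → z ∈ Ln (lift pt) x y → w ∈ Ln (lift pt) x y → ∀ t, t ∈ Ln (lift pt) x y → t ∈ Ln (lift pt) z w := by
    intro x y z w h1 h2 h3 h4 t ht
    rwa [hv.Ln_eq h1 h2 h3 h4]
  have abd : a ∉ Ln (lift pt) b d := fun h => dab (two b d a b db.symm abc.1 h (left_mem_Ln _ _ _) d (right_mem_Ln _ _ _))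
  have ace : a ∉ Ln (lift pt) c e := fun h => by
    have := two c e a c cev.1 abc.2.2.1 h (left_mem_Ln _ _ _) e (right_mem_Ln _ _ _)
    rw [hv.Ln_eq abc.1 abc.2.2.1 haL hcL] at this
    exact eab this
  have uab : u ∉ Ln (lift pt) a b := fun h => by
    have hu1 : u ∈ Ln (lift pt) b d := by rw [bdu.2.2.2]; simp
    have := two b d b u db.symm bdu.2.2.1 (left_mem_Ln _ _ _) hu1 d (right_mem_Ln _ _ _)
    rw [hv.Ln_eq abc.1 bdu.2.2.1 hbL h] at this
    exact dab this
  have uad : u ∉ Ln (lift pt) a d := fun h => by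
    have hu1 : u ∈ Ln (lift pt) b d := by rw [bdu.2.2.2]; simp
    have := two b d d u db.symm bdu.2.1 (right_mem_Ln _ _ _) hu1 b (left_mem_Ln _ _ _)
    rw [hv.Ln_eq ade.1 bdu.2.1 hdL h] at this
    exact bad this
  have vab : v ∉ Ln (lift pt) a b := fun h => by
    have hu1 : v ∈ Ln (lift pt) c e := by rw [cev.2.2.2]; simp
    have := two c e c v cev.1 cev.2.2.1 (left_mem_Ln _ _ _) hu1 e (right_mem_Ln _ _ _)
    rw [hv.Ln_eq abc.1 cev.2.2.1 hcL h] at this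
    exact eab this
  have vad : v ∉ Ln (lift pt) a d := fun h => by
    have hu1 : v ∈ Ln (lift pt) c e := by rw [cev.2.2.2]; simp
    have := two c e e v cev.1 cev.2.1 (right_mem_Ln _ _ _) hu1 c (left_mem_Ln _ _ _)
    rw [hv.Ln_eq ade.1 cev.2.1 heL h] at this
    exact cad this
  rw [mem_Ln] at abd ace uab uad vab vad eab
  have hself : ∀ x y : V3, dot (crs x y) x = 0 := by intro x y; simp [dot, crs]; ring
  obtain ⟨k, l, hk, hl⟩ := decomp (H := cub C) (by omega) ha hb hc hd he abc.det ade.det abd ace (lift_inj hv abc.2.1) (lift_inj hv ade.2.1)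
    (lift_inj hv abc.2.2.1) (lift_inj hv ade.2.2.1) eab
  have m1u : dot (crs (hat (pt b)) (hat (pt d))) (hat (pt u)) = 0 := bdu.det
  have m2v : dot (crs (hat (pt c)) (hat (pt e))) (hat (pt v)) = 0 := cev.det
  have uab' : dot (crs (hat (pt a)) (hat (pt b))) (hat (pt u)) ≠ 0 := uab
  have uad' : dot (crs (hat (pt a)) (hat (pt d))) (hat (pt u)) ≠ 0 := uad
  have vab' : dot (crs (hat (pt a)) (hat (pt b))) (hat (pt v)) ≠ 0 := vab
  have vad' : dot (crs (hat (pt a)) (hat (pt d))) (hat (pt v)) ≠ 0 := vad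
  refine ⟨_, _, k, _, _, l, hk, hself _ _, hself _ _, hl, abd, ace, m1u, m2v, ?_, ?_, uab', uad'⟩
  · rw [hk] at hu
    simp only [E_add, E_mul, E_lin', m1u, zero_mul, add_zero] at hu
    simpa [uab', uad'] using hu
  · rw [hk] at hv'
    simp only [E_add, E_mul, E_lin', m2v, zero_mul, mul_zero, add_zero] at hv'
    simpa [vab', vad'] using hv'

end
end DM

namespace DM

open Finset
open scoped Classical

noncomputable section
variable {n : ℕ}

def dir (l : V3) (w : ℝ × ℝ) : ℝ := l.1 * w.1 + l.2.1 * w.2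

lemma dot_line (l : V3) (z w : ℝ × ℝ) (s : ℝ) : dot l (hat (z.1 + s * w.1, z.2 + s * w.2)) = dot l (hat z) + s * dir l w := by
  simp [dot, hat, dir]; ring

lemma dir_sub (l : V3) (x a : ℝ × ℝ) : dir l (x.1 - a.1, x.2 - a.2) = dot l (hat x) - dot l (hat a) := by
  simp [dot, hat, dir]; ring

lemma dir_zero {l : V3} (h : ∀ w, dir l w = 0) {z : ℝ × ℝ} (hz : dot l (hat z) = 0) : l = 0 := by
  have h1 := h (1, 0)
  have h2 := h (0, 1)
  simp [dir] at h1 h2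
  simp [dot, hat, h1, h2] at hz
  exact Prod.ext h1 (Prod.ext h2 hz)

lemma no_prod {H : MP} (hH : Irreducible H) (h3 : H.totalDegree = 3) {p q r : V3} (h : H = lin p * (lin q * lin r)) : False := by
  have d1 := lin_deg p
  have d2 := MvPolynomial.totalDegree_mul (lin q) (lin r)
  have d3 := MvPolynomial.totalDegree_mul (lin p) (lin q * lin r)
  have d4 := lin_deg q
  have d5 := lin_deg r
  rw [← h] at d3
  rcases hH.isUnit_or_isUnit h with hu | hu
  · have := (MvPolynomial.isUnit_iff_totalDegree_of_isReduced.1 hu).2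
    omega
  · have := (MvPolynomial.isUnit_iff_totalDegree_of_isReduced.1 hu).2
    omega

variable {c : Fin 10 → ℝ} {a u v : ℝ × ℝ} {l1 l2 k m1 m2 l : V3}

lemma lin_zero : lin 0 = 0 := by simp [lin]

lemma Dec.E (h : Dec c a u v l1 l2 k m1 m2 l) (z : ℝ × ℝ) : E (cub c) z =
    dot l1 (hat z) * (dot l2 (hat z) * dot k (hat z)) + dot m1 (hat z) * dot m2 (hat z) * dot l (hat z) := by
  rw [h.eq]; simp [E_lin']

lemma dd_lin' (z w : ℝ × ℝ) (l : V3) : dd z w (lin l) = dir l w := dd_lin ..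

lemma Dec.D1 (h : Dec c a u v l1 l2 k m1 m2 l) (z w : ℝ × ℝ) : D1 c z w =
    dir l1 w * (dot l2 (hat z) * dot k (hat z)) + dot l1 (hat z) * (dir l2 w * dot k (hat z) + dot l2 (hat z) * dir k w)
    + ((dir m1 w * dot m2 (hat z) + dot m1 (hat z) * dir m2 w) * dot l (hat z) + dot m1 (hat z) * dot m2 (hat z) * dir l w) := by
  rw [← dd_cub, h.eq]
  simp only [dd_add, dd_mul, dd_lin', E_mul, E_lin']

lemma Dec.D1a (h : Dec c a u v l1 l2 k m1 m2 l) (w : ℝ × ℝ) : DM.D1 c a w = dot m1 (hat a) * dot m2 (hat a) * dir l w := by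
  rw [h.D1, h.l1a, h.l2a, h.la]; ring

lemma Dec.nonsing (hH : Irreducible (cub c)) (h3 : (cub c).totalDegree = 3) (h : Dec c a u v l1 l2 k m1 m2 l) :
    DM.E (Px c) a ≠ 0 ∨ DM.E (Py c) a ≠ 0 := by
  by_contra hc
  push Not at hc
  have h1 : ∀ w, dir l w = 0 := by
    intro w
    have := h.D1a w
    rw [DM.D1, hc.1, hc.2] at this
    have h2 : dot m1 (hat a) * dot m2 (hat a) * dir l w = 0 := by linarith
    exact (mul_eq_zero.1 h2).resolve_left (mul_ne_zero h.m1a h.m2a)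
  have h2 := dir_zero h1 h.la
  have := h.eq
  rw [h2, lin_zero, mul_zero, add_zero] at this
  exact no_prod hH h3 this

lemma Dec.nonsing_u (hH : Irreducible (cub c)) (h3 : (cub c).totalDegree = 3) (h : Dec c a u u l1 l2 k m1 m2 l) :
    DM.E (Px c) u ≠ 0 ∨ DM.E (Py c) u ≠ 0 := by
  by_contra hc
  push Not at hc
  have h1 : ∀ w, dir k w = 0 := by
    intro w
    have := h.D1 u w
    rw [DM.D1, hc.1, hc.2, h.ku, h.m1u, h.m2v] at this
    have h2 : dot l1 (hat u) * dot l2 (hat u) * dir k w = 0 := by linarith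
    exact (mul_eq_zero.1 h2).resolve_left (mul_ne_zero h.l1u h.l2u)
  have h2 := dir_zero h1 h.ku
  have := h.eq
  rw [h2, lin_zero, mul_zero, mul_zero, zero_add, mul_assoc] at this
  exact no_prod hH h3 this

def XX (c : Fin 10 → ℝ) (u v : ℝ × ℝ) : V3 :=
  if u = v then
    (D3 c (- E (Py c) u, E (Px c) u), D3 c (- E (Py c) u, E (Px c) u) * u.1 - D2 c u (- E (Py c) u, E (Px c) u) / 2 * (- E (Py c) u),
      D3 c (- E (Py c) u, E (Px c) u) * u.2 - D2 c u (- E (Py c) u, E (Px c) u) / 2 * (E (Px c) u))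
  else (D3 c (v.1 - u.1, v.2 - u.2), D3 c (v.1 - u.1, v.2 - u.2) * u.1 + D1 c u (v.1 - u.1, v.2 - u.2) * (v.1 - u.1),
    D3 c (v.1 - u.1, v.2 - u.2) * u.2 + D1 c u (v.1 - u.1, v.2 - u.2) * (v.2 - u.2))

lemma sub_ne {u v : ℝ × ℝ} (h : u ≠ v) : ((v.1 - u.1, v.2 - u.2) : ℝ × ℝ) ≠ 0 := by
  intro e
  have e1 := congrArg Prod.fst e
  have e2 := congrArg Prod.snd e
  simp only [Prod.fst_zero, Prod.snd_zero] at e1 e2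
  exact h (Prod.ext (by linarith) (by linarith))

lemma perp_ne {p q : ℝ} (h : p ≠ 0 ∨ q ≠ 0) : ((-q, p) : ℝ × ℝ) ≠ 0 := by
  intro e
  have e1 := congrArg Prod.fst e
  have e2 := congrArg Prod.snd e
  simp only [Prod.fst_zero, Prod.snd_zero, neg_eq_zero] at e1 e2
  exact h.elim (fun h' => h' e2) (fun h' => h' e1)

lemma smul_dir_zero {w : ℝ × ℝ} (hw : w ≠ 0) {t : ℝ} (h1 : t * w.1 = 0) (h2 : t * w.2 = 0) : t = 0 := by
  by_contra ht
  exact hw (Prod.ext ((mul_eq_zero.1 h1).resolve_left ht) ((mul_eq_zero.1 h2).resolve_left ht))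

lemma XX_ne (hH : Irreducible (cub c)) (h3 : (cub c).totalDegree = 3) (hu : E (cub c) u = 0) (hv : E (cub c) v = 0)
    (hns : u = v → (E (Px c) u ≠ 0 ∨ E (Py c) u ≠ 0)) : XX c u v ≠ 0 := by
  intro h
  by_cases huv : u = v
  · rw [XX, if_pos huv] at h
    have hw := perp_ne (hns huv)
    have e1 := congrArg (fun x : V3 => x.1) h
    have e2 := congrArg (fun x : V3 => x.2.1) h
    have e3 := congrArg (fun x : V3 => x.2.2) h
    simp only [Prod.fst_zero, Prod.snd_zero] at e1 e2 e3
    rw [e1] at e2 e3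
    have h2 : D2 c u (- E (Py c) u, E (Px c) u) / 2 = 0 := smul_dir_zero hw (by simp only; linarith) (by simp only; linarith)
    apply no_line hH (by omega) hw (z := u)
    intro s
    rw [taylor, hu, e1, h2]
    simp only [D1]; ring
  · rw [XX, if_neg huv] at h
    have hw := sub_ne huv
    have e1 := congrArg (fun x : V3 => x.1) h
    have e2 := congrArg (fun x : V3 => x.2.1) h
    have e3 := congrArg (fun x : V3 => x.2.2) h
    simp only [Prod.fst_zero, Prod.snd_zero] at e1 e2 e3
    rw [e1] at e2 e3
    have h2 : D1 c u (v.1 - u.1, v.2 - u.2) = 0 := smul_dir_zero hw (by simp only; linarith) (by simp only; linarith)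
    have ht := taylor c u (v.1 - u.1, v.2 - u.2) 1
    rw [show ((u.1 + 1 * (v.1 - u.1, v.2 - u.2).1, u.2 + 1 * (v.1 - u.1, v.2 - u.2).2) : ℝ × ℝ) = v from by ext <;> simp, hv, hu, h2, e1] at ht
    have h2' : D2 c u (v.1 - u.1, v.2 - u.2) = 0 := by linarith
    apply no_line hH (by omega) hw (z := u)
    intro s
    rw [taylor, hu, e1, h2, h2']; ring

lemma cub_coef {A B C D a b d e : ℝ} (h : ∀ s : ℝ, A + s * B + s^2 * C + s^3 * D = a + s * b + s^2 * d + s^3 * e) :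
    A = a ∧ B = b ∧ C = d ∧ D = e := by
  have h0 := h 0
  have h1 := h 1
  have h2 := h (-1)
  have h3 := h 2
  refine ⟨?_, ?_, ?_, ?_⟩ <;> linarith

lemma Dec.pol (h : Dec c a u v l1 l2 k m1 m2 l) : DM.E (Pol c (XX c u v)) a = 0 := by
  rw [E_Pol, h.D1a]
  have hX : (XX c u v).2.1 * l.1 + (XX c u v).2.2 * l.2.1 + (XX c u v).1 * l.2.2 = 0 := by
    by_cases huv : u = v
    · subst huv
      rw [XX, if_pos rfl]
      set w : ℝ × ℝ := (- DM.E (Py c) u, DM.E (Px c) u) with hw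
      have d0 : DM.D1 c u w = 0 := by simp only [DM.D1, hw]; ring
      have kw : dir k w = 0 := by
        have := h.D1 u w
        rw [d0, h.ku, h.m1u, h.m2v] at this
        have h2 : dot l1 (hat u) * dot l2 (hat u) * dir k w = 0 := by linarith
        exact (mul_eq_zero.1 h2).resolve_left (mul_ne_zero h.l1u h.l2u)
      have key : ∀ s : ℝ, DM.E (cub c) u + s * DM.D1 c u w + s^2 * (D2 c u w / 2) + s^3 * D3 c w =
          0 + s * 0 + s^2 * (dir m1 w * dir m2 w * dot l (hat u)) + s^3 * (dir m1 w * dir m2 w * dir l w) := by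
        intro s
        rw [← taylor, h.E]
        simp only [dot_line, h.ku, kw, h.m1u, h.m2v]; ring
      obtain ⟨-, -, k2, k3⟩ := cub_coef key
      show (D3 c w * u.1 - D2 c u w / 2 * w.1) * l.1 + (D3 c w * u.2 - D2 c u w / 2 * w.2) * l.2.1 + D3 c w * l.2.2 = 0
      rw [k2, k3]
      simp [dot, dir, hat]; ring
    · rw [XX, if_neg huv]
      set w : ℝ × ℝ := (v.1 - u.1, v.2 - u.2) with hw
      have kw : dir k w = 0 := by rw [hw, dir_sub, h.ku, h.kv]; ring
      have m2w : dir m2 w = - dot m2 (hat u) := by rw [hw, dir_sub, h.m2v]; ring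
      have key : ∀ s : ℝ, DM.E (cub c) u + s * DM.D1 c u w + s^2 * (D2 c u w / 2) + s^3 * D3 c w =
          0 + s * (- (dir m1 w * dir m2 w * dot l (hat u))) + s^2 * (dir m1 w * dir m2 w * dot l (hat u) - dir m1 w * dir m2 w * dir l w)
            + s^3 * (dir m1 w * dir m2 w * dir l w) := by
        intro s
        rw [← taylor, h.E]
        simp only [dot_line, h.ku, kw, h.m1u, m2w]; ring
      obtain ⟨-, k1, -, k3⟩ := cub_coef key
      show (D3 c w * u.1 + DM.D1 c u w * w.1) * l.1 + (D3 c w * u.2 + DM.D1 c u w * w.2) * l.2.1 + D3 c w * l.2.2 = 0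
      rw [k1, k3]
      simp [dot, dir, hat]; ring
  have hla := h.la
  have : dir l ((XX c u v).2.1 - (XX c u v).1 * a.1, (XX c u v).2.2 - (XX c u v).1 * a.2) = 0 := by
    simp only [dir, dot, hat] at hla ⊢
    linear_combination hX - (XX c u v).1 * hla
  rw [this, mul_zero]

/-- third point -/
lemma Dec.third (hH : Irreducible (cub c)) (h3 : (cub c).totalDegree = 3) (h : Dec c a u v l1 l2 k m1 m2 l) {x : ℝ × ℝ}
    (huv : u ≠ v) (hux : u ≠ x) (hvx : v ≠ x) (hdet : det3 (hat u) (hat v) (hat x) = 0) (hx : DM.E (cub c) x = 0) :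
    dot k (hat x) = 0 ∧ dot l (hat x) = 0 := by
  have hw := sub_ne huv
  have par : ∀ z, det3 (hat u) (hat v) (hat z) = 0 → ∃ s : ℝ, z = (u.1 + s * (v.1 - u.1), u.2 + s * (v.2 - u.2)) := by
    intro z hz
    have hz' : (v.1 - u.1) * (z.2 - u.2) = (v.2 - u.2) * (z.1 - u.1) := by
      simp [det3, dot, crs, hat] at hz; linarith
    by_cases h1 : v.1 - u.1 = 0
    · have h2 : v.2 - u.2 ≠ 0 := fun h2 => hw (by rw [h1, h2]; rfl)
      refine ⟨(z.2 - u.2) / (v.2 - u.2), ?_⟩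
      rw [h1, zero_mul] at hz'
      have := (mul_eq_zero.1 hz'.symm).resolve_left h2
      ext
      · simp [h1]; linarith
      · simp only; field_simp; ring
    · refine ⟨(z.1 - u.1) / (v.1 - u.1), ?_⟩
      ext
      · simp only; field_simp; ring
      · simp only
        have : z.2 - u.2 = (z.1 - u.1) / (v.1 - u.1) * (v.2 - u.2) := by field_simp; linarith
        linarith
  have kw : dir k (v.1 - u.1, v.2 - u.2) = 0 := by rw [dir_sub, h.ku, h.kv]; ring
  obtain ⟨s, hs⟩ := par x hdet
  have dl : ∀ l : V3, ∀ s : ℝ, dot l (hat (u.1 + s * (v.1 - u.1), u.2 + s * (v.2 - u.2))) = dot l (hat u) + s * dir l (v.1 - u.1, v.2 - u.2) := by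
    intro l s; exact dot_line l u (v.1 - u.1, v.2 - u.2) s
  have kx : ∀ s : ℝ, dot k (hat (u.1 + s * (v.1 - u.1), u.2 + s * (v.2 - u.2))) = 0 := by
    intro s; rw [dl, h.ku, kw]; ring
  have hs0 : s ≠ 0 := by rintro rfl; apply hux; rw [hs]; ext <;> simp
  have hs1 : s - 1 ≠ 0 := by
    intro e; have : s = 1 := by linarith
    subst this; apply hvx; rw [hs]; ext <;> simp
  have nl : ¬ (∀ s : ℝ, DM.E (cub c) (u.1 + s * (v.1 - u.1), u.2 + s * (v.2 - u.2)) = 0) := fun hh =>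
    no_line hH (by omega) hw (z := u) hh
  have m2w : dir m2 (v.1 - u.1, v.2 - u.2) = - dot m2 (hat u) := by rw [dir_sub, h.m2v]; ring
  refine ⟨by rw [hs]; exact kx s, ?_⟩
  have e := h.E x
  rw [hs, kx, mul_zero, mul_zero, zero_add, ← hs, hx] at e
  rcases mul_eq_zero.1 e.symm with e1 | e1
  · exfalso
    apply nl
    intro t
    rw [h.E, kx, dl m1, dl m2, h.m1u, m2w]
    rw [hs, dl m1, dl m2, h.m1u, m2w] at e1
    have e2 : (s * (s - 1)) * (dir m1 (v.1 - u.1, v.2 - u.2) * dot m2 (hat u)) = 0 := by linarith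
    have e3 := (mul_eq_zero.1 e2).resolve_left (mul_ne_zero hs0 hs1)
    linear_combination (t * (1 - t) * dot l (hat (u.1 + t * (v.1 - u.1), u.2 + t * (v.2 - u.2)))) * e3
  · exact e1

lemma Dec.tang (h : Dec c a u v l1 l2 k m1 m2 l) {x : ℝ × ℝ} (hx : dot l (hat x) = 0) : DM.D1 c a (x.1 - a.1, x.2 - a.2) = 0 := by
  rw [h.D1a, dir_sub, hx, h.la]; ring

lemma Dec.flex (h : Dec c a u v l1 l2 k m1 m2 l) (hk : dot k (hat a) = 0) : DM.E (Flx c) a = 0 := by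
  set w : ℝ × ℝ := (- DM.E (Py c) a, DM.E (Px c) a) with hw
  have d0 : DM.D1 c a w = 0 := by simp only [DM.D1, hw]; ring
  have lw : dir l w = 0 := by
    have := h.D1a w
    rw [d0] at this
    exact (mul_eq_zero.1 this.symm).resolve_left (mul_ne_zero h.m1a h.m2a)
  have key : ∀ s : ℝ, DM.E (cub c) a + s * DM.D1 c a w + s^2 * (D2 c a w / 2) + s^3 * D3 c w =
      0 + s * 0 + s^2 * 0 + s^3 * (dir l1 w * dir l2 w * dir k w) := by
    intro s
    rw [← taylor, h.E]
    simp only [dot_line, h.l1a, h.l2a, hk, h.la, lw]; ring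
  obtain ⟨-, -, k2, -⟩ := cub_coef key
  rw [E_Flx]
  simp only [D2, hw] at k2
  linear_combination 2 * k2

end
end DM

namespace DM

open Finset
open scoped Classical

noncomputable section
variable {n : ℕ}

lemma par_line {u v z : ℝ × ℝ} (huv : u ≠ v) (hz : det3 (hat u) (hat v) (hat z) = 0) :
    ∃ s : ℝ, z = (u.1 + s * (v.1 - u.1), u.2 + s * (v.2 - u.2)) := by
  have hw := sub_ne huv
  have hz' : (v.1 - u.1) * (z.2 - u.2) = (v.2 - u.2) * (z.1 - u.1) := by
    simp [det3, dot, crs, hat] at hz; linarith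
  by_cases h1 : v.1 - u.1 = 0
  · have h2 : v.2 - u.2 ≠ 0 := fun h2 => hw (by rw [h1, h2]; rfl)
    refine ⟨(z.2 - u.2) / (v.2 - u.2), ?_⟩
    rw [h1, zero_mul] at hz'
    have := (mul_eq_zero.1 hz'.symm).resolve_left h2
    ext
    · simp [h1]; linarith
    · simp only; field_simp; ring
  · refine ⟨(z.1 - u.1) / (v.1 - u.1), ?_⟩
    ext
    · simp only; field_simp; ring
    · simp only
      have : z.2 - u.2 = (z.1 - u.1) / (v.1 - u.1) * (v.2 - u.2) := by field_simp; linarith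
      linarith

lemma at_one (u v : ℝ × ℝ) : ((u.1 + 1 * (v.1 - u.1), u.2 + 1 * (v.2 - u.2)) : ℝ × ℝ) = v := by ext <;> simp


lemma dbl1 {c : Fin 10 → ℝ} (hH : Irreducible (cub c)) (h3 : (cub c).totalDegree = 3) {a x y : ℝ × ℝ} (ha : E (cub c) a = 0) (hx : E (cub c) x = 0) (hy : E (cub c) y = 0) (hax : a ≠ x) (hya : y ≠ a) (hyx : y ≠ x)
    (hd : D1 c a (x.1 - a.1, x.2 - a.2) = 0) (hdet : det3 (hat a) (hat x) (hat y) = 0) : False := by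
  obtain ⟨s, hs⟩ := par_line hax hdet
  have hw := sub_ne hax
  have T : ∀ s : ℝ, E (cub c) (a.1 + s * (x.1 - a.1), a.2 + s * (x.2 - a.2)) = _ := fun s => taylor c a (x.1 - a.1, x.2 - a.2) s
  have t1 := T 1
  have t2 := T s
  rw [at_one, hx, ha, hd] at t1
  rw [← hs, hy, ha, hd] at t2
  have hs0 : s ≠ 0 := by rintro rfl; apply hya; rw [hs]; ext <;> simp
  have hs1 : s - 1 ≠ 0 := by
    intro e; have : s = 1 := by linarith
    subst this; apply hyx; rw [hs]; ext <;> simp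
  have e2 : (s^2 * (s - 1)) * D3 c (x.1 - a.1, x.2 - a.2) = 0 := by linear_combination (s^2) * t1 - t2
  have e3 := (mul_eq_zero.1 e2).resolve_left (mul_ne_zero (pow_ne_zero 2 hs0) hs1)
  rw [e3] at t1
  have e4 : D2 c a (x.1 - a.1, x.2 - a.2) = 0 := by linarith
  apply no_line hH (by omega) hw (z := a)
  intro t
  rw [taylor, ha, hd, e3, e4]; ring

lemma dbl2 {c : Fin 10 → ℝ} (hH : Irreducible (cub c)) (h3 : (cub c).totalDegree = 3) {a x : ℝ × ℝ} (ha : E (cub c) a = 0) (hx : E (cub c) x = 0) (hax : a ≠ x)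
    (hd : D1 c a (x.1 - a.1, x.2 - a.2) = 0) (hd' : D1 c x (a.1 - x.1, a.2 - x.2) = 0) : False := by
  have hw := sub_ne hax
  have t1 : E (cub c) (a.1 + 1 * (x.1 - a.1), a.2 + 1 * (x.2 - a.2)) = _ := taylor c a (x.1 - a.1, x.2 - a.2) 1
  rw [at_one, hx, ha, hd] at t1
  have e : D1 c x (a.1 - x.1, a.2 - x.2) = - (D1 c a (x.1 - a.1, x.2 - a.2) + D2 c a (x.1 - a.1, x.2 - a.2) + 3 * D3 c (x.1 - a.1, x.2 - a.2)) := by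
    simp [D1, D2, D3, Px, Py, Pxx, Pxy, Pyy, quad, E_lin, dot]; ring
  rw [hd', hd] at e
  have e3 : D3 c (x.1 - a.1, x.2 - a.2) = 0 := by linarith
  have e4 : D2 c a (x.1 - a.1, x.2 - a.2) = 0 := by linarith
  apply no_line hH (by omega) hw (z := a)
  intro t
  rw [taylor, ha, hd, e3, e4]; ring


lemma con_class {c : Fin 10 → ℝ} (hH : Irreducible (cub c)) (h3 : (cub c).totalDegree = 3)
    {pt : Fin n → ℝ × ℝ} (hv : Cfg (lift pt)) (u v : Fin n) (S : Finset (Fin n))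
    (hS : ∀ a ∈ S, ∃ b c' d e, Con pt (zs pt (cub c)) a b c' d e u v) : S.card ≤ 9 := by
  rcases S.eq_empty_or_nonempty with rfl | ⟨a0, ha0⟩
  · simp
  have hX : XX c (pt u) (pt v) ≠ 0 := by
    obtain ⟨b, c', d, e, h⟩ := hS a0 ha0
    obtain ⟨l1, l2, k, m1, m2, l, hD⟩ := h.ex hv h3
    refine XX_ne hH h3 (mem_zs.1 h.hu) (mem_zs.1 h.hv) ?_
    intro huv
    rw [← huv] at hD
    exact hD.nonsing_u hH h3
  refine class_bound hv hH h3 hX S ?_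
  intro a ha
  obtain ⟨b, c', d, e, h⟩ := hS a ha
  obtain ⟨l1, l2, k, m1, m2, l, hD⟩ := h.ex hv h3
  exact ⟨mem_zs.1 h.ha, hD.pol⟩

lemma good_three {c : Fin 10 → ℝ} (hH : Irreducible (cub c)) (h3 : (cub c).totalDegree = 3)
    {pt : Fin n → ℝ × ℝ} (hv : Cfg (lift pt)) {a b c' d e u v x : Fin n} (h : Con pt (zs pt (cub c)) a b c' d e u v) (ht : Tri (lift pt) u v x) (hx : x ∈ zs pt (cub c)) :
    (E (Px c) (pt a) ≠ 0 ∨ E (Py c) (pt a) ≠ 0) ∧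
    (E (Flx c) (pt a) = 0 ∨ (∃ w ∉ zs pt (cub c), E (Pol c (1, (pt w).1, (pt w).2)) (pt a) = 0) ∨
    ∃ x ∈ zs pt (cub c), x ≠ a ∧ D1 c (pt a) ((pt x).1 - (pt a).1, (pt x).2 - (pt a).2) = 0 ∧ Ln (lift pt) a x = {a, x}) := by
  obtain ⟨l1, l2, k, m1, m2, l, hD⟩ := h.ex hv h3
  refine ⟨hD.nonsing hH h3, ?_⟩
  obtain ⟨kx, lx⟩ := hD.third hH h3 (lift_inj hv ht.1) (lift_inj hv ht.2.2.1) (lift_inj hv ht.2.1) ht.det (mem_zs.1 hx)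
  by_cases hxa : x = a
  · subst hxa
    exact Or.inl (hD.flex kx)
  · right
    have hd := hD.tang lx
    by_cases hw : ∃ w, w ∉ zs pt (cub c) ∧ w ∈ Ln (lift pt) a x
    · obtain ⟨w, hw, hw'⟩ := hw
      left
      refine ⟨w, hw, ?_⟩
      obtain ⟨s, hs⟩ := par_line (lift_inj hv (Ne.symm hxa)) (mem_Ln.1 hw')
      rw [E_Pol, hs]
      simp only [D1] at hd ⊢
      linear_combination s * hd
    · right
      push Not at hw
      refine ⟨x, hx, hxa, hd, ?_⟩
      ext y
      simp only [mem_insert, mem_singleton]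
      constructor
      · intro hy
        by_contra hc
        push Not at hc
        have hyA : y ∈ zs pt (cub c) := by by_contra h'; exact hw y h' hy
        exact dbl1 hH h3 (mem_zs.1 h.ha) (mem_zs.1 hx) (mem_zs.1 hyA) (lift_inj hv (Ne.symm hxa)) (lift_inj hv hc.1) (lift_inj hv hc.2) hd (mem_Ln.1 hy)
      · rintro (rfl | rfl)
        · exact left_mem_Ln _ _ _
        · exact right_mem_Ln _ _ _

lemma good_count {c : Fin 10 → ℝ} (hH : Irreducible (cub c)) (h3 : (cub c).totalDegree = 3)
    {pt : Fin n → ℝ × ℝ} (hv : Cfg (lift pt)) (S : Finset (Fin n)) (hS : ∀ a ∈ S, ∃ b c' d e u v x, Con pt (zs pt (cub c)) a b c' d e u v ∧ Tri (lift pt) u v x ∧ x ∈ zs pt (cub c)) :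
    S.card ≤ 15 + 9 * (univ \ zs pt (cub c)).card + N2 (lift pt) := by
  rcases S.eq_empty_or_nonempty with rfl | ⟨a0, ha0⟩
  · simp
  have hA : ∀ a ∈ S, E (cub c) (pt a) = 0 := by
    intro a ha
    obtain ⟨b, c', d, e, u, v, x, h, -⟩ := hS a ha
    exact mem_zs.1 h.ha
  have hT : ∀ a ∈ S, (E (Px c) (pt a) ≠ 0 ∨ E (Py c) (pt a) ≠ 0) ∧
    (E (Flx c) (pt a) = 0 ∨ (∃ w ∉ zs pt (cub c), E (Pol c (1, (pt w).1, (pt w).2)) (pt a) = 0) ∨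
    ∃ x ∈ zs pt (cub c), x ≠ a ∧ D1 c (pt a) ((pt x).1 - (pt a).1, (pt x).2 - (pt a).2) = 0 ∧ Ln (lift pt) a x = {a, x}) := fun a ha => by
    obtain ⟨b, c', d, e, u, v, x, h, ht, hx⟩ := hS a ha
    exact good_three hH h3 hv h ht hx
  set F := S.filter (fun a => E (Flx c) (pt a) = 0)
  set W := (univ \ zs pt (cub c)).biUnion (fun w => S.filter (fun a => E (Pol c (1, (pt w).1, (pt w).2)) (pt a) = 0))
  set T := S.filter (fun a => ∃ x ∈ zs pt (cub c), x ≠ a ∧ D1 c (pt a) ((pt x).1 - (pt a).1, (pt x).2 - (pt a).2) = 0 ∧ Ln (lift pt) a x = {a, x})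
  have hF : F.card ≤ 15 := by
    refine flex_bound hv hH h3 F ?_ ⟨a0, hA a0 ha0, (hT a0 ha0).1⟩
    intro a ha
    exact ⟨hA a (mem_filter.1 ha).1, (mem_filter.1 ha).2⟩
  have hW : W.card ≤ (univ \ zs pt (cub c)).card * 9 := by
    refine card_biUnion_le_card_mul _ _ _ ?_
    intro w hw
    refine class_bound hv hH h3 (X := (1, (pt w).1, (pt w).2)) (by intro h; have := congrArg (fun x : V3 => x.1) h; simp at this) _ ?_
    intro a ha
    exact ⟨hA a (mem_filter.1 ha).1, (mem_filter.1 ha).2⟩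
  have hTc : T.card ≤ N2 (lift pt) := by
    have : ∀ a : Fin n, ∃ x, a ∈ T → (x ∈ zs pt (cub c) ∧ x ≠ a ∧ D1 c (pt a) ((pt x).1 - (pt a).1, (pt x).2 - (pt a).2) = 0 ∧ Ln (lift pt) a x = {a, x}) := by
      intro a
      by_cases ha : a ∈ T
      · obtain ⟨x, hx⟩ := (mem_filter.1 ha).2
        exact ⟨x, fun _ => hx⟩
      · exact ⟨a, fun h => absurd h ha⟩
    choose f hf using this
    unfold N2
    refine card_le_card_of_injOn (fun a => Ln (lift pt) a (f a)) ?_ ?_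
    · intro a ha
      have := hf a ha
      simp only [coe_filter, Set.mem_setOf_eq]
      refine ⟨Ln_mem_lines this.2.1.symm, ?_⟩
      rw [this.2.2.2]; exact card_pair this.2.1.symm
    · intro a ha a' ha' hh
      by_contra hne
      have h1 := hf a ha
      have h2 := hf a' ha'
      simp only at hh
      rw [h1.2.2.2, h2.2.2.2] at hh
      have e1 : a' ∈ ({a, f a} : Finset (Fin n)) := by rw [hh]; simp
      have e2 : a ∈ ({a', f a'} : Finset (Fin n)) := by rw [← hh]; simp
      simp only [mem_insert, mem_singleton] at e1 e2
      have e1 := e1.resolve_left (Ne.symm hne)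
      have e2 := e2.resolve_left hne
      rw [← e1] at h1
      rw [← e2] at h2
      exact dbl2 hH h3 (mem_zs.1 h2.1) (mem_zs.1 h1.1) (lift_inj hv hne) h1.2.2.1 h2.2.2.1
  have hsub : S ⊆ F ∪ (W ∪ T) := by
    intro a ha
    simp only [mem_union]
    rcases (hT a ha).2 with h | ⟨w, hw, h⟩ | h
    · exact Or.inl (mem_filter.2 ⟨ha, h⟩)
    · exact Or.inr (Or.inl (mem_biUnion.2 ⟨w, by simpa using hw, mem_filter.2 ⟨ha, h⟩⟩))
    · exact Or.inr (Or.inr (mem_filter.2 ⟨ha, h⟩))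
  have := card_le_card hsub
  have := card_union_le F (W ∪ T)
  have := card_union_le W T
  omega

/-- good pair -/
def gp (pt : Fin n → ℝ × ℝ) (A : Finset (Fin n)) (x y : Fin n) : Prop := ∃ z ∈ A, Tri (lift pt) x y z

def bp (pt : Fin n → ℝ × ℝ) (A : Finset (Fin n)) : Finset (Fin n × Fin n) := (A ×ˢ A).filter (fun q => ¬ gp pt A q.1 q.2)

lemma bp_card {pt : Fin n → ℝ × ℝ} (hv : Cfg (lift pt)) {H : MP} (hH : Irreducible H) (h3 : H.totalDegree = 3) :
    (bp pt (zs pt H)).card ≤ n + 2 * N2 (lift pt) + 2 * n * (univ \ zs pt H).card := by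
  set A := zs pt H with hA
  set B1 := (univ : Finset (Fin n)).image (fun x => (x, x))
  set B2 := ((lines (lift pt)).filter (fun L => L.card = 2)).biUnion (fun L => L.offDiag)
  set B3 := ((univ : Finset (Fin n)) ×ˢ (univ \ A)).biUnion (fun q => (A.filter (fun y => y ≠ q.1 ∧ q.2 ∈ Ln (lift pt) q.1 y ∧ q.1 ∈ A)).image (fun y => (q.1, y)))
  have hsub : bp pt A ⊆ B1 ∪ (B2 ∪ B3) := by
    rintro ⟨x, y⟩ hq
    simp only [bp, mem_filter, mem_product] at hq
    obtain ⟨⟨hx, hy⟩, hq⟩ := hq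
    simp only [mem_union]
    by_cases hxy : x = y
    · left; subst hxy; exact mem_image_of_mem (fun x => (x, x)) (mem_univ x)
    right
    by_cases hw : ∃ w, w ∉ A ∧ w ∈ Ln (lift pt) x y
    · obtain ⟨w, hw, hw'⟩ := hw
      right
      refine mem_biUnion.2 ⟨(x, w), by simpa using hw, mem_image.2 ⟨y, mem_filter.2 ⟨hy, Ne.symm hxy, hw', hx⟩, rfl⟩⟩
    · push Not at hw
      left
      have hall : ∀ z ∈ Ln (lift pt) x y, z ∈ A := fun z hz => by by_contra h'; exact hw z h' hz
      have hle : (Ln (lift pt) x y).card ≤ 3 := by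
        rw [← h3]
        exact line_zs hv hH (by omega) hxy _ (fun z hz => ⟨mem_zs.1 (hall z hz), hz⟩)
      have hge := two_le_line (Ln_mem_lines (v := lift pt) hxy)
      have hne : (Ln (lift pt) x y).card ≠ 3 := by
        intro h
        obtain ⟨z, hz⟩ := hv.tri_of_card hxy h
        exact hq ⟨z, hall z (by rw [hz.2.2.2]; simp), hz⟩
      refine mem_biUnion.2 ⟨Ln (lift pt) x y, mem_filter.2 ⟨Ln_mem_lines hxy, by omega⟩, mem_offDiag.2 ⟨left_mem_Ln _ _ _, right_mem_Ln _ _ _, hxy⟩⟩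
  have c1 : B1.card ≤ n := card_image_le.trans (by simp)
  have c2 : B2.card ≤ N2 (lift pt) * 2 := by
    refine card_biUnion_le_card_mul _ _ _ ?_
    intro L hL
    rw [offDiag_card, (mem_filter.1 hL).2]
  have c3 : B3.card ≤ (n * (univ \ A).card) * 2 := by
    have : ((univ : Finset (Fin n)) ×ˢ (univ \ A)).card = n * (univ \ A).card := by simp
    rw [← this]
    refine card_biUnion_le_card_mul _ _ _ ?_
    rintro ⟨x, w⟩ hq
    refine card_image_le.trans ?_
    simp only [mem_product, mem_univ, true_and, mem_sdiff] at hq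
    simp only
    by_cases hxA : x ∈ A
    · have hxw : x ≠ w := by rintro rfl; exact hq hxA
      set S := A.filter (fun y => y ≠ x ∧ w ∈ Ln (lift pt) x y ∧ x ∈ A) with hS
      have hxS : x ∉ S := by simp [hS]
      have := line_zs hv hH (by omega) hxw (insert x S) (by
        intro z hz
        rw [mem_insert] at hz
        rcases hz with rfl | hz
        · exact ⟨mem_zs.1 hxA, left_mem_Ln _ _ _⟩
        · simp only [hS, mem_filter] at hz
          refine ⟨mem_zs.1 hz.1, ?_⟩
          rw [hv.Ln_eq hz.2.1.symm hxw (left_mem_Ln _ _ _) hz.2.2.1]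
          exact right_mem_Ln _ _ _)
      rw [card_insert_of_notMem hxS, h3] at this
      omega
    · simp [hxA]
  have := card_le_card hsub
  have := card_union_le B1 (B2 ∪ B3)
  have := card_union_le B2 B3
  nlinarith

end
end DM

namespace DM

open Finset
open scoped Classical

noncomputable section
variable {n : ℕ}

lemma gp.symm {pt : Fin n → ℝ × ℝ} {A : Finset (Fin n)} {x y : Fin n} (h : gp pt A x y) : gp pt A y x := by
  obtain ⟨z, hz, ht⟩ := h
  exact ⟨z, hz, ht.swap12⟩

lemma third_inj {pt : Fin n → ℝ × ℝ} (hv : Cfg (lift pt)) {a b b' z : Fin n} (h : Tri (lift pt) a b z) (h' : Tri (lift pt) a b' z) : b = b' :=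
  (h.swap23 hv).uniq (h'.swap23 hv)

lemma Tri.ne {v : Fin n → V3} {i j k : Fin n} (h : Tri v i j k) : i ≠ j := h.1

lemma ar1 {n M z k : ℕ} (hn : 10000 ≤ n) (hM : 200 * M ≤ 400 * n + n * n) (hk : n ≤ 20 * k + 20) (h : z * k ≤ M) : 10 * z ≤ n + 500 := by
  have r2 : z * n ≤ 20 * (M + z) := by
    calc z * n ≤ z * (20 * k + 20) := Nat.mul_le_mul_left _ hk
      _ = 20 * (z * k) + 20 * z := by ring
      _ ≤ _ := by omega
  by_contra hc
  push Not at hc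
  obtain ⟨m, rfl⟩ : ∃ m, n = m + 20 := ⟨n - 20, by omega⟩
  have r3 : 10 * (z * m) ≤ 200 * M := by nlinarith
  have r4 : (m + 521) * m ≤ 10 * z * m := Nat.mul_le_mul_right _ (by omega)
  nlinarith

lemma ar2 {n M z k : ℕ} (hn : 10000 ≤ n) (hM : 200 * M ≤ 400 * n + n * n) (hk : n ≤ 2 * k + 2) (h : z * k ≤ M * 9) : 100 * z ≤ 9 * n + 5600 := by
  have r2 : z * n ≤ 18 * M + 2 * z := by
    calc z * n ≤ z * (2 * k + 2) := Nat.mul_le_mul_left _ hk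
      _ = 2 * (z * k) + 2 * z := by ring
      _ ≤ _ := by omega
  by_contra hc
  push Not at hc
  obtain ⟨m, rfl⟩ : ∃ m, n = m + 2 := ⟨n - 2, by omega⟩
  have r3 : 100 * (z * m) ≤ 1800 * M := by nlinarith
  have r4 : (9 * m + 5619) * m ≤ 100 * z * m := Nat.mul_le_mul_right _ (by omega)
  nlinarith

lemma cubic_main {C : Fin 10 → ℝ} (hH : Irreducible (cub C)) (h3 : (cub C).totalDegree = 3)
    {pt : Fin n → ℝ × ℝ} (hv : Cfg (lift pt)) (hN : 2 * N2 (lift pt) < n) (hn : 10000 ≤ n)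
    (hout : 400 * (univ \ zs pt (cub C)).card ≤ n) : False := by
  have hgood := good_count hH h3 hv
  have hclass := con_class hH h3 hv
  have hbp := bp_card hv hH h3
  set A := zs pt (cub C) with hA
  set o := (univ \ A).card with ho
  have hcard : A.card + o = n := by
    have := card_sdiff_add_card_eq_card (subset_univ A)
    simp at this; omega
  set M := (bp pt A).card with hM
  have hM' : 200 * M ≤ 400 * n + n * n := by nlinarith
  set β : Fin n → ℕ := fun y => (A.filter (fun x => ¬ gp pt A y x)).card with hβ
  set Z := A.filter (fun y => n < 20 * β y) with hZ
  have hZc : Z.card * (n / 20) ≤ M * 1 := by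
    refine card_mul_le_card_mul (fun y q => q.1 = y) ?_ ?_
    · intro y hy
      rw [hZ, mem_filter] at hy
      refine le_trans (show n / 20 ≤ β y by omega) ?_
      refine card_le_card_of_injOn (fun x => (y, x)) ?_ ?_
      · intro x hx
        have hx := mem_filter.1 hx
        simp only [bipartiteAbove, bp, coe_filter, mem_filter, mem_product, Set.mem_setOf_eq]
        exact ⟨⟨⟨hy.1, hx.1⟩, hx.2⟩, trivial⟩
      · intro x _ x' _ h; simpa using h
    · intro q _
      refine card_le_one.2 ?_
      intro x hx y hy
      simp only [bipartiteBelow, mem_filter] at hx hy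
      rw [← hx.2, ← hy.2]
  have hgoodc := hgood (A.filter (fun a => ∃ b c' d e u v x, Con pt A a b c' d e u v ∧ Tri (lift pt) u v x ∧ x ∈ A))
    (fun a ha => (mem_filter.1 ha).2)
  set Gd := A.filter (fun a => ∃ b c' d e u v x, Con pt A a b c' d e u v ∧ Tri (lift pt) u v x ∧ x ∈ A) with hGd
  set E3 := A \ (Gd ∪ Z) with hE3
  have hE3c : E3.card * (n / 2) ≤ M * 9 := by
    refine card_mul_le_card_mul (fun a q => ∃ b c' d e, Con pt A a b c' d e q.1 q.2) ?_ ?_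
    swap
    · intro q _
      refine hclass q.1 q.2 _ ?_
      intro a ha
      simp only [bipartiteBelow, mem_filter] at ha
      exact ha.2
    intro a ha
    simp only [hE3, mem_sdiff, mem_union, not_or] at ha
    obtain ⟨haA, haG, haZ⟩ := ha
    have nZ : ∀ y ∈ A, y ∉ Z → 20 * β y ≤ n := by
      intro y hy hyZ
      simp only [hZ, mem_filter, not_and, not_lt] at hyZ
      exact hyZ hy
    have : ∀ x y : Fin n, ∃ z, gp pt A x y → z ∈ A ∧ Tri (lift pt) x y z := by
      intro x y
      by_cases h : gp pt A x y
      · obtain ⟨z, hz, ht⟩ := h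
        exact ⟨z, fun _ => ⟨hz, ht⟩⟩
      · exact ⟨x, fun h' => absurd h' h⟩
    choose f hf using this
    have hZle' : 10 * Z.card ≤ n + 500 := ar1 hn hM' (by omega) (by omega : Z.card * (n / 20) ≤ M)
    -- choose b
    have hb : ∃ b ∈ A, gp pt A a b ∧ b ∉ Z ∧ f a b ∉ Z := by
      by_contra hcon
      push Not at hcon
      have hsub : A ⊆ (A.filter (fun x => ¬ gp pt A a x)) ∪ (Z ∪ (A.filter (fun b => gp pt A a b ∧ f a b ∈ Z))) := by
        intro b hb
        simp only [mem_union, mem_filter]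
        by_cases h1 : gp pt A a b
        · by_cases h2 : b ∈ Z
          · exact Or.inr (Or.inl h2)
          · exact Or.inr (Or.inr ⟨hb, h1, hcon b hb h1 h2⟩)
        · exact Or.inl ⟨hb, h1⟩
      have e1 := card_le_card hsub
      have e2 := card_union_le (A.filter (fun x => ¬ gp pt A a x)) (Z ∪ (A.filter (fun b => gp pt A a b ∧ f a b ∈ Z)))
      have e3 := card_union_le Z (A.filter (fun b => gp pt A a b ∧ f a b ∈ Z))
      have e4 : (A.filter (fun b => gp pt A a b ∧ f a b ∈ Z)).card ≤ Z.card := by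
        refine card_le_card_of_injOn (f a) ?_ ?_
        · intro b hb; exact (mem_filter.1 hb).2.2
        · intro b hb b' hb' h
          have h1 := (hf a b (mem_filter.1 hb).2.1).2
          have h2 := (hf a b' (mem_filter.1 hb').2.1).2
          rw [h] at h1
          exact third_inj hv h1 h2
      have e5 := nZ a haA haZ
      have e6 : (A.filter (fun x => ¬ gp pt A a x)).card = β a := rfl
      omega
    obtain ⟨b, hbA, gab, hbZ, hcZ⟩ := hb
    obtain ⟨hcA, habc⟩ := hf a b gab
    set c := f a b with hc
    set D := A.filter (fun d => d ≠ a ∧ d ≠ b ∧ d ≠ c ∧ gp pt A a d ∧ gp pt A b d ∧ gp pt A c (f a d)) with hD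
    have hDc : n / 2 ≤ D.card := by
      have hsub : A ⊆ D ∪ ({a, b, c} ∪ ((A.filter (fun x => ¬ gp pt A a x)) ∪ ((A.filter (fun x => ¬ gp pt A b x)) ∪
          (A.filter (fun d => gp pt A a d ∧ ¬ gp pt A c (f a d)))))) := by
        intro d hd
        simp only [mem_union, mem_filter, hD, mem_insert, mem_singleton, hd, true_and]
        tauto
      have e1 := card_le_card hsub
      have e2 := card_union_le D ({a, b, c} ∪ ((A.filter (fun x => ¬ gp pt A a x)) ∪ ((A.filter (fun x => ¬ gp pt A b x)) ∪
          (A.filter (fun d => gp pt A a d ∧ ¬ gp pt A c (f a d))))))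
      have e3 := card_union_le {a, b, c} ((A.filter (fun x => ¬ gp pt A a x)) ∪ ((A.filter (fun x => ¬ gp pt A b x)) ∪
          (A.filter (fun d => gp pt A a d ∧ ¬ gp pt A c (f a d)))))
      have e4 := card_union_le (A.filter (fun x => ¬ gp pt A a x)) ((A.filter (fun x => ¬ gp pt A b x)) ∪
          (A.filter (fun d => gp pt A a d ∧ ¬ gp pt A c (f a d))))
      have e5 := card_union_le (A.filter (fun x => ¬ gp pt A b x)) (A.filter (fun d => gp pt A a d ∧ ¬ gp pt A c (f a d)))
      have e6 : ({a, b, c} : Finset (Fin n)).card ≤ 3 := card_le_three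
      have e7 : (A.filter (fun d => gp pt A a d ∧ ¬ gp pt A c (f a d))).card ≤ β c := by
        refine card_le_card_of_injOn (f a) ?_ ?_
        · intro d hd
          have hd := mem_filter.1 hd
          simp only [coe_filter, Set.mem_setOf_eq]
          exact ⟨(hf a d hd.2.1).1, hd.2.2⟩
        · intro b hb b' hb' h
          have h1 := (hf a b (mem_filter.1 hb).2.1).2
          have h2 := (hf a b' (mem_filter.1 hb').2.1).2
          rw [h] at h1
          exact third_inj hv h1 h2
      have e8 := nZ a haA haZ
      have e9 := nZ b hbA hbZ
      have e10 := nZ c hcA hcZ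
      have e11 : (A.filter (fun x => ¬ gp pt A a x)).card = β a := rfl
      have e12 : (A.filter (fun x => ¬ gp pt A b x)).card = β b := rfl
      omega
    refine hDc.trans ?_
    refine card_le_card_of_injOn (fun d => (f b d, f c (f a d))) ?_ ?_
    · intro d hd
      have hd := mem_filter.1 hd
      obtain ⟨hdA, da, db, dc, g1, g2, g3⟩ := hd
      have hcon : Con pt A a b c d (f a d) (f b d) (f c (f a d)) :=
        ⟨haA, hbA, hcA, hdA, (hf a d g1).1, (hf b d g2).1, (hf c _ g3).1, habc, (hf a d g1).2, (hf b d g2).2, (hf c _ g3).2, da, db, dc⟩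
      simp only [bipartiteAbove, bp, coe_filter, mem_filter, mem_product, Set.mem_setOf_eq]
      refine ⟨⟨⟨(hf b d g2).1, (hf c _ g3).1⟩, ?_⟩, b, c, d, f a d, hcon⟩
      rintro ⟨x, hx, ht⟩
      exact haG (mem_filter.2 ⟨haA, b, c, d, f a d, _, _, x, hcon, ht, hx⟩)
    · intro d hd d' hd' h
      have h1 := (hf b d (mem_filter.1 hd).2.2.2.2.2.1).2
      have h2 := (hf b d' (mem_filter.1 hd').2.2.2.2.2.1).2
      simp only [Prod.mk.injEq] at h
      rw [h.1] at h1
      exact third_inj hv h1 h2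
  have htot : A.card ≤ E3.card + (Gd.card + Z.card) := by
    have e1 : A ⊆ E3 ∪ (Gd ∪ Z) := by
      intro x hx
      simp only [hE3, mem_union, mem_sdiff]
      tauto
    have := card_le_card e1
    have := card_union_le E3 (Gd ∪ Z)
    have := card_union_le Gd Z
    omega
  have r1 : 10 * Z.card ≤ n + 500 := ar1 hn hM' (by omega) (by omega : Z.card * (n / 20) ≤ M)
  have r5 : 100 * E3.card ≤ 9 * n + 5600 := ar2 hn hM' (by omega) hE3c
  omega

/-- there is no cubic component for `n` large -/
lemma no_cubic : ∀ D : ℕ, ∃ N0, ∀ n ≥ N0, ∀ pt : Fin n → ℝ × ℝ, Cfg (lift pt) → 2 * N2 (lift pt) < n →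
    ∀ H : MP, Irreducible H → H.totalDegree = 3 → n ≤ D * (zs pt H).card → False := by
  intro D
  refine ⟨10000 + D * (12 * (5569 * 400 + 1)) + 1, ?_⟩
  intro n hn pt hv hN H hH h3 hD
  obtain ⟨c, rfl⟩ := exists_cub (f := H) (by omega)
  refine cubic_main hH h3 hv hN (by omega) ?_
  have h := atyp hv hN 400
  refine le_trans ?_ h
  rw [mul_comm]
  refine Nat.mul_le_mul_right _ (card_le_card ?_)
  intro p hp
  simp only [mem_sdiff, mem_univ, true_and, mem_zs] at hp
  simp only [mem_filter, mem_univ, true_and]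
  by_contra hc
  have h1 := cubic_off hv hH h3 hp
  have h2 : (zs pt (cub c)).card ≤ 12 * (5569 * 400 + 1) := h1.trans (Nat.mul_le_mul_left _ (by omega))
  have := Nat.mul_le_mul_left D h2
  omega

end
end DM

namespace DM

open Finset
open scoped Classical

noncomputable section
variable {n : ℕ}

/-- parabola data -/
structure PD (v : Fin n → V3) (m : ℕ) (X : ℕ → Fin n) (T : ℕ → ℝ) (w : Fin n → V3) : Prop where
  mono : ∀ a b, a < b → b < m → T a < T b
  wX : ∀ a < m, w (X a) = (1, T a, T a ^ 2)
  det : ∀ i j k, det3 (v i) (v j) (v k) = 0 ↔ det3 (w i) (w j) (w k) = 0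

def ext (w : V3) : Prop := w.1 * w.2.2 < w.2.1 ^ 2
def prw (w : V3) (t u : ℝ) : Prop := w.1 * (t * u) - w.2.1 * (t + u) + w.2.2 = 0
def fw (w : V3) (t : ℝ) : ℝ := w.1 * t - w.2.1

lemma prw.symm {w : V3} {t u : ℝ} (h : prw w t u) : prw w u t := by
  unfold prw at *; linarith

lemma prw.prod {w : V3} {t u : ℝ} (h : prw w t u) : fw w t * fw w u = w.2.1 ^ 2 - w.1 * w.2.2 := by
  unfold prw fw at *; linear_combination w.1 * h

lemma prw.diff {w : V3} {t u t' u' : ℝ} (h : prw w t u) (h' : prw w t' u') :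
    (u - u') * (fw w t * fw w t') = (t' - t) * (w.2.1 ^ 2 - w.1 * w.2.2) := by
  unfold prw fw at *; linear_combination (w.1 * t' - w.2.1) * h - (w.1 * t - w.2.1) * h'

lemma prw.anti {w : V3} {t u t' u' : ℝ} (he : ext w) (h : prw w t u) (h' : prw w t' u') (hs : 0 < fw w t * fw w t') (hlt : t < t') : u' < u := by
  have := h.diff h'
  unfold ext at he
  have h2 : 0 < (t' - t) * (w.2.1 ^ 2 - w.1 * w.2.2) := mul_pos (by linarith) (by linarith)
  rw [← this] at h2
  have := (pos_iff_pos_of_mul_pos h2).2 hs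
  linarith

lemma prw.monoI {w : V3} {t u t' u' : ℝ} (he : w.2.1 ^ 2 < w.1 * w.2.2) (h : prw w t u) (h' : prw w t' u') (hs : 0 < fw w t * fw w t') (hlt : t < t') : u < u' := by
  have := h.diff h'
  have h2 : (t' - t) * (w.2.1 ^ 2 - w.1 * w.2.2) < 0 := mul_neg_of_pos_of_neg (by linarith) (by linarith)
  rw [← this] at h2
  have := neg_of_mul_neg_left h2 hs.le
  linarith

lemma prw.ne {w : V3} {t u : ℝ} (he : ext w) (h : prw w t u) : fw w t ≠ 0 := by
  intro h0
  have := h.prod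
  unfold ext at he
  rw [h0] at this; linarith

lemma prw.ne' {w : V3} {t u : ℝ} (he : w.2.1 ^ 2 < w.1 * w.2.2) (h : prw w t u) : fw w t ≠ 0 := by
  intro h0
  have := h.prod
  rw [h0] at this; linarith

lemma sign3 {x y z : ℝ} (hx : x ≠ 0) (hy : y ≠ 0) (hz : z ≠ 0) : 0 < x * y ∨ 0 < y * z ∨ 0 < x * z := by
  rcases lt_or_gt_of_ne hx with h1 | h1 <;> rcases lt_or_gt_of_ne hy with h2 | h2 <;> rcases lt_or_gt_of_ne hz with h3 | h3
  · left; exact mul_pos_of_neg_of_neg h1 h2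
  · left; exact mul_pos_of_neg_of_neg h1 h2
  · right; right; exact mul_pos_of_neg_of_neg h1 h3
  · right; left; exact mul_pos h2 h3
  · right; left; exact mul_pos_of_neg_of_neg h2 h3
  · right; right; exact mul_pos h1 h3
  · left; exact mul_pos h1 h2
  · left; exact mul_pos h1 h2

lemma no_three {w : V3} (he : ext w) {t1 t2 t3 u1 u2 u3 : ℝ} (h1 : prw w t1 u1) (h2 : prw w t2 u2) (h3 : prw w t3 u3)
    (a1 : t1 < t2) (a2 : t2 < t3) (b1 : u1 < u2) (b2 : u2 < u3) : False := by
  rcases sign3 (h1.ne he) (h2.ne he) (h3.ne he) with h | h | h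
  · have := prw.anti he h1 h2 h a1; linarith
  · have := prw.anti he h2 h3 h a2; linarith
  · have := prw.anti he h1 h3 h (a1.trans a2); linarith

variable {v : Fin n → V3} {m : ℕ} {X : ℕ → Fin n} {T : ℕ → ℝ} {w : Fin n → V3}

lemma PD.T_inj (D : PD v m X T w) {a b : ℕ} (ha : a < m) (hb : b < m) (h : T a = T b) : a = b := by
  rcases lt_trichotomy a b with h' | h' | h'
  · have := D.mono a b h' hb; linarith
  · exact h'
  · have := D.mono b a h' ha; linarith

lemma PD.lt_iff (D : PD v m X T w) {a b : ℕ} (ha : a < m) (hb : b < m) : T a < T b ↔ a < b := by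
  constructor
  · intro h
    rcases lt_trichotomy a b with h' | h' | h'
    · exact h'
    · subst h'; exact absurd h (lt_irrefl _)
    · have := D.mono b a h' ha; linarith
  · intro h; exact D.mono a b h hb

lemma PD.X_inj (D : PD v m X T w) {a b : ℕ} (ha : a < m) (hb : b < m) (h : X a = X b) : a = b := by
  have h1 := D.wX a ha
  rw [h, D.wX b hb] at h1
  have := congrArg (fun x : V3 => x.2.1) h1
  exact (D.T_inj hb ha this).symm

lemma PD.mem (D : PD v m X T w) {a b : ℕ} (ha : a < m) (hb : b < m) (hab : a ≠ b) (p : Fin n) :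
    p ∈ Ln v (X a) (X b) ↔ prw (w p) (T a) (T b) := by
  rw [mem_Ln, D.det, D.wX a ha, D.wX b hb]
  have hT : T b - T a ≠ 0 := fun h => hab (D.T_inj ha hb (by linarith))
  have : det3 (1, T a, T a ^ 2) (1, T b, T b ^ 2) (w p) = (T b - T a) * ((w p).1 * (T a * T b) - (w p).2.1 * (T a + T b) + (w p).2.2) := by
    simp [det3, dot, crs]; ring
  rw [this, mul_eq_zero]
  unfold prw
  simp [hT]

lemma PD.not_ext (D : PD v m X T w) {a : ℕ} (ha : a < m) : ¬ ext (w (X a)) := by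
  rw [D.wX a ha]; simp [ext]

/-- chord vector -/
def ch (t u : ℝ) : V3 := (t * u, - (t + u), 1)

lemma prw_ch {w : V3} {t u : ℝ} : prw w t u ↔ dot w (ch t u) = 0 := by
  unfold prw dot ch
  constructor <;> intro h <;> simp only at * <;> linarith

lemma pascal_id (a a' b b' c c' : ℝ) : det3 (crs (ch a' b) (ch a b')) (crs (ch b' c) (ch b c')) (crs (ch a' c) (ch a c')) = 0 := by
  simp only [det3, dot, crs, ch]; ring

end
end DM

namespace DM

open Finset
open scoped Classical

noncomputable section
variable {n : ℕ}

lemma card_rel {α β : Type*} (A : Finset α) (B : Finset β) (R : α → β → Prop) (h1 : ∀ a ∈ A, ∃ b ∈ B, R a b)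
    (h2 : ∀ a ∈ A, ∀ a' ∈ A, ∀ b ∈ B, R a b → R a' b → a = a') : A.card ≤ B.card := by
  rcases A.eq_empty_or_nonempty with rfl | ⟨a0, ha0⟩
  · simp
  obtain ⟨b0, -⟩ := h1 a0 ha0
  haveI : Nonempty β := ⟨b0⟩
  choose! f hf using h1
  refine card_le_card_of_injOn f (fun a ha => (hf a ha).1) ?_
  intro a ha a' ha' h
  exact h2 a ha a' ha' (f a) (hf a ha).1 (hf a ha).2 (by rw [h]; exact (hf a' ha').2)

/-- no three collinear -/
def gpS (v : Fin n → V3) (S : Finset (Fin n)) : Prop :=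
  ∀ a ∈ S, ∀ b ∈ S, ∀ c ∈ S, a ≠ b → c ∈ Ln v a b → c = a ∨ c = b

lemma zs_gp {pt : Fin n → ℝ × ℝ} (hv : Cfg (lift pt)) {H : MP} (hH : Irreducible H) (h2 : H.totalDegree = 2) : gpS (lift pt) (zs pt H) := by
  intro a ha b hb c hc hab hcL
  by_contra hcon
  push Not at hcon
  have := line_zs hv hH h2.ge hab {a, b, c} (by
    intro z hz
    simp only [mem_insert, mem_singleton] at hz
    rcases hz with rfl | rfl | rfl
    · exact ⟨mem_zs.1 ha, left_mem_Ln _ _ _⟩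
    · exact ⟨mem_zs.1 hb, right_mem_Ln _ _ _⟩
    · exact ⟨mem_zs.1 hc, hcL⟩)
  rw [card_eq_three.2 ⟨a, b, c, hab, hcon.1.symm, hcon.2.symm, rfl⟩, h2] at this
  omega

lemma Cfg.Ln_left {v : Fin n → V3} (hv : Cfg v) {a b p : Fin n} (hab : a ≠ b) (hp : p ∈ Ln v a b) (hpa : p ≠ a) : Ln v a p = Ln v a b :=
  hv.Ln_eq hab hpa.symm (left_mem_Ln _ _ _) hp

lemma mem_Ln_cyc {v : Fin n → V3} {a b p : Fin n} (hp : p ∈ Ln v a b) : b ∈ Ln v a p := by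
  rw [mem_Ln] at *
  rw [det3_swap23, hp, neg_zero]

lemma ord_pairs {v : Fin n → V3} (hv : Cfg v) (A : Finset (Fin n × Fin n)) (hA : ∀ x ∈ A, x.1 ≠ x.2 ∧ (Ln v x.1 x.2).card = 2) : A.card ≤ 2 * N2 v := by
  unfold N2
  rw [mul_comm]
  have hm : ∀ x ∈ A, Ln v x.1 x.2 ∈ (lines v).filter (fun L => L.card = 2) := fun x hx =>
    mem_filter.2 ⟨Ln_mem_lines (hA x hx).1, (hA x hx).2⟩
  rw [card_eq_sum_card_fiberwise hm, ← smul_eq_mul]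
  apply sum_le_card_nsmul
  intro L hL
  have : A.filter (fun x => Ln v x.1 x.2 = L) ⊆ L.offDiag := by
    intro x hx
    rw [mem_filter] at hx
    rw [mem_offDiag, ← hx.2]
    exact ⟨left_mem_Ln _ _ _, right_mem_Ln _ _ _, (hA x hx.1).1⟩
  refine (card_le_card this).trans ?_
  rw [offDiag_card, (mem_filter.1 hL).2]

lemma pair_up {v : Fin n → V3} (hv : Cfg v) {S : Finset (Fin n)} (hS : gpS v S) : S.card * S.card - S.card ≤ 2 * N2 v + (n - S.card) * S.card := by
  rw [← offDiag_card, ← card_filter_add_card_filter_not (s := S.offDiag) (fun x => (Ln v x.1 x.2).card = 2)]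
  apply add_le_add
  · apply ord_pairs hv
    intro x hx
    rw [mem_filter, mem_offDiag] at hx
    exact ⟨hx.1.2.2, hx.2⟩
  · have hc : (Sᶜ ×ˢ S).card = (n - S.card) * S.card := by rw [card_product, card_compl, Fintype.card_fin]
    rw [← hc]
    apply card_rel _ _ (fun x y => y.2 = x.1 ∧ y.1 ∈ Ln v x.1 x.2)
    · intro x hx
      rw [mem_filter, mem_offDiag] at hx
      obtain ⟨⟨h1, h2, h3⟩, h4⟩ := hx
      have : ∃ p ∈ Ln v x.1 x.2, p ∉ S := by
        by_contra hcon
        push Not at hcon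
        apply h4
        have : Ln v x.1 x.2 = {x.1, x.2} := by
          ext p
          rw [mem_insert, mem_singleton]
          constructor
          · intro hp; exact hS _ h1 _ h2 _ (hcon p hp) h3 hp
          · rintro (rfl | rfl)
            · exact left_mem_Ln _ _ _
            · exact right_mem_Ln _ _ _
        rw [this, card_pair h3]
      obtain ⟨p, hp, hpS⟩ := this
      exact ⟨(p, x.1), by simp [hpS, h1], rfl, hp⟩
    · rintro ⟨a, b⟩ hx ⟨a', b'⟩ hx' ⟨p, c⟩ hy ⟨h1, h2⟩ ⟨h3, h4⟩
      simp only at h1 h2 h3 h4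
      subst h1; subst h3
      rw [mem_filter, mem_offDiag] at hx hx'
      simp only [mem_product, mem_compl] at hy
      have hpc : p ≠ c := fun h => hy.1 (h ▸ hy.2)
      have e1 := hv.Ln_left hx.1.2.2 h2 hpc
      have e2 := hv.Ln_left hx'.1.2.2 h4 hpc
      simp only at e1 e2
      have : b' ∈ Ln v c b := by rw [← e1, e2]; exact right_mem_Ln _ _ _
      rcases hS c hx.1.1 b hx.1.2.1 b' hx'.1.2.1 hx.1.2.2 this with h | h
      · exact absurd h.symm hx'.1.2.2
      · rw [h]

/-- `p` is matched with all but `B` points of `S` -/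
lemma pair_dn {v : Fin n → V3} (hv : Cfg v) {S Q : Finset (Fin n)} {B : ℕ}
    (hQ : ∀ p ∈ Q, p ∉ S ∧ (S.filter (fun q => ¬ ∃ q' ∈ S, Tri v p q q')).card ≤ B) : Q.card * (S.card - B) ≤ S.card * S.card - S.card := by
  rw [← offDiag_card]
  set A := (Q ×ˢ S).filter (fun x => ∃ q' ∈ S, Tri v x.1 x.2 q') with hA
  have h1 : Q.card * (S.card - B) ≤ A.card := by
    have hm : ∀ x ∈ A, x.1 ∈ Q := fun x hx => by rw [hA, mem_filter, mem_product] at hx; exact hx.1.1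
    rw [card_eq_sum_card_fiberwise hm, ← smul_eq_mul]
    apply card_nsmul_le_sum
    intro p hp
    have hc := card_filter_add_card_filter_not (s := S) (fun q => ∃ q' ∈ S, Tri v p q q')
    have hB := (hQ p hp).2
    have : (S.filter (fun q => ∃ q' ∈ S, Tri v p q q')).card ≤ (A.filter (fun x => x.1 = p)).card := by
      apply card_le_card_of_injOn (fun q => (p, q))
      · intro q hq
        rw [mem_coe, mem_filter] at hq
        rw [mem_coe, mem_filter, hA, mem_filter, mem_product]
        exact ⟨⟨⟨hp, hq.1⟩, hq.2⟩, rfl⟩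
      · intro a _ b _ h; exact (Prod.mk.inj h).2
    omega
  refine h1.trans ?_
  apply card_rel _ _ (fun x y => y.1 = x.2 ∧ Tri v x.1 x.2 y.2)
  · intro x hx
    rw [hA, mem_filter, mem_product] at hx
    obtain ⟨⟨h1, h2⟩, q, hq, ht⟩ := hx
    exact ⟨(x.2, q), by rw [mem_offDiag]; exact ⟨h2, hq, ht.2.1⟩, rfl, ht⟩
  · rintro ⟨p, a⟩ hx ⟨p', a'⟩ hx' ⟨c, b⟩ hy ⟨h1, h2⟩ ⟨h3, h4⟩
    simp only at h1 h2 h3 h4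
    subst h1; subst h3
    rw [(h2.rot hv).uniq (h4.rot hv)]

end
end DM

namespace DM

open Finset
open scoped Classical

noncomputable section
variable {n : ℕ} {v : Fin n → V3} {m : ℕ} {X : ℕ → Fin n} {T : ℕ → ℝ} {w : Fin n → V3}

/-- `p` matches positions `a`, `b` -/
def mt (v : Fin n → V3) (m : ℕ) (X : ℕ → Fin n) (p : Fin n) (a b : ℕ) : Prop := a < m ∧ b < m ∧ Tri v p (X a) (X b)

def um (v : Fin n → V3) (m : ℕ) (X : ℕ → Fin n) (p : Fin n) : Finset ℕ := (range m).filter (fun a => ¬ ∃ b, mt v m X p a b)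

lemma mt.symm (hv : Cfg v) {p : Fin n} {a b : ℕ} (h : mt v m X p a b) : mt v m X p b a := ⟨h.2.1, h.1, h.2.2.swap23 hv⟩

lemma mt.prw (hv : Cfg v) (D : PD v m X T w) {p : Fin n} {a b : ℕ} (h : mt v m X p a b) : prw (w p) (T a) (T b) := by
  have hab : a ≠ b := fun he => h.2.2.2.1 (by rw [he])
  rw [← D.mem h.1 h.2.1 hab, mem_Ln, ← h.2.2.det, det3_rot]

lemma mt.ne {p : Fin n} {a b : ℕ} (h : mt v m X p a b) : a ≠ b := fun he => h.2.2.2.1 (by rw [he])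

lemma mt.uniq (D : PD v m X T w) {p : Fin n} {a b c : ℕ} (h : mt v m X p a b) (h' : mt v m X p a c) : b = c :=
  D.X_inj h.2.1 h'.2.1 (h.2.2.uniq h'.2.2)

lemma mt.uniq_p (hv : Cfg v) {p p' : Fin n} {a b : ℕ} (h : mt v m X p a b) (h' : mt v m X p' a b) : p = p' :=
  (h.2.2.rot hv).uniq (h'.2.2.rot hv)

lemma fw_between {w : V3} {s t u r : ℝ} (h1 : s < t) (h2 : t < u) (hs : 0 < fw w s * r) (hu : 0 < fw w u * r) : 0 < fw w t * r := by
  unfold fw at *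
  have e : (w.1 * t - w.2.1) * r * (u - s) = (w.1 * s - w.2.1) * r * (u - t) + (w.1 * u - w.2.1) * r * (t - s) := by ring
  have h3 : 0 < (w.1 * t - w.2.1) * r * (u - s) := by
    rw [e]; exact add_pos (mul_pos hs (by linarith)) (mul_pos hu (by linarith))
  exact (pos_iff_pos_of_mul_pos h3).2 (by linarith)

/-- the good positions of an exterior point -/
def gd (v : Fin n → V3) (m : ℕ) (X : ℕ → Fin n) (p : Fin n) : Finset ℕ :=
  (range (m - 1)).filter (fun a => ∃ b, mt v m X p (a + 1) b ∧ mt v m X p a (b + 1))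

lemma mul_pos3 {x y z : ℝ} (h1 : 0 < x * y) (h2 : 0 < y * z) : 0 < x * z := by
  have : 0 < (x * z) * (y * y) := by nlinarith [mul_pos h1 h2]
  exact (pos_iff_pos_of_mul_pos this).2 (by
    rcases eq_or_ne y 0 with rfl | h
    · simp at h1
    · exact mul_self_pos.2 h)

lemma fw_change {w : V3} {s t s' t' : ℝ} (h1 : s < t) (h2 : t ≤ s') (h3 : s' < t') (ha : fw w s * fw w t < 0) (hb : fw w s' * fw w t' < 0) : False := by
  unfold fw at *
  have : w.1 ≠ 0 := by
    rintro h; rw [h] at ha; nlinarith [sq_nonneg w.2.1]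
  have hw : 0 < w.1 ^ 2 := by positivity
  by_contra
  obtain ⟨c, hc⟩ : ∃ c, w.2.1 = w.1 * c := ⟨w.2.1 / w.1, by field_simp⟩
  rw [hc] at ha hb
  have e1 : w.1 ^ 2 * ((s - c) * (t - c)) < 0 := by linarith
  have e2 : w.1 ^ 2 * ((s' - c) * (t' - c)) < 0 := by linarith
  have f1 : (s - c) * (t - c) < 0 := by by_contra hh; push Not at hh; nlinarith [mul_nonneg hw.le hh]
  have f2 : (s' - c) * (t' - c) < 0 := by by_contra hh; push Not at hh; nlinarith [mul_nonneg hw.le hh]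
  have g1 : c < t := by by_contra hh; push Not at hh; nlinarith [mul_nonneg (sub_nonneg.2 (h1.le.trans hh)) (sub_nonneg.2 hh)]
  nlinarith [mul_pos (show 0 < s' - c by linarith) (show 0 < t' - c by linarith)]

lemma gd_card (hv : Cfg v) (D : PD v m X T w) {p : Fin n} (he : ext (w p)) : m - 1 ≤ (gd v m X p).card + (3 * (um v m X p).card + 1) := by
  set U := um v m X p with hU
  have hmem : ∀ a, a < m → a ∉ U → ∃ b, mt v m X p a b := by
    intro a ha h
    rw [hU, um, mem_filter, mem_range] at h
    by_contra hc
    exact h ⟨ha, hc⟩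
  set A3 := (range (m - 1)).filter (fun a => fw (w p) (T a) * fw (w p) (T (a + 1)) < 0) with hA3
  set A1 := (range (m - 1)).filter (fun a => a + 1 ∈ U) with hA1
  set A4 := (range (m - 1)).filter (fun a => ∃ b, mt v m X p (a + 1) b ∧ b + 1 ∈ U) with hA4
  have c3 : A3.card ≤ 1 := by
    rw [card_le_one]
    intro a ha b hb
    rw [hA3, mem_filter, mem_range] at ha hb
    by_contra hab
    rcases lt_or_gt_of_ne hab with h | h
    · refine fw_change (D.mono a (a+1) (by omega) (by omega)) ?_ (D.mono b (b+1) (by omega) (by omega)) ha.2 hb.2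
      rcases eq_or_lt_of_le (show a + 1 ≤ b by omega) with h' | h'
      · rw [h']
      · exact (D.mono _ _ h' (by omega)).le
    · refine fw_change (D.mono b (b+1) (by omega) (by omega)) ?_ (D.mono a (a+1) (by omega) (by omega)) hb.2 ha.2
      rcases eq_or_lt_of_le (show b + 1 ≤ a by omega) with h' | h'
      · rw [h']
      · exact (D.mono _ _ h' (by omega)).le
  have c1 : A1.card ≤ U.card := by
    refine card_le_card_of_injOn (fun a => a + 1) (fun a ha => (mem_filter.1 ha).2) ?_
    intro a _ b _ h
    simpa using h
  have c4 : A4.card ≤ U.card := by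
    apply card_rel _ _ (fun a c => ∃ b, mt v m X p (a + 1) b ∧ b + 1 = c)
    · intro a ha
      obtain ⟨b, hb, hb'⟩ := (mem_filter.1 ha).2
      exact ⟨b + 1, hb', b, hb, rfl⟩
    · rintro a ha a' ha' c hc ⟨b, hb, hb'⟩ ⟨d, hd, hd'⟩
      have : b = d := by omega
      subst this
      have := (hb.symm hv).uniq D (hd.symm hv)
      omega
  have hsub : range (m - 1) ⊆ gd v m X p ∪ (U ∪ (A1 ∪ (A4 ∪ A3))) := by
    intro a ha
    by_contra hcon
    simp only [mem_union, not_or] at hcon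
    obtain ⟨h0, h1, h2, h3, h4⟩ := hcon
    have ha' := mem_range.1 ha
    rw [hA1, mem_filter, not_and] at h2
    rw [hA3, mem_filter, not_and] at h4
    rw [hA4, mem_filter, not_and] at h3
    rw [gd, mem_filter, not_and] at h0
    have h2 := h2 ha
    have h3 := h3 ha
    have h4 := h4 ha
    have h0 := h0 ha
    obtain ⟨b', hb'⟩ := hmem a (by omega) h1
    obtain ⟨b, hb⟩ := hmem (a + 1) (by omega) h2
    have pb' := hb'.prw hv D
    have pb := hb.prw hv D
    have hs : 0 < fw (w p) (T a) * fw (w p) (T (a + 1)) := lt_of_le_of_ne (not_lt.1 h4) (mul_ne_zero (pb'.ne he) (pb.ne he)).symm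
    have ta := D.mono a (a+1) (by omega) (by omega)
    have hbb := prw.anti he pb' pb hs ta
    have hlt := (D.lt_iff hb.2.1 hb'.2.1).1 hbb
    have hb1 : b + 1 ∉ U := fun h => h3 ⟨b, hb, h⟩
    obtain ⟨c, hc⟩ := hmem (b + 1) (by have := hb'.2.1; omega) hb1
    rcases eq_or_lt_of_le (show b + 1 ≤ b' by omega) with h' | h'
    · rw [← h'] at hb'
      exact h0 ⟨b, hb, hb'⟩
    · have pc := hc.prw hv D
      have q1 := pb'.prod
      have q2 := pb.prod
      have hd : 0 < (w p).2.1 ^ 2 - (w p).1 * (w p).2.2 := by unfold ext at he; linarith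
      have s1 : 0 < fw (w p) (T b') * fw (w p) (T a) := by rw [mul_comm, q1]; exact hd
      have s2 : 0 < fw (w p) (T b) * fw (w p) (T (a + 1)) := by rw [mul_comm, q2]; exact hd
      have s3 : 0 < fw (w p) (T b) * fw (w p) (T a) := mul_pos3 s2 (by rw [mul_comm]; exact hs)
      have t1 := D.mono b (b + 1) (by omega) (by have := hb'.2.1; omega)
      have t2 := D.mono (b + 1) b' h' hb'.2.1
      have s4 := fw_between t1 t2 s3 s1
      have u1 := prw.anti he (pb.symm) pc (mul_pos3 s3 (by rw [mul_comm]; exact s4)) t1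
      have u2 := prw.anti he pc pb'.symm (mul_pos3 s4 (by rw [mul_comm]; exact s1)) t2
      have := (D.lt_iff hc.2.1 (show a + 1 < m by omega)).1 u1
      have := (D.lt_iff (show a < m by omega) hc.2.1).1 u2
      omega
  have := card_le_card hsub
  rw [card_range] at this
  have e1 := card_union_le (gd v m X p) (U ∪ (A1 ∪ (A4 ∪ A3)))
  have e2 := card_union_le U (A1 ∪ (A4 ∪ A3))
  have e3 := card_union_le A1 (A4 ∪ A3)
  have e4 := card_union_le A4 A3
  omega

/-- good pairs -/
def Fr (w : Fin n → V3) (m : ℕ) (T : ℕ → ℝ) (p : Fin n) (a b : ℕ) : Prop :=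
  a + 1 < m ∧ b + 1 < m ∧ a ≠ b ∧ ext (w p) ∧ prw (w p) (T (a + 1)) (T b) ∧ prw (w p) (T a) (T (b + 1))

def FF (w : Fin n → V3) (m : ℕ) (T : ℕ → ℝ) : Finset (ℕ × ℕ) :=
  (range m ×ˢ range m).filter (fun x => ∃ p, Fr w m T p x.1 x.2)

lemma FF_card (hv : Cfg v) (D : PD v m X T w) {Q : Finset (Fin n)} {B : ℕ} (hQ : ∀ p ∈ Q, ext (w p) ∧ (um v m X p).card ≤ B) :
    Q.card * (m - 1 - (3 * B + 1)) ≤ (FF w m T).card + m := by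
  set A := Q.sigma (fun p => gd v m X p) with hA
  have h1 : Q.card * (m - 1 - (3 * B + 1)) ≤ A.card := by
    rw [hA, card_sigma, ← smul_eq_mul]
    apply card_nsmul_le_sum
    intro p hp
    have := gd_card hv D (hQ p hp).1
    have := (hQ p hp).2
    omega
  refine h1.trans ?_
  have h2 : A.card ≤ (FF w m T ∪ (range m).image (fun a => (a, a))).card := by
    apply card_rel _ _ (fun x y => x.2 = y.1 ∧ mt v m X x.1 (y.1 + 1) y.2)
    · rintro ⟨p, a⟩ hx
      rw [hA, mem_sigma, gd, mem_filter] at hx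
      obtain ⟨hp, ha, b, hb, hb'⟩ := hx
      refine ⟨(a, b), ?_, rfl, hb⟩
      have ha : a < m - 1 := mem_range.1 ha
      rw [mem_union]
      by_cases hab : a = b
      · right
        rw [mem_image]; exact ⟨a, by rw [mem_range]; omega, by rw [hab]⟩
      · left
        rw [FF, mem_filter, mem_product, mem_range, mem_range]
        exact ⟨⟨by omega, hb.2.1⟩, p, by omega, hb'.2.1, hab, (hQ p hp).1, hb.prw hv D, hb'.prw hv D⟩
    · rintro ⟨p, a⟩ hx ⟨p', a'⟩ hx' ⟨c, b⟩ hy ⟨h1, h2⟩ ⟨h3, h4⟩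
      simp only at h1 h2 h3 h4
      subst h1; subst h3
      rw [h2.uniq_p hv h4]
  refine h2.trans ((card_union_le _ _).trans ?_)
  have := card_image_le (s := range m) (f := fun a => (a, a))
  rw [card_range] at this
  omega

lemma ch_ne {a a' b b' : ℝ} (h1 : a ≠ a') (h2 : a' ≠ b') : crs (ch a' b) (ch a b') ≠ 0 := by
  intro h
  simp only [crs, ch, Prod.mk_eq_zero] at h
  obtain ⟨e1, e2, -⟩ := h
  have : (a' - a) * (a' - b') = 0 := by linear_combination -a' * e1 + e2
  rcases mul_eq_zero.1 this with h | h
  · exact h1 (by linarith)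
  · exact h2 (by linarith)

lemma Fr.eqn (D : PD v m X T w) {p : Fin n} {a b : ℕ} (h : Fr w m T p a b) :
    ∃ r : ℝ, w p = r • crs (ch (T (a + 1)) (T b)) (ch (T a) (T (b + 1))) := by
  obtain ⟨ha, hb, hab, -, h1, h2⟩ := h
  apply exists_smul_of_orth
  · apply ch_ne
    · intro h; have := D.T_inj (by omega) ha h; omega
    · intro h; have := D.T_inj ha hb h; omega
  · rw [dot_comm]; exact prw_ch.1 h1
  · rw [dot_comm]; exact prw_ch.1 h2

lemma Fr.pascal (D : PD v m X T w) {p p' p'' : Fin n} {i j k : ℕ} (h : Fr w m T p i j) (h' : Fr w m T p' j k) (h'' : Fr w m T p'' i k) :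
    p'' ∈ Ln v p p' := by
  rw [mem_Ln, D.det]
  obtain ⟨r, hr⟩ := h.eqn D
  obtain ⟨r', hr'⟩ := h'.eqn D
  obtain ⟨r'', hr''⟩ := h''.eqn D
  rw [hr, hr', hr'']
  have := pascal_id (T i) (T (i + 1)) (T j) (T (j + 1)) (T k) (T (k + 1))
  have e : ∀ a b c : V3, det3 (r • a) (r' • b) (r'' • c) = r * r' * r'' * det3 a b c := by
    intro a b c; simp [det3, dot, crs]; ring
  rw [e, this, mul_zero]

end
end DM

namespace DM

open Finset
open scoped Classical

noncomputable section
variable {n : ℕ} {v : Fin n → V3} {m : ℕ} {X : ℕ → Fin n} {T : ℕ → ℝ} {w : Fin n → V3}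

lemma interlace {w : V3} (he : w.2.1 ^ 2 < w.1 * w.2.2) {a b c d : ℝ} (h1 : prw w a b) (h2 : prw w c d) (hca : c ≠ a) (hcb : c ≠ b) :
    (c - a) * (c - b) * ((d - a) * (d - b)) < 0 := by
  unfold prw at *
  have key : w.1 ^ 2 * ((c - a) * (c - b) * ((d - a) * (d - b))) = (a + b - (c + d)) ^ 2 * (w.2.1 ^ 2 - w.1 * w.2.2) := by
    linear_combination (w.1 * (a * b - c * d) + w.2.1 * (a + b - (c + d))) * (h1 - h2) + w.1 * (a + b - (c + d)) * ((a + b) * h2 - (c + d) * h1)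
  have hw : w.1 ≠ 0 := by rintro h; rw [h] at he; nlinarith [sq_nonneg w.2.1]
  have hw2 : 0 < w.1 ^ 2 := by positivity
  have hs : a + b - (c + d) ≠ 0 := by
    intro h
    have e : w.1 * ((c - a) * (c - b)) = 0 := by linear_combination h1 - h2 + (w.2.1 - w.1 * c) * h
    rcases mul_eq_zero.1 e with h | h
    · exact hw h
    · rcases mul_eq_zero.1 h with h | h
      · exact hca (by linarith)
      · exact hcb (by linarith)
  have hs2 : 0 < (a + b - (c + d)) ^ 2 := by positivity
  by_contra hcon
  push Not at hcon
  have := mul_nonneg hw2.le hcon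
  rw [key] at this
  have := mul_neg_of_pos_of_neg hs2 (show w.2.1 ^ 2 - w.1 * w.2.2 < 0 by linarith)
  linarith

lemma mt.cross (hv : Cfg v) (D : PD v m X T w) {p : Fin n} (he : (w p).2.1 ^ 2 < (w p).1 * (w p).2.2) {a b c d : ℕ} (h : mt v m X p a b)
    (h' : mt v m X p c d) (hab : a < b) (hca : c ≠ a) (hcb : c ≠ b) : (a < c ∧ c < b) ↔ (d < a ∨ b < d) := by
  have hda : d ≠ a := by
    rintro rfl
    exact hcb (((h'.symm hv).uniq D h))
  have hdb : d ≠ b := by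
    rintro rfl
    exact hca (((h'.symm hv).uniq D (h.symm hv)))
  have nT : ∀ {x y : ℕ}, x < m → y < m → x ≠ y → T x ≠ T y := fun hx hy hne he => hne (D.T_inj hx hy he)
  have key := interlace he (h.prw hv D) (h'.prw hv D) (nT h'.1 h.1 hca) (nT h'.1 h.2.1 hcb)
  have Tab := D.mono a b hab h.2.1
  constructor
  · rintro ⟨h1, h2⟩
    by_contra hcon
    push Not at hcon
    have t1 := D.mono a c h1 h'.1
    have t2 := D.mono c b h2 h.2.1
    have t3 := D.mono a d (lt_of_le_of_ne hcon.1 hda.symm) h'.2.1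
    have t4 := D.mono d b (lt_of_le_of_ne hcon.2 hdb) h.2.1
    have := mul_pos (mul_pos (sub_pos.2 t1) (sub_pos.2 t2)) (mul_pos (sub_pos.2 t3) (sub_pos.2 t4))
    nlinarith
  · intro hd
    have pd : 0 < (T d - T a) * (T d - T b) := by
      rcases hd with hd | hd
      · have t1 := D.mono d a hd h.1
        exact mul_pos_of_neg_of_neg (by linarith) (by linarith)
      · have t1 := D.mono b d hd h'.2.1
        exact mul_pos (by linarith) (by linarith)
    have nc : (T c - T a) * (T c - T b) < 0 := by
      by_contra hcon
      push Not at hcon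
      have := mul_nonneg hcon pd.le
      linarith
    constructor
    · by_contra hcon
      have t1 := D.mono c a (lt_of_le_of_ne (not_lt.1 hcon) hca) h.1
      have := mul_pos_of_neg_of_neg (show T c - T a < 0 by linarith) (show T c - T b < 0 by linarith)
      linarith
    · by_contra hcon
      have t1 := D.mono b c (lt_of_le_of_ne (not_lt.1 hcon) hcb.symm) h'.1
      have := mul_pos (show 0 < T c - T a by linarith) (show 0 < T c - T b by linarith)
      linarith

lemma mt.window (hv : Cfg v) (D : PD v m X T w) {p : Fin n} (he : (w p).2.1 ^ 2 < (w p).1 * (w p).2.2) {a b : ℕ} (h : mt v m X p a b)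
    (hab : a < b) : m ≤ 2 * (b - a) + (um v m X p).card ∧ 2 * (b - a) ≤ m + (um v m X p).card := by
  set U := um v m X p with hU
  set M := (range m).filter (fun a => ∃ b, mt v m X p a b) with hM
  set I := (range m).filter (fun c => a < c ∧ c < b) with hI
  set O := (range m).filter (fun c => c < a ∨ b < c) with hO
  have hb := h.2.1
  have hIc : I.card = b - a - 1 := by
    have : I = Ioo a b := by ext c; rw [hI, mem_filter, mem_range, mem_Ioo]; omega
    rw [this, Nat.card_Ioo]
  have hOc : O.card + (b - a + 1) = m := by
    have h1 : O = range m \ Icc a b := by ext c; rw [hO, mem_filter, mem_sdiff, mem_range, mem_Icc]; omega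
    have h2 := card_sdiff_add_card_eq_card (s := Icc a b) (t := range m) (by intro c hc; rw [mem_Icc] at hc; rw [mem_range]; omega)
    rw [← h1, Nat.card_Icc, card_range] at h2
    omega
  have hne : ∀ {c d}, mt v m X p c d → c ≠ a → c ≠ b → d ≠ a ∧ d ≠ b := by
    intro c d h' h1 h2
    constructor
    · rintro rfl; exact h2 (((h'.symm hv).uniq D h))
    · rintro rfl; exact h1 (((h'.symm hv).uniq D (h.symm hv)))
  have e1 : (I.filter (fun c => c ∈ M)).card ≤ (O.filter (fun c => c ∈ M)).card := by
    apply card_rel _ _ (fun c d => mt v m X p c d)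
    · intro c hc
      rw [mem_filter, hI, mem_filter, hM, mem_filter] at hc
      obtain ⟨⟨_, hc1⟩, _, d, hd⟩ := hc
      refine ⟨d, ?_, hd⟩
      rw [mem_filter, hO, mem_filter, hM, mem_filter, mem_range]
      exact ⟨⟨hd.2.1, (h.cross hv D he hd hab (by omega) (by omega)).1 hc1⟩, hd.2.1, c, hd.symm hv⟩
    · intro c _ c' _ d _ h1 h2
      exact (h1.symm hv).uniq D (h2.symm hv)
  have e2 : (O.filter (fun c => c ∈ M)).card ≤ (I.filter (fun c => c ∈ M)).card := by
    apply card_rel _ _ (fun c d => mt v m X p c d)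
    · intro c hc
      rw [mem_filter, hO, mem_filter, hM, mem_filter] at hc
      obtain ⟨⟨_, hc1⟩, _, d, hd⟩ := hc
      refine ⟨d, ?_, hd⟩
      rw [mem_filter, hI, mem_filter, hM, mem_filter, mem_range]
      have := hne hd (by omega) (by omega)
      exact ⟨⟨hd.2.1, (h.cross hv D he (hd.symm hv) hab this.1 this.2).2 hc1⟩, hd.2.1, c, hd.symm hv⟩
    · intro c _ c' _ d _ h1 h2
      exact (h1.symm hv).uniq D (h2.symm hv)
  have f1 := card_filter_add_card_filter_not (s := I) (fun c => c ∈ M)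
  have f2 := card_filter_add_card_filter_not (s := O) (fun c => c ∈ M)
  have hUm : ∀ c, c < m → c ∉ M → c ∈ U := by
    intro c hc h1
    rw [hU, um, mem_filter, mem_range]
    refine ⟨hc, fun h2 => h1 ?_⟩
    rw [hM, mem_filter, mem_range]; exact ⟨hc, h2⟩
  have g1 : (I.filter (fun c => c ∉ M)).card ≤ U.card := by
    apply card_le_card
    intro c hc
    rw [mem_filter, hI, mem_filter, mem_range] at hc
    exact hUm c hc.1.1 hc.2
  have g2 : (O.filter (fun c => c ∉ M)).card ≤ U.card := by
    apply card_le_card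
    intro c hc
    rw [mem_filter, hO, mem_filter, mem_range] at hc
    exact hUm c hc.1.1 hc.2
  omega

lemma int_card (hv : Cfg v) (D : PD v m X T w) {Q : Finset (Fin n)} {B : ℕ}
    (hQ : ∀ p ∈ Q, (w p).2.1 ^ 2 < (w p).1 * (w p).2.2 ∧ (um v m X p).card ≤ B) : Q.card * (m - B) ≤ m * (2 * B + 4) := by
  set A := Q.sigma (fun p => (range m).filter (fun a => ∃ b, mt v m X p a b)) with hA
  have h1 : Q.card * (m - B) ≤ A.card := by
    rw [hA, card_sigma, ← smul_eq_mul]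
    apply card_nsmul_le_sum
    intro p hp
    have h1 := (hQ p hp).2
    have := card_filter_add_card_filter_not (s := range m) (fun a => ∃ b, mt v m X p a b)
    rw [card_range] at this
    unfold um at h1
    omega
  refine h1.trans ?_
  set C := (range m).sigma (fun a => Icc (a + (m - B) / 2) (a + (m + B) / 2) ∪ Icc (a - (m + B) / 2) (a - (m - B) / 2)) with hC
  have h2 : A.card ≤ C.card := by
    apply card_rel _ _ (fun x y => x.2 = y.1 ∧ mt v m X x.1 y.1 y.2)
    · rintro ⟨p, a⟩ hx
      rw [hA, mem_sigma, mem_filter] at hx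
      obtain ⟨hp, ha, b, hb⟩ := hx
      simp only at hp ha hb
      refine ⟨⟨a, b⟩, ?_, rfl, hb⟩
      have hB := (hQ p hp).2
      rw [hC, mem_sigma, mem_union, mem_Icc, mem_Icc]
      refine ⟨ha, ?_⟩
      simp only
      rcases lt_or_gt_of_ne hb.ne with h | h
      · have := hb.window hv D (hQ p hp).1 h
        left; omega
      · have := (hb.symm hv).window hv D (hQ p hp).1 h
        right; omega
    · rintro ⟨p, a⟩ hx ⟨p', a'⟩ hx' ⟨c, b⟩ hy ⟨h1, h2⟩ ⟨h3, h4⟩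
      simp only at h1 h2 h3 h4
      subst h1; subst h3
      rw [h2.uniq_p hv h4]
  refine h2.trans ?_
  rw [hC, card_sigma]
  have : ∀ a ∈ range m, (Icc (a + (m - B) / 2) (a + (m + B) / 2) ∪ Icc (a - (m + B) / 2) (a - (m - B) / 2)).card ≤ 2 * B + 4 := by
    intro a _
    refine (card_union_le _ _).trans ?_
    rw [Nat.card_Icc, Nat.card_Icc]
    omega
  have := sum_le_card_nsmul _ _ _ this
  rwa [card_range, smul_eq_mul] at this

lemma prw.uniq {w : V3} (he : ext w) {t t' u : ℝ} (h : prw w t u) (h' : prw w t' u) : t = t' := by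
  have := h.diff h'
  rw [sub_self, zero_mul] at this
  unfold ext at he
  rcases mul_eq_zero.1 this.symm with h | h <;> linarith

lemma Fr.uniq1 (D : PD v m X T w) {p : Fin n} {a a' b : ℕ} (h : Fr w m T p a b) (h' : Fr w m T p a' b) : a = a' := by
  have := D.T_inj h.1 h'.1 (h.2.2.2.2.1.uniq h.2.2.2.1 h'.2.2.2.2.1)
  omega

lemma Fr.symm {p : Fin n} {a b : ℕ} (h : Fr w m T p a b) : Fr w m T p b a :=
  ⟨h.2.1, h.1, h.2.2.1.symm, h.2.2.2.1, h.2.2.2.2.2.symm, h.2.2.2.2.1.symm⟩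

def JJ (w : Fin n → V3) (m : ℕ) (T : ℕ → ℝ) (p p' : Fin n) : Finset ℕ :=
  (range m).filter (fun j => ∃ p'' i k, Fr w m T p i j ∧ Fr w m T p' j k ∧ Fr w m T p'' i k)

lemma three_sorted (s : Finset ℕ) (h : 2 < s.card) : ∃ x ∈ s, ∃ y ∈ s, ∃ z ∈ s, x < y ∧ y < z := by
  refine ⟨s.orderEmbOfFin rfl ⟨0, by omega⟩, orderEmbOfFin_mem _ _ _, s.orderEmbOfFin rfl ⟨1, by omega⟩, orderEmbOfFin_mem _ _ _,
    s.orderEmbOfFin rfl ⟨2, h⟩, orderEmbOfFin_mem _ _ _, ?_, ?_⟩ <;>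
  · rw [OrderEmbedding.lt_iff_lt]; simp [Fin.lt_def]

lemma same_sign {x y : ℝ} (hx : x ≠ 0) (hy : y ≠ 0) (h : decide (0 < x) = decide (0 < y)) : 0 < x * y := by
  have h : 0 < x ↔ 0 < y := by simpa using h
  rcases lt_or_gt_of_ne hx with h1 | h1
  · have : y < 0 := lt_of_le_of_ne (not_lt.1 (fun h2 => absurd (h.2 h2) (not_lt.2 h1.le))) hy
    exact mul_pos_of_neg_of_neg h1 this
  · exact mul_pos h1 (h.1 h1)

lemma JJ_fib (D : PD v m X T w) {p p' p'' : Fin n} (A : Finset ℕ) (hA : ∀ j ∈ A, ∃ i k, Fr w m T p i j ∧ Fr w m T p' j k ∧ Fr w m T p'' i k) :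
    A.card ≤ 8 := by
  by_contra hcon
  push Not at hcon
  obtain ⟨y, -, hy⟩ := exists_lt_card_fiber_of_mul_lt_card_of_maps_to (s := A) (t := (univ : Finset (Bool × Bool))) (n := 2)
    (f := fun j => (decide (0 < fw (w p) (T j)), decide (0 < fw (w p') (T j)))) (fun _ _ => mem_univ _) (by simpa using hcon)
  obtain ⟨j1, h1, j2, h2, j3, h3, l12, l23⟩ := three_sorted _ hy
  rw [mem_filter] at h1 h2 h3
  obtain ⟨i1, k1, a1, b1, c1⟩ := hA j1 h1.1
  obtain ⟨i2, k2, a2, b2, c2⟩ := hA j2 h2.1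
  obtain ⟨i3, k3, a3, b3, c3⟩ := hA j3 h3.1
  have main : ∀ {j j' i i' k k'}, Fr w m T p i j → Fr w m T p' j k → Fr w m T p i' j' → Fr w m T p' j' k' → j < j' →
      (decide (0 < fw (w p) (T j)), decide (0 < fw (w p') (T j))) = y → (decide (0 < fw (w p) (T j')), decide (0 < fw (w p') (T j'))) = y →
      T (i' + 1) < T (i + 1) ∧ T k' < T k := by
    intro j j' i i' k k' f1 f2 f3 f4 hj e1 e2
    rw [← e2] at e1
    have e3 := (Prod.mk.inj e1).1
    have e4 := (Prod.mk.inj e1).2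
    have hT := D.mono j j' hj (by have := f4.1; omega)
    have q1 := f1.2.2.2.2.1.symm
    have q2 := f3.2.2.2.2.1.symm
    have q3 := f2.2.2.2.2.2
    have q4 := f4.2.2.2.2.2
    have he := f1.2.2.2.1
    have he' := f2.2.2.2.1
    refine ⟨prw.anti he q1 q2 (same_sign (q1.ne he) (q2.ne he) e3) hT, ?_⟩
    have := prw.anti he' q3 q4 (same_sign (q3.ne he') (q4.ne he') e4) hT
    have := (D.lt_iff f4.2.1 f2.2.1).1 this
    exact D.mono _ _ (by omega) (by have := f2.2.1; omega)
  have m1 := main a1 b1 a2 b2 l12 h1.2 h2.2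
  have m2 := main a2 b2 a3 b3 l23 h2.2 h3.2
  exact no_three c1.2.2.2.1 c3.2.2.2.2.1 c2.2.2.2.2.1 c1.2.2.2.2.1 m2.1 m1.1 m2.2 m1.2

lemma JJ_card (D : PD v m X T w) (p p' : Fin n) : (JJ w m T p p').card ≤ 8 * (Ln v p p').card := by
  have hex : ∀ j ∈ JJ w m T p p', ∃ p'' i k, Fr w m T p i j ∧ Fr w m T p' j k ∧ Fr w m T p'' i k := fun j hj => (mem_filter.1 hj).2
  haveI : Nonempty (Fin n) := ⟨p⟩
  choose! g hg using hex
  have hm : ∀ j ∈ JJ w m T p p', g j ∈ Ln v p p' := by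
    intro j hj
    obtain ⟨i, k, h1, h2, h3⟩ := hg j hj
    exact h1.pascal D h2 h3
  refine card_le_mul_card_image_of_maps_to hm 8 ?_
  intro q _
  apply JJ_fib D (p := p) (p' := p') (p'' := q)
  intro j hj
  rw [mem_filter] at hj
  have := hg j hj.1
  rwa [hj.2] at this

end
end DM

namespace DM

open Finset
open scoped Classical

noncomputable section
variable {n : ℕ} {v : Fin n → V3} {m : ℕ} {X : ℕ → Fin n} {T : ℕ → ℝ} {w : Fin n → V3}

lemma tri_count (F : Finset (ℕ × ℕ)) (hF : F ⊆ range m ×ˢ range m) :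
    m * (m * m) ≤ (((range m) ×ˢ (range m ×ˢ range m)).filter (fun x => (x.1, x.2.1) ∈ F ∧ (x.2.1, x.2.2) ∈ F ∧ (x.1, x.2.2) ∈ F)).card
      + 3 * (m * (m * m - F.card)) := by
  set A := (range m) ×ˢ (range m ×ˢ range m) with hA
  set G := A.filter (fun x => (x.1, x.2.1) ∈ F ∧ (x.2.1, x.2.2) ∈ F ∧ (x.1, x.2.2) ∈ F) with hG
  set N := (range m ×ˢ range m) \ F with hN
  have hNc : N.card = m * m - F.card := by
    rw [hN, card_sdiff_of_subset hF, card_product, card_range]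
  have hAc : A.card = m * (m * m) := by rw [hA, card_product, card_product, card_range]
  have b : ∀ (f : ℕ × (ℕ × ℕ) → (ℕ × ℕ) × ℕ), Function.Injective f → (∀ x ∈ A, (f x).1 ∈ range m ×ˢ range m ∧ (f x).2 ∈ range m) →
      (A.filter (fun x => (f x).1 ∉ F)).card ≤ m * (m * m - F.card) := by
    intro f hf hx
    have : (N ×ˢ range m).card = m * (m * m - F.card) := by rw [card_product, hNc, card_range, mul_comm]
    rw [← this]
    apply card_le_card_of_injOn f
    · intro x hx'
      rw [mem_coe, mem_filter] at hx'
      rw [mem_coe, mem_product, hN, mem_sdiff]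
      exact ⟨⟨(hx x hx'.1).1, hx'.2⟩, (hx x hx'.1).2⟩
    · exact hf.injOn
  have hsub : A ⊆ G ∪ (A.filter (fun x => (x.1, x.2.1) ∉ F) ∪ (A.filter (fun x => (x.2.1, x.2.2) ∉ F) ∪ A.filter (fun x => (x.1, x.2.2) ∉ F))) := by
    intro x hx
    simp only [mem_union, mem_filter, hG]
    by_cases h1 : (x.1, x.2.1) ∈ F <;> by_cases h2 : (x.2.1, x.2.2) ∈ F <;> by_cases h3 : (x.1, x.2.2) ∈ F <;> simp [hx, h1, h2, h3]
  have b1 := b (fun x => ((x.1, x.2.1), x.2.2)) (by rintro ⟨a, b, c⟩ ⟨a', b', c'⟩ h; simp at h ⊢; exact ⟨h.1.1, h.1.2, h.2⟩)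
    (by rintro ⟨a, b, c⟩ h; simp only [hA, mem_product] at h ⊢; exact ⟨⟨h.1, h.2.1⟩, h.2.2⟩)
  have b2 := b (fun x => ((x.2.1, x.2.2), x.1)) (by rintro ⟨a, b, c⟩ ⟨a', b', c'⟩ h; simp at h ⊢; exact ⟨h.2, h.1.1, h.1.2⟩)
    (by rintro ⟨a, b, c⟩ h; simp only [hA, mem_product] at h ⊢; exact ⟨⟨h.2.1, h.2.2⟩, h.1⟩)
  have b3 := b (fun x => ((x.1, x.2.2), x.2.1)) (by rintro ⟨a, b, c⟩ ⟨a', b', c'⟩ h; simp at h ⊢; exact ⟨h.1.1, h.2, h.1.2⟩)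
    (by rintro ⟨a, b, c⟩ h; simp only [hA, mem_product] at h ⊢; exact ⟨⟨h.1, h.2.2⟩, h.2.1⟩)
  simp only at b1 b2 b3
  have := card_le_card hsub
  have e1 := card_union_le G (A.filter (fun x => (x.1, x.2.1) ∉ F) ∪ (A.filter (fun x => (x.2.1, x.2.2) ∉ F) ∪ A.filter (fun x => (x.1, x.2.2) ∉ F)))
  have e2 := card_union_le (A.filter (fun x => (x.1, x.2.1) ∉ F)) (A.filter (fun x => (x.2.1, x.2.2) ∉ F) ∪ A.filter (fun x => (x.1, x.2.2) ∉ F))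
  have e3 := card_union_le (A.filter (fun x => (x.2.1, x.2.2) ∉ F)) (A.filter (fun x => (x.1, x.2.2) ∉ F))
  rw [← hAc]
  omega

lemma rich_pairs (hv : Cfg v) (D : PD v m X T w) (hm : 0 < m) {Pe : Finset (Fin n)} (hPe : ∀ p, ext (w p) → p ∈ Pe) :
    2 * (m * m) ≤ 6 * (m * m - (FF w m T).card) + Pe.card + Pe.card * Pe.card +
      ∑ L ∈ (lines v).filter (fun L => m ≤ 16 * L.card), L.card * L.card := by
  have hFs : FF w m T ⊆ range m ×ˢ range m := filter_subset _ _
  have h1 := tri_count (m := m) _ hFs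
  set F := FF w m T with hF
  set G3 := ((range m) ×ˢ (range m ×ˢ range m)).filter (fun x => (x.1, x.2.1) ∈ F ∧ (x.2.1, x.2.2) ∈ F ∧ (x.1, x.2.2) ∈ F) with hG3
  have hFF : ∀ {a b : ℕ}, (a, b) ∈ F → ∃ p, Fr w m T p a b := fun h => (mem_filter.1 h).2
  have h2 : G3.card ≤ ((Pe ×ˢ Pe).sigma (fun x => JJ w m T x.1 x.2)).card := by
    apply card_rel _ _ (fun x y => y.2 = x.2.1 ∧ Fr w m T y.1.1 x.1 x.2.1 ∧ Fr w m T y.1.2 x.2.1 x.2.2)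
    · rintro ⟨i, j, k⟩ hx
      rw [hG3, mem_filter, mem_product, mem_product] at hx
      obtain ⟨⟨hi, hj, hk⟩, f1, f2, f3⟩ := hx
      obtain ⟨p, hp⟩ := hFF f1
      obtain ⟨p', hp'⟩ := hFF f2
      obtain ⟨p'', hp''⟩ := hFF f3
      simp only at hp hp' hp''
      refine ⟨⟨(p, p'), j⟩, ?_, rfl, hp, hp'⟩
      rw [mem_sigma, mem_product, JJ, mem_filter]
      exact ⟨⟨hPe p hp.2.2.2.1, hPe p' hp'.2.2.2.1⟩, hj, p'', i, k, hp, hp', hp''⟩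
    · rintro ⟨i, j, k⟩ - ⟨i', j', k'⟩ - ⟨⟨p, p'⟩, c⟩ - ⟨h1, h2, h3⟩ ⟨h4, h5, h6⟩
      simp only at h1 h2 h3 h4 h5 h6
      subst h1; subst h4
      rw [h2.uniq1 D h5, h3.symm.uniq1 D h6.symm]
  set R := (lines v).filter (fun L => m ≤ 16 * L.card) with hR
  set G := (Pe ×ˢ Pe).filter (fun x => x.1 ≠ x.2 ∧ m ≤ 2 * (JJ w m T x.1 x.2).card) with hG
  set Dg := (Pe ×ˢ Pe).filter (fun x => x.1 = x.2) with hDg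
  have h3 : 2 * ((Pe ×ˢ Pe).sigma (fun x => JJ w m T x.1 x.2)).card ≤ m * (Pe.card * Pe.card) + (m * G.card + m * Dg.card) := by
    rw [card_sigma, mul_sum]
    have : ∀ x ∈ Pe ×ˢ Pe, 2 * (JJ w m T x.1 x.2).card ≤ m + ((if x.1 ≠ x.2 ∧ m ≤ 2 * (JJ w m T x.1 x.2).card then m else 0) + if x.1 = x.2 then m else 0) := by
      intro x _
      have hc : (JJ w m T x.1 x.2).card ≤ m := by
        have := card_le_card (filter_subset _ _ : JJ w m T x.1 x.2 ⊆ range m)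
        rwa [card_range] at this
      split_ifs <;> omega
    refine (sum_le_sum this).trans ?_
    rw [sum_add_distrib, sum_add_distrib, ← sum_filter, ← sum_filter, sum_const, sum_const, sum_const, card_product]
    simp only [smul_eq_mul]
    rw [mul_comm m G.card, mul_comm m Dg.card, mul_comm m]
  have h4 : Dg.card ≤ Pe.card := by
    apply card_le_card_of_injOn (fun x => x.1)
    · intro x hx; exact (mem_product.1 (mem_filter.1 hx).1).1
    · rintro ⟨a, b⟩ hx ⟨a', b'⟩ hx' h
      have e1 : a = b := (mem_filter.1 hx).2
      have e2 : a' = b' := (mem_filter.1 hx').2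
      simp only at h
      subst e1; subst e2; rw [h]
  have h5 : G.card ≤ ∑ L ∈ R, L.card * L.card := by
    have hm' : ∀ x ∈ G, Ln v x.1 x.2 ∈ R := by
      intro x hx
      have hx := (mem_filter.1 hx).2
      rw [hR, mem_filter]
      refine ⟨Ln_mem_lines hx.1, ?_⟩
      have := JJ_card D x.1 x.2
      omega
    rw [card_eq_sum_card_fiberwise hm']
    apply sum_le_sum
    intro L _
    rw [← card_product]
    apply card_le_card
    intro x hx
    rw [mem_filter] at hx
    rw [mem_product, ← hx.2]
    exact ⟨left_mem_Ln _ _ _, right_mem_Ln _ _ _⟩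
  set N := m * m - F.card
  set q := Pe.card
  set g := ∑ L ∈ R, L.card * L.card
  have h6 : m * (2 * (m * m)) ≤ m * (6 * N + q + q * q + g) := by
    have : m * G.card ≤ m * g := Nat.mul_le_mul_left _ h5
    have : m * Dg.card ≤ m * q := Nat.mul_le_mul_left _ h4
    nlinarith
  exact Nat.le_of_mul_le_mul_left h6 hm

end
end DM

namespace DM

open Finset
open scoped Classical

noncomputable section
variable {n : ℕ} {v : Fin n → V3}

def tri3 (α β γ u : V3) : V3 := (dot α u, dot β u, dot γ u)

lemma tri3_det (α β γ u1 u2 u3 : V3) : det3 (tri3 α β γ u1) (tri3 α β γ u2) (tri3 α β γ u3) = det3 α β γ * det3 u1 u2 u3 := by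
  simp [tri3, det3, dot, crs]; ring

lemma det3_smul3 (a b c : V3) (x y z : ℝ) : det3 (x • a) (y • b) (z • c) = x * y * z * det3 a b c := by
  simp [det3, dot, crs]; ring

lemma PD_of_cov (hv : Cfg v) (S : Finset (Fin n)) (α β γ : V3) (hdet : det3 α β γ ≠ 0)
    (hS : ∀ i ∈ S, dot α (v i) ≠ 0 ∧ dot α (v i) * dot γ (v i) = (dot β (v i)) ^ 2) :
    ∃ X T w, PD v S.card X T w ∧ (∀ a < S.card, X a ∈ S) ∧ (∀ q ∈ S, ∃ a < S.card, X a = q) ∧ (∀ p ∉ S, w p = tri3 α β γ (v p)) := by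
  set k : Fin n → ℝ := fun i => if i ∈ S then (dot α (v i))⁻¹ else 1 with hk
  have hk0 : ∀ i, k i ≠ 0 := by
    intro i
    simp only [hk]
    split_ifs with h
    · exact inv_ne_zero (hS i h).1
    · exact one_ne_zero
  set w : Fin n → V3 := fun i => k i • tri3 α β γ (v i) with hw
  set t : Fin n → ℝ := fun i => dot β (v i) / dot α (v i) with ht
  have hwS : ∀ i ∈ S, w i = (1, t i, t i ^ 2) := by
    intro i hi
    obtain ⟨h1, h2⟩ := hS i hi
    simp only [hw, hk, if_pos hi, tri3, ht]
    ext
    · simp [h1]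
    · simp; field_simp
    · simp; field_simp; linear_combination h2
  have hinj : Set.InjOn t S := by
    intro i hi j hj hij
    by_contra hne
    have hww : w i = w j := by rw [hwS i hi, hwS j hj, hij]
    have h0 : ∀ u, det3 (w i) (w j) (tri3 α β γ u) = 0 := by
      intro u; rw [hww]; exact det3_self12 _ _
    have h1 : det3 (v i) (v j) (crs (v i) (v j)) = 0 := by
      have := h0 (crs (v i) (v j))
      rw [show tri3 α β γ (crs (v i) (v j)) = (1 : ℝ) • tri3 α β γ (crs (v i) (v j)) by rw [one_smul]] at this
      simp only [hw] at this
      rw [det3_smul3, tri3_det] at this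
      have hh := mul_ne_zero (mul_ne_zero (hk0 i) (hk0 j)) one_ne_zero
      rcases mul_eq_zero.1 this with h | h
      · exact absurd h hh
      · exact (mul_eq_zero.1 h).resolve_left hdet
    rw [det3_def] at h1
    exact absurd h1 (dot_self_pos (hv.np i j hne)).ne'
  have hc : (S.image t).card = S.card := card_image_of_injOn hinj
  set f := (S.image t).orderEmbOfFin hc with hf
  have hX : ∀ a, ∃ i : Fin n, ∀ h : a < S.card, i ∈ S ∧ t i = f ⟨a, h⟩ := by
    intro a
    by_cases h : a < S.card
    · have := (S.image t).orderEmbOfFin_mem hc ⟨a, h⟩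
      obtain ⟨i, hi, hi'⟩ := mem_image.1 this
      exact ⟨i, fun _ => ⟨hi, hi'⟩⟩
    · exact ⟨⟨0, hv.pos_n⟩, fun h' => absurd h' h⟩
  choose X hX using hX
  refine ⟨X, fun a => t (X a), w, ⟨?_, ?_, ?_⟩, fun a h => (hX a h).1, ?_, ?_⟩
  · intro a b hab hb
    have h1 := (hX a (hab.trans hb)).2
    have h2 := (hX b hb).2
    show t (X a) < t (X b)
    rw [h1, h2, OrderEmbedding.lt_iff_lt]
    exact hab
  · intro a ha; exact hwS _ (hX a ha).1
  · intro i j l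
    simp only [hw]
    rw [det3_smul3, tri3_det]
    simp [hk0, hdet]
  · intro q hq
    have : t q ∈ Set.range f := by
      rw [hf, range_orderEmbOfFin]; exact mem_coe.2 (mem_image_of_mem _ hq)
    obtain ⟨⟨a, ha⟩, hat⟩ := this
    refine ⟨a, ha, hinj (hX a ha).1 hq ?_⟩
    rw [(hX a ha).2, hat]
  · intro p hp
    simp only [hw, hk, if_neg hp, one_smul]

def qf (c : Fin 6 → ℝ) (u : V3) : ℝ := c 0 * u.2.2 ^ 2 + c 1 * (u.1 * u.2.2) + c 2 * (u.2.1 * u.2.2) + c 3 * u.1 ^ 2 + c 4 * (u.1 * u.2.1) + c 5 * u.2.1 ^ 2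
def qp (c : Fin 6 → ℝ) (u v : V3) : ℝ := 2 * c 0 * (u.2.2 * v.2.2) + c 1 * (u.1 * v.2.2 + u.2.2 * v.1) + c 2 * (u.2.1 * v.2.2 + u.2.2 * v.2.1)
  + 2 * c 3 * (u.1 * v.1) + c 4 * (u.1 * v.2.1 + u.2.1 * v.1) + 2 * c 5 * (u.2.1 * v.2.1)

lemma qf_comb (c : Fin 6 → ℝ) (u v t : V3) (x y z : ℝ) : qf c (x • u + y • v + z • t) =
    x ^ 2 * qf c u + y ^ 2 * qf c v + z ^ 2 * qf c t + x * y * qp c u v + x * z * qp c u t + y * z * qp c v t := by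
  simp [qf, qp]; ring

lemma qf_smul (c : Fin 6 → ℝ) (u : V3) (x : ℝ) : qf c (x • u) = x ^ 2 * qf c u := by
  simp [qf]; ring

lemma exists_qf {H : MP} (hd : H.totalDegree ≤ 2) : ∃ c, ∀ z, E H z = qf c (hat z) := by
  obtain ⟨c, h0, h⟩ := exists_poly hd
  refine ⟨![c 0 0, c 1 0, c 0 1, c 2 0, c 1 1, c 0 2], fun z => ?_⟩
  rw [h]
  simp [sum_range_succ, qf, hat, h0 1 2, h0 2 1, h0 2 2, pow_two]
  ring

lemma qp_ne {H : MP} (hH : Irreducible H) (h2 : H.totalDegree = 2) {c : Fin 6 → ℝ} (hc : ∀ z, E H z = qf c (hat z)) {x y : ℝ × ℝ} (hxy : x ≠ y)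
    (hx : E H x = 0) (hy : E H y = 0) : qp c (hat x) (hat y) ≠ 0 := by
  intro h0
  have hw : ((y.1 - x.1, y.2 - x.2) : ℝ × ℝ) ≠ 0 := by
    intro h
    apply hxy
    simp only [Prod.mk_eq_zero] at h
    ext <;> linarith [h.1, h.2]
  apply no_line hH h2.ge hw (z := x)
  intro s
  rw [hc] at hx hy ⊢
  have : hat (x.1 + s * (y.1 - x.1, y.2 - x.2).1, x.2 + s * (y.1 - x.1, y.2 - x.2).2) = (1 - s) • hat x + s • hat y + (0 : ℝ) • hat y := by
    ext <;> simp [hat] <;> ring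
  rw [this, qf_comb, hx, hy, h0]; ring

lemma exists_PD {pt : Fin n → ℝ × ℝ} (hv : Cfg (lift pt)) {H : MP} (hH : Irreducible H) (h2 : H.totalDegree = 2) (h3 : 3 ≤ (zs pt H).card) :
    ∃ o ∈ zs pt H, ∃ X T w, PD (lift pt) ((zs pt H).card - 1) X T w ∧ (∀ a < (zs pt H).card - 1, X a ∈ zs pt H ∧ X a ≠ o) ∧
      (∀ q ∈ zs pt H, q ≠ o → ∃ a < (zs pt H).card - 1, X a = q) ∧ (∀ p ∉ zs pt H, (w p).2.1 ^ 2 ≠ (w p).1 * (w p).2.2) := by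
  obtain ⟨c, hc⟩ := exists_qf h2.le
  obtain ⟨o, x, y, ho, hx, hy, hox, hoy, hxy⟩ := two_lt_card_iff.1 (show 2 < (zs pt H).card by omega)
  have hd : det3 (lift pt o) (lift pt x) (lift pt y) ≠ 0 := by
    intro h
    rcases zs_gp hv hH h2 o ho x hx y hy hox (mem_Ln.2 h) with h | h
    · exact hoy h.symm
    · exact hxy h.symm
  set O := lift pt o with hO
  set X' := lift pt x with hX'
  set Y := lift pt y with hY
  set A := qp c O X' with hA
  set B := qp c O Y with hB
  set C := qp c X' Y with hC
  have hA0 : A ≠ 0 := qp_ne hH h2 hc (lift_inj hv hox) (mem_zs.1 ho) (mem_zs.1 hx)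
  have hB0 : B ≠ 0 := qp_ne hH h2 hc (lift_inj hv hoy) (mem_zs.1 ho) (mem_zs.1 hy)
  have hC0 : C ≠ 0 := qp_ne hH h2 hc (lift_inj hv hxy) (mem_zs.1 hx) (mem_zs.1 hy)
  have qO : qf c O = 0 := by rw [hO, lift, ← hc]; exact mem_zs.1 ho
  have qX : qf c X' = 0 := by rw [hX', lift, ← hc]; exact mem_zs.1 hx
  have qY : qf c Y = 0 := by rw [hY, lift, ← hc]; exact mem_zs.1 hy
  set d := det3 O X' Y with hdd
  set α : V3 := A • crs Y O + B • crs O X' with hα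
  set β : V3 := crs Y O with hβ
  set γ : V3 := (B / (A * C)) • crs X' Y + (1 / A) • crs Y O with hγ
  have ea : ∀ u, dot (crs X' Y) u = det3 u X' Y := by intro u; simp [det3, dot, crs]; ring
  have eb : ∀ u, dot (crs Y O) u = det3 O u Y := by intro u; simp [det3, dot, crs]; ring
  have ec : ∀ u, dot (crs O X') u = det3 O X' u := by intro u; simp [det3, dot, crs]
  have dα : ∀ u, dot α u = A * det3 O u Y + B * det3 O X' u := by
    intro u; rw [hα, dot_add_left, dot_smul_left, dot_smul_left, eb, ec]
  have dβ : ∀ u, dot β u = det3 O u Y := by intro u; rw [hβ, eb]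
  have dγ : ∀ u, dot γ u = B / (A * C) * det3 u X' Y + 1 / A * det3 O u Y := by
    intro u; rw [hγ, dot_add_left, dot_smul_left, dot_smul_left, ea, eb]
  have key : ∀ u, A * C * (dot α u * dot γ u - dot β u ^ 2) = B * d ^ 2 * qf c u := by
    intro u
    have h1 : d ^ 2 * qf c u = det3 u X' Y * det3 O u Y * A + det3 u X' Y * det3 O X' u * B + det3 O u Y * det3 O X' u * C := by
      rw [← qf_smul, hdd, cramer, qf_comb, qO, qX, qY]; ring
    rw [show B * d ^ 2 * qf c u = B * (d ^ 2 * qf c u) by ring, h1, dα, dβ, dγ]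
    field_simp
    ring
  have hdet : det3 α β γ ≠ 0 := by
    have e : det3 α β γ = B * (B / (A * C)) * det3 (crs O X') (crs Y O) (crs X' Y) := by
      rw [hα, hβ, hγ]
      generalize crs O X' = p
      generalize crs Y O = q
      generalize crs X' Y = r
      simp [det3, dot, crs]; ring
    have e2 : det3 (crs O X') (crs Y O) (crs X' Y) = - d ^ 2 := by
      rw [hdd]; simp [det3, dot, crs]; ring
    rw [e, e2]
    have := div_ne_zero hB0 (mul_ne_zero hA0 hC0)
    have hd2 : d ^ 2 ≠ 0 := pow_ne_zero 2 hd
    exact mul_ne_zero (mul_ne_zero hB0 this) (neg_ne_zero.2 hd2)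
  have hcon : ∀ i, i ∈ zs pt H ↔ dot α (lift pt i) * dot γ (lift pt i) = dot β (lift pt i) ^ 2 := by
    intro i
    rw [mem_zs, hc]
    have := key (lift pt i)
    constructor
    · intro h
      rw [show qf c (lift pt i) = 0 from h, mul_zero] at this
      rcases mul_eq_zero.1 this with h | h
      · exact absurd h (mul_ne_zero hA0 hC0)
      · linarith
    · intro h
      rw [h, sub_self, mul_zero] at this
      exact (mul_eq_zero.1 this.symm).resolve_left (mul_ne_zero hB0 (pow_ne_zero 2 hd))
  obtain ⟨X, T, w, D, h4, h5, h6⟩ := PD_of_cov hv ((zs pt H).erase o) α β γ hdet (by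
    intro i hi
    rw [mem_erase] at hi
    have h1 := (hcon i).1 hi.2
    refine ⟨fun h0 => ?_, h1⟩
    rw [h0, zero_mul] at h1
    have hb : dot β (lift pt i) = 0 := by
      have := h1.symm; exact pow_eq_zero_iff (two_ne_zero) |>.1 this
    rw [dα, ← dβ, hb, mul_zero, zero_add] at h0
    have hdd := (mul_eq_zero.1 h0).resolve_left hB0
    rw [dβ] at hb
    have hcr := cramer O X' Y (lift pt i)
    rw [hb, hdd, zero_smul, zero_smul, add_zero, add_zero] at hcr
    apply hi.1
    have : det3 O X' (lift pt i) = 0 := hdd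
    rcases zs_gp hv hH h2 o ho x hx i hi.2 hox (mem_Ln.2 hdd) with h | h
    · exact h
    · exfalso
      rw [h] at hb
      exact hd hb)
  rw [card_erase_of_mem ho] at D h4 h5
  refine ⟨o, ho, X, T, w, D, fun a ha => ?_, fun q hq hqo => h5 q (mem_erase.2 ⟨hqo, hq⟩), fun p hp => ?_⟩
  · have := h4 a ha
    rw [mem_erase] at this
    exact ⟨this.2, this.1⟩
  · rw [h6 p (fun h => hp (mem_erase.1 h).2)]
    simp only [tri3]
    intro h
    exact hp ((hcon p).2 h.symm)

end
end DM

namespace DM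

open Finset
open scoped Classical

noncomputable section
variable {n : ℕ} {v : Fin n → V3}

lemma um_le {pt : Fin n → ℝ × ℝ} (hv : Cfg (lift pt)) {H : MP} {o : Fin n} {m : ℕ} {X : ℕ → Fin n} {T : ℕ → ℝ} {w : Fin n → V3}
    (D : PD (lift pt) m X T w) (h4 : ∀ a < m, X a ∈ zs pt H ∧ X a ≠ o) (h5 : ∀ q ∈ zs pt H, q ≠ o → ∃ a < m, X a = q) (p : Fin n) :
    (um (lift pt) m X p).card ≤ (unp pt H p).card + 1 := by
  have hsp := card_filter_add_card_filter_not (s := um (lift pt) m X p) (fun a => X a ∈ unp pt H p)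
  have h1 : ((um (lift pt) m X p).filter (fun a => X a ∈ unp pt H p)).card ≤ (unp pt H p).card := by
    apply card_le_card_of_injOn X
    · intro a ha; exact (mem_filter.1 ha).2
    · intro a ha b hb hab
      have ha := mem_range.1 (mem_filter.1 (mem_filter.1 ha).1).1
      have hb := mem_range.1 (mem_filter.1 (mem_filter.1 hb).1).1
      exact D.X_inj ha hb hab
  have h2 : ((um (lift pt) m X p).filter (fun a => ¬ X a ∈ unp pt H p)).card ≤ 1 := by
    have key : ∀ a ∈ (um (lift pt) m X p).filter (fun a => ¬ X a ∈ unp pt H p), a < m ∧ Tri (lift pt) p (X a) o := by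
      intro a ha
      rw [mem_filter, um, mem_filter, mem_range] at ha
      obtain ⟨⟨ham, hno⟩, hun⟩ := ha
      rw [unp, mem_filter] at hun
      push Not at hun
      obtain ⟨q', hq', ht⟩ := hun (h4 a ham).1
      refine ⟨ham, ?_⟩
      by_cases hqo : q' = o
      · rwa [hqo] at ht
      · obtain ⟨b, hb, rfl⟩ := h5 q' hq' hqo
        exact absurd ⟨b, ham, hb, ht⟩ hno
    rw [card_le_one]
    intro a ha b hb
    obtain ⟨ha, ta⟩ := key a ha
    obtain ⟨hb, tb⟩ := key b hb
    exact D.X_inj ha hb ((ta.swap23 hv).uniq (tb.swap23 hv))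
  omega

lemma rich_num {N x s m q fs pe R : ℝ} (hx : 1 ≤ x) (hx2 : 200 * x ≤ N) (h1 : 2 * s ≤ N + x) (h2 : N - 2 * x ≤ 2 * s)
    (hm : m = s - 1) (hq : N - s - 2 * x ≤ q) (hf : q * (m - x) ≤ fs + m) (hpe0 : 0 ≤ pe) (hpe : pe + m ≤ N)
    (hr : 2 * (m * m) ≤ 6 * (m * m - fs) + pe + pe * pe + R) : N * N / 4 - 47 * (x * N) ≤ R := by
  have hm1 : N / 2 - 2 * x ≤ m := by linarith
  have hm2 : m ≤ N / 2 + x := by linarith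
  have hq1 : N / 2 - 3 * x ≤ q := by linarith
  have hpe2 : pe ≤ N / 2 + 2 * x := by linarith
  have hxN : N ≤ x * N := by nlinarith
  have e1 : (N / 2 - 3 * x) * (N / 2 - 3 * x) ≤ q * (m - x) :=
    mul_le_mul hq1 (by linarith) (by linarith) (by linarith)
  have e2 : m * m ≤ (N / 2 + x) * (N / 2 + x) := mul_le_mul hm2 hm2 (by linarith) (by linarith)
  have e3 : (N / 2 - 2 * x) * (N / 2 - 2 * x) ≤ m * m := mul_le_mul hm1 hm1 (by linarith) (by linarith)
  have e4 : pe * pe ≤ (N / 2 + 2 * x) * (N / 2 + 2 * x) := mul_le_mul hpe2 hpe2 hpe0 (by linarith)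
  have e5 : 200 * (x * x) ≤ x * N := by nlinarith
  have e6 : 0 ≤ x * x := mul_self_nonneg x
  nlinarith

lemma conic_num {K e B1 C D n s m at' q qe qi ff pe sg : ℕ} {R : Finset (Finset (Fin n))} (hK : 1 ≤ K) (he : e = 200 * K)
    (hC : C = 100 * B1 + 10 * D + 1000) (hneC : e * C ≤ n) (hsC : C ≤ s) (F1 : 2 * s ≤ n + D + 1) (hAtc : at' * e ≤ n) (hcov : n ≤ s + q + at')
    (F2 : q ≤ s + 2 * B1) (hm : m = s - 1) (hsp : qe + qi = q) (F3 : qi ≤ 4 * (B1 + 1) + 8) (F4 : qe * (m - 1 - (3 * (B1 + 1) + 1)) ≤ ff + m)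
    (hFm : ff ≤ m * m) (F5 : 2 * (m * m) ≤ 6 * (m * m - ff) + pe + pe * pe + ∑ L ∈ R, L.card * L.card) (hPec : pe + m ≤ n)
    (hsg : sg = ∑ L ∈ R, L.card) (G1 : 2 * ∑ L ∈ R, (L.card - 3) + 6 < n) (G2 : ∑ L ∈ R, (L.card - 3) + 3 * R.card = sg) 
    (G3 : sg ≤ 2 * ∑ L ∈ R, (L.card - 3)) (G4 : R.card * m ≤ 16 * sg) :
    K * n ≤ 2 * K * s + n ∧ ∃ L ∈ R, K * n ≤ 2 * K * L.card + n := by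
  have hx0 : (0 : ℝ) < e := by
    have : 0 < e := by omega
    exact_mod_cast this
  obtain ⟨x, hx⟩ : ∃ x : ℝ, x * e = n := ⟨n / e, by field_simp⟩
  have hCx : (C : ℝ) ≤ x := by
    have : (e : ℝ) * C ≤ n := by exact_mod_cast hneC
    rw [← hx, mul_comm] at this
    exact le_of_mul_le_mul_right this hx0
  have hKx : 200 * x * K = n := by
    rw [← hx, he]; push_cast; ring
  have hK1 : (1 : ℝ) ≤ K := by exact_mod_cast hK
  have hCv : (C : ℝ) = 100 * B1 + 10 * D + 1000 := by rw [hC]; push_cast; ring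
  have hB0 : (0 : ℝ) ≤ B1 := Nat.cast_nonneg _
  have hD0 : (0 : ℝ) ≤ D := Nat.cast_nonneg _
  have hx200 : 200 * x ≤ n := by nlinarith only [hKx, hK1, hCx, hCv, hB0, hD0]
  have hAtx : (at' : ℝ) ≤ x := by
    have : (at' : ℝ) * e ≤ n := by exact_mod_cast hAtc
    rw [← hx] at this
    exact le_of_mul_le_mul_right this hx0
  have r1 : 2 * (s : ℝ) ≤ n + x := by
    have : 2 * (s : ℝ) ≤ n + D + 1 := by exact_mod_cast F1
    linarith
  have rcov : (n : ℝ) ≤ s + q + at' := by exact_mod_cast hcov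
  have r2 : (n : ℝ) - 2 * x ≤ 2 * s := by
    have : (q : ℝ) ≤ s + 2 * B1 := by exact_mod_cast F2
    linarith
  have hmr : (m : ℝ) = s - 1 := by
    rw [hm, Nat.cast_sub (by omega)]; simp
  have rq : (n : ℝ) - s - 2 * x ≤ qe := by
    have a1 : (qe : ℝ) + qi = q := by exact_mod_cast hsp
    have a2 : (qi : ℝ) ≤ 4 * (B1 + 1) + 8 := by exact_mod_cast F3
    linarith
  have rf : (qe : ℝ) * (m - x) ≤ ff + m := by
    have a1 : (qe : ℝ) * ((m - 1 - (3 * (B1 + 1) + 1) : ℕ) : ℝ) ≤ ff + m := by exact_mod_cast F4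
    refine le_trans (mul_le_mul_of_nonneg_left ?_ (Nat.cast_nonneg _)) a1
    have a2 : m ≤ (m - 1 - (3 * (B1 + 1) + 1)) + (3 * (B1 + 1) + 2) := by omega
    have a3 : (m : ℝ) ≤ ((m - 1 - (3 * (B1 + 1) + 1) : ℕ) : ℝ) + (3 * (B1 + 1) + 2) := by exact_mod_cast a2
    linarith
  have rr : 2 * ((m : ℝ) * m) ≤ 6 * (m * m - ff) + pe + pe * pe + ((∑ L ∈ R, L.card * L.card : ℕ) : ℝ) := by
    have : ((2 * (m * m) : ℕ) : ℝ) ≤ ((6 * (m * m - ff) + pe + pe * pe + ∑ L ∈ R, L.card * L.card : ℕ) : ℝ) := by exact_mod_cast F5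
    push_cast [Nat.cast_sub hFm] at this ⊢
    linarith
  have fin := rich_num (by linarith) hx200 r1 r2 hmr rq rf (Nat.cast_nonneg _) (by exact_mod_cast hPec) rr
  have hRc : R.card ≤ 48 := by
    have a1 : n ≤ 3 * m := by
      have : (n : ℝ) ≤ 3 * m := by linarith
      exact_mod_cast this
    have a2 : R.card * m ≤ 48 * m := by omega
    exact Nat.le_of_mul_le_mul_right a2 (by omega)
  have hsgr : 2 * (sg : ℝ) ≤ n + 288 := by
    have : 2 * sg ≤ n + 288 := by omega
    exact_mod_cast this
  have hsK : K * n ≤ 2 * K * s + n := by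
    have a1 := mul_le_mul_of_nonneg_left r2 (show (0 : ℝ) ≤ K by linarith)
    have a2 : (0 : ℝ) ≤ K * x := mul_nonneg (by linarith) (by linarith)
    have : (K : ℝ) * n ≤ 2 * K * s + n := by linarith only [a1, hKx, a2]
    exact_mod_cast this
  refine ⟨hsK, ?_⟩
  by_contra hcon
  have hall : ∀ L ∈ R, (L.card : ℝ) ≤ n / 2 - 100 * x := by
    intro L hL
    by_contra h
    push Not at h
    apply hcon
    refine ⟨L, hL, ?_⟩
    have a1 := mul_le_mul_of_nonneg_left h.le (show (0 : ℝ) ≤ K by linarith)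
    have : (K : ℝ) * n ≤ 2 * K * L.card + n := by linarith only [a1, hKx]
    exact_mod_cast this
  have hup : ((∑ L ∈ R, L.card * L.card : ℕ) : ℝ) ≤ (n / 2 - 100 * x) * sg := by
    rw [hsg]
    push_cast
    rw [mul_sum]
    apply sum_le_sum
    intro L hL
    exact mul_le_mul_of_nonneg_right (hall L hL) (Nat.cast_nonneg _)
  have : (n / 2 - 100 * x) * (sg : ℝ) ≤ (n / 2 - 100 * x) * ((n + x) / 2) :=
    mul_le_mul_of_nonneg_left (by linarith) (by linarith)
  have h3 := mul_pos (show (0 : ℝ) < x by linarith) (show (0 : ℝ) < n by linarith)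
  have h4 : (0 : ℝ) ≤ x * x := mul_self_nonneg x
  linarith only [this, hup, fin, h3, h4]

set_option maxHeartbeats 1000000 in
lemma conic_core {K e B1 C D : ℕ} (hK : 1 ≤ K) (hD : 0 < D) (he : e = 200 * K) (hB1 : B1 = 8 * (5569 * e + 1)) (hC : C = 100 * B1 + 10 * D + 1000)
    {pt : Fin n → ℝ × ℝ} (hneC : e * C ≤ n) (hnDC : D * C ≤ n) (hv : Cfg (lift pt)) (hN : 2 * N2 (lift pt) < n) {H : MP} (hH : Irreducible H)
    (h2 : H.totalDegree = 2) (hDs : n ≤ D * (zs pt H).card) :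
    ∃ L ∈ lines (lift pt), K * n ≤ 2 * K * L.card + n ∧ K * n ≤ 2 * K * (zs pt H).card + n := by
  set S := zs pt H with hS
  set s := S.card with hs
  have hsC : C ≤ s := by
    have : D * C ≤ D * s := by omega
    exact Nat.le_of_mul_le_mul_left this hD
  have hgp := zs_gp hv hH h2
  have hsn : s ≤ n := by simpa using card_le_univ S
  have F1 : 2 * s ≤ n + D + 1 := by
    have h := pair_up hv hgp
    rw [← hS, ← hs] at h
    have h' : s * s ≤ s * (1 + D + (n - s)) := by
      have e1 : s * (1 + D + (n - s)) = s + D * s + (n - s) * s := by ring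
      omega
    have := Nat.le_of_mul_le_mul_left h' (by omega)
    omega
  set At := univ.filter (fun p => 5569 * e < bad (lift pt) p) with hAt
  have hAtc : At.card * e ≤ n := atyp hv hN e
  set Q := univ.filter (fun p => p ∉ S ∧ bad (lift pt) p ≤ 5569 * e) with hQ
  have hQu : ∀ p ∈ Q, p ∉ S ∧ (unp pt H p).card ≤ B1 := by
    intro p hp
    rw [hQ, mem_filter] at hp
    refine ⟨hp.2.1, ?_⟩
    have := conic_off hv hH h2 (p := p) (fun h => hp.2.1 (mem_zs.2 h))
    have := hp.2.2
    omega
  have hcov : n ≤ s + Q.card + At.card := by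
    have h1 : (univ : Finset (Fin n)) ⊆ (S ∪ Q) ∪ At := by
      intro p _
      by_cases h : p ∈ S
      · exact mem_union_left _ (mem_union_left _ h)
      · by_cases h' : bad (lift pt) p ≤ 5569 * e
        · exact mem_union_left _ (mem_union_right _ (mem_filter.2 ⟨mem_univ _, h, h'⟩))
        · exact mem_union_right _ (mem_filter.2 ⟨mem_univ _, by omega⟩)
    have h2 := card_le_card h1
    have h3 := card_union_le (S ∪ Q) At
    have h4 := card_union_le S Q
    simp only [card_univ, Fintype.card_fin] at h2
    omega
  have F2 : Q.card ≤ s + 2 * B1 := by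
    have h := pair_dn hv hQu
    rw [← hs] at h
    by_contra hcon
    push Not at hcon
    have h1 : (s + 2 * B1) * (s - B1) ≤ s * s - s := le_trans (Nat.mul_le_mul_right _ hcon.le) h
    obtain ⟨d, hd⟩ := Nat.exists_eq_add_of_le (show 2 * B1 ≤ s by omega)
    rw [show s - B1 = d + B1 by omega] at h1
    have h5 : s * s ≤ (s + 2 * B1) * (d + B1) := by rw [hd]; nlinarith
    have h6 : 0 < s * s := by have : 0 < s := by omega
                              positivity
    omega
  obtain ⟨o, ho, X, T, w, PDh, h4, h5, h6⟩ := exists_PD hv hH h2 (show 3 ≤ s by omega)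
  rw [← hS] at h6
  rw [← hS, ← hs] at PDh h4 h5
  set m := s - 1 with hm
  have hum : ∀ p ∈ Q, (um (lift pt) m X p).card ≤ B1 + 1 := by
    intro p hp
    have := um_le hv PDh h4 h5 p
    have := (hQu p hp).2
    omega
  have hsp := card_filter_add_card_filter_not (s := Q) (fun p => ext (w p))
  set Qe := Q.filter (fun p => ext (w p)) with hQe
  set Qi := Q.filter (fun p => ¬ ext (w p)) with hQi
  have F3 : Qi.card ≤ 4 * (B1 + 1) + 8 := by
    have h := int_card hv PDh (Q := Qi) (B := B1 + 1) (by
      intro p hp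
      rw [hQi, mem_filter] at hp
      refine ⟨?_, hum p hp.1⟩
      have a1 := h6 p (hQu p hp.1).1
      have a2 := hp.2
      unfold ext at a2
      push Not at a2
      exact lt_of_le_of_ne a2 a1)
    have h1 : m * Qi.card ≤ m * (4 * (B1 + 1) + 8) := by
      have a1 : m ≤ 2 * (m - (B1 + 1)) := by omega
      have a2 := Nat.mul_le_mul_left Qi.card a1
      nlinarith
    exact Nat.le_of_mul_le_mul_left h1 (by omega)
  have F4 := FF_card hv PDh (Q := Qe) (B := B1 + 1) (by
    intro p hp
    rw [hQe, mem_filter] at hp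
    exact ⟨hp.2, hum p hp.1⟩)
  set Pe := univ.filter (fun p => ext (w p)) with hPe
  have F5 := rich_pairs hv PDh (by omega) (Pe := Pe) (fun p hp => mem_filter.2 ⟨mem_univ _, hp⟩)
  have hPec : Pe.card + m ≤ n := by
    have h1 : ((range m).image X).card = m := by
      rw [card_image_of_injOn, card_range]
      intro a ha b hb hab
      exact PDh.X_inj (mem_range.1 ha) (mem_range.1 hb) hab
    have h2 : Disjoint Pe ((range m).image X) := by
      rw [disjoint_left]
      intro p hp hp'
      obtain ⟨a, ha, rfl⟩ := mem_image.1 hp'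
      have := (mem_filter.1 hp).2
      rw [PDh.wX a (mem_range.1 ha)] at this
      unfold ext at this
      simp at this
    have h3 := card_le_univ (Pe ∪ (range m).image X)
    rw [card_union_of_disjoint h2, h1, Fintype.card_fin] at h3
    exact h3
  -- numbers
  set R := (lines (lift pt)).filter (fun L => m ≤ 16 * L.card) with hR
  set sg := ∑ L ∈ R, L.card with hsg
  have G1 := rich_sum hv hN R (filter_subset _ _)
  have hLb : ∀ L ∈ R, 6 ≤ L.card ∧ m ≤ 16 * L.card := by
    intro L hL
    have := (mem_filter.1 hL).2
    omega
  have G2 : ∑ L ∈ R, (L.card - 3) + 3 * R.card = sg := by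
    rw [hsg, mul_comm, ← smul_eq_mul, ← sum_const, ← sum_add_distrib]
    apply sum_congr rfl
    intro L hL
    have := hLb L hL
    omega
  have G3 : sg ≤ 2 * ∑ L ∈ R, (L.card - 3) := by
    rw [hsg, mul_sum]
    apply sum_le_sum
    intro L hL
    have := hLb L hL
    omega
  have G4 : R.card * m ≤ 16 * sg := by
    rw [hsg, mul_sum, ← smul_eq_mul]
    apply card_nsmul_le_sum
    intro L hL
    exact (hLb L hL).2
  have hFm : (FF w m T).card ≤ m * m := by
    have := card_le_card (filter_subset (fun x : ℕ × ℕ => ∃ p, Fr w m T p x.1 x.2) (range m ×ˢ range m))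
    rw [card_product, card_range] at this
    exact this
  obtain ⟨hsK, L, hL, hLK⟩ := conic_num hK he hC hneC hsC F1 hAtc hcov F2 hm hsp F3 F4 hFm F5 hPec hsg G1 G2 G3 G4
  exact ⟨L, (mem_filter.1 hL).1, hLK, hsK⟩

lemma conic_struct (K : ℕ) (hK : 1 ≤ K) : ∃ N0, ∀ n ≥ N0, ∀ pt : Fin n → ℝ × ℝ, Cfg (lift pt) → 2 * N2 (lift pt) < n →
    ∃ H : MP, Irreducible H ∧ H.totalDegree = 2 ∧ ∃ L ∈ lines (lift pt), K * n ≤ 2 * K * L.card + n ∧ K * n ≤ 2 * K * (zs pt H).card + n := by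
  obtain ⟨D, Na, hD, hcomp⟩ := exists_comp 2 le_rfl
  obtain ⟨Nb, hcub⟩ := no_cubic D
  obtain ⟨e, he⟩ : ∃ e, e = 200 * K := ⟨_, rfl⟩
  obtain ⟨B1, hB1⟩ : ∃ B1, B1 = 8 * (5569 * e + 1) := ⟨_, rfl⟩
  obtain ⟨C, hC⟩ : ∃ C, C = 100 * B1 + 10 * D + 1000 := ⟨_, rfl⟩
  refine ⟨Na + Nb + e * C + D * C, ?_⟩
  intro n hn pt hv hN
  obtain ⟨H, hH, hd2, hd3, hDs⟩ := hcomp n (by omega) pt hv hN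
  have h2 : H.totalDegree = 2 := by
    by_contra hne
    exact hcub n (by omega) pt hv hN H hH (by omega) hDs
  exact ⟨H, hH, h2, conic_core hK hD he hB1 hC (by omega) (by omega) hv hN hH h2 hDs⟩

end
end DM

namespace DM

open Finset
open scoped Classical

noncomputable section
variable {n : ℕ} {v : Fin n → V3}

lemma det3_orth {l a b c : V3} (hl : l ≠ 0) (ha : dot l a = 0) (hb : dot l b = 0) (hc : dot l c = 0) : det3 a b c = 0 := by
  have h := congrArg (dot l) (cramer a b c l)
  rw [dot_smul_right, dot_add_right, dot_add_right, dot_smul_right, dot_smul_right, dot_smul_right, ha, hb, hc] at h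
  have := (dot_self_pos hl).ne'
  simp only [mul_zero, add_zero] at h
  exact (mul_eq_zero.1 h).resolve_right this

lemma det3_aff {l y q u u' : V3} (hl : l ≠ 0) (hy : dot l y = 0) (hq : dot l q = 1) (hu : dot l u = 1) (hu' : dot l u' = 1) :
    det3 y u u' = det3 y q u' - det3 y q u := by
  have h := det3_orth hl hy (show dot l (u - q) = 0 by rw [dot_sub_right, hu, hq, sub_self])
    (show dot l (u' - q) = 0 by rw [dot_sub_right, hu', hq, sub_self])
  have e : det3 y (u - q) (u' - q) = det3 y u u' - (det3 y q u' - det3 y q u) := by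
    simp [det3, dot, crs]; ring
  rw [e] at h
  linarith

def sb (b : Bool) : ℝ := if b then 1 else -1

lemma sb_ne {a b : Bool} (h : a ≠ b) : sb a = - sb b := by
  cases a <;> cases b <;> simp [sb] at *

lemma exists_sb {x : ℝ} (h : x ≠ 0) : ∃ b, 0 < sb b * x := by
  rcases lt_or_gt_of_ne h with h | h
  · exact ⟨false, by simp [sb, h]⟩
  · exact ⟨true, by simp [sb, h]⟩

lemma sb_mul_self (b : Bool) : sb b * sb b = 1 := by cases b <;> simp [sb]

lemma hull (hv : Cfg v) {L : Finset (Fin n)} (hL : L ∈ lines v) {S : Finset (Fin n)} (hS : gpS v S) (hSL : ∀ z ∈ S, z ∉ L) (h3 : 3 ≤ S.card) :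
    2 * L.card ≤ ((S ×ˢ L).filter (fun x => Ln v x.1 x.2 = {x.1, x.2})).card + S.card + 2 * ((S ∪ L)ᶜ).card := by
  obtain ⟨i, j, hij, hLe⟩ := mem_lines.1 hL
  set l := crs (v i) (v j) with hl
  have hl0 : l ≠ 0 := hv.np i j hij
  have hmL : ∀ z, z ∈ L ↔ dot l (v z) = 0 := by
    intro z; rw [← hLe, mem_Ln, det3_def]
  obtain ⟨a0, b0, c0, ha0, hb0, hc0, hab0, hac0, hbc0⟩ := two_lt_card_iff.1 (show 2 < S.card by omega)
  have hnc : ∀ y x, y ≠ x → ¬ ∀ z ∈ S, z ∈ Ln v y x := by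
    intro y x hyx h
    have e := hv.Ln_eq hyx hab0 (h a0 ha0) (h b0 hb0)
    rcases hS a0 ha0 b0 hb0 c0 hc0 hab0 (by rw [e]; exact h c0 hc0) with h | h
    · exact hac0 h.symm
    · exact hbc0 h.symm
  set k : Fin n → ℝ := fun z => (dot l (v z))⁻¹ with hk
  set e : Fin n → V3 := fun z => k z • v z with he
  have hk0 : ∀ z, z ∉ L → k z ≠ 0 := fun z hz => inv_ne_zero (fun h => hz ((hmL z).2 h))
  have he1 : ∀ z, z ∉ L → dot l (e z) = 1 := by
    intro z hz
    rw [he]; simp only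
    rw [dot_smul_right, hk]
    exact inv_mul_cancel₀ (fun h => hz ((hmL z).2 h))
  have hF0 : ∀ y z z', z ∉ L → z' ∉ L → (det3 (v y) (e z) (e z') = 0 ↔ z' ∈ Ln v y z) := by
    intro y z z' hz hz'
    rw [mem_Ln, ← one_smul ℝ (v y), he]
    simp only
    rw [det3_smul3, one_smul]
    simp [hk0 z hz, hk0 z' hz']
  clear_value e
  have hmax : ∀ (y : Fin n) (σ : Bool), ∃ x, y ∈ L → x ∈ S ∧ ∀ z ∈ S, sb σ * det3 (v y) (e x) (e z) ≤ 0 := by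
    intro y σ
    obtain ⟨x, hx, hm⟩ := exists_max_image S (fun z => sb σ * det3 (v y) (e a0) (e z)) ⟨a0, ha0⟩
    refine ⟨x, fun hy => ⟨hx, fun z hz => ?_⟩⟩
    rw [det3_aff hl0 ((hmL y).1 hy) (he1 a0 (hSL a0 ha0)) (he1 x (hSL x hx)) (he1 z (hSL z hz))]
    have := hm z hz
    linarith
  choose X hX using hmax
  have hne : ∀ y ∈ L, ∀ σ, y ≠ X y σ := fun y hy σ h => hSL _ (hX y σ hy).1 (h ▸ hy)
  -- both maximisers cannot lie on one line through `y`
  have hboth : ∀ y ∈ L, ∀ σ σ', X y σ' ∈ Ln v y (X y σ) → σ = σ' := by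
    intro y hy σ σ' h
    by_contra hss
    obtain ⟨h1, h2⟩ := hX y σ hy
    obtain ⟨h1', h2'⟩ := hX y σ' hy
    apply hnc y (X y σ) (hne y hy σ)
    intro z hz
    rw [← hF0 y _ z (hSL _ h1) (hSL z hz)]
    have h0 := (hF0 y _ _ (hSL _ h1) (hSL _ h1')).2 h
    have a1 := h2 z hz
    have a2 := h2' z hz
    have yl := (hmL y).1 hy
    rw [sb_ne hss] at a1
    rw [det3_aff hl0 yl (he1 _ (hSL _ h1)) (he1 _ (hSL _ h1')) (he1 z (hSL z hz)), h0] at a2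
    have a3 : sb σ' * det3 (v y) (e (X y σ)) (e z) = 0 := by linarith
    have : sb σ' ≠ 0 := by intro h; have := sb_mul_self σ'; rw [h] at this; simp at this
    exact (mul_eq_zero.1 a3).resolve_left this
  have hstrict : ∀ y ∈ L, ∀ σ, ∀ z ∈ S, z ∉ Ln v y (X y σ) → sb σ * det3 (v y) (e (X y σ)) (e z) < 0 := by
    intro y hy σ z hz hzn
    obtain ⟨h1, h2⟩ := hX y σ hy
    refine lt_of_le_of_ne (h2 z hz) (fun h => hzn ?_)
    rw [← hF0 y _ z (hSL _ h1) (hSL z hz)]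
    have : sb σ ≠ 0 := by intro h; have := sb_mul_self σ; rw [h] at this; simp at this
    exact (mul_eq_zero.1 h).resolve_left this
  set A : Finset (Fin n × Bool) := L ×ˢ univ with hA
  have hAc : A.card = 2 * L.card := by rw [hA, card_product]; simp [mul_comm]
  set P1 : Fin n × Bool → Prop := fun f => Ln v (X f.1 f.2) f.1 = {X f.1 f.2, f.1} with hP1
  set P2 : Fin n × Bool → Prop := fun f => ∃ x' ∈ S, x' ≠ X f.1 f.2 ∧ x' ∈ Ln v f.1 (X f.1 f.2) with hP2
  have hsp1 := card_filter_add_card_filter_not (s := A) P1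
  have hsp2 := card_filter_add_card_filter_not (s := A.filter (fun f => ¬ P1 f)) P2
  have c1 : (A.filter P1).card ≤ ((S ×ˢ L).filter (fun x => Ln v x.1 x.2 = {x.1, x.2})).card := by
    apply card_rel _ _ (fun f x => x.1 = X f.1 f.2 ∧ x.2 = f.1)
    · rintro ⟨y, σ⟩ hf
      rw [mem_filter, hA, mem_product] at hf
      exact ⟨(X y σ, y), mem_filter.2 ⟨mem_product.2 ⟨(hX y σ hf.1.1).1, hf.1.1⟩, hf.2⟩, rfl, rfl⟩
    · rintro ⟨y, σ⟩ hf ⟨y', σ'⟩ hf' ⟨x, y''⟩ hx ⟨h1, h2⟩ ⟨h1', h2'⟩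
      simp only at h1 h2 h1' h2'
      subst h2; subst h2'
      rw [mem_filter, hA, mem_product] at hf
      rw [hboth y'' hf.1.1 σ σ' (by rw [← h1', h1]; exact right_mem_Ln _ _ _)]
  have c2 : ((A.filter (fun f => ¬ P1 f)).filter P2).card ≤ S.card := by
    apply card_rel _ _ (fun f a => ∃ b ∈ S, a ≠ b ∧ f.1 ∈ Ln v a b ∧ X f.1 f.2 ∈ Ln v a b ∧ ∀ z ∈ S, z ≠ a → z ≠ b → 0 < det3 (e a) (e b) (e z))
    · rintro ⟨y, σ⟩ hf
      rw [mem_filter, mem_filter, hA, mem_product] at hf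
      obtain ⟨⟨⟨hy, -⟩, -⟩, x', hx', hne', hon⟩ := hf
      simp only at hy hne' hon
      have hxS := (hX y σ hy).1
      have hyx := hne y hy σ
      have hyon : y ∈ Ln v (X y σ) x' := by
        rw [mem_Ln] at hon ⊢; rw [← hon]; exact det3_rot _ _ _
      have hcr : crs (e (X y σ)) (e x') ≠ 0 := by
        have : crs (e (X y σ)) (e x') = (k (X y σ) * k x') • crs (v (X y σ)) (v x') := by
          rw [he]; ext <;> simp [crs] <;> ring
        rw [this]
        exact smul_ne_zero (mul_ne_zero (hk0 _ (hSL _ hxS)) (hk0 _ (hSL _ hx'))) (hv.np _ _ hne'.symm)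
      obtain ⟨α, β, hαβ⟩ := exists_comb hcr (c := v y) (by
        rw [det3_rot]; exact (hF0 y _ _ (hSL _ hxS) (hSL _ hx')).2 hon)
      have hab : α + β = 0 := by
        have h := congrArg (dot l) hαβ
        rw [(hmL y).1 hy, dot_add_right, dot_smul_right, dot_smul_right, he1 _ (hSL _ hxS), he1 _ (hSL _ hx')] at h
        linarith
      have hdet : ∀ z, det3 (v y) (e (X y σ)) (e z) = α * det3 (e (X y σ)) (e x') (e z) := by
        intro z
        rw [hαβ, show β = - α by linarith]
        simp [det3, dot, crs]; ring
      have hline : ∀ z ∈ S, z ≠ X y σ → z ≠ x' → z ∉ Ln v y (X y σ) := by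
        intro z hz h1 h2 h
        have e1 := hv.Ln_eq hyx hne'.symm (right_mem_Ln _ _ _) hon
        rw [← e1] at h
        rcases hS _ hxS _ hx' z hz hne'.symm h with h | h
        · exact h1 h
        · exact h2 h
      have hpos : ∀ z ∈ S, z ≠ X y σ → z ≠ x' → sb σ * α * det3 (e (X y σ)) (e x') (e z) < 0 := by
        intro z hz h1 h2
        have := hstrict y hy σ z hz (hline z hz h1 h2)
        rw [hdet] at this
        linarith
      rcases le_or_gt (sb σ * α) 0 with hs | hs
      · refine ⟨X y σ, hxS, x', hx', hne'.symm, hyon, left_mem_Ln _ _ _, fun z hz h1 h2 => ?_⟩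
        have := hpos z hz h1 h2
        by_contra hcon
        push Not at hcon
        nlinarith
      · refine ⟨x', hx', X y σ, hxS, hne', by rw [Ln_comm]; exact hyon, right_mem_Ln _ _ _, fun z hz h1 h2 => ?_⟩
        have := hpos z hz h2 h1
        rw [det3_swap12]
        by_contra hcon
        push Not at hcon
        nlinarith
    · rintro ⟨y, σ⟩ hf ⟨y', σ'⟩ hf' a ha ⟨b, hb, hab, h1, h2, h4⟩ ⟨b', hb', hab', h1', h2', h4'⟩
      rw [mem_filter, mem_filter, hA, mem_product] at hf hf'
      have hy := hf.1.1.1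
      have hy' := hf'.1.1.1
      simp only at h1 h2 h1' h2' hy hy'
      have hbb : b = b' := by
        by_contra hbb
        have a1 := h4 b' hb' hab'.symm (Ne.symm hbb)
        have a2 := h4' b hb hab.symm hbb
        rw [det3_swap23] at a2
        linarith
      subst hbb
      have hyy : y = y' := by
        by_contra hyy
        have := hv.line_inter hL (Ln_mem_lines hab) hyy hy hy' h1 h1'
        exact hSL a ha (by rw [this]; exact left_mem_Ln _ _ _)
      subst hyy
      rw [hboth y hy σ σ' (by rw [hv.Ln_eq hab (hne y hy σ) h1 h2]; exact h2')]
  have c3 : ((A.filter (fun f => ¬ P1 f)).filter (fun f => ¬ P2 f)).card ≤ 2 * ((S ∪ L)ᶜ).card := by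
    have hc : (((S ∪ L)ᶜ) ×ˢ (univ : Finset Bool)).card = 2 * ((S ∪ L)ᶜ).card := by rw [card_product]; simp [mul_comm]
    rw [← hc]
    apply card_rel _ _ (fun f x => x.1 ∈ Ln v f.1 (X f.1 f.2) ∧ ∀ z ∈ S, z ≠ X f.1 f.2 → 0 < sb x.2 * det3 (v x.1) (e (X f.1 f.2)) (e z))
    · rintro ⟨y, σ⟩ hf
      rw [mem_filter, mem_filter, hA, mem_product] at hf
      obtain ⟨⟨⟨hy, -⟩, hn1⟩, hn2⟩ := hf
      simp only [hP1, hP2] at hy hn1 hn2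
      push Not at hn2
      have hxS := (hX y σ hy).1
      have hyx := hne y hy σ
      have : ∃ w ∈ Ln v y (X y σ), w ≠ y ∧ w ≠ X y σ := by
        by_contra hcon
        push Not at hcon
        apply hn1
        rw [Ln_comm]
        ext w
        rw [mem_insert, mem_singleton]
        constructor
        · intro hw
          by_cases h : w = y
          · exact Or.inr h
          · exact Or.inl (hcon w hw h)
        · rintro (rfl | rfl)
          · exact right_mem_Ln _ _ _
          · exact left_mem_Ln _ _ _
      obtain ⟨w, hw, hwy, hwx⟩ := this
      have hwS : w ∉ S := fun h => hn2 w h hwx hw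
      have hwL : w ∉ L := by
        intro h
        have := hv.line_inter hL (Ln_mem_lines hyx) hwy h hy hw (left_mem_Ln _ _ _)
        exact hSL _ hxS (by rw [this]; exact right_mem_Ln _ _ _)
      obtain ⟨α, β, hαβ⟩ := exists_comb (hv.np _ _ hyx) (mem_Ln.1 hw)
      have hα : α ≠ 0 := by
        intro h0
        rw [h0, zero_smul, zero_add] at hαβ
        apply hv.np _ _ hwx
        rw [hαβ]
        ext <;> simp [crs] <;> ring
      have hdet : ∀ z, det3 (v w) (e (X y σ)) (e z) = α * det3 (v y) (e (X y σ)) (e z) := by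
        intro z
        rw [hαβ, he]
        simp [det3, dot, crs]; ring
      have hsσ : sb σ * α ≠ 0 := mul_ne_zero (by intro h; have := sb_mul_self σ; rw [h] at this; simp at this) hα
      obtain ⟨τ, hτ⟩ := exists_sb (neg_ne_zero.2 hsσ)
      refine ⟨(w, τ), mem_product.2 ⟨by rw [mem_compl, mem_union]; exact fun h => h.elim hwS hwL, mem_univ _⟩, hw, fun z hz hzx => ?_⟩
      have h1 := hstrict y hy σ z hz (hn2 z hz hzx)
      simp only
      rw [hdet]
      have h2 := sb_mul_self σ
      have h5 : sb τ * (α * det3 (v y) (e (X y σ)) (e z)) = (sb τ * -(sb σ * α)) * (- (sb σ * det3 (v y) (e (X y σ)) (e z))) := by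
        linear_combination (- sb τ * α * det3 (v y) (e (X y σ)) (e z)) * h2
      rw [h5]
      exact mul_pos hτ (by linarith)
    · rintro ⟨y, σ⟩ hf ⟨y', σ'⟩ hf' ⟨w, τ⟩ hw ⟨h1, h2⟩ ⟨h1', h2'⟩
      rw [mem_filter, mem_filter, hA, mem_product] at hf hf'
      have hy := hf.1.1.1
      have hy' := hf'.1.1.1
      rw [mem_product, mem_compl, mem_union] at hw
      simp only at h1 h2 h1' h2' hy hy' hw
      have hw := hw.1
      push Not at hw
      have hxS := (hX y σ hy).1
      have hxS' := (hX y' σ' hy').1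
      have hxx : X y σ = X y' σ' := by
        by_contra hxx
        have a1 := h2 _ hxS' (Ne.symm hxx)
        have a2 := h2' _ hxS hxx
        rw [det3_swap23] at a2
        linarith
      have hwx : w ≠ X y σ := fun h => hw.1 (h ▸ hxS)
      have e1 := hv.Ln_eq (hne y hy σ) hwx h1 (right_mem_Ln _ _ _)
      rw [← hxx] at h1'
      have hne' := hne y' hy' σ'
      rw [← hxx] at hne'
      have e2 := hv.Ln_eq hne' hwx h1' (right_mem_Ln _ _ _)
      have hyy : y = y' := by
        by_contra hyy
        have := hv.line_inter hL (Ln_mem_lines hwx) hyy hy hy' (by rw [e1]; exact left_mem_Ln _ _ _) (by rw [e2]; exact left_mem_Ln _ _ _)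
        exact hw.2 (by rw [this]; exact left_mem_Ln _ _ _)
      subst hyy
      rw [hboth y hy σ σ' (by rw [← hxx]; exact right_mem_Ln _ _ _)]
  omega

end
end DM

namespace DM

open Finset
open scoped Classical

noncomputable section
variable {n : ℕ} {v : Fin n → V3} {S L : Finset (Fin n)}

/-- a conic-like set `S` and a line `L` missing it -/
structure SL (v : Fin n → V3) (S L : Finset (Fin n)) : Prop where
  hv : Cfg v
  hL : L ∈ lines v
  hS : gpS v S
  hSL : ∀ z ∈ S, z ∉ L

/-- ordered ordinary pairs -/
def OP (v : Fin n → V3) (A B : Finset (Fin n)) : Finset (Fin n × Fin n) := (A ×ˢ B).filter (fun x => Ln v x.1 x.2 = {x.1, x.2} ∧ x.1 ≠ x.2)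

lemma OP_swap (v : Fin n → V3) (A B : Finset (Fin n)) : (OP v A B).card ≤ (OP v B A).card := by
  apply card_le_card_of_injOn Prod.swap
  · rintro ⟨a, b⟩ h
    simp only [OP, coe_filter, mem_product, Set.mem_setOf_eq, Prod.swap] at h ⊢
    refine ⟨⟨h.1.2, h.1.1⟩, ?_, h.2.2.symm⟩
    rw [Ln_comm, h.2.1, pair_comm]
  · exact fun a _ b _ h => Prod.swap_injective h

lemma OP_disj {A B A' B' : Finset (Fin n)} (h : Disjoint A A' ∨ Disjoint B B') : Disjoint (OP v A B) (OP v A' B') := by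
  rw [disjoint_left]
  rintro ⟨a, b⟩ h1 h2
  simp only [OP, mem_filter, mem_product] at h1 h2
  rcases h with h | h
  · exact disjoint_left.1 h h1.1.1 h2.1.1
  · exact disjoint_left.1 h h1.1.2 h2.1.2

lemma SL.ord_count (h : SL v S L) : 2 * (OP v S L).card + 2 * (OP v ((S ∪ L)ᶜ) L).card + (OP v S S).card ≤ 2 * N2 v := by
  set W := (S ∪ L)ᶜ with hW
  have dSL : Disjoint S L := disjoint_left.2 h.hSL
  have dSW : Disjoint S W := by
    rw [hW, disjoint_left]; intro z hz; simp [hz]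
  have dLW : Disjoint L W := by
    rw [hW, disjoint_left]; intro z hz; simp [hz]
  have h1 := ord_pairs h.hv ((((OP v S L ∪ OP v L S) ∪ OP v W L) ∪ OP v L W) ∪ OP v S S) (by
    intro x hx
    have : x ∈ OP v univ univ := by
      simp only [mem_union, OP, mem_filter, mem_product, mem_univ, true_and] at hx ⊢
      rcases hx with (((h | h) | h) | h) | h <;> exact h.2
    rw [OP, mem_filter] at this
    exact ⟨this.2.2, by rw [this.2.1, card_pair this.2.2]⟩)
  rw [card_union_of_disjoint, card_union_of_disjoint, card_union_of_disjoint, card_union_of_disjoint] at h1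
  · have a1 := OP_swap v S L
    have a2 := OP_swap v W L
    omega
  · exact OP_disj (Or.inl dSL)
  · rw [disjoint_union_left]
    exact ⟨OP_disj (Or.inl dSW), OP_disj (Or.inl dLW)⟩
  · rw [disjoint_union_left, disjoint_union_left]
    exact ⟨⟨OP_disj (Or.inl dSL), OP_disj (Or.inr dSW)⟩, OP_disj (Or.inl dLW.symm)⟩
  · rw [disjoint_union_left, disjoint_union_left, disjoint_union_left]
    exact ⟨⟨⟨OP_disj (Or.inr dSL.symm), OP_disj (Or.inl dSL.symm)⟩, OP_disj (Or.inr dSL.symm)⟩, OP_disj (Or.inl dSL.symm)⟩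

def cS (v : Fin n → V3) (S : Finset (Fin n)) (w y : Fin n) : Finset (Fin n) := S.filter (fun x => x ∈ Ln v w y)
def b0 (v : Fin n → V3) (S L : Finset (Fin n)) (w : Fin n) : Finset (Fin n) := L.filter (fun y => (cS v S w y).card = 0)
def b1 (v : Fin n → V3) (S L : Finset (Fin n)) (w : Fin n) : Finset (Fin n) := L.filter (fun y => (cS v S w y).card = 1)

lemma SL.notW {w : Fin n} (hw : w ∈ (S ∪ L)ᶜ) : w ∉ S ∧ w ∉ L := by
  rw [mem_compl, mem_union] at hw; push Not at hw; exact hw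

/-- a line through a point off `L` meets `L` at most once -/
lemma SL.onL (h : SL v S L) {a b y y' : Fin n} (hab : a ≠ b) (ha : a ∉ L) (hy : y ∈ L) (hy' : y' ∈ L) (h1 : y ∈ Ln v a b) (h2 : y' ∈ Ln v a b) : y = y' := by
  by_contra hne
  have := h.hv.line_inter h.hL (Ln_mem_lines hab) hne hy hy' h1 h2
  exact ha (by rw [this]; exact left_mem_Ln _ _ _)

lemma SL.sum_c (h : SL v S L) {w : Fin n} (hw : w ∈ (S ∪ L)ᶜ) : 2 * L.card ≤ S.card + 2 * (b0 v S L w).card + (b1 v S L w).card := by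
  obtain ⟨hwS, hwL⟩ := SL.notW hw
  have h1 : ∑ y ∈ L, (cS v S w y).card ≤ S.card := by
    rw [← card_biUnion]
    · apply card_le_card
      intro x hx
      obtain ⟨y, _, hx⟩ := mem_biUnion.1 hx
      exact (mem_filter.1 hx).1
    · intro y hy y' hy' hne
      rw [Function.onFun, disjoint_left]
      intro x hx hx'
      rw [cS, mem_filter] at hx hx'
      have hwx : w ≠ x := fun e => hwS (e ▸ hx.1)
      exact hne (h.onL hwx hwL hy hy' (mem_Ln_cyc hx.2) (mem_Ln_cyc hx'.2))
  have h2 : ∑ y ∈ L, 2 ≤ ∑ y ∈ L, ((cS v S w y).card + 2 * (if (cS v S w y).card = 0 then 1 else 0) + (if (cS v S w y).card = 1 then 1 else 0)) := by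
    apply sum_le_sum
    intro y _
    split_ifs <;> omega
  rw [sum_add_distrib, sum_add_distrib, ← mul_sum, sum_const, smul_eq_mul, ← card_filter, ← card_filter] at h2
  unfold b0 b1
  omega

lemma SL.b0_le (h : SL v S L) {w : Fin n} (hw : w ∈ (S ∪ L)ᶜ) : (b0 v S L w).card ≤ (OP v ((S ∪ L)ᶜ) L).card + ((S ∪ L)ᶜ).card := by
  obtain ⟨hwS, hwL⟩ := SL.notW hw
  rw [← card_filter_add_card_filter_not (s := b0 v S L w) (fun y => Ln v w y = {w, y})]
  apply add_le_add
  · apply card_le_card_of_injOn (fun y => (w, y))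
    · intro y hy
      have hy := mem_filter.1 hy
      have hyL := (mem_filter.1 hy.1).1
      exact mem_filter.2 ⟨mem_product.2 ⟨hw, hyL⟩, hy.2, fun e => hwL ((show w = y from e) ▸ hyL)⟩
    · intro a _ b _ e; exact (Prod.mk.inj e).2
  · apply card_rel _ _ (fun y w' => w' ≠ w ∧ w' ∈ Ln v w y)
    · intro y hy
      have hy := mem_filter.1 hy
      have hy1 := mem_filter.1 hy.1
      have hwy : w ≠ y := fun e => hwL (e ▸ hy1.1)
      have hex : ∃ w' ∈ Ln v w y, w' ≠ w ∧ w' ≠ y := by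
        by_contra hcon
        push Not at hcon
        apply hy.2
        ext z
        rw [mem_insert, mem_singleton]
        constructor
        · intro hz
          by_cases e : z = w
          · exact Or.inl e
          · exact Or.inr (hcon z hz e)
        · rintro (rfl | rfl)
          · exact left_mem_Ln _ _ _
          · exact right_mem_Ln _ _ _
      obtain ⟨w', hm, h1, h2⟩ := hex
      refine ⟨w', ?_, h1, hm⟩
      rw [mem_compl, mem_union]
      rintro (e | e)
      · have := card_eq_zero.1 hy1.2
        exact notMem_empty w' (this ▸ mem_filter.2 ⟨e, hm⟩)
      · exact h2 (h.onL hwy hwL e hy1.1 hm (right_mem_Ln _ _ _))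
    · intro y hy y' hy' w' hw' ⟨h1, h2⟩ ⟨_, h2'⟩
      have hyL := (mem_filter.1 (mem_filter.1 hy).1).1
      have hyL' := (mem_filter.1 (mem_filter.1 hy').1).1
      exact h.onL h1.symm hwL hyL hyL' (mem_Ln_cyc h2) (mem_Ln_cyc h2')

/-- pairs `(x, y)` such that the line has no further point of `S` -/
def Sing (v : Fin n → V3) (S L : Finset (Fin n)) : Finset (Fin n × Fin n) := (S ×ˢ L).filter (fun x => ∀ x' ∈ S, x' ∈ Ln v x.1 x.2 → x' = x.1)
/-- pairs in `S` whose line misses `L` -/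
def Dp (v : Fin n → V3) (S L : Finset (Fin n)) : Finset (Fin n × Fin n) := S.offDiag.filter (fun x => ∀ y ∈ L, y ∉ Ln v x.1 x.2)
def Gam (v : Fin n → V3) (S L : Finset (Fin n)) (w : Fin n) : Finset (Fin n × Fin n) := (Dp v S L).filter (fun x => w ∈ Ln v x.1 x.2)

/-- single pairs whose third point is exactly `w` -/
def Bp (v : Fin n → V3) (S L : Finset (Fin n)) (w : Fin n) : Finset (Fin n × Fin n) :=
  (Sing v S L).filter (fun x => w ∈ Ln v x.1 x.2 ∧ ∀ w' ∈ (S ∪ L)ᶜ, w' ∈ Ln v x.1 x.2 → w' = w)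

lemma SL.b1_le (h : SL v S L) {w : Fin n} (hw : w ∈ (S ∪ L)ᶜ) : (b1 v S L w).card ≤ (Bp v S L w).card + ((S ∪ L)ᶜ).card := by
  obtain ⟨hwS, hwL⟩ := SL.notW hw
  rw [← card_filter_add_card_filter_not (s := b1 v S L w) (fun y => ∃ w' ∈ (S ∪ L)ᶜ, w' ∈ Ln v w y ∧ w' ≠ w), add_comm]
  apply add_le_add
  · apply card_rel _ _ (fun y x => x.2 = y)
    · intro y hy
      have hy := mem_filter.1 hy
      have hy1 := mem_filter.1 hy.1
      have hno := hy.2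
      push Not at hno
      obtain ⟨x, hx⟩ := card_eq_one.1 hy1.2
      have hxm : x ∈ cS v S w y := by rw [hx]; exact mem_singleton_self _
      have hxm := mem_filter.1 hxm
      have hwy : w ≠ y := fun e => hwL (e ▸ hy1.1)
      have hxy : x ≠ y := fun e => h.hSL x hxm.1 (e ▸ hy1.1)
      have e1 := h.hv.Ln_eq hwy hxy hxm.2 (right_mem_Ln _ _ _)
      refine ⟨(x, y), mem_filter.2 ⟨mem_filter.2 ⟨mem_product.2 ⟨hxm.1, hy1.1⟩, ?_⟩, ?_, ?_⟩, rfl⟩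
      · intro x' hx' hm
        simp only at hm ⊢
        rw [e1] at hm
        have : x' ∈ cS v S w y := mem_filter.2 ⟨hx', hm⟩
        rw [hx] at this
        exact mem_singleton.1 this
      · simp only; rw [e1]; exact left_mem_Ln _ _ _
      · intro w' hw' hm
        simp only at hm
        rw [e1] at hm
        exact hno w' hw' hm
    · intro y _ y' _ x _ e e'
      rw [← e, ← e']
  · apply card_rel _ _ (fun y w' => w' ≠ w ∧ w' ∈ Ln v w y)
    · intro y hy
      obtain ⟨w', h1, h2, h3⟩ := (mem_filter.1 hy).2
      exact ⟨w', h1, h3, h2⟩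
    · intro y hy y' hy' w' hw' ⟨h1, h2⟩ ⟨_, h2'⟩
      have hyL := (mem_filter.1 (mem_filter.1 hy).1).1
      have hyL' := (mem_filter.1 (mem_filter.1 hy').1).1
      exact h.onL h1.symm hwL hyL hyL' (mem_Ln_cyc h2) (mem_Ln_cyc h2')

lemma SL.sing_ge (h : SL v S L) : (OP v S L).card + ∑ w ∈ (S ∪ L)ᶜ, (Bp v S L w).card ≤ (Sing v S L).card := by
  rw [← card_biUnion, ← card_union_of_disjoint]
  · apply card_le_card
    intro x hx
    rcases mem_union.1 hx with hx | hx
    · rw [OP, mem_filter, mem_product] at hx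
      refine mem_filter.2 ⟨mem_product.2 hx.1, fun x' hx' hm => ?_⟩
      rw [hx.2.1, mem_insert, mem_singleton] at hm
      rcases hm with hm | hm
      · exact hm
      · exact absurd hx.1.2 (hm ▸ h.hSL x' hx')
    · obtain ⟨w, _, hx⟩ := mem_biUnion.1 hx
      exact (mem_filter.1 hx).1
  · rw [disjoint_left]
    intro x hx hx'
    obtain ⟨w, hw, hx'⟩ := mem_biUnion.1 hx'
    have hm := (mem_filter.1 hx').2.1
    rw [OP, mem_filter, mem_product] at hx
    rw [hx.2.1, mem_insert, mem_singleton] at hm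
    obtain ⟨hwS, hwL⟩ := SL.notW hw
    rcases hm with hm | hm
    · exact hwS (hm ▸ hx.1.1)
    · exact hwL (hm ▸ hx.1.2)
  · intro w hw w' hw' hne
    rw [Function.onFun, disjoint_left]
    intro x hx hx'
    have a := (mem_filter.1 hx).2
    have a' := (mem_filter.1 hx').2
    exact hne (a'.2 w hw a.1)

lemma SL.sing_le (h : SL v S L) : (Sing v S L).card + S.card * S.card ≤ (Dp v S L).card + S.card * L.card + S.card := by
  have h1 := card_filter_add_card_filter_not (s := S ×ˢ L) (fun x => ∀ x' ∈ S, x' ∈ Ln v x.1 x.2 → x' = x.1)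
  have h2 := card_filter_add_card_filter_not (s := S.offDiag) (fun x => ∀ y ∈ L, y ∉ Ln v x.1 x.2)
  rw [card_product] at h1
  rw [offDiag_card] at h2
  have hss : S.card ≤ S.card * S.card := Nat.le_mul_self _
  have h3 : (S.offDiag.filter (fun x => ¬ ∀ y ∈ L, y ∉ Ln v x.1 x.2)).card ≤ ((S ×ˢ L).filter (fun x => ¬ ∀ x' ∈ S, x' ∈ Ln v x.1 x.2 → x' = x.1)).card := by
    apply card_rel _ _ (fun x z => z.1 = x.1 ∧ z.2 ∈ Ln v x.1 x.2)
    · rintro ⟨a, b⟩ hx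
      rw [mem_filter, mem_offDiag] at hx
      obtain ⟨⟨ha, hb, hab⟩, hx⟩ := hx
      push Not at hx
      obtain ⟨y, hy, hm⟩ := hx
      refine ⟨(a, y), mem_filter.2 ⟨mem_product.2 ⟨ha, hy⟩, fun hc => hab (hc b hb (mem_Ln_cyc hm)).symm⟩, rfl, hm⟩
    · rintro ⟨a, b⟩ hx ⟨a', b'⟩ hx' ⟨c, y⟩ hz ⟨e1, e2⟩ ⟨e1', e2'⟩
      simp only at e1 e2 e1' e2'
      subst e1; subst e1'
      rw [mem_filter, mem_offDiag] at hx hx'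
      rw [mem_filter, mem_product] at hz
      have hcy : y ≠ c := fun e => h.hSL c hz.1.1 (e ▸ hz.1.2)
      have l1 := h.hv.Ln_left hx.1.2.2 e2 hcy
      have l2 := h.hv.Ln_left hx'.1.2.2 e2' hcy
      simp only at l1 l2
      have : b' ∈ Ln v c b := by rw [← l1, l2]; exact right_mem_Ln _ _ _
      rcases h.hS c hx.1.1 b hx.1.2.1 b' hx'.1.2.1 hx.1.2.2 this with e | e
      · exact absurd e.symm hx'.1.2.2
      · rw [e]
  unfold Sing Dp
  omega

lemma SL.gam_le (h : SL v S L) {w : Fin n} (hw : w ∈ (S ∪ L)ᶜ) : (Gam v S L w).card + (b1 v S L w).card ≤ S.card := by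
  obtain ⟨hwS, hwL⟩ := SL.notW hw
  rw [← card_filter_add_card_filter_not (s := S) (fun x => ∀ y ∈ L, y ∉ Ln v w x)]
  apply add_le_add
  · apply card_rel _ _ (fun x z => x.1 = z)
    · rintro ⟨a, b⟩ hx
      obtain ⟨hD, hm⟩ := mem_filter.1 hx
      rw [Dp, mem_filter, mem_offDiag] at hD
      simp only at hm hD
      have hwa : w ≠ a := fun e => hwS (e ▸ hD.1.1)
      refine ⟨a, mem_filter.2 ⟨hD.1.1, ?_⟩, rfl⟩
      rw [Ln_comm, h.hv.Ln_left hD.1.2.2 hm hwa]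
      exact hD.2
    · rintro ⟨a, b⟩ hx ⟨a', b'⟩ hx' z hz e e'
      simp only at e e'
      subst e; subst e'
      obtain ⟨hD, hm⟩ := mem_filter.1 hx
      obtain ⟨hD', hm'⟩ := mem_filter.1 hx'
      rw [Dp, mem_filter, mem_offDiag] at hD hD'
      simp only at hm hD hm' hD'
      have hwa : w ≠ a' := fun e => hwS (e ▸ hD.1.1)
      have l1 := h.hv.Ln_left hD.1.2.2 hm hwa
      have l2 := h.hv.Ln_left hD'.1.2.2 hm' hwa
      have : b' ∈ Ln v a' b := by rw [← l1, l2]; exact right_mem_Ln _ _ _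
      rcases h.hS a' hD.1.1 b hD.1.2.1 b' hD'.1.2.1 hD.1.2.2 this with e | e
      · exact absurd e.symm hD'.1.2.2
      · rw [e]
  · apply card_rel _ _ (fun y x => x ∈ Ln v w y)
    · intro y hy
      obtain ⟨hy, hc⟩ := mem_filter.1 hy
      obtain ⟨x, hx⟩ := card_eq_one.1 hc
      have hxm : x ∈ cS v S w y := by rw [hx]; exact mem_singleton_self _
      have hxm := mem_filter.1 hxm
      refine ⟨x, mem_filter.2 ⟨hxm.1, ?_⟩, hxm.2⟩
      push Not
      exact ⟨y, hy, mem_Ln_cyc hxm.2⟩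
    · intro y hy y' hy' x hx hm hm'
      have hwx : w ≠ x := fun e => hwS (e ▸ (mem_filter.1 hx).1)
      exact h.onL hwx hwL (mem_filter.1 hy).1 (mem_filter.1 hy').1 (mem_Ln_cyc hm) (mem_Ln_cyc hm')

lemma SL.dp_le (h : SL v S L) : (Dp v S L).card ≤ (OP v S S).card + ∑ w ∈ (S ∪ L)ᶜ, (Gam v S L w).card := by
  have : Dp v S L ⊆ OP v S S ∪ ((S ∪ L)ᶜ).biUnion (fun w => Gam v S L w) := by
    rintro ⟨a, b⟩ hx
    have hD := hx
    rw [Dp, mem_filter, mem_offDiag] at hD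
    obtain ⟨⟨ha, hb, hab⟩, hno⟩ := hD
    simp only at ha hb hab hno
    by_cases hex : ∃ w ∈ (S ∪ L)ᶜ, w ∈ Ln v a b
    · obtain ⟨w, hw, hm⟩ := hex
      exact mem_union_right _ (mem_biUnion.2 ⟨w, hw, mem_filter.2 ⟨hx, hm⟩⟩)
    · push Not at hex
      refine mem_union_left _ (mem_filter.2 ⟨mem_product.2 ⟨ha, hb⟩, ?_, hab⟩)
      ext z
      simp only [mem_insert, mem_singleton]
      constructor
      · intro hz
        by_cases hzS : z ∈ S
        · exact h.hS a ha b hb z hzS hab hz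
        · exact absurd hz (hex z (by rw [mem_compl, mem_union]; exact fun e => e.elim hzS (fun hl => hno z hl hz)))
      · rintro (rfl | rfl)
        · exact left_mem_Ln _ _ _
        · exact right_mem_Ln _ _ _
  refine (card_le_card this).trans ((card_union_le _ _).trans (add_le_add le_rfl card_biUnion_le))

/-- the main count -/
lemma SL.main (h : SL v S L) (h3 : 3 ≤ S.card) :
    2 * L.card ≤ (OP v S L).card + S.card + 2 * ((S ∪ L)ᶜ).card ∧
    (∀ w ∈ (S ∪ L)ᶜ, 2 * L.card ≤ S.card + 2 * (N2 v - (OP v S L).card + ((S ∪ L)ᶜ).card) + (b1 v S L w).card) ∧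
    3 * (OP v S L).card + 2 * ∑ w ∈ (S ∪ L)ᶜ, (b1 v S L w).card + S.card * S.card ≤
      2 * N2 v + S.card * L.card + S.card + ((S ∪ L)ᶜ).card * ((S ∪ L)ᶜ).card + ((S ∪ L)ᶜ).card * S.card := by
  refine ⟨?_, ?_, ?_⟩
  · have h1 := hull h.hv h.hL h.hS h.hSL h3
    have : (S ×ˢ L).filter (fun x => Ln v x.1 x.2 = {x.1, x.2}) = OP v S L := by
      unfold OP
      apply filter_congr
      intro x hx
      rw [mem_product] at hx
      exact ⟨fun e => ⟨e, fun e' => h.hSL x.1 hx.1 (e' ▸ hx.2)⟩, fun e => e.1⟩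
    rwa [this] at h1
  · intro w hw
    have a1 := h.sum_c hw
    have a2 := h.b0_le hw
    have a3 := h.ord_count
    omega
  · have a1 := h.ord_count
    have a2 := h.sing_ge
    have a3 := h.sing_le
    have a4 := h.dp_le
    have a5 : ∑ w ∈ (S ∪ L)ᶜ, (b1 v S L w).card ≤ ∑ w ∈ (S ∪ L)ᶜ, (Bp v S L w).card + ((S ∪ L)ᶜ).card * ((S ∪ L)ᶜ).card := by
      rw [← smul_eq_mul, ← sum_const, ← sum_add_distrib]
      exact sum_le_sum (fun w hw => h.b1_le hw)
    have a6 : ∑ w ∈ (S ∪ L)ᶜ, (Gam v S L w).card + ∑ w ∈ (S ∪ L)ᶜ, (b1 v S L w).card ≤ ((S ∪ L)ᶜ).card * S.card := by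
      rw [← smul_eq_mul, ← sum_const, ← sum_add_distrib]
      exact sum_le_sum (fun w hw => h.gam_le hw)
    omega

end
end DM

namespace DM

open Finset
open scoped Classical

noncomputable section
variable {n : ℕ}

lemma num1 (n h s r t D N2 Sg : ℤ) (hn : n = h + s + r) (hr0 : 0 ≤ r) (hs0 : 0 ≤ s) (hr : r ≤ 712832) (hD : 100000000 * D ≤ n + 100000000) (hD0 : 0 ≤ D)
    (h1 : n ≤ 2 * h + D) (h2 : n ≤ 2 * s + D + 4) (h3 : 2 * h < n) (hN : 2 * N2 < n) (ht : 2 * h ≤ t + s + 2 * r)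
    (hS : r * (2 * h - s - 2 * (N2 - t + r)) ≤ Sg)
    (hm : 3 * t + 2 * Sg + s * s ≤ 2 * N2 + s * h + s + r * r + r * s) (hbig : 1000000000000000 ≤ n) : False := by
  have e1 : r * (n - 9 * D - 6 * r) ≤ r * (2 * (2 * h - s - 2 * (N2 - t + r))) := mul_le_mul_of_nonneg_left (by linarith) hr0
  have e2 : s * (h + 1) ≤ s * (s + r) := mul_le_mul_of_nonneg_left (by linarith) hs0
  have e3 : r * (2 * s) ≤ r * (n + D - 2 * r) := mul_le_mul_of_nonneg_left (by linarith) hr0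
  have e4 : r * (10 * D + 5 * r) ≤ 712832 * (10 * D + 5 * 712832) := by
    apply mul_le_mul hr (by linarith) (by linarith) (by norm_num)
  nlinarith only [e1, e2, e3, e4, hS, hm, hN, ht, h1, h2, h3, hn, hr, hr0, hD, hbig]

lemma num2 {n r e : ℕ} (he : e = n / 356416) (h : r * e ≤ n) (hbig : 1000000000000000 ≤ n) : r ≤ 712832 := by
  by_contra hc
  have : 712833 * e ≤ r * e := Nat.mul_le_mul_right _ (by omega)
  omega

lemma L4 {pt : Fin n → ℝ × ℝ} {H : MP} {L : Finset (Fin n)} (h : SL (lift pt) (zs pt H \ L) L) (h2 : (zs pt H ∩ L).card ≤ 2) {w : Fin n}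
    (hw : w ∈ ((zs pt H \ L) ∪ L)ᶜ) : L.card ≤ (b0 (lift pt) (zs pt H \ L) L w).card + (unp pt H w).card + 2 := by
  obtain ⟨hwS, hwL⟩ := SL.notW hw
  have hc : ((L \ b0 (lift pt) (zs pt H \ L) L w) \ zs pt H).card ≤ (unp pt H w).card := by
    apply card_rel _ _ (fun y x => x ≠ w ∧ x ∈ Ln (lift pt) w y)
    · intro y hy
      simp only [mem_sdiff, b0, mem_filter, not_and] at hy
      obtain ⟨⟨hyL, hy1⟩, hyz⟩ := hy
      obtain ⟨x, hx⟩ := card_pos.1 (Nat.pos_of_ne_zero (hy1 hyL))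
      rw [cS, mem_filter] at hx
      obtain ⟨hxS, hxm⟩ := hx
      have hxw : x ≠ w := fun e => hwS (e ▸ hxS)
      refine ⟨x, ?_, hxw, hxm⟩
      refine mem_filter.2 ⟨(mem_sdiff.1 hxS).1, ?_⟩
      rintro ⟨q, hq, hT⟩
      have hy2 : y ∈ Ln (lift pt) w x := mem_Ln_cyc hxm
      rw [hT.2.2.2] at hy2
      simp only [mem_insert, mem_singleton] at hy2
      rcases hy2 with e | e | e
      · exact hwL (e ▸ hyL)
      · exact (mem_sdiff.1 hxS).2 (e ▸ hyL)
      · exact hyz (e ▸ hq)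
    · intro y hy y' hy' x hx ⟨h1, h2⟩ ⟨_, h2'⟩
      simp only [mem_sdiff] at hy hy'
      exact h.onL h1.symm hwL hy.1.1 hy'.1.1 (mem_Ln_cyc h2) (mem_Ln_cyc h2')
  have : L ⊆ (b0 (lift pt) (zs pt H \ L) L w ∪ (zs pt H ∩ L)) ∪ ((L \ b0 (lift pt) (zs pt H \ L) L w) \ zs pt H) := by
    intro y hy
    simp only [mem_union, mem_sdiff, mem_inter]
    by_cases a : y ∈ b0 (lift pt) (zs pt H \ L) L w
    · exact Or.inl (Or.inl a)
    · by_cases b : y ∈ zs pt H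
      · exact Or.inl (Or.inr ⟨b, hy⟩)
      · exact Or.inr ⟨⟨hy, a⟩, b⟩
  have a1 := card_le_card this
  have a2 := card_union_le (b0 (lift pt) (zs pt H \ L) L w ∪ (zs pt H ∩ L)) ((L \ b0 (lift pt) (zs pt H \ L) L w) \ zs pt H)
  have a3 := card_union_le (b0 (lift pt) (zs pt H \ L) L w) (zs pt H ∩ L)
  omega

lemma num3 {n h s r t D N2 b u o e : ℕ} (hn : n = h + s + r) (hD : 100000000 * D ≤ n + 100000000)
    (h1 : n ≤ 2 * h + D) (h2 : n ≤ 2 * s + D + 4) (hN : 2 * N2 < n) (ht : 2 * h ≤ t + s + 2 * r)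
    (h4 : h ≤ b + u + 2) (hb : b ≤ o + r) (ho : 2 * t + 2 * o ≤ 2 * N2) (hu : u ≤ 8 * (5569 * e + 1)) (he : e = n / 356416)
    (hbig : 1000000000000000 ≤ n) : False := by
  omega

theorem final_count : ∃ N0, ∀ n ≥ N0, ∀ pt : Fin n → ℝ × ℝ, Cfg (lift pt) → n ≤ 2 * N2 (lift pt) := by
  obtain ⟨N0, hN0⟩ := conic_struct 100000000 (by norm_num)
  refine ⟨max N0 1000000000000000, fun n hn pt hv => ?_⟩
  by_contra hN
  push Not at hN
  have hbig : 1000000000000000 ≤ n := (le_max_right _ _).trans hn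
  obtain ⟨H, hH, h2, L, hL, hLc, hzc⟩ := hN0 n ((le_max_left _ _).trans hn) pt hv hN
  have hgp := zs_gp hv hH h2
  have h2i : (zs pt H ∩ L).card ≤ 2 := by
    by_contra hc
    push Not at hc
    obtain ⟨a, b, c, ha, hb, hcc, hab, hac, hbc⟩ := two_lt_card_iff.1 hc
    rw [mem_inter] at ha hb hcc
    have e := hv.line_eq hL hab ha.2 hb.2
    have hcm : c ∈ Ln (lift pt) a b := by first | (rw [← e]; exact hcc.2) | (rw [e]; exact hcc.2)
    rcases hgp a ha.1 b hb.1 c hcc.1 hab hcm with e | e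
    · exact hac e.symm
    · exact hbc e.symm
  have h : SL (lift pt) (zs pt H \ L) L :=
    ⟨hv, hL, fun a ha b hb c hc => hgp a (mem_sdiff.1 ha).1 b (mem_sdiff.1 hb).1 c (mem_sdiff.1 hc).1, fun z hz => (mem_sdiff.1 hz).2⟩
  have hcs : (zs pt H \ L).card + (zs pt H ∩ L).card = (zs pt H).card := card_sdiff_add_card_inter _ _
  have hrich := rich_sum hv hN {L} (by simpa using hL)
  rw [sum_singleton] at hrich
  have hcard : (zs pt H \ L ∪ L).card + ((zs pt H \ L) ∪ L)ᶜ.card = n := by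
    rw [card_add_card_compl, Fintype.card_fin]
  rw [card_union_of_disjoint sdiff_disjoint] at hcard
  have hord := h.ord_count
  have hD : ∃ D, 100000000 * D ≤ n + 100000000 ∧ n ≤ 2 * L.card + D ∧ n ≤ 2 * (zs pt H).card + D := by
    refine ⟨n / 100000000 + 1, ?_, ?_, ?_⟩ <;> omega
  obtain ⟨D, hD, hD1, hD2⟩ := hD
  obtain ⟨m1, m2, m3⟩ := h.main (by omega)
  have hatyp : ((zs pt H \ L) ∪ L)ᶜ ⊆ univ.filter (fun p => 5569 * (n / 356416) < bad (lift pt) p) := by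
    intro w hw
    rw [mem_filter]
    refine ⟨mem_univ _, ?_⟩
    by_contra hb
    have hwz : E H (pt w) ≠ 0 := by
      intro e
      obtain ⟨a, b⟩ := SL.notW hw
      exact a (mem_sdiff.2 ⟨mem_zs.2 e, b⟩)
    have hu := conic_off hv hH h2 hwz
    have h4 := L4 h h2i hw
    have hb0 := h.b0_le hw
    exact num3 (n := n) (h := L.card) (s := (zs pt H \ L).card) (D := D) (e := n / 356416) (by omega) hD hD1 (by omega) hN m1 h4 hb0 (by omega) (by omega : (unp pt H w).card ≤ _) rfl hbig
  have hr : ((zs pt H \ L) ∪ L)ᶜ.card ≤ 712832 :=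
    num2 (e := n / 356416) rfl ((Nat.mul_le_mul_right _ (card_le_card hatyp)).trans (atyp hv hN _)) hbig
  have htN : (OP (lift pt) (zs pt H \ L) L).card ≤ N2 (lift pt) := by omega
  have hL3 : 2 * L.card < n := by omega
  have hsum : ((((zs pt H \ L) ∪ L)ᶜ.card : ℤ)) * (2 * L.card - (zs pt H \ L).card - 2 * (N2 (lift pt) - (OP (lift pt) (zs pt H \ L) L).card + ((zs pt H \ L) ∪ L)ᶜ.card)) ≤ ((∑ w ∈ ((zs pt H \ L) ∪ L)ᶜ, (b1 (lift pt) (zs pt H \ L) L w).card : ℕ) : ℤ) := by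
    rw [Nat.cast_sum, ← nsmul_eq_mul]
    apply card_nsmul_le_sum
    intro w hw
    have := m2 w hw
    omega
  refine num1 n L.card (zs pt H \ L).card _ (OP (lift pt) (zs pt H \ L) L).card D (N2 (lift pt)) _ ?_ (by positivity) (by positivity) (by exact_mod_cast hr) (by exact_mod_cast hD) (by positivity) (by exact_mod_cast hD1) ?_ (by exact_mod_cast hL3) (by exact_mod_cast hN) (by exact_mod_cast m1) hsum (by exact_mod_cast m3) (by exact_mod_cast hbig)
  · omega
  · omega

end
end DM

namespace DM

open Finset
open scoped Classical

noncomputable section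
variable {n : ℕ}

lemma hat_crs {a b : ℝ × ℝ} (h : a ≠ b) : crs (hat a) (hat b) ≠ 0 := by
  intro e
  apply h
  have e1 := congrArg Prod.fst e
  have e2 := congrArg (fun z : V3 => z.2.1) e
  simp [crs, hat] at e1 e2
  exact Prod.ext (by linarith) (by linarith)

lemma hat_line {a b p : ℝ × ℝ} (h : a ≠ b) (hd : det3 (hat a) (hat b) (hat p) = 0) : ∃ r : ℝ, p = r • (b - a) + a := by
  obtain ⟨x, y, e⟩ := exists_comb (hat_crs h) hd
  have e0 := congrArg Prod.fst e
  have e1 := congrArg (fun z : V3 => z.2.1) e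
  have e2 := congrArg (fun z : V3 => z.2.2) e
  simp [hat] at e0 e1 e2
  have : x = 1 - y := by linarith
  subst this
  refine ⟨y, Prod.ext ?_ ?_⟩
  · simp; linarith
  · simp; linarith

lemma mem_span_iff {a b p : ℝ × ℝ} (h : a ≠ b) : p ∈ line[ℝ, a, b] ↔ det3 (hat a) (hat b) (hat p) = 0 := by
  constructor
  · intro hp
    have e : p = (p - a) +ᵥ a := by simp
    rw [e, vadd_left_mem_affineSpan_pair] at hp
    obtain ⟨r, hr⟩ := hp
    have e : p = r • (b - a) + a := by
      have : p - a = r • (b - a) := hr.symm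
      rw [← this]; simp
    rw [e, det3_def]
    simp [hat, dot, crs]
    ring
  · intro hp
    obtain ⟨r, rfl⟩ := hat_line h hp
    exact smul_vsub_vadd_mem_affineSpan_pair r a b

lemma isLine_span {a b : ℝ × ℝ} (h : a ≠ b) : IsLine line[ℝ, a, b] := by
  refine ⟨⟨a, left_mem_affineSpan_pair ℝ a b⟩, ?_⟩
  rw [direction_affineSpan, vectorSpan_pair_rev, finrank_span_singleton]
  simpa [sub_eq_zero] using h.symm

lemma isLine_eq {L : AffineSubspace ℝ (ℝ × ℝ)} (hL : IsLine L) {a b : ℝ × ℝ} (h : a ≠ b) (ha : a ∈ L) (hb : b ∈ L) : line[ℝ, a, b] = L := by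
  have hle : line[ℝ, a, b] ≤ L := affineSpan_pair_le_of_mem_of_mem ha hb
  refine AffineSubspace.eq_of_direction_eq_of_nonempty_of_le ?_ ⟨a, left_mem_affineSpan_pair ℝ a b⟩ hle
  exact Submodule.eq_of_le_of_finrank_eq (AffineSubspace.direction_le hle) ((isLine_span h).2.trans hL.2.symm)

lemma ord_finite {P : Set (ℝ × ℝ)} (hP : P.Finite) :
    {L : AffineSubspace ℝ (ℝ × ℝ) | IsLine L ∧ (P ∩ (L : Set (ℝ × ℝ))).ncard = 2}.Finite := by
  apply ((hP.prod hP).image (fun x => line[ℝ, x.1, x.2])).subset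
  rintro L ⟨hL, h2⟩
  obtain ⟨a, b, hab, e⟩ := Set.ncard_eq_two.1 h2
  have ha : a ∈ P ∩ (L : Set (ℝ × ℝ)) := by rw [e]; simp
  have hb : b ∈ P ∩ (L : Set (ℝ × ℝ)) := by rw [e]; simp
  exact ⟨(a, b), ⟨ha.1, hb.1⟩, isLine_eq hL hab ha.2 hb.2⟩

lemma bridge {P : Set (ℝ × ℝ)} (hP : P.Finite) {pt : Fin n → ℝ × ℝ} (hv : Cfg (lift pt)) (hr : Set.range pt = P) :
    N2 (lift pt) ≤ numOrdinaryLines P := by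
  have key : ∀ L ∈ (lines (lift pt)).filter (fun L => L.card = 2), IsLine (affineSpan ℝ (pt '' (L : Set (Fin n)))) ∧
      P ∩ (affineSpan ℝ (pt '' (L : Set (Fin n))) : Set (ℝ × ℝ)) = pt '' (L : Set (Fin n)) := by
    intro L hL
    rw [mem_filter] at hL
    obtain ⟨hL, h2⟩ := hL
    obtain ⟨i, j, hij, e⟩ := card_eq_two.1 h2
    have hne := lift_inj hv hij
    have e2 : Ln (lift pt) i j = L := by
      have := hv.line_eq hL hij (by rw [e]; simp) (by rw [e]; simp)
      first | exact this | exact this.symm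
    have e3 : pt '' (L : Set (Fin n)) = {pt i, pt j} := by
      rw [e]; simp [Set.image_pair]
    rw [e3]
    refine ⟨isLine_span hne, ?_⟩
    ext p
    constructor
    · rintro ⟨hp, hl⟩
      rw [← hr] at hp
      obtain ⟨k, rfl⟩ := hp
      have : k ∈ Ln (lift pt) i j := mem_Ln.2 ((mem_span_iff hne).1 hl)
      rw [e2, e] at this
      simp only [mem_insert, mem_singleton] at this
      rcases this with rfl | rfl <;> simp
    · rintro (rfl | rfl)
      · exact ⟨hr ▸ Set.mem_range_self i, left_mem_affineSpan_pair ℝ _ _⟩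
      · exact ⟨hr ▸ Set.mem_range_self j, right_mem_affineSpan_pair ℝ _ _⟩
  unfold N2 numOrdinaryLines
  rw [← Set.ncard_coe_finset]
  refine Set.ncard_le_ncard_of_injOn (ht := ord_finite hP) (fun L : Finset (Fin n) => affineSpan ℝ (pt '' (L : Set (Fin n)))) ?_ ?_
  · intro L hL
    have hL := mem_coe.1 hL
    obtain ⟨k1, k2⟩ := key L hL
    refine ⟨k1, ?_⟩
    rw [k2, Set.ncard_image_of_injective _ (lift_injective hv), Set.ncard_coe_finset]
    exact (mem_filter.1 hL).2
  · intro L hL L' hL' e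
    simp only at e
    have k := (key L (mem_coe.1 hL)).2
    have k' := (key L' (mem_coe.1 hL')).2
    rw [e, k'] at k
    exact_mod_cast ((lift_injective hv).image_injective k).symm

end
end DM

/-- The Dirac–Motzkin conjecture for large `n`: any set of `n` points in the plane,
not all collinear, spans at least `n / 2` ordinary lines. -/
theorem dirac_motzkin :
    ∃ n₀ : ℕ, 0 < n₀ ∧ ∀ n : ℕ, n₀ ≤ n →
      ∀ P : Set (ℝ × ℝ), P.Finite → P.ncard = n → ¬ Collinear ℝ P →
        (n : ℝ) / 2 ≤ (numOrdinaryLines P : ℝ) := by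
  obtain ⟨N0, hN0⟩ := DM.final_count
  refine ⟨N0 + 2, by omega, fun n hn P hP hc hcol => ?_⟩
  haveI := hP.fintype
  have hcard : Fintype.card P = n := by rw [← Nat.card_coe_set_eq, Nat.card_eq_fintype_card] at hc; exact hc
  let f := (Fintype.equivFinOfCardEq hcard).symm
  let pt : Fin n → ℝ × ℝ := fun i => (f i : ℝ × ℝ)
  have hinj : Function.Injective pt := Subtype.val_injective.comp f.injective
  have hr : Set.range pt = P := by
    ext p
    constructor
    · rintro ⟨i, rfl⟩; exact (f i).2
    · intro hp; exact ⟨f.symm ⟨p, hp⟩, by simp [pt]⟩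
  have hv : DM.Cfg (DM.lift pt) := by
    refine ⟨fun i j hij => DM.hat_crs (fun e => hij (hinj e)), ?_⟩
    by_contra hcon
    push Not at hcon
    apply hcol
    have hne : (⟨0, by omega⟩ : Fin n) ≠ ⟨1, by omega⟩ := by simp
    rw [collinear_iff_of_mem (p₀ := pt ⟨0, by omega⟩) (hr ▸ Set.mem_range_self _)]
    refine ⟨pt ⟨1, by omega⟩ - pt ⟨0, by omega⟩, fun p hp => ?_⟩
    rw [← hr] at hp
    obtain ⟨k, rfl⟩ := hp
    exact DM.hat_line (fun e => hne (hinj e)) (hcon _ _ k)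
  have h1 := hN0 n (by omega) pt hv
  have h2 := DM.bridge hP hv hr
  have h3 : (n : ℝ) ≤ 2 * (numOrdinaryLines P : ℝ) := by exact_mod_cast (by omega : n ≤ 2 * numOrdinaryLines P)
  linarith
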